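/- For c = 7, every sufficiently large odd integer n can be written as n = p1^2 + p2^2 + p3^3 + p4^3 + p5^5 + p6^6 + p7^7 with p1, ..., p7 all prime. That is, there exists N such that for every odd integer n ≥ N there exist primes p1, ..., p7 with n = p1^2 + p2^2 + p3^3 + p4^3 + p5^5 + p6^6 + p7^7. -/

import Mathlib

namespace WG
open Complex Finset
open Real (pi)

local notation "ln" => Real.log
local notation:70 j "/₈" n:71 => ((j:ℕ):ℝ) / ((8 * n:ℕ):ℝ)
local notation "DC" => DirichletCharacter ℂ
local notation "AF" => ArithmeticFunction ℝ

section Lbounds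
variable {q:ℕ} [NeZero q]

noncomputable def kap (χ : DC q) : ℂ := (∑ a, χ a) / q

lemma norm_kap_le (χ : DC q) : ‖kap χ‖ ≤ 1 := by
  have hq : (0:ℝ) < q := by exact_mod_cast Nat.pos_of_ne_zero (NeZero.ne q)
  rw [kap, norm_div, Complex.norm_natCast, div_le_one hq]
  calc ‖∑ a, χ a‖ ≤ ∑ a : ZMod q, ‖χ a‖ := norm_sum_le _ _
    _ ≤ ∑ a : ZMod q, 1 := sum_le_sum fun a _ => χ.norm_le_one a
    _ = q := by simp [ZMod.card]

lemma sum_range_char (χ : DC q) : ∑ n ∈ range q, χ n = ∑ a, χ a := by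
  refine sum_nbij' (fun n => (n : ZMod q)) ZMod.val ?_ ?_ ?_ ?_ ?_
  · simp
  · intro a _; simpa using ZMod.val_lt a
  · intro a ha; exact ZMod.val_cast_of_lt (by simpa using ha)
  · intro a _; simp
  · simp

lemma sum_range_sub_bound (χ : DC q) (N:ℕ) :
    ‖∑ n ∈ range N, (χ n - kap χ)‖ ≤ 2 * q := by
  have hq : 0 < q := Nat.pos_of_ne_zero (NeZero.ne q)
  induction N using Nat.strong_induction_on with
  | _ N ih =>
    rcases lt_or_ge N q with h | h
    · calc ‖∑ n ∈ range N, (χ n - kap χ)‖ ≤ ∑ n ∈ range N, ‖χ n - kap χ‖ := norm_sum_le _ _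
        _ ≤ ∑ n ∈ range N, 2 := sum_le_sum fun a _ => by
            refine (norm_sub_le _ _).trans ?_
            linarith [χ.norm_le_one (a : ZMod q), norm_kap_le χ]
        _ = 2 * N := by simp [mul_comm]
        _ ≤ 2 * q := by gcongr
    · obtain ⟨M, rfl⟩ := Nat.exists_eq_add_of_le h
      rw [sum_range_add]
      have h0 : ∑ n ∈ range q, (χ n - kap χ) = 0 := by
        rw [sum_sub_distrib, sum_range_char]
        simp [kap]; field_simp; simp
      rw [h0, zero_add]
      simpa using ih M (by omega)

noncomputable def Rt (χ : DC q) (t:ℝ) : ℂ :=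
  ∑ k ∈ Icc 1 ⌊t⌋₊, χ k - kap χ * t

lemma norm_Rt_le (χ : DC q) {t:ℝ} (ht : 0 ≤ t) : ‖Rt χ t‖ ≤ 6 * q := by
  have hq : (1:ℝ) ≤ q := by exact_mod_cast Nat.pos_of_ne_zero (NeZero.ne q)
  have h1 : ∑ k ∈ Icc 1 ⌊t⌋₊, χ k = ∑ n ∈ range (⌊t⌋₊ + 1), χ n - χ ((0:ℕ) : ZMod q) := by
    rw [range_eq_Ico, sum_eq_sum_Ico_succ_bot (by omega)]
    simp
    rfl
  have h2 := sum_range_sub_bound χ (⌊t⌋₊ + 1)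
  rw [sum_sub_distrib] at h2
  have h3 : Rt χ t = (∑ n ∈ range (⌊t⌋₊ + 1), χ n - ∑ n ∈ range (⌊t⌋₊ + 1), kap χ)
      + (kap χ * ((⌊t⌋₊ + 1 - t:ℝ):ℂ)) - χ ((0:ℕ) : ZMod q) := by
    rw [Rt, h1]; simp; ring
  rw [h3]
  refine (norm_sub_le _ _).trans ?_
  have h4 : ‖kap χ * ((⌊t⌋₊ + 1 - t:ℝ):ℂ)‖ ≤ 1 := by
    rw [norm_mul, norm_real]
    have : ‖(⌊t⌋₊ + 1 - t:ℝ)‖ ≤ 1 := by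
      rw [Real.norm_eq_abs, abs_le]
      constructor <;> linarith [Nat.floor_le ht, Nat.lt_floor_add_one t]
    nlinarith [norm_kap_le χ, norm_nonneg (kap χ), norm_nonneg (⌊t⌋₊ + 1 - t:ℝ)]
  have h5 := χ.norm_le_one ((0:ℕ) : ZMod q)
  have := norm_add_le (∑ n ∈ range (⌊t⌋₊ + 1), χ n - ∑ n ∈ range (⌊t⌋₊ + 1), kap χ) (kap χ * ((⌊t⌋₊ + 1 - t:ℝ):ℂ))
  linarith

lemma measurable_Rt (χ : DC q) : Measurable (Rt χ) := by
  unfold Rt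
  refine Measurable.sub ?_ (by fun_prop)
  exact (measurable_from_nat (f := fun n => ∑ k ∈ Icc 1 n, χ k)).comp Nat.measurable_floor

noncomputable def Phi (χ : DC q) (s:ℂ) : ℂ :=
  ∫ t in Set.Ioi (1:ℝ), Rt χ t * (t:ℂ) ^ (-(s + 1))

lemma norm_Phi_le (χ : DC q) {s:ℂ} (hs : 0 < s.re) :
    ‖Phi χ s‖ ≤ 6 * q / s.re := by
  have h1 : ∀ t ∈ Set.Ioi (1:ℝ), ‖Rt χ t * (t:ℂ) ^ (-(s + 1))‖ ≤ 6 * q * t ^ (-s.re - 1) := by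
    intro t ht
    have ht' : (0:ℝ) < t := lt_trans one_pos ht
    rw [norm_mul, norm_cpow_eq_rpow_re_of_pos ht']
    have : (-(s + 1)).re = -s.re - 1 := by simp; ring
    rw [this]
    gcongr
    exact norm_Rt_le χ ht'.le
  have hi := integrableOn_Ioi_rpow_of_lt (show -s.re - 1 < -1 by linarith) one_pos
  have h2 := MeasureTheory.norm_integral_le_of_norm_le (hi.const_mul (6 * (q:ℝ)))
    ((MeasureTheory.ae_restrict_iff' measurableSet_Ioi).2 (Filter.Eventually.of_forall h1))
  refine h2.trans ?_
  rw [MeasureTheory.integral_const_mul, integral_Ioi_rpow_of_lt (by linarith) one_pos]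
  simp [div_eq_mul_inv]

lemma differentiableAt_Phi (χ : DC q) {s:ℂ} (hs : 0 < s.re) :
    DifferentiableAt ℂ (Phi χ) s := by
  set f : ℝ → ℂ := Set.indicator (Set.Ioi 1) (Rt χ) with hf
  have hbd : ∀ t, ‖f t‖ ≤ 6 * q := by
    intro t
    by_cases ht : t ∈ Set.Ioi (1:ℝ)
    · rw [hf, Set.indicator_of_mem ht]; exact norm_Rt_le χ (le_trans zero_le_one (le_of_lt ht))
    · rw [hf, Set.indicator_of_notMem ht]; simp
  have hm : Measurable f := (measurable_Rt χ).indicator measurableSet_Ioi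
  have hPhi : Phi χ = fun s => mellin f (-s) := by
    ext s
    rw [Phi, mellin]
    have : ∀ t : ℝ, (t:ℂ) ^ (-s - 1) • f t =
        Set.indicator (Set.Ioi 1) (fun t : ℝ => Rt χ t * (t:ℂ) ^ (-(s + 1))) t := by
      intro t
      rw [hf]
      by_cases ht : t ∈ Set.Ioi (1:ℝ)
      · simp only [Set.indicator_of_mem ht, smul_eq_mul]; rw [mul_comm]; ring_nf
      · simp [Set.indicator_of_notMem ht]
    simp_rw [this]
    rw [MeasureTheory.setIntegral_indicator measurableSet_Ioi]
    congr 2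
    rw [Set.Ioi_inter_Ioi]; simp
  rw [hPhi]
  have hd : DifferentiableAt ℂ (mellin f) (-s) := by
    refine mellin_differentiableAt_of_isBigO_rpow (a := 0) (b := (-s).re - 1) ?_ ?_ (by simpa) ?_ (by linarith)
    · intro x _
      refine ⟨Set.univ ∩ Metric.closedBall x 1, ?_, ?_⟩
      · exact mem_nhdsWithin_of_mem_nhds (by simpa using Metric.closedBall_mem_nhds x one_pos)
      · refine MeasureTheory.IntegrableOn.mono_set ?_ Set.inter_subset_right
        refine MeasureTheory.Measure.integrableOn_of_bounded (M := 6 * q) ?_ hm.aestronglyMeasurable ?_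
        · exact MeasureTheory.measure_closedBall_lt_top.ne
        · exact Filter.Eventually.of_forall hbd
    · simp only [neg_zero, Real.rpow_zero]
      exact Asymptotics.IsBigO.of_bound (6 * q) (Filter.Eventually.of_forall fun t => by simpa using hbd t)
    · refine Asymptotics.IsBigO.of_bound 1 ?_
      have : Set.Ioo (0:ℝ) 1 ∈ nhdsWithin (0:ℝ) (Set.Ioi 0) := Ioo_mem_nhdsGT one_pos
      filter_upwards [this] with t ht
      rw [hf, Set.indicator_of_notMem (by simpa using ht.2.le)]
      simp
  exact hd.comp s differentiableAt_id.neg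

noncomputable def HH (χ : DC q) (s:ℂ) : ℂ :=
  if χ = 1 then DirichletCharacter.LFunctionTrivChar₁ q s else (s - 1) * χ.LFunction s

lemma HH_eq (χ : DC q) {s:ℂ} (hs : s ≠ 1) : HH χ s = (s - 1) * χ.LFunction s := by
  unfold HH
  split_ifs with h
  · subst h
    rw [DirichletCharacter.LFunctionTrivChar₁, Function.update_of_ne hs]
  · rfl

lemma differentiable_HH (χ : DC q) : Differentiable ℂ (HH χ) := by
  unfold HH
  split_ifs with h
  · exact DirichletCharacter.differentiable_LFunctionTrivChar₁ q
  · exact (differentiable_id.sub_const 1).mul (DirichletCharacter.differentiable_LFunction h)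

lemma LSeries_char_eq (χ : DC q) {s:ℂ} (hs : 1 < s.re) :
    χ.LFunction s = s * Phi χ s + kap χ * s / (s - 1) := by
  rw [DirichletCharacter.LFunction_eq_LSeries χ hs]
  have h0 : s - 1 ≠ 0 := by intro h; rw [sub_eq_zero] at h; simp [h] at hs
  rw [LSeries_eq_mul_integral (fun n => χ n) (r := 1) zero_le_one hs
    (DirichletCharacter.LSeriesSummable_of_one_lt_re χ hs) ?_]
  · have hi1 : MeasureTheory.IntegrableOn (fun t : ℝ => Rt χ t * (t:ℂ) ^ (-(s + 1))) (Set.Ioi 1) := by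
      have hi := integrableOn_Ioi_rpow_of_lt (show -s.re - 1 < -1 by linarith) one_pos
      refine MeasureTheory.Integrable.mono' (hi.const_mul (6 * (q:ℝ))) ?_ ?_
      · refine ((measurable_Rt χ).mul ?_).aestronglyMeasurable
        exact Measurable.pow_const (by fun_prop) _
      · refine (MeasureTheory.ae_restrict_iff' measurableSet_Ioi).2 (Filter.Eventually.of_forall ?_)
        intro t ht
        have ht' : (0:ℝ) < t := lt_trans one_pos ht
        rw [norm_mul, norm_cpow_eq_rpow_re_of_pos ht']
        have : (-(s + 1)).re = -s.re - 1 := by simp; ring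
        rw [this]
        gcongr
        exact norm_Rt_le χ ht'.le
    have hi2 : MeasureTheory.IntegrableOn (fun t : ℝ => kap χ * (t:ℂ) ^ (-s)) (Set.Ioi 1) :=
      (integrableOn_Ioi_cpow_of_lt (by simpa using hs) one_pos).const_mul _
    have h2 : ∫ t in Set.Ioi (1:ℝ), (∑ k ∈ Icc 1 ⌊t⌋₊, χ k) * (t:ℂ) ^ (-(s + 1)) =
        ∫ t in Set.Ioi (1:ℝ), (Rt χ t * (t:ℂ) ^ (-(s + 1)) + kap χ * (t:ℂ) ^ (-s)) := by
      refine MeasureTheory.setIntegral_congr_fun measurableSet_Ioi ?_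
      intro t ht
      have ht' : (t:ℂ) ≠ 0 := by
        have : (0:ℝ) < t := lt_trans one_pos ht
        exact_mod_cast this.ne'
      simp only [Rt]
      have : (t:ℂ) ^ (-s) = t * (t:ℂ) ^ (-(s + 1)) := by rw [show -s = 1 + (-(s + 1)) by ring, cpow_add _ _ ht', cpow_one]
      rw [this]; ring
    rw [h2, MeasureTheory.integral_add hi1 hi2, MeasureTheory.integral_const_mul,
      integral_Ioi_cpow_of_lt (by simpa using hs) one_pos]
    rw [← Phi]
    have h3 : -s + 1 ≠ 0 := by intro h; apply h0; linear_combination -h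
    simp only [ofReal_one, one_cpow]
    field_simp
    ring
  · refine Asymptotics.IsBigO.of_bound 1 (Filter.Eventually.of_forall fun n => ?_)
    simp only [Real.rpow_one, one_mul]
    calc ‖∑ k ∈ Icc 1 n, χ k‖ ≤ ∑ k ∈ Icc 1 n, ‖χ k‖ := norm_sum_le _ _
      _ ≤ ∑ k ∈ Icc 1 n, 1 := sum_le_sum fun a _ => χ.norm_le_one _
      _ = ‖(n:ℝ)‖ := by simp

lemma HH_repr (χ : DC q) {s:ℂ} (hs : 0 < s.re) :
    HH χ s = (s - 1) * (s * Phi χ s) + kap χ * s := by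
  have hU : IsOpen {s : ℂ | 0 < s.re} := isOpen_lt continuous_const continuous_re
  have hc : IsPreconnected {s : ℂ | 0 < s.re} := (convex_halfSpace_re_gt 0).isPreconnected
  have h1 : AnalyticOnNhd ℂ (HH χ) {s : ℂ | 0 < s.re} :=
    (differentiable_HH χ).differentiableOn.analyticOnNhd hU
  have h2 : AnalyticOnNhd ℂ (fun s => (s - 1) * (s * Phi χ s) + kap χ * s) {s : ℂ | 0 < s.re} := by
    refine DifferentiableOn.analyticOnNhd (fun s hs => ?_) hU
    have := differentiableAt_Phi χ (s := s) hs
    exact DifferentiableAt.differentiableWithinAt (by fun_prop)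
  refine h1.eqOn_of_preconnected_of_eventuallyEq h2 hc (z₀ := 2) (by simp) ?_ hs
  have h3 : {s : ℂ | 1 < s.re} ∈ nhds (2:ℂ) :=
    (isOpen_lt continuous_const continuous_re).mem_nhds (by simp)
  filter_upwards [h3] with z hz
  have h0 : z ≠ 1 := by intro h; simp [h] at hz
  rw [HH_eq χ h0, LSeries_char_eq χ hz]
  field_simp

lemma norm_HH_le (χ : DC q) {s:ℂ} (hs : 1 / 2 ≤ s.re) :
    ‖HH χ s‖ ≤ 13 * q * (‖s‖ + 1) ^ 2 := by
  have hq : (1:ℝ) ≤ q := by exact_mod_cast Nat.pos_of_ne_zero (NeZero.ne q)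
  rw [HH_repr χ (by linarith)]
  have h1 : ‖Phi χ s‖ ≤ 12 * q := by
    refine (norm_Phi_le χ (by linarith)).trans ?_
    rw [div_le_iff₀ (by linarith)]; nlinarith
  have h2 : ‖s - 1‖ ≤ ‖s‖ + 1 := by simpa using norm_sub_le s 1
  calc _ ≤ ‖s - 1‖ * (‖s‖ * ‖Phi χ s‖) + ‖kap χ‖ * ‖s‖ := by
        refine (norm_add_le _ _).trans ?_
        simp
    _ ≤ (‖s‖ + 1) * ((‖s‖ + 1) * (12 * q)) + 1 * (‖s‖ + 1) := by
        gcongr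
        · linarith
        · exact norm_kap_le χ
        · linarith
    _ ≤ _ := by nlinarith [norm_nonneg s, mul_nonneg (norm_nonneg s) (norm_nonneg s)]

end Lbounds

section growth
variable {q:ℕ} [NeZero q]

noncomputable def XX (q:ℕ) (s:ℂ) : ℝ := q * (|s.im| + 2)

lemma one_le_q (q:ℕ) [NeZero q] : (1:ℝ) ≤ q := by
  exact_mod_cast Nat.pos_of_ne_zero (NeZero.ne q)

lemma two_le_XX (q:ℕ) [NeZero q] (s:ℂ) : 2 ≤ XX q s := by
  unfold XX
  nlinarith [one_le_q q, abs_nonneg s.im]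

lemma XX_near (q:ℕ) [NeZero q] {s z:ℂ} (h : ‖z - s‖ ≤ 1) : XX q z ≤ 2 * XX q s := by
  unfold XX
  have h1 : |z.im - s.im| ≤ 1 := by simpa using (abs_im_le_norm (z - s)).trans h
  have h2 : |z.im| ≤ |s.im| + 1 := by
    have := abs_add_le (z.im - s.im) s.im
    simp at this; linarith
  nlinarith [one_le_q q, abs_nonneg s.im]

lemma norm_L_le_zeta (χ : DC q) {s:ℂ} (hs : 1 < s.re) :
    ‖χ.LFunction s‖ ≤ ‖riemannZeta (s.re:ℂ)‖ := by
  rw [DirichletCharacter.LFunction_eq_LSeries χ hs,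
    zeta_eq_tsum_one_div_nat_cpow (by simpa using hs)]
  have h1 : ∀ n : ℕ, (1 / (n:ℂ) ^ (s.re:ℂ)) = ((1 / (n:ℝ) ^ s.re:ℝ):ℂ) := by
    intro n
    push_cast
    rw [ofReal_cpow (Nat.cast_nonneg n)]; simp
  simp_rw [h1]
  rw [← ofReal_tsum, norm_real, Real.norm_eq_abs, abs_of_nonneg
    (tsum_nonneg fun n => by positivity), LSeries]
  refine tsum_of_norm_bounded (Real.summable_one_div_nat_rpow.2 hs).hasSum ?_
  intro n
  rcases Nat.eq_zero_or_pos n with h | h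
  · subst h; simp; positivity
  · rw [LSeries.term_of_ne_zero h.ne', norm_div, norm_natCast_cpow_of_pos h]
    gcongr
    exact χ.norm_le_one _

lemma norm_L_le (χ : DC q) {s:ℂ} (hs : 1 < s.re) (hs' : s.re ≤ 3) :
    ‖χ.LFunction s‖ ≤ 208 / (s.re - 1) := by
  refine (norm_L_le_zeta χ hs).trans ?_
  have h1 : (s.re:ℂ) ≠ 1 := by intro h; apply hs.ne'; exact_mod_cast h
  have h := norm_HH_le (q := 1) 1 (s := (s.re:ℂ)) (by simp; linarith)
  rw [HH_eq _ h1, DirichletCharacter.LFunction_modOne_eq, norm_mul] at h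
  have h2 : ‖(s.re:ℂ) - 1‖ = s.re - 1 := by rw [← ofReal_one, ← ofReal_sub, norm_real, Real.norm_eq_abs, abs_of_pos (by linarith)]
  have h3 : ‖(s.re:ℂ)‖ = s.re := by rw [norm_real, Real.norm_eq_abs, abs_of_pos (by linarith)]
  rw [h2, h3] at h
  rw [le_div_iff₀ (by linarith)]
  push_cast at h
  nlinarith

lemma HH_growth_aux (χ : DC q) {ε:ℝ} (hε : 0 < ε) (hε1 : ε ≤ 1) {s:ℂ}
    (hs1 : 1 - ε / 8 ≤ s.re) (hs2 : s.re ≤ 1 + ε / 8) :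
    ‖HH χ s‖ ≤ 64 * (13 * (208 / (ε / 8))) * XX q s ^ ε * (|s.im| + 2) := by
  set T := |s.im| + 2 with hT
  have hT2 : 2 ≤ T := by simp [hT]
  have hq := one_le_q q
  set w : ℂ → ℂ := fun z => z - s.im * I + 2 with hw
  have hwre : ∀ z, (w z).re = z.re + 2 := by intro z; simp [hw]
  have hw2 : ∀ z : ℂ, 0 ≤ z.re → 2 ≤ ‖w z‖ := by
    intro z hz
    have := re_le_norm (w z)
    rw [hwre] at this; linarith
  have hw0 : ∀ z : ℂ, 0 ≤ z.re → w z ≠ 0 := by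
    intro z hz h
    have := hw2 z hz
    rw [h] at this; norm_num at this
  have hzw : ∀ z : ℂ, 0 ≤ z.re → ‖z‖ + 1 ≤ T * ‖w z‖ := by
    intro z hz
    have h1 : ‖z - s.im * I‖ ≤ ‖w z‖ := by
      rw [norm_def, norm_def]
      apply Real.sqrt_le_sqrt
      simp only [normSq_apply]
      have e1 : (w z).im = (z - s.im * I).im := by simp [hw]
      have e2 : (z - s.im * I).re = z.re := by simp
      rw [e1, e2, hwre]; nlinarith
    have h2 : ‖z‖ ≤ ‖z - s.im * I‖ + |s.im| := by
      have := norm_add_le (z - s.im * I) (s.im * I)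
      simpa using this
    nlinarith [hw2 z hz]
  set g : ℂ → ℂ := fun z => HH χ z / (w z) ^ 3 with hg
  have hgA : ∀ z : ℂ, 1 / 2 ≤ z.re → ‖g z‖ ≤ 13 * q * T ^ 2 := by
    intro z hz
    have h1 := norm_HH_le χ hz
    have h2 := hzw z (by linarith)
    have h3 := hw2 z (by linarith)
    rw [hg]; simp only
    rw [norm_div, norm_pow, div_le_iff₀ (by positivity)]
    calc _ ≤ _ := h1
      _ ≤ 13 * q * (T * ‖w z‖) ^ 2 := by gcongr
      _ = 13 * q * T ^ 2 * (‖w z‖ ^ 2 * 1) := by ring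
      _ ≤ 13 * q * T ^ 2 * (‖w z‖ ^ 2 * ‖w z‖) := by gcongr; linarith
      _ = _ := by ring
  set l : ℝ := 1 / 2
  set u : ℝ := 1 + ε / 8 with hu
  have hgB : ∀ z ∈ re ⁻¹' {u}, ‖g z‖ ≤ 208 / (ε / 8) * T := by
    intro z hz
    have hz' : z.re = 1 + ε / 8 := hz
    have h1 := norm_L_le χ (s := z) (by linarith) (by linarith)
    have h2 := hzw z (by linarith)
    have h3 := hw2 z (by linarith)
    have hz1 : z ≠ 1 := by intro h; rw [h] at hz'; simp at hz'; linarith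
    rw [hg]; simp only
    rw [norm_div, norm_pow, div_le_iff₀ (by positivity), HH_eq χ hz1, norm_mul]
    have h4 : ‖z - 1‖ ≤ ‖z‖ + 1 := by simpa using norm_sub_le z 1
    rw [hz', add_sub_cancel_left] at h1
    calc _ ≤ (T * ‖w z‖) * (208 / (ε / 8)) := by gcongr; linarith
      _ = 208 / (ε / 8) * T * (‖w z‖ * 1) := by ring
      _ ≤ 208 / (ε / 8) * T * (‖w z‖ * ‖w z‖ ^ 2) := by gcongr; nlinarith
      _ = _ := by ring
  have hlu : l < u := by simp only [l, u]; linarith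
  have hmain := HadamardThreeLines.norm_le_interp_of_mem_verticalClosedStrip' (f := g) (z := s)
    (a := 13 * q * T ^ 2) (b := 208 / (ε / 8) * T) hlu ⟨by simp only [l]; linarith, hs2⟩ ?_ ?_ ?_ hgB
  · set θ := 1 - (s.re - l) / (u - l) with hθ
    have hul : 0 < u - l := by linarith
    have hθ0 : 0 ≤ θ := by rw [hθ, sub_nonneg, div_le_one hul]; linarith
    have hθ1 : θ ≤ ε / 2 := by
      rw [hθ, sub_le_comm, le_div_iff₀ hul]
      simp only [l, u]; nlinarith
    have e1 : (s.re - l) / (u - l) = 1 - θ := by rw [hθ]; ring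
    rw [e1] at hmain
    have hε8 : 1 ≤ 208 / (ε / 8) := by rw [le_div_iff₀ (by positivity)]; linarith
    have hb1 : 1 ≤ 208 / (ε / 8) * T := by nlinarith
    have hX : XX q s = q * T := rfl
    have hX1 : 1 ≤ q * T := by nlinarith
    have b1 : (208 / (ε / 8) * T) ^ (1 - θ) ≤ 208 / (ε / 8) * T := by
      conv_rhs => rw [← Real.rpow_one (208 / (ε / 8) * T)]
      exact Real.rpow_le_rpow_of_exponent_le hb1 (by linarith)
    have b2 : (13 * q * T ^ 2) ^ θ ≤ 13 * (q * T) ^ ε := by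
      calc (13 * q * T ^ 2) ^ θ ≤ (13 * (q * T) ^ 2) ^ θ := by
            apply Real.rpow_le_rpow (by positivity) _ hθ0
            nlinarith [mul_nonneg (sub_nonneg.2 hq) (show (0:ℝ) ≤ q * T ^ 2 by positivity)]
        _ ≤ (13 * (q * T) ^ 2) ^ (ε / 2) := by
            apply Real.rpow_le_rpow_of_exponent_le _ hθ1
            nlinarith
        _ = 13 ^ (ε / 2) * (q * T) ^ ε := by
            rw [Real.mul_rpow (by norm_num) (by positivity), ← Real.rpow_natCast, ← Real.rpow_mul (by positivity)]
            congr 2; push_cast; ring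
        _ ≤ 13 ^ (1:ℝ) * (q * T) ^ ε := by
            gcongr
            · norm_num
            · linarith
        _ = _ := by simp
    have hws : ‖w s‖ ≤ 4 := by
      have : w s = ((s.re + 2:ℝ):ℂ) := by apply Complex.ext <;> simp [hw]
      rw [this, norm_real, Real.norm_eq_abs, abs_of_nonneg (by linarith)]; linarith
    have e2 : HH χ s = g s * (w s) ^ 3 := by
      rw [hg]; simp only
      rw [div_mul_cancel₀]; exact pow_ne_zero _ (hw0 s (by linarith))
    rw [e2, norm_mul, norm_pow, hX]
    calc ‖g s‖ * ‖w s‖ ^ 3 ≤ ((13 * (q * T) ^ ε) * (208 / (ε / 8) * T)) * 4 ^ 3 := by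
          gcongr
          exact hmain.trans (by gcongr)
      _ = _ := by ring
  · refine DifferentiableOn.diffContOnCl (fun z hz => ?_)
    have hz' : 0 ≤ z.re := by
      have : z ∈ closure (re ⁻¹' Set.Ioo l u) := hz
      rw [closure_preimage_re, closure_Ioo hlu.ne] at this
      have h2 : l ≤ z.re := this.1
      simp only [l] at h2; linarith
    have h1 := (differentiable_HH χ) z
    have h2 := hw0 z hz'
    have h3 : DifferentiableAt ℂ w z := by simp only [hw]; fun_prop
    exact ((h1.div (h3.pow 3) (pow_ne_zero _ h2))).differentiableWithinAt
  · refine ⟨13 * q * T ^ 2, ?_⟩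
    rintro _ ⟨z, hz, rfl⟩
    exact hgA z hz.1
  · intro z hz
    exact hgA z (le_of_eq (by simpa using hz.symm))

theorem HH_growth {ε:ℝ} (hε : 0 < ε) : ∃ η C : ℝ, 0 < η ∧ η ≤ 1 / 8 ∧ 1 ≤ C ∧
    ∀ (q:ℕ) [NeZero q] (χ : DC q) (s:ℂ), 1 - η ≤ s.re → s.re ≤ 3 →
      ‖HH χ s‖ ≤ C * XX q s ^ ε * (|s.im| + 2) := by
  set ε' := min ε 1
  have h0 : 0 < ε' := lt_min hε one_pos
  have h1 : ε' ≤ 1 := min_le_right _ _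
  refine ⟨ε' / 8, 64 * (13 * (208 / (ε' / 8))), by positivity, by linarith, ?_, ?_⟩
  · have : 1 ≤ 208 / (ε' / 8) := by rw [le_div_iff₀ (by positivity)]; linarith
    linarith
  intro q _ χ s hs1 hs2
  have hX := two_le_XX q s
  have hXe : XX q s ^ ε' ≤ XX q s ^ ε :=
    Real.rpow_le_rpow_of_exponent_le (by linarith) (min_le_left _ _)
  have hT : 2 ≤ |s.im| + 2 := by simp
  rcases le_or_gt s.re (1 + ε' / 8) with h | h
  · refine (HH_growth_aux χ h0 h1 hs1 h).trans ?_
    gcongr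
  · have hz1 : s ≠ 1 := by intro h'; rw [h'] at h; simp at h; linarith
    rw [HH_eq χ hz1, norm_mul]
    have h2 := norm_L_le χ (s := s) (by linarith) hs2
    have h3 : ‖s - 1‖ ≤ 2 * (|s.im| + 2) := by
      have := norm_le_abs_re_add_abs_im (s - 1)
      simp at this
      have h4 : |s.re - 1| ≤ 2 := by rw [abs_le]; constructor <;> linarith
      linarith
    have h4 : 208 / (s.re - 1) ≤ 208 / (ε' / 8) := by apply div_le_div_of_nonneg_left (by norm_num) (by positivity) (by linarith)
    have h5 : 1 ≤ XX q s ^ ε := Real.one_le_rpow (by linarith) hε.le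
    have h6 : 0 < 208 / (ε' / 8) := by positivity
    calc ‖s - 1‖ * ‖χ.LFunction s‖ ≤ (2 * (|s.im| + 2)) * (208 / (ε' / 8)) := by
          gcongr; linarith
      _ ≤ (64 * 13 * (|s.im| + 2)) * (208 / (ε' / 8)) * 1 := by nlinarith [mul_pos h6 (show 0 < |s.im| + 2 by linarith)]
      _ ≤ (64 * 13 * (|s.im| + 2)) * (208 / (ε' / 8)) * XX q s ^ ε := by gcongr
      _ = _ := by ring

theorem L_growth {ε:ℝ} (hε : 0 < ε) : ∃ η C : ℝ, 0 < η ∧ η ≤ 1 / 8 ∧ 1 ≤ C ∧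
    ∀ (q:ℕ) [NeZero q] (χ : DC q) (s:ℂ), χ ≠ 1 → 1 - η ≤ s.re → s.re ≤ 3 →
      ‖χ.LFunction s‖ ≤ C * XX q s ^ ε := by
  obtain ⟨η, C, hη, hη1, hC, H⟩ := HH_growth hε
  have h2ε : (1:ℝ) ≤ 2 ^ ε := Real.one_le_rpow (by norm_num) hε.le
  have key : ∀ (q:ℕ) [NeZero q] (χ : DC q) (s:ℂ), 1 - η ≤ s.re → s.re ≤ 3 →
      η / 2 ≤ ‖s - 1‖ → ‖χ.LFunction s‖ ≤ C * (1 + 4 / η) * XX q s ^ ε := by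
    intro q _ χ s h1 h2 h3
    have hX := two_le_XX q s
    have h := H q χ s h1 h2
    have hs1 : s ≠ 1 := by intro h; simp [h] at h3; linarith
    rw [HH_eq χ hs1, norm_mul] at h
    have h4 : |s.im| ≤ ‖s - 1‖ := by simpa using abs_im_le_norm (s - 1)
    have h5 : |s.im| + 2 ≤ ‖s - 1‖ * (1 + 4 / η) := by
      have : 2 ≤ ‖s - 1‖ * (4 / η) := by
        calc (2:ℝ) = η / 2 * (4 / η) := by field_simp; norm_num
          _ ≤ _ := by gcongr
      linarith
    have hpos : 0 < ‖s - 1‖ := by linarith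
    have : ‖s - 1‖ * ‖χ.LFunction s‖ ≤ ‖s - 1‖ * (C * (1 + 4 / η) * XX q s ^ ε) := by
      calc _ ≤ _ := h
        _ ≤ C * XX q s ^ ε * (‖s - 1‖ * (1 + 4 / η)) := by gcongr
        _ = _ := by ring
    exact le_of_mul_le_mul_left this hpos
  refine ⟨η, C * (1 + 4 / η) * 2 ^ ε, hη, hη1, ?_, ?_⟩
  · have : 0 < 4 / η := by positivity
    have : 1 ≤ C * (1 + 4 / η) := by nlinarith
    nlinarith
  intro q _ χ s hχ h1 h2
  have hX := two_le_XX q s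
  rcases le_or_gt (η / 2) ‖s - 1‖ with h | h
  · refine (key q χ s h1 h2 h).trans ?_
    have h0 : 0 ≤ C * (1 + 4 / η) := by positivity
    have h3 : C * (1 + 4 / η) ≤ C * (1 + 4 / η) * 2 ^ ε := le_mul_of_one_le_right h0 h2ε
    exact mul_le_mul_of_nonneg_right h3 (by positivity)
  · have hd := DirichletCharacter.differentiable_LFunction hχ
    refine norm_le_of_forall_mem_frontier_norm_le (U := Metric.ball 1 (η / 2)) Metric.isBounded_ball
      hd.diffContOnCl ?_ (subset_closure (by simpa [dist_eq_norm] using h))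
    intro z hz
    rw [frontier_ball _ (by positivity), mem_sphere_iff_norm] at hz
    have hre : |z.re - 1| ≤ η / 2 := by rw [← hz]; simpa using abs_re_le_norm (z - 1)
    rw [abs_le] at hre
    refine (key q χ z (by linarith) (by linarith) hz.ge).trans ?_
    have hX2 := XX_near q (s := s) (z := z) (by
      have : z - s = (z - 1) - (s - 1) := by ring
      rw [this]; refine (norm_sub_le _ _).trans ?_; linarith)
    have hXz := two_le_XX q z
    rw [mul_assoc _ _ (XX q s ^ ε), ← Real.mul_rpow (by norm_num) (by linarith)]
    gcongr

theorem L_deriv_growth {ε:ℝ} (hε : 0 < ε) : ∃ η C : ℝ, 0 < η ∧ η ≤ 1 / 8 ∧ 1 ≤ C ∧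
    ∀ (q:ℕ) [NeZero q] (χ : DC q) (s:ℂ), χ ≠ 1 → 1 - η ≤ s.re → s.re ≤ 5/2 →
      ‖χ.LFunction s‖ ≤ C * XX q s ^ ε ∧ ‖deriv χ.LFunction s‖ ≤ C * XX q s ^ ε := by
  obtain ⟨η, C, hη, hη1, hC, H⟩ := L_growth hε
  have h2ε : (1:ℝ) ≤ 2 ^ ε := Real.one_le_rpow (by norm_num) hε.le
  refine ⟨η / 2, C * 2 ^ ε * (2 / η), by positivity, by linarith, ?_, ?_⟩
  · have : 1 ≤ 2 / η := by rw [le_div_iff₀ hη]; linarith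
    have : 1 ≤ C * 2 ^ ε := by nlinarith
    nlinarith
  intro q _ χ s hχ h1 h2
  have hX := two_le_XX q s
  have hη2 : 1 ≤ 2 / η := by rw [le_div_iff₀ hη]; linarith
  constructor
  · refine (H q χ s hχ (by linarith) (by linarith)).trans ?_
    gcongr
    calc C = C * 1 * 1 := by ring
      _ ≤ C * 2 ^ ε * (2 / η) := by gcongr
  · have := norm_deriv_le_of_forall_mem_sphere_norm_le (f := χ.LFunction) (c := s) (R := η / 2)
      (C := C * 2 ^ ε * XX q s ^ ε) (by positivity) (DirichletCharacter.differentiable_LFunction hχ).diffContOnCl ?_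
    · refine this.trans (le_of_eq ?_)
      field_simp
    · intro z hz
      rw [mem_sphere_iff_norm] at hz
      have hre : |z.re - s.re| ≤ η / 2 := by rw [← hz]; simpa using abs_re_le_norm (z - s)
      rw [abs_le] at hre
      refine (H q χ z hχ (by linarith) (by linarith)).trans ?_
      have hX2 := XX_near q (s := s) (z := z) (by linarith)
      have hXz := two_le_XX q z
      rw [mul_assoc, ← Real.mul_rpow (by norm_num) (by linarith)]
      gcongr

theorem HH_deriv_growth {ε:ℝ} (hε : 0 < ε) : ∃ η C : ℝ, 0 < η ∧ η ≤ 1 / 8 ∧ 1 ≤ C ∧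
    ∀ (q:ℕ) [NeZero q] (χ : DC q) (s:ℂ), 1 - η ≤ s.re → s.re ≤ 5/2 →
      ‖HH χ s‖ ≤ C * XX q s ^ ε * (|s.im| + 2) ∧ ‖deriv (HH χ) s‖ ≤ C * XX q s ^ ε * (|s.im| + 2) := by
  obtain ⟨η, C, hη, hη1, hC, H⟩ := HH_growth hε
  have h2ε : (1:ℝ) ≤ 2 ^ ε := Real.one_le_rpow (by norm_num) hε.le
  refine ⟨η / 2, C * 2 ^ ε * 2 * (2 / η), by positivity, by linarith, ?_, ?_⟩
  · have : 1 ≤ 2 / η := by rw [le_div_iff₀ hη]; linarith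
    have : 1 ≤ C * 2 ^ ε := by nlinarith
    nlinarith
  intro q _ χ s h1 h2
  have hX := two_le_XX q s
  have hη2 : 1 ≤ 2 / η := by rw [le_div_iff₀ hη]; linarith
  constructor
  · refine (H q χ s (by linarith) (by linarith)).trans ?_
    gcongr
    calc C = C * 1 * 1 * 1 := by ring
      _ ≤ C * 2 ^ ε * 2 * (2 / η) := by gcongr; norm_num
  · have := norm_deriv_le_of_forall_mem_sphere_norm_le (f := HH χ) (c := s) (R := η / 2)
      (C := C * (2 ^ ε * XX q s ^ ε) * (2 * (|s.im| + 2))) (by positivity) (differentiable_HH χ).diffContOnCl ?_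
    · refine this.trans (le_of_eq ?_)
      field_simp
    · intro z hz
      rw [mem_sphere_iff_norm] at hz
      have hre : |z.re - s.re| ≤ η / 2 := by rw [← hz]; simpa using abs_re_le_norm (z - s)
      rw [abs_le] at hre
      refine (H q χ z (by linarith) (by linarith)).trans ?_
      have hX2 := XX_near q (s := s) (z := z) (by linarith)
      have hX3 := XX_near 1 (s := s) (z := z) (by linarith)
      simp only [XX, Nat.cast_one, one_mul] at hX3
      have hXz := two_le_XX q z
      rw [← Real.mul_rpow (by norm_num) (by linarith)]
      gcongr

end growth

section estermann
open scoped ComplexOrder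

lemma estermann_coeff {h : ℂ → ℂ} (hd : Differentiable ℂ h) {B:ℝ}
    (hB : ∀ s ∈ Metric.closedBall (2:ℂ) (3/2), ‖h s‖ ≤ B)
    {b : ℕ → ℂ} (hb : ∀ m, b m = (-1) ^ m * iteratedDeriv m (fun s => h s / (s - 1)) 2 / m.factorial) :
    (∀ m, ‖b m - h 1‖ ≤ 4 * B * (2/3) ^ m) ∧
    ∀ x : ℝ, 1/2 < x → x < 7/2 → HasSum (fun m => (b m - h 1) * ((2 - x:ℝ):ℂ) ^ m) (dslope h 1 x) := by
  set g := dslope h 1 with hg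
  have hgd : Differentiable ℂ g := by
    have := (differentiableOn_dslope (s := Set.univ) (c := (1:ℂ)) (f := h) Filter.univ_mem).2 hd.differentiableOn
    exact differentiableOn_univ.1 this
  have hB0 : 0 ≤ B := (norm_nonneg _).trans (hB 2 (by simp; norm_num))
  have hgs : ∀ s, s ≠ 1 → g s = (h s - h 1) / (s - 1) := by
    intro s hs
    rw [hg, dslope_of_ne _ hs, slope_def_field]
  have hbd : ∀ z ∈ Metric.sphere (2:ℂ) (3/2), ‖g z‖ ≤ 4 * B := by
    intro z hz
    rw [mem_sphere_iff_norm] at hz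
    have h1 : 1/2 ≤ ‖z - 1‖ := by
      have := norm_sub_norm_le (z - 2) (1 - 2)
      rw [hz] at this
      have e : z - 2 - (1 - 2) = z - 1 := by ring
      rw [e] at this
      norm_num at this ⊢; linarith
    have hz1 : z ≠ 1 := by intro h; simp [h] at h1; linarith
    rw [hgs z hz1, norm_div, div_le_iff₀ (by linarith)]
    have h2 := hB z (by simp [dist_eq_norm, hz])
    have h3 := hB 1 (by simp [dist_eq_norm]; norm_num)
    have := norm_sub_le (h z) (h 1)
    nlinarith
  have hc : ∀ m, ‖iteratedDeriv m g 2‖ ≤ m.factorial * (4 * B) / (3/2) ^ m := fun m =>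
    norm_iteratedDeriv_le_of_forall_mem_sphere_norm_le m (by norm_num) hgd.diffContOnCl hbd
  have hrel : ∀ m, b m - h 1 = (-1) ^ m * iteratedDeriv m g 2 / m.factorial := by
    intro m
    have he : g =ᶠ[nhds 2] (fun s => h s / (s - 1) - h 1 * (s - 1)⁻¹) := by
      have : ({1}ᶜ : Set ℂ) ∈ nhds (2:ℂ) := isOpen_compl_singleton.mem_nhds (by simp)
      filter_upwards [this] with s hs
      rw [hgs s hs]; ring
    have ha : AnalyticAt ℂ (fun s : ℂ => (s - 1)⁻¹) 2 := by
      have : AnalyticAt ℂ (fun s : ℂ => s - 1) 2 := by fun_prop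
      exact this.inv (by norm_num)
    have hha : AnalyticAt ℂ h 2 := hd.analyticAt 2
    have ha2 : AnalyticAt ℂ (fun s : ℂ => h s / (s - 1)) 2 := by simpa [div_eq_mul_inv] using! hha.mul ha
    have e1 : iteratedDeriv m g 2 = iteratedDeriv m (fun s => h s / (s - 1)) 2 - h 1 * ((-1) ^ m * m.factorial) := by
      rw [he.iteratedDeriv_eq, iteratedDeriv_fun_sub ha2.contDiffAt (ContDiffAt.mul contDiffAt_const ha.contDiffAt),
        iteratedDeriv_const_mul_field]
      congr 2
      have := iter_deriv_inv_linear_sub m 1 (1:ℂ)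
      rw [iteratedDeriv_eq_iterate]
      simp only [one_mul] at this
      rw [this]
      norm_num
    rw [hb, e1]
    have hs : ((-1:ℂ) ^ m) * (-1) ^ m = 1 := by rw [← mul_pow]; simp
    field_simp
    linear_combination ((m.factorial:ℂ) * h 1) * hs
  refine ⟨fun m => ?_, fun x hx1 hx2 => ?_⟩
  · rw [hrel, norm_div, norm_mul, norm_pow, norm_neg, norm_one, one_pow, one_mul, Complex.norm_natCast]
    have : (0:ℝ) < m.factorial := by exact_mod_cast m.factorial_pos
    rw [div_le_iff₀ this]
    refine (hc m).trans (le_of_eq ?_)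
    rw [div_eq_mul_inv, ← inv_pow]; norm_num; ring
  · have := hasSum_taylorSeries_of_entire hgd 2 (x:ℂ)
    convert! this using 2 with m
    rw [hrel]
    have : ((2 - x:ℝ):ℂ) = (-1) * ((x:ℂ) - 2) := by push_cast; ring
    rw [this, mul_pow]
    have hs : ((-1:ℂ) ^ m) * (-1) ^ m = 1 := by rw [← mul_pow]; simp
    simp only [smul_eq_mul]
    rw [div_eq_inv_mul]
    linear_combination ((m.factorial:ℂ)⁻¹ * iteratedDeriv m g 2 * ((x:ℂ) - 2) ^ m) * hs

lemma estermann_real {h : ℂ → ℂ} (hd : Differentiable ℂ h)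
    (hpos : ∀ m, 0 ≤ (-1) ^ m * iteratedDeriv m (fun s => h s / (s - 1)) 2)
    {x:ℝ} (hx1 : 1/2 < x) (hx2 : x < 7/2) : (h x).im = 0 := by
  obtain ⟨B, hB⟩ := (isCompact_closedBall (2:ℂ) (3/2)).exists_bound_of_continuousOn hd.continuous.continuousOn
  set b : ℕ → ℂ := fun m => (-1) ^ m * iteratedDeriv m (fun s => h s / (s - 1)) 2 / m.factorial with hbdef
  obtain ⟨h1, h2⟩ := estermann_coeff hd hB (b := b) (fun m => rfl)
  have hbim : ∀ m, (b m).im = 0 := by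
    intro m
    have := (nonneg_iff.1 (hpos m)).2
    rw [hbdef]; simp only
    rw [div_natCast_im, ← this]; simp
  have hlim : (h 1).im = 0 := by
    have ht : Filter.Tendsto (fun m : ℕ => 4 * B * (2/3:ℝ) ^ m) Filter.atTop (nhds 0) := by
      have := (tendsto_pow_atTop_nhds_zero_of_lt_one (r := (2/3:ℝ)) (by norm_num) (by norm_num)).const_mul (4 * B)
      simpa using this
    have : |(h 1).im| ≤ 0 := by
      refine ge_of_tendsto' ht (fun m => ?_)
      refine le_trans ?_ (h1 m)
      have := abs_im_le_norm (b m - h 1)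
      simpa [hbim] using this
    simpa using this
  have hs := h2 x hx1 hx2
  have hg : (dslope h 1 x).im = 0 := by
    have := (hasSum_im hs)
    have h0 : (fun m => ((b m - h 1) * ((2 - x:ℝ):ℂ) ^ m).im) = fun _ => 0 := by
      ext m
      rw [← ofReal_pow, im_mul_ofReal]; simp [hbim, hlim]
    rw [h0] at this
    exact this.unique hasSum_zero
  have e : h x = ((x - 1:ℝ):ℂ) * dslope h 1 x + h 1 := by
    have := sub_smul_dslope h 1 (x:ℂ)
    simp only [smul_eq_mul] at this
    push_cast; rw [this]; ring
  rw [e]; rw [add_im, im_ofReal_mul, hg, hlim]; simp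

lemma estermann {h : ℂ → ℂ} (hd : Differentiable ℂ h) {B:ℝ} (hB1 : 1 ≤ B)
    (hB : ∀ s ∈ Metric.closedBall (2:ℂ) (3/2), ‖h s‖ ≤ B)
    (hpos : ∀ m, 0 ≤ (-1) ^ m * iteratedDeriv m (fun s => h s / (s - 1)) 2)
    (hb0 : 1/100 ≤ (h 2).re) {β:ℝ} (hβ : 9/10 ≤ β) (hβ1 : β < 1) (hhβ : 0 ≤ (h β).re) :
    (1 - β) / 600 * (3200 * B) ^ (-(4 * (1 - β))) ≤ (h 1).re := by
  set b : ℕ → ℂ := fun m => (-1) ^ m * iteratedDeriv m (fun s => h s / (s - 1)) 2 / m.factorial with hbdef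
  obtain ⟨h1, h2⟩ := estermann_coeff hd hB (b := b) (fun m => rfl)
  have hbre : ∀ m, 0 ≤ (b m).re := by
    intro m
    have := (nonneg_iff.1 (hpos m)).1
    rw [hbdef]; simp only
    rw [div_natCast_re]; positivity
  have hb00 : 1/100 ≤ (b 0).re := by rw [hbdef]; simp; norm_num; norm_num at hb0; exact hb0
  set l := (h 1).re with hl
  have hs := hasSum_re (h2 β (by linarith) (by linarith))
  have e0 : ∀ m, ((b m - h 1) * ((2 - β:ℝ):ℂ) ^ m).re = ((b m).re - l) * (2 - β) ^ m := by
    intro m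
    rw [← ofReal_pow, re_mul_ofReal]; simp [hl]
  simp_rw [e0] at hs
  have hge : (dslope h 1 β).re * (1 - β) ≤ l := by
    have e : h β = ((β - 1:ℝ):ℂ) * dslope h 1 β + h 1 := by
      have := sub_smul_dslope h 1 (β:ℂ)
      simp only [smul_eq_mul] at this
      push_cast; rw [this]; ring
    rw [e, add_re, re_ofReal_mul] at hhβ
    linarith
  set L := ln (3200 * B) with hL
  have hL0 : 0 ≤ L := Real.log_nonneg (by linarith)
  set K := ⌈4 * L⌉₊ with hK
  have hK1 : 4 * L ≤ K := Nat.le_ceil _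
  have hK2 : (K:ℝ) ≤ 4 * L + 1 := (Nat.ceil_lt_add_one (by positivity)).le
  have hpow1 : (3/4:ℝ) ^ K * (3200 * B) ≤ 1 := by
    have e1 : (3/4:ℝ) ≤ Real.exp (-(1/4)) := by have := Real.add_one_le_exp (-(1/4:ℝ)); linarith
    have e2 : (3/4:ℝ) ^ K ≤ Real.exp (-L) := by
      calc (3/4:ℝ) ^ K ≤ Real.exp (-(1/4)) ^ K := by gcongr
        _ = Real.exp (-(K / 4)) := by rw [← Real.exp_nat_mul]; congr 1; ring
        _ ≤ Real.exp (-L) := by apply Real.exp_le_exp.2; linarith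
    have e3 : 3200 * B = Real.exp L := by rw [hL, Real.exp_log (by positivity)]
    calc _ ≤ Real.exp (-L) * Real.exp L := by rw [← e3]; gcongr
      _ = 1 := by rw [← Real.exp_add]; simp
  have hpow2 : (2 - β) ^ K ≤ 3 * (3200 * B) ^ (4 * (1 - β)) := by
    have e1 : 2 - β ≤ Real.exp (1 - β) := by have := Real.add_one_le_exp (1 - β); linarith
    calc (2 - β) ^ K ≤ Real.exp (1 - β) ^ K := by gcongr; linarith
      _ = Real.exp (K * (1 - β)) := by rw [← Real.exp_nat_mul]
      _ ≤ Real.exp (1 + L * (4 * (1 - β))) := by apply Real.exp_le_exp.2; nlinarith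
      _ = Real.exp 1 * (3200 * B) ^ (4 * (1 - β)) := by rw [Real.exp_add, Real.rpow_def_of_pos (by positivity)]
      _ ≤ _ := by gcongr; linarith [Real.exp_one_lt_d9]
  -- tail
  have hsum := hs.summable
  have hsplit := hsum.sum_add_tsum_nat_add K
  rw [hs.tsum_eq] at hsplit
  have htail : -(16 * B * (3/4) ^ K) ≤ ∑' i, ((b (i + K)).re - l) * (2 - β) ^ (i + K) := by
    have hgeo : HasSum (fun i : ℕ => 4 * B * (3/4:ℝ) ^ K * (3/4) ^ i) (4 * B * (3/4) ^ K * (1 - 3/4)⁻¹) :=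
      (hasSum_geometric_of_lt_one (by norm_num) (by norm_num)).mul_left _
    have hb : ∀ i, ‖((b (i + K)).re - l) * (2 - β) ^ (i + K)‖ ≤ 4 * B * (3/4:ℝ) ^ K * (3/4) ^ i := by
      intro i
      rw [norm_mul, norm_pow, Real.norm_eq_abs, Real.norm_eq_abs, abs_of_nonneg (show 0 ≤ 2 - β by linarith)]
      have e1 : |(b (i + K)).re - l| ≤ 4 * B * (2/3) ^ (i + K) := by
        refine le_trans ?_ (h1 (i + K))
        simpa using abs_re_le_norm (b (i + K) - h 1)
      calc _ ≤ 4 * B * (2/3) ^ (i + K) * (2 - β) ^ (i + K) := by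
              have : 0 ≤ 2 - β := by linarith
              gcongr
        _ = 4 * B * (2/3 * (2 - β)) ^ (i + K) := by rw [mul_pow]; ring
        _ ≤ 4 * B * (3/4) ^ (i + K) := by gcongr; linarith; linarith
        _ = _ := by rw [pow_add]; ring
    have := tsum_of_norm_bounded hgeo hb
    rw [Real.norm_eq_abs] at this
    have := (abs_le.1 this).1
    refine le_trans (le_of_eq ?_) this
    norm_num; ring
  have hKpos : 0 < K := by
    rw [hK, Nat.ceil_pos]
    have : 0 < L := Real.log_pos (by linarith)
    positivity
  have hhead : 1/100 - l * (∑ i ∈ range K, (2 - β) ^ i) ≤ ∑ i ∈ range K, ((b i).re - l) * (2 - β) ^ i := by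
    simp_rw [sub_mul]
    rw [sum_sub_distrib, ← mul_sum]
    have : (b 0).re * (2 - β) ^ 0 ≤ ∑ i ∈ range K, (b i).re * (2 - β) ^ i := by
      apply single_le_sum (f := fun i => (b i).re * (2 - β) ^ i)
      · intro i _
        have : 0 ≤ 2 - β := by linarith
        have := hbre i
        positivity
      · simpa using hKpos
    simp at this
    linarith
  have hgeom : (∑ i ∈ range K, (2 - β) ^ i) * (1 - β) = (2 - β) ^ K - 1 := by
    have := geom_sum_mul (2 - β) K
    rw [show 2 - β - 1 = 1 - β by ring] at this
    exact this
  have hfin : 1/200 * (1 - β) ≤ l * (2 - β) ^ K := by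
    have hx : 1/200 - l * (∑ i ∈ range K, (2 - β) ^ i) ≤ (dslope h 1 β).re := by linarith
    have := mul_le_mul_of_nonneg_right hx (show 0 ≤ 1 - β by linarith)
    have e : (1/200 - l * (∑ i ∈ range K, (2 - β) ^ i)) * (1 - β) = 1/200 * (1 - β) - l * ((2 - β) ^ K - 1) := by linear_combination (-l) * hgeom
    rw [e] at this
    linarith
  have hlpos : 0 ≤ l := by
    have : 0 < (2 - β) ^ K := by apply pow_pos; linarith
    by_contra hneg
    push Not at hneg
    nlinarith
  have h3 : 1/200 * (1 - β) ≤ l * (3 * (3200 * B) ^ (4 * (1 - β))) :=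
    hfin.trans (by gcongr)
  rw [Real.rpow_neg (by positivity), ← div_eq_mul_inv, div_le_iff₀ (by positivity)]
  linarith

/-- derivatives of a function with nonnegative logarithmic derivative coefficients -/
lemma alternating_of_logDeriv {F u : ℂ → ℂ} (hF : AnalyticAt ℂ F 2) (hu : AnalyticAt ℂ u 2)
    (hFu : ∀ᶠ s in nhds (2:ℂ), deriv F s = - (u s * F s)) (hF2 : 0 ≤ F 2)
    (hua : ∀ m, 0 ≤ (-1) ^ m * iteratedDeriv m u 2) (m:ℕ) :
    0 ≤ (-1) ^ m * iteratedDeriv m F 2 := by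
  induction m using Nat.strong_induction_on with
  | _ m ih =>
    rcases m with _ | m
    · simpa using hF2
    · have he : deriv F =ᶠ[nhds 2] (fun s => - (u s * F s)) := hFu
      have hmul := iteratedDeriv_mul (n := m) (f := u) (g := F) (x := 2) hu.contDiffAt hF.contDiffAt
      rw [iteratedDeriv_succ', he.iteratedDeriv_eq]
      have e1 : iteratedDeriv m (fun s => - (u s * F s)) 2 = - iteratedDeriv m (u * F) 2 := by rw [← iteratedDeriv_neg]; rfl
      rw [e1, hmul, ← sum_neg_distrib, mul_sum]
      refine sum_nonneg fun i hi => ?_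
      have hi' : i ≤ m := by simp at hi; omega
      have h1 := hua i
      have h2 := ih (m - i) (by omega)
      have h3 : (0:ℂ) ≤ (m.choose i:ℂ) := by exact_mod_cast Nat.zero_le _
      have e2 : (-1:ℂ) ^ (m + 1) = - ((-1) ^ i * (-1) ^ (m - i)) := by rw [← pow_add, Nat.add_sub_cancel' hi', pow_succ]; ring
      rw [e2]
      have := mul_nonneg h3 (mul_nonneg h1 h2)
      convert this using 1
      ring

end estermann

section siegel
open scoped ComplexOrder

lemma char_real_cases {q:ℕ} {χ : DC q} (h : χ ^ 2 = 1) (a : ZMod q) :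
    χ a = 0 ∨ χ a = 1 ∨ χ a = -1 := by
  by_cases ha : IsUnit a
  · right
    have : (χ ^ 2) a = 1 := by rw [h, MulChar.one_apply ha]
    rw [MulChar.pow_apply' _ two_ne_zero] at this
    exact mul_self_eq_one_iff.1 (by rw [← sq]; exact this)
  · left; exact χ.map_nonunit ha

structure LD (F : ℂ → ℂ) (a : ℕ → ℂ) : Prop where
  diff : ∀ s : ℂ, 1 < s.re → DifferentiableAt ℂ F s
  der : ∀ s : ℂ, 1 < s.re → deriv F s = - (LSeries a s * F s)
  summ : ∀ s : ℂ, 1 < s.re → LSeriesSummable a s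

lemma LD.mul {F G : ℂ → ℂ} {a b : ℕ → ℂ} (h1 : LD F a) (h2 : LD G b) : LD (F * G) (a + b) where
  diff s hs := (h1.diff s hs).mul (h2.diff s hs)
  der s hs := by
    rw [deriv_mul (h1.diff s hs) (h2.diff s hs), h1.der s hs, h2.der s hs,
      LSeries_add (h1.summ s hs) (h2.summ s hs), Pi.mul_apply]
    ring
  summ s hs := (h1.summ s hs).add (h2.summ s hs)

lemma halfplane_nhds {s:ℂ} (hs : 1 < s.re) : {z : ℂ | 1 < z.re} ∈ nhds s :=
  (isOpen_lt continuous_const continuous_re).mem_nhds hs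

lemma ne_one_of_re {s:ℂ} (hs : 1 < s.re) : s ≠ 1 := by
  intro h; simp [h] at hs

noncomputable def vM (χ : ℕ → ℂ) : ℕ → ℂ := fun n => χ n * (ArithmeticFunction.vonMangoldt n:ℂ)

lemma LD_char {q:ℕ} [NeZero q] (χ : DC q) : LD χ.LFunction (vM fun n => χ n) where
  diff s hs := DirichletCharacter.differentiableAt_LFunction χ s (Or.inl (ne_one_of_re hs))
  der s hs := by
    have h := DirichletCharacter.LSeries_twist_vonMangoldt_eq χ hs
    have e1 : (fun s => LSeries (fun n => χ n) s) =ᶠ[nhds s] χ.LFunction := by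
      filter_upwards [halfplane_nhds hs] with z hz
      rw [DirichletCharacter.LFunction_eq_LSeries χ hz]
    have hne := DirichletCharacter.LFunction_ne_zero_of_one_le_re χ (Or.inr (ne_one_of_re hs)) hs.le
    change LSeries (vM fun n => χ n) s = _ at h
    rw [h]
    have e2 : deriv (LSeries (fun n => χ n)) s = deriv χ.LFunction s := e1.deriv_eq
    rw [e2, ← DirichletCharacter.LFunction_eq_LSeries χ hs]
    field_simp
  summ s hs := DirichletCharacter.LSeriesSummable_twist_vonMangoldt χ hs

lemma LD.alternating {F : ℂ → ℂ} {a : ℕ → ℂ} (h : LD F a) (ha : 0 ≤ a) (hF2 : 0 ≤ F 2) (m:ℕ) :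
    0 ≤ (-1) ^ m * iteratedDeriv m F 2 := by
  have h2 : (1:ℝ) < (2:ℂ).re := by simp
  have hopen : IsOpen {z : ℂ | 1 < z.re} := isOpen_lt continuous_const continuous_re
  have habs : LSeries.abscissaOfAbsConv a ≤ (1:ℝ) :=
    LSeries.abscissaOfAbsConv_le_of_forall_lt_LSeriesSummable (fun y hy => h.summ y (by simpa using hy))
  have habs2 : LSeries.abscissaOfAbsConv a < ((2:ℝ) : EReal) := lt_of_le_of_lt habs (by exact_mod_cast one_lt_two)
  refine alternating_of_logDeriv (u := LSeries a) ?_ ?_ ?_ hF2 ?_ m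
  · have : DifferentiableOn ℂ F {z : ℂ | 1 < z.re} := fun z hz => (h.diff z hz).differentiableWithinAt
    exact this.analyticOnNhd hopen 2 h2
  · have : DifferentiableOn ℂ (LSeries a) {z : ℂ | 1 < z.re} := fun z hz => by
      refine (LSeries_hasDerivAt (lt_of_le_of_lt habs ?_)).differentiableAt.differentiableWithinAt
      exact_mod_cast hz
    exact this.analyticOnNhd hopen 2 h2
  · filter_upwards [halfplane_nhds h2] with z hz using h.der z hz
  · intro m
    have := LSeries.iteratedDeriv_alternating ha (x := 2) habs2 m
    simpa using this

lemma L_two {q:ℕ} [NeZero q] {χ : DC q} (h : χ ^ 2 = 1) :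
    0 ≤ χ.LFunction 2 ∧ 1/3 ≤ (χ.LFunction 2).re := by
  have h2 : (1:ℝ) < (2:ℂ).re := by simp
  rw [DirichletCharacter.LFunction_eq_LSeries χ h2]
  have hs : HasSum (LSeries.term (fun n => χ n) 2) (LSeries (fun n => χ n) 2) :=
    (DirichletCharacter.LSeriesSummable_of_one_lt_re χ h2).hasSum
  have hterm : ∀ n : ℕ, LSeries.term (fun n => χ n) 2 n = χ n / ((n ^ 2:ℕ):ℂ) := by
    intro n
    rw [LSeries.term_def]
    split_ifs with h0
    · simp [h0]
    · push_cast; congr 1; norm_cast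
  have him : (LSeries (fun n => χ n) 2).im = 0 := by
    have h3 := hasSum_im hs
    have : (fun n => (LSeries.term (fun n => χ n) 2 n).im) = fun _ => 0 := by
      ext n
      rw [hterm, div_natCast_im]
      rcases char_real_cases h (n : ZMod q) with h | h | h <;> simp [h]
    rw [this] at h3
    exact h3.unique hasSum_zero
  have hre : 1/3 ≤ (LSeries (fun n => χ n) 2).re := by
    have h3 := hasSum_re hs
    have hz : HasSum (fun n : ℕ => (1:ℝ) / (n:ℝ) ^ 2) (pi ^ 2 / 6) := hasSum_zeta_two
    have h4 := h3.add hz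
    have hnn : ∀ n, 0 ≤ (LSeries.term (fun n => χ n) 2 n).re + (1:ℝ) / (n:ℝ) ^ 2 := by
      intro n
      rw [hterm, div_natCast_re]
      have : (((n ^ 2:ℕ)):ℝ) = (n:ℝ) ^ 2 := by push_cast; rfl
      rw [this, ← add_div]
      apply div_nonneg _ (by positivity)
      rcases char_real_cases h (n : ZMod q) with h | h | h <;> simp [h]
    have h5 := le_hasSum h4 1 (fun n _ => hnn n)
    rw [hterm] at h5
    simp at h5
    have := Real.pi_lt_d2
    have := Real.pi_pos
    nlinarith
  refine ⟨nonneg_iff.2 ⟨by linarith, him.symm⟩, hre⟩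

lemma L_ball_bound {q:ℕ} [NeZero q] {χ : DC q} (h : χ ≠ 1) {s:ℂ}
    (hs : s ∈ Metric.closedBall (2:ℂ) (3/2)) : ‖χ.LFunction s‖ ≤ 600 * q := by
  have hd := DirichletCharacter.differentiable_LFunction h
  refine norm_le_of_forall_mem_frontier_norm_le (U := Metric.ball 2 (3/2)) Metric.isBounded_ball
      hd.diffContOnCl ?_ (by rwa [closure_ball _ (by norm_num)])
  intro z hz
  rw [frontier_ball _ (by norm_num), mem_sphere_iff_norm] at hz
  have h1 : 1/2 ≤ ‖z - 1‖ := by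
    have := norm_sub_norm_le (z - 2) (1 - 2)
    rw [hz] at this
    have e : z - 2 - (1 - 2) = z - 1 := by ring
    rw [e] at this
    norm_num at this ⊢; linarith
  have hre : |z.re - 2| ≤ 3/2 := by rw [← hz]; simpa using abs_re_le_norm (z - 2)
  rw [abs_le] at hre
  have hz1 : z ≠ 1 := by intro h; simp [h] at h1; linarith
  have h2 := norm_HH_le χ (s := z) (by linarith)
  have h3 : ‖z‖ ≤ 7/2 := by
    have := norm_add_le (z - 2) 2
    rw [hz] at this; simp at this; linarith
  rw [HH_eq χ hz1, norm_mul] at h2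
  have h4 : 13 * (q:ℝ) * (‖z‖ + 1) ^ 2 ≤ 300 * q := by
    have : (‖z‖ + 1) ^ 2 ≤ (9/2) ^ 2 := by gcongr; linarith
    nlinarith
  nlinarith [norm_nonneg (χ.LFunction z)]

lemma HH1_ball_bound {s:ℂ} (hs : s ∈ Metric.closedBall (2:ℂ) (3/2)) :
    ‖HH (1 : DC 1) s‖ ≤ 600 := by
  rw [mem_closedBall_iff_norm] at hs
  have hre : |s.re - 2| ≤ 3/2 := by refine le_trans ?_ hs; simpa using abs_re_le_norm (s - 2)
  rw [abs_le] at hre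
  have h2 := norm_HH_le (1 : DC 1) (s := s) (by linarith)
  have h3 : ‖s‖ ≤ 7/2 := by
    have := norm_add_le (s - 2) 2
    simp at this; linarith
  refine h2.trans ?_
  have : (‖s‖ + 1) ^ 2 ≤ (9/2) ^ 2 := by gcongr; linarith
  push_cast
  nlinarith

/-- the product `ζ(s) G(s)` with simple pole removed, where `G` is entire -/
lemma siegel_core {G : ℂ → ℂ} (hG : Differentiable ℂ G) {a : ℕ → ℂ} (hLD : LD G a)
    (ha : 0 ≤ (vM fun _ => 1) + a) (hG2 : 0 ≤ G 2) (hG3 : 1/27 ≤ (G 2).re) {B:ℝ} (hB1 : 1 ≤ B)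
    (hB : ∀ s ∈ Metric.closedBall (2:ℂ) (3/2), ‖G s‖ ≤ B) {β:ℝ} (hβ : 9/10 ≤ β) (hβ1 : β < 1)
    (hz : (HH (1 : DC 1) β * G β = 0) ∨
      (∀ x : ℝ, β ≤ x → x ≤ 2 → HH (1 : DC 1) x * G x ≠ 0)) :
    (1 - β) / 600 * (3200 * (600 * B)) ^ (-(4 * (1 - β))) ≤ 600 * ‖G 1‖ := by
  set H1 := HH (1 : DC 1) with hH1
  set h : ℂ → ℂ := fun s => H1 s * G s with hh
  have hd : Differentiable ℂ h := (differentiable_HH _).mul hG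
  have hLD1 : LD ((1 : DC 1).LFunction * G) ((vM fun _ => 1) + a) := by
    have := (LD_char (1 : DC 1)).mul hLD
    convert! this using 4 with n
    simp [Subsingleton.eq_one (α := ZMod 1)]
  have hF : ∀ s : ℂ, s ≠ 1 → h s / (s - 1) = ((1 : DC 1).LFunction * G) s := by
    intro s hs
    rw [hh]; simp only
    rw [hH1, HH_eq _ hs, Pi.mul_apply]; field_simp
  have hL2 := L_two (χ := (1 : DC 1)) (by simp)
  have hprod : 0 ≤ ((1 : DC 1).LFunction * G) 2 := mul_nonneg hL2.1 hG2
  have hev : (fun s => h s / (s - 1)) =ᶠ[nhds 2] ((1 : DC 1).LFunction * G) := by filter_upwards [halfplane_nhds (s := 2) (by simp)] with z hz using hF z (ne_one_of_re hz)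
  have hpos : ∀ m, 0 ≤ (-1) ^ m * iteratedDeriv m (fun s => h s / (s - 1)) 2 := by
    intro m
    rw [hev.iteratedDeriv_eq]
    exact hLD1.alternating ha hprod m
  have h2re : 1/100 ≤ (h 2).re := by
    have := hF 2 (by norm_num)
    have e : (2:ℂ) - 1 = 1 := by norm_num
    rw [e, div_one, Pi.mul_apply] at this
    rw [this]
    have i1 := (nonneg_iff.1 hL2.1).2
    rw [mul_re, ← i1]
    nlinarith [hL2.2]
  have hbd : ∀ s ∈ Metric.closedBall (2:ℂ) (3/2), ‖h s‖ ≤ 600 * B := by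
    intro s hs
    rw [hh]; simp only
    rw [norm_mul]
    exact mul_le_mul (HH1_ball_bound hs) (hB s hs) (norm_nonneg _) (by norm_num)
  have hβ0 : 0 ≤ (h β).re := by
    rcases hz with hz | hz
    · have : h β = 0 := hz
      simp [this]
    · by_contra hneg
      push Not at hneg
      have hc : ContinuousOn (fun x : ℝ => (h x).re) (Set.Icc β 2) :=
        (continuous_re.comp (hd.continuous.comp continuous_ofReal)).continuousOn
      have h20 : (0:ℝ) ≤ (h (2:ℝ)).re := by push_cast; linarith
      obtain ⟨x, hx, hx0⟩ := intermediate_value_Icc (by linarith) hc ⟨hneg.le, h20⟩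
      have hx0' : (h x).re = 0 := hx0
      have := estermann_real hd hpos (x := x) (by linarith [hx.1]) (by linarith [hx.2])
      exact hz x hx.1 hx.2 (Complex.ext hx0' this)
  have := estermann hd (B := 600 * B) (by linarith) hbd hpos h2re hβ hβ1 hβ0
  refine this.trans ((re_le_norm _).trans ?_)
  rw [hh]; simp only
  rw [norm_mul]
  gcongr
  exact HH1_ball_bound (by simp [dist_eq_norm]; norm_num)

lemma pow_omega_le {ε:ℝ} (hε : 0 < ε) : ∃ C : ℝ, 1 ≤ C ∧ ∀ N : ℕ, N ≠ 0 →
    (4:ℝ) ^ N.primeFactors.card ≤ C * (N:ℝ) ^ ε := by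
  obtain ⟨P, hP⟩ := exists_nat_ge ((4:ℝ) ^ (1 / ε))
  refine ⟨4 ^ P, one_le_pow₀ (by norm_num), fun N hN => ?_⟩
  have h1 : ∀ p ∈ N.primeFactors, (4:ℝ) ≤ (if p < P then 4 else 1) * (p:ℝ) ^ ε := by
    intro p hp
    have hp1 : 1 ≤ (p:ℝ) := by exact_mod_cast (Nat.prime_of_mem_primeFactors hp).one_le
    split_ifs with h
    · have := Real.one_le_rpow hp1 hε.le
      linarith
    · push Not at h
      have : (4:ℝ) ^ (1 / ε) ≤ p := hP.trans (by exact_mod_cast h)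
      calc (4:ℝ) = ((4:ℝ) ^ (1 / ε)) ^ ε := by
            rw [← Real.rpow_mul (by norm_num)]; field_simp; norm_num
        _ ≤ (p:ℝ) ^ ε := by gcongr
        _ = _ := by ring
  calc (4:ℝ) ^ N.primeFactors.card = ∏ p ∈ N.primeFactors, 4 := by simp
    _ ≤ ∏ p ∈ N.primeFactors, ((if p < P then 4 else 1) * (p:ℝ) ^ ε) :=
        prod_le_prod (fun _ _ => by norm_num) h1
    _ = (∏ p ∈ N.primeFactors, (if p < P then (4:ℝ) else 1)) * (∏ p ∈ N.primeFactors, (p:ℝ)) ^ ε := by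
        rw [prod_mul_distrib, Real.finsetProd_rpow]
        intro i _; positivity
    _ ≤ 4 ^ P * (N:ℝ) ^ ε := by
        gcongr
        · rw [prod_ite]
          simp only [prod_const, one_pow, mul_one]
          apply pow_le_pow_right₀ (by norm_num)
          calc _ ≤ (range P).card := by
                apply card_le_card
                intro x hx; simp at hx ⊢; exact hx.2
            _ = P := by simp
        · have := Nat.le_of_dvd (Nat.pos_of_ne_zero hN) (Nat.prod_primeFactors_dvd N)
          rw [← Nat.cast_prod]; exact_mod_cast this

end siegel

section siegel2
open scoped ComplexOrder
open DirichletCharacter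

lemma HH1_nonvanish : ∃ δ : ℝ, 0 < δ ∧ ∀ x : ℝ, 1 - δ ≤ x → HH (1 : DC 1) x ≠ 0 := by
  have h1 : HH (1 : DC 1) ((1:ℝ):ℂ) ≠ 0 := by
    have := LFunctionTrivChar₁_apply_one_ne_zero 1
    simpa [HH] using this
  have hc : Continuous fun x : ℝ => HH (1 : DC 1) (x:ℂ) :=
    (differentiable_HH _).continuous.comp continuous_ofReal
  have := hc.continuousAt.eventually_ne h1
  rw [Metric.eventually_nhds_iff] at this
  obtain ⟨d, hd, H⟩ := this
  refine ⟨d / 2, by linarith, fun x hx => ?_⟩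
  rcases lt_or_ge 1 x with h | h
  · have hx1 : (x:ℂ) ≠ 1 := by exact_mod_cast h.ne'
    rw [HH_eq _ hx1]
    refine mul_ne_zero (sub_ne_zero.2 hx1) ?_
    exact LFunction_ne_zero_of_one_le_re _ (Or.inr hx1) (by simpa using h.le)
  · apply H
    rw [Real.dist_eq, abs_of_nonpos (by linarith)]; linarith

lemma char_prod {q1 q2:ℕ} (χ1 : DC q1) (χ2 : DC q2) (n:ℕ) :
    (changeLevel (Nat.dvd_mul_right q1 q2) χ1 * changeLevel (Nat.dvd_mul_left q2 q1) χ2) (n : ZMod (q1 * q2))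
      = χ1 n * χ2 n := by
  by_cases h : Nat.Coprime n (q1 * q2)
  · have hc : IsCoprime (n:ℤ) ((q1 * q2:ℕ):ℤ) := Nat.isCoprime_iff_coprime.2 h
    have h1 := changeLevel_eq_cast_of_dvd' χ1 (Nat.dvd_mul_right q1 q2) hc
    have h2 := changeLevel_eq_cast_of_dvd' χ2 (Nat.dvd_mul_left q2 q1) hc
    simp only [Int.cast_natCast] at h1 h2
    rw [MulChar.mul_apply, h1, h2]
  · rw [MulChar.map_nonunit _ (by rwa [ZMod.isUnit_iff_coprime])]
    rw [Nat.coprime_mul_iff_right, not_and_or] at h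
    rcases h with h | h
    · rw [χ1.map_nonunit (by rwa [ZMod.isUnit_iff_coprime]), zero_mul]
    · rw [χ2.map_nonunit (by rwa [ZMod.isUnit_iff_coprime]), mul_zero]

lemma one_add_nonneg {z:ℂ} (h : z = 0 ∨ z = 1 ∨ z = -1) : 0 ≤ 1 + z := by
  rcases h with h | h | h <;> simp [h]
  exact add_nonneg zero_le_one zero_le_one

lemma euler_factor {q:ℕ} (χ : DC q) (S : Finset ℕ) (hS : ∀ p ∈ S, 2 ≤ p) :
    (1/2:ℝ) ^ S.card ≤ ‖∏ p ∈ S, (1 - χ p * (p:ℂ) ^ (-(1:ℂ)))‖ ∧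
    ‖∏ p ∈ S, (1 - χ p * (p:ℂ) ^ (-(1:ℂ)))‖ ≤ 2 ^ S.card := by
  have h : ∀ p ∈ S, ‖χ p * (p:ℂ) ^ (-(1:ℂ))‖ ≤ 1/2 := by
    intro p hp
    rw [cpow_neg_one, norm_mul, norm_inv, Complex.norm_natCast]
    have h2 : (2:ℝ) ≤ p := by exact_mod_cast hS p hp
    have : ((p:ℝ))⁻¹ ≤ 1/2 := by rw [one_div]; exact inv_anti₀ (by norm_num) h2
    have h3 := χ.norm_le_one (p : ZMod q)
    calc _ ≤ 1 * (1/2:ℝ) := by gcongr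
      _ = _ := by ring
  rw [norm_prod]
  constructor
  · rw [← prod_const]
    apply prod_le_prod (fun _ _ => by norm_num)
    intro p hp
    have := norm_sub_norm_le (1:ℂ) (χ p * (p:ℂ) ^ (-(1:ℂ)))
    rw [norm_one] at this
    linarith [h p hp]
  · rw [← prod_const]
    apply prod_le_prod (fun _ _ => norm_nonneg _)
    intro p hp
    have := norm_sub_le (1:ℂ) (χ p * (p:ℂ) ^ (-(1:ℂ)))
    rw [norm_one] at this
    linarith [h p hp]

lemma siegel_arith {ε β B K:ℝ} {q:ℝ} (hq : 1 ≤ q) (hε : 0 < ε) (hβ1 : β < 1) (hβ : 1 - ε/16 ≤ β)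
    (hB : 1 ≤ B) (hBK : 3200 * (600 * B) ≤ K * q ^ 2) :
    (1 - β) / 600 * (K ^ (-(ε/4)) * q ^ (-(ε/2))) ≤ (1 - β) / 600 * (3200 * (600 * B)) ^ (-(4 * (1 - β))) := by
  have hK : 0 < K := by
    by_contra h
    push Not at h
    nlinarith [sq_nonneg q]
  have h1β : 0 ≤ (1 - β) / 600 := by linarith
  refine mul_le_mul_of_nonneg_left ?_ h1β
  · calc K ^ (-(ε/4)) * q ^ (-(ε/2)) = (K * q ^ 2) ^ (-(ε/4)) := by
          rw [Real.mul_rpow hK.le (by positivity), ← Real.rpow_natCast q 2, ← Real.rpow_mul (by linarith)]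
          congr 2; push_cast; ring
      _ ≤ (3200 * (600 * B)) ^ (-(ε/4)) := by apply Real.rpow_le_rpow_of_nonpos (by positivity) hBK; linarith
      _ ≤ _ := by apply Real.rpow_le_rpow_of_exponent_le (by linarith); linarith

theorem siegel {ε:ℝ} (hε : 0 < ε) : ∃ c : ℝ, 0 < c ∧ ∀ (q:ℕ) [NeZero q] (χ : DC q),
    χ ≠ 1 → χ ^ 2 = 1 → c * (q:ℝ) ^ (-ε) ≤ ‖χ.LFunction 1‖ := by
  obtain ⟨δ0, hδ0, Hδ0⟩ := HH1_nonvanish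
  set δ := min (ε / 16) (min δ0 (1/10)) with hδ
  have hδp : 0 < δ := by simp only [hδ, lt_min_iff]; exact ⟨by linarith, hδ0, by norm_num⟩
  have d1 : δ ≤ ε / 16 := min_le_left _ _
  have d2 : δ ≤ δ0 := (min_le_right _ _).trans (min_le_left _ _)
  have d3 : δ ≤ 1/10 := (min_le_right _ _).trans (min_le_right _ _)
  have hqpos : ∀ q : ℕ, [NeZero q] → (1:ℝ) ≤ q := fun q _ => one_le_q q
  by_cases hcase : ∃ (q:ℕ) (_ : NeZero q) (χ : DC q), χ ≠ 1 ∧ χ ^ 2 = 1 ∧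
      ∃ β : ℝ, 1 - δ ≤ β ∧ β < 1 ∧ χ.LFunction β = 0
  · obtain ⟨q1, _, χ1, hχ1, hχ1s, β, hβ, hβ1, hz⟩ := hcase
    obtain ⟨η, C, hη, _, hC1, HC⟩ := L_growth (ε := ε / 2) (by linarith)
    obtain ⟨C', hC', Hω⟩ := pow_omega_le hε
    have hL1 : 0 < ‖χ1.LFunction 1‖ := norm_pos_iff.2
      (LFunction_ne_zero_of_one_le_re χ1 (Or.inl hχ1) (by simp))
    have hq1 := hqpos q1
    set K : ℝ := 3200 * (600 * (600 ^ 3 * (q1:ℝ) ^ 2)) with hK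
    have hKp : 0 < K := by positivity
    set c1 : ℝ := (1 - β) / 600 * K ^ (-(ε/4)) / (600 * (600 * q1) * (C * (2 * q1) ^ (ε/2))) with hc1
    have hc1p : 0 < c1 := by have : 0 < 1 - β := by linarith
                             positivity
    set c2 : ℝ := ‖χ1.LFunction 1‖ / (C' * (q1:ℝ) ^ ε) with hc2
    have hc2p : 0 < c2 := by positivity
    refine ⟨min c1 c2, lt_min hc1p hc2p, fun q2 _ χ2 hχ2 hχ2s => ?_⟩
    have hq2 := hqpos q2
    set N := q1 * q2 with hN
    have : NeZero N := ⟨mul_ne_zero (NeZero.ne q1) (NeZero.ne q2)⟩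
    have hNc : (N:ℝ) = q1 * q2 := by simp [hN]
    set ψ := changeLevel (Nat.dvd_mul_right q1 q2) χ1 * changeLevel (Nat.dvd_mul_left q2 q1) χ2 with hψ
    have hψs : ψ ^ 2 = 1 := by rw [hψ, mul_pow, ← map_pow, ← map_pow, hχ1s, hχ2s, map_one, map_one, one_mul]
    by_cases hψ1 : ψ = 1
    · have hee : changeLevel (Nat.dvd_mul_right q1 q2) χ1 = changeLevel (Nat.dvd_mul_left q2 q1) χ2 := by
        have h1 : (changeLevel (Nat.dvd_mul_right q1 q2) χ1) ^ 2 = 1 := by rw [← map_pow, hχ1s, map_one]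
        have h2 : changeLevel (Nat.dvd_mul_right q1 q2) χ1 * changeLevel (Nat.dvd_mul_left q2 q1) χ2 = 1 := hψ1
        rw [sq] at h1
        exact mul_left_cancel (h1.trans h2.symm)
      have e1 := LFunction_changeLevel (Nat.dvd_mul_right q1 q2) χ1 (s := 1) (Or.inl hχ1)
      have e2 := LFunction_changeLevel (Nat.dvd_mul_left q2 q1) χ2 (s := 1) (Or.inl hχ2)
      rw [hee, e2] at e1
      have e3 := congrArg norm e1
      rw [norm_mul, norm_mul] at e3
      have hS : ∀ p ∈ (q1 * q2).primeFactors, 2 ≤ p := fun p hp => (Nat.prime_of_mem_primeFactors hp).two_le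
      have f1 := euler_factor χ1 _ hS
      have f2 := euler_factor χ2 _ hS
      have f3 := Hω N (NeZero.ne N)
      have hw : (4:ℝ) ^ (N.primeFactors.card) = 2 ^ N.primeFactors.card * 2 ^ N.primeFactors.card := by rw [← mul_pow]; norm_num
      have g1 : ‖χ1.LFunction 1‖ ≤ ‖χ2.LFunction 1‖ * 4 ^ N.primeFactors.card := by
        have k1 : ‖χ1.LFunction 1‖ * (1/2:ℝ) ^ N.primeFactors.card ≤ ‖χ2.LFunction 1‖ * 2 ^ N.primeFactors.card := by
          calc _ ≤ ‖χ1.LFunction 1‖ * _ := mul_le_mul_of_nonneg_left f1.1 (norm_nonneg _)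
            _ = _ := e3.symm
            _ ≤ _ := mul_le_mul_of_nonneg_left f2.2 (norm_nonneg _)
        have k2 : (1/2:ℝ) ^ N.primeFactors.card * 2 ^ N.primeFactors.card = 1 := by rw [← mul_pow]; norm_num
        rw [hw]
        calc ‖χ1.LFunction 1‖ = ‖χ1.LFunction 1‖ * (1/2:ℝ) ^ N.primeFactors.card * 2 ^ N.primeFactors.card := by
              rw [mul_assoc, k2, mul_one]
          _ ≤ (‖χ2.LFunction 1‖ * 2 ^ N.primeFactors.card) * 2 ^ N.primeFactors.card := by gcongr
          _ = _ := by ring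
      calc min c1 c2 * (q2:ℝ) ^ (-ε) ≤ c2 * (q2:ℝ) ^ (-ε) := by gcongr; exact min_le_right _ _
        _ ≤ _ := by
          rw [hc2, Real.rpow_neg (by positivity), ← div_eq_mul_inv, div_div, div_le_iff₀ (by positivity)]
          calc _ ≤ _ := g1
            _ ≤ ‖χ2.LFunction 1‖ * (C' * (N:ℝ) ^ ε) := by gcongr
            _ = _ := by rw [hNc, Real.mul_rpow (by positivity) (by positivity)]; ring
    · set G : ℂ → ℂ := χ1.LFunction * χ2.LFunction * ψ.LFunction with hG
      have hGd : Differentiable ℂ G :=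
        ((differentiable_LFunction hχ1).mul (differentiable_LFunction hχ2)).mul (differentiable_LFunction hψ1)
      have hLD : LD G _ := ((LD_char χ1).mul (LD_char χ2)).mul (LD_char ψ)
      have l1 := L_two hχ1s
      have l2 := L_two hχ2s
      have l3 := L_two hψs
      have hG2 : 0 ≤ G 2 := mul_nonneg (mul_nonneg l1.1 l2.1) l3.1
      have hG3 : 1/27 ≤ (G 2).re := by
        have i1 := (nonneg_iff.1 l1.1).2
        have i2 := (nonneg_iff.1 l2.1).2
        have i3 := (nonneg_iff.1 l3.1).2
        have : (G 2).re = (χ1.LFunction 2).re * (χ2.LFunction 2).re * (ψ.LFunction 2).re := by simp only [hG, Pi.mul_apply, mul_re, mul_im, ← i1, ← i2, ← i3]; ring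
        rw [this]
        have a1 : 1/9 ≤ (χ1.LFunction 2).re * (χ2.LFunction 2).re := by nlinarith [l1.2, l2.2]
        nlinarith [l3.2]
      have ha : 0 ≤ (vM fun _ => 1) + ((vM fun n => χ1 n) + (vM fun n => χ2 n) + (vM fun n => ψ n)) := by
        intro n
        simp only [Pi.add_apply, Pi.zero_apply, vM]
        rw [show ψ n = χ1 n * χ2 n from char_prod χ1 χ2 n]
        have : (1 * (ArithmeticFunction.vonMangoldt n:ℂ) + (χ1 n * (ArithmeticFunction.vonMangoldt n:ℂ)
          + χ2 n * (ArithmeticFunction.vonMangoldt n:ℂ) + χ1 n * χ2 n * (ArithmeticFunction.vonMangoldt n:ℂ)))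
          = (1 + χ1 n) * (1 + χ2 n) * (ArithmeticFunction.vonMangoldt n:ℂ) := by ring
        rw [this]
        refine mul_nonneg (mul_nonneg (one_add_nonneg (char_real_cases hχ1s _)) (one_add_nonneg (char_real_cases hχ2s _))) ?_
        exact_mod_cast ArithmeticFunction.vonMangoldt_nonneg
      set B : ℝ := 600 * q1 * (600 * q2) * (600 * N) with hB
      have hB1 : 1 ≤ B := by
        have a1 : (1:ℝ) ≤ 600 * q1 := by linarith
        have a2 : (1:ℝ) ≤ 600 * q2 := by linarith
        have a3 : (1:ℝ) ≤ 600 * N := by linarith [hqpos N]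
        exact one_le_mul_of_one_le_of_one_le (one_le_mul_of_one_le_of_one_le a1 a2) a3
      have hBd : ∀ s ∈ Metric.closedBall (2:ℂ) (3/2), ‖G s‖ ≤ B := by
        intro s hs
        simp only [hG, hB, Pi.mul_apply, norm_mul]
        gcongr
        · exact L_ball_bound hχ1 hs
        · exact L_ball_bound hχ2 hs
        · exact L_ball_bound hψ1 hs
      have core := siegel_core hGd hLD ha hG2 hG3 hB1 hBd (β := β) (by linarith) hβ1
        (Or.inl (by simp [hG, hz]))
      have ar := siegel_arith (ε := ε) (β := β) (B := B) (K := K) hq2 hε hβ1 (by linarith) hB1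
        (by rw [hB, hK, hNc]; apply le_of_eq; ring)
      have hl1 : ‖χ1.LFunction 1‖ ≤ 600 * q1 := L_ball_bound hχ1 (by simp [dist_eq_norm]; norm_num)
      have hlψ : ‖ψ.LFunction 1‖ ≤ C * ((2 * q1) ^ (ε/2) * (q2:ℝ) ^ (ε/2)) := by
        have := HC N ψ 1 hψ1 (by simp [hη.le]) (by simp)
        have e : XX N 1 = (2 * q1) * q2 := by simp [XX, hNc]; ring
        rwa [e, Real.mul_rpow (by positivity) (by positivity)] at this
      have hfin : (1 - β) / 600 * (K ^ (-(ε/4)) * (q2:ℝ) ^ (-(ε/2))) ≤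
          600 * ((600 * q1) * ‖χ2.LFunction 1‖ * (C * ((2 * q1) ^ (ε/2) * (q2:ℝ) ^ (ε/2)))) := by
        refine (ar.trans core).trans ?_
        simp only [hG, Pi.mul_apply, norm_mul]
        gcongr
      calc min c1 c2 * (q2:ℝ) ^ (-ε) ≤ c1 * (q2:ℝ) ^ (-ε) := by gcongr; exact min_le_left _ _
        _ = c1 * ((q2:ℝ) ^ (-(ε/2)) / (q2:ℝ) ^ (ε/2)) := by rw [← Real.rpow_sub (by positivity)]; congr 2; ring
        _ ≤ _ := by
            rw [hc1, div_mul_div_comm, div_le_iff₀ (by positivity)]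
            calc _ = (1 - β) / 600 * (K ^ (-(ε/4)) * (q2:ℝ) ^ (-(ε/2))) := by ring
              _ ≤ _ := hfin
              _ = _ := by ring
  · push Not at hcase
    set K : ℝ := 3200 * (600 * 600) with hK
    set c1 : ℝ := (δ / 600 * K ^ (-(ε/4))) / 600 with hc1
    refine ⟨c1, by positivity, fun q _ χ hχ hχs => ?_⟩
    have hq := hqpos q
    have l1 := L_two hχs
    have ha : 0 ≤ (vM fun _ => 1) + (vM fun n => χ n) := by
      intro n
      simp only [Pi.add_apply, Pi.zero_apply, vM]
      rw [← add_mul]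
      refine mul_nonneg (one_add_nonneg (char_real_cases hχs _)) ?_
      exact_mod_cast ArithmeticFunction.vonMangoldt_nonneg
    have core := siegel_core (differentiable_LFunction hχ) (LD_char χ) ha l1.1 (by linarith [l1.2])
      (B := 600 * q) (by linarith) (fun s hs => L_ball_bound hχ hs) (β := 1 - δ) (by linarith) (by linarith)
      (Or.inr (fun x hx1 hx2 => mul_ne_zero (Hδ0 x (by linarith)) (by
        rcases lt_or_ge x 1 with h | h
        · exact hcase q inferInstance χ hχ hχs x hx1 h
        · exact LFunction_ne_zero_of_one_le_re χ (Or.inl hχ) (by simpa using h))))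
    have ar := siegel_arith (ε := ε) (β := 1 - δ) (B := 600 * q) (K := K) hq hε (by linarith) (by linarith)
      (by linarith) (by rw [hK]; nlinarith)
    have h3 := ar.trans core
    have h4 : (q:ℝ) ^ (-ε) ≤ (q:ℝ) ^ (-(ε/2)) := Real.rpow_le_rpow_of_exponent_le hq (by linarith)
    rw [show 1 - (1 - δ) = δ by ring] at h3
    calc c1 * (q:ℝ) ^ (-ε) ≤ c1 * (q:ℝ) ^ (-(ε/2)) := by gcongr
      _ = (δ / 600 * (K ^ (-(ε/4)) * (q:ℝ) ^ (-(ε/2)))) / 600 := by rw [hc1]; ring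
      _ ≤ _ := by rw [div_le_iff₀ (by norm_num)]; linarith

end siegel2

section
open DirichletCharacter

lemma lower_abs {f : ℝ → ℝ} {A D:ℝ} (hA : 1 ≤ A) (hD : 1 ≤ D) (hf : ∀ x, 0 ≤ f x)
    (h1 : ∀ x, 0 < x → x ≤ 1 → x ^ 3 ≤ A * f x ^ 4)
    (h2 : ∀ x y, 0 < x → x ≤ y → y ≤ 1 → f y - f x ≤ D * (y - x)) {x:ℝ} (hx : 0 < x) (hx1 : x ≤ 1) :
    1 / (16 * A * D ^ 3) ≤ f x := by
  have hAp : 0 < A := by linarith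
  set m : ℝ := 1 / (8 * A * D ^ 3) with hm
  set x1 : ℝ := 1 / (16 * A * D ^ 4) with hx1'
  have hmp : 0 < m := by positivity
  have hx1p : 0 < x1 := by positivity
  have key : ∀ y, x1 ≤ y → y ≤ 1 → m ≤ f y := by
    intro y hy hy1
    have := h1 y (by linarith) hy1
    have h3 : x1 ^ 3 ≤ y ^ 3 := by gcongr
    have h4 : m ^ 4 ≤ f y ^ 4 := by
      have e : m ^ 4 = x1 ^ 3 / A := by rw [hm, hx1']; field_simp; norm_num
      rw [e, div_le_iff₀ hAp]; linarith
    exact le_of_pow_le_pow_left₀ (by norm_num) (hf y) h4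
  have e1 : 1 / (16 * A * D ^ 3) = m / 2 := by rw [hm]; field_simp; norm_num
  have e2 : D * x1 = m / 2 := by rw [hm, hx1']; field_simp; norm_num
  have hx1le : x1 ≤ 1 := by
    rw [hx1', div_le_one (by positivity)]
    have : 1 ≤ D ^ 4 := one_le_pow₀ hD
    nlinarith
  rw [e1]
  rcases le_or_gt x1 x with h | h
  · linarith [key x h hx1]
  · have := h2 x x1 hx h.le hx1le
    have k := key x1 le_rfl hx1le
    nlinarith

/-- consequence of the 3-4-1 inequality -/
lemma three_four {q:ℕ} [NeZero q] (χ : DC q) {x y B:ℝ} (hx : 0 < x) (hx1 : x ≤ 1)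
    (hB : ‖(χ ^ 2).LFunction (1 + x + 2 * I * y)‖ ≤ B) :
    x ^ 3 ≤ 208 ^ 3 * B * ‖χ.LFunction (1 + x + I * y)‖ ^ 4 := by
  have h := norm_LFunction_product_ge_one χ hx y
  rw [norm_mul, norm_mul, norm_pow, norm_pow] at h
  have h1 : ‖LFunctionTrivChar q (1 + x)‖ ≤ 208 / x := by
    have := norm_L_le (1 : DC q) (s := 1 + x) (by simp [hx]) (by simp; linarith)
    simpa using this
  have h2 : (1:ℝ) ≤ (208 / x) ^ 3 * ‖χ.LFunction (1 + x + I * y)‖ ^ 4 * B := by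
    refine h.trans ?_
    gcongr
  rw [div_pow, div_mul_eq_mul_div, div_mul_eq_mul_div, le_div_iff₀ (by positivity)] at h2
  linarith

lemma lip_line {G : ℂ → ℂ} (hG : Differentiable ℂ G) {D y:ℝ}
    (hD : ∀ z : ℂ, 1 ≤ z.re → z.re ≤ 2 → z.im = y → ‖deriv G z‖ ≤ D) {x x':ℝ} (hx : 0 < x) (hxx : x ≤ x') (hx' : x' ≤ 1) :
    ‖G (1 + x' + I * y)‖ - ‖G (1 + x + I * y)‖ ≤ D * (x' - x) := by
  have hconv : Convex ℝ (segment ℝ ((1:ℂ) + x + I * y) (1 + x' + I * y)) := convex_segment _ _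
  have hmem : ∀ z ∈ segment ℝ ((1:ℂ) + x + I * y) (1 + x' + I * y), 1 ≤ z.re ∧ z.re ≤ 2 ∧ z.im = y := by
    rintro z ⟨a, b, ha, hb, hab, rfl⟩
    have hbe : b = 1 - a := by linarith
    subst hbe
    simp
    refine ⟨by nlinarith, by nlinarith, by ring⟩
  have := hconv.norm_image_sub_le_of_norm_deriv_le (f := G) (C := D) (fun z _ => hG z)
    (fun z hz => hD z (hmem z hz).1 (hmem z hz).2.1 (hmem z hz).2.2) (left_mem_segment _ _ _) (right_mem_segment _ _ _)
  refine (norm_sub_norm_le _ _).trans (this.trans (le_of_eq ?_))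
  have : (1 + (x':ℂ) + I * y) - (1 + x + I * y) = ((x' - x:ℝ):ℂ) := by push_cast; ring
  rw [this, norm_real, Real.norm_of_nonneg (by linarith)]

lemma eq_line (s:ℂ) : s = 1 + ((s.re - 1:ℝ):ℂ) + I * (s.im:ℝ) := by
  apply Complex.ext <;> simp

lemma XX_congr {q:ℕ} {s z:ℂ} (h : z.im = s.im) : XX q z = XX q s := by simp [XX, h]

lemma XX_two {q:ℕ} {s z:ℂ} (h : z.im = 2 * s.im) : XX q z ≤ 2 * XX q s := by
  simp only [XX, h, abs_mul]
  have : |(2:ℝ)| = 2 := by norm_num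
  rw [this]
  nlinarith [abs_nonneg s.im]

/-- general application of `lower_abs` to `L` -/
lemma L_lower_of {q:ℕ} [NeZero q] {χ : DC q} (hχ : χ ≠ 1) {B D y:ℝ} (hB : 1 ≤ B) (hD : 1 ≤ D)
    (h1 : ∀ x : ℝ, 0 < x → x ≤ 1 → ‖(χ ^ 2).LFunction (1 + x + 2 * I * y)‖ ≤ B)
    (h2 : ∀ z : ℂ, 1 ≤ z.re → z.re ≤ 2 → z.im = y → ‖deriv χ.LFunction z‖ ≤ D) {x:ℝ} (hx : 0 < x) (hx1 : x ≤ 1) :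
    1 / (16 * (208 ^ 3 * B) * D ^ 3) ≤ ‖χ.LFunction (1 + x + I * y)‖ := by
  exact lower_abs (f := fun x : ℝ => ‖χ.LFunction (1 + x + I * y)‖) (A := 208 ^ 3 * B) (D := D) (by linarith) hD
    (fun _ => norm_nonneg _) (fun x hx hx1 => three_four χ hx hx1 (h1 x hx hx1))
    (fun x x' hx hxx hx' => lip_line (differentiable_LFunction hχ) h2 hx hxx hx') hx hx1

lemma norm_ge_im_re (x y:ℝ) : |x| ≤ ‖(x:ℂ) + 2 * I * y‖ ∧ |2 * y| ≤ ‖(x:ℂ) + 2 * I * y‖ := by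
  constructor
  · simpa using abs_re_le_norm ((x:ℂ) + 2 * I * y)
  · simpa using abs_im_le_norm ((x:ℂ) + 2 * I * y)

set_option maxHeartbeats 2000000 in
theorem L_lower {ε:ℝ} (hε : 0 < ε) : ∃ c : ℝ, 0 < c ∧ ∀ (q:ℕ) [NeZero q] (χ : DC q) (s:ℂ),
    χ ≠ 1 → 1 < s.re → s.re ≤ 2 → c * XX q s ^ (-ε) ≤ ‖χ.LFunction s‖ := by
  set e := ε / 10 with he
  have hep : 0 < e := by positivity
  obtain ⟨η, C, hη, _, hC, HL⟩ := L_deriv_growth hep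
  obtain ⟨η', C', hη', _, hC', HH'⟩ := HH_growth hep
  obtain ⟨c, hc, HS⟩ := siegel hep
  have h2e : (1:ℝ) ≤ 2 ^ e := Real.one_le_rpow (by norm_num) hep.le
  set K : ℝ := 4 * C * C' * 2 ^ e * (1 + 8 * C * 2 ^ e / c) with hK
  have hcp : 0 ≤ 8 * C * 2 ^ e / c := by positivity
  have hK1 : 1 ≤ K := by
    have : 1 ≤ C * C' := one_le_mul_of_one_le_of_one_le hC hC'
    have : 1 ≤ C * C' * 2 ^ e := one_le_mul_of_one_le_of_one_le this h2e
    rw [hK]; exact one_le_mul_of_one_le_of_one_le (by linarith) (by linarith)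
  have hCK : C * 2 ^ e ≤ K := by
    have : C * 2 ^ e * 1 ≤ (C * 2 ^ e) * C' := by gcongr
    have h3 : 0 < (C * 2 ^ e) * C' := by positivity
    calc C * 2 ^ e = C * 2 ^ e * 1 * 1 := by ring
      _ ≤ (4 * C * C' * 2 ^ e) * (1 + 8 * C * 2 ^ e / c) :=
        mul_le_mul (by linarith) (by linarith) zero_le_one (by positivity)
      _ = K := hK.symm
  -- uniform final constant
  refine ⟨min (1 / (16 * (208 ^ 3 * K) * C ^ 3)) (min (c / 2) (1 / (8 * 208 ^ 3 * K ^ 4))), by positivity, ?_⟩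
  intro q _ χ s hχ hs1 hs2
  set m := min (1 / (16 * (208 ^ 3 * K) * C ^ 3)) (min (c / 2) (1 / (8 * 208 ^ 3 * K ^ 4))) with hm
  set X := XX q s with hX
  have hX2 : 2 ≤ X := two_le_XX q s
  have hXp : 0 < X := by linarith
  have hXe : 1 ≤ X ^ e := Real.one_le_rpow (by linarith) hep.le
  set x := s.re - 1 with hx
  set y := s.im with hy
  have hxp : 0 < x := by simp only [hx]; linarith
  have hx1 : x ≤ 1 := by simp only [hx]; linarith
  have hs : s = 1 + (x:ℂ) + I * (y:ℝ) := eq_line s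
  have hD : ∀ z : ℂ, 1 ≤ z.re → z.re ≤ 2 → z.im = y → ‖deriv χ.LFunction z‖ ≤ C * X ^ e := by
    intro z h1 h2 h3
    have := (HL q χ z hχ (by linarith) (by linarith)).2
    rwa [XX_congr (s := s) h3] at this
  have hDone : 1 ≤ C * X ^ e := one_le_mul_of_one_le_of_one_le hC hXe
  clear_value K m X x y
  -- main case: B ≤ K * X^(3e)
  have pw : ∀ a : ℝ, X ^ (a * e) = (X ^ e) ^ a := fun a => by rw [mul_comm, Real.rpow_mul hXp.le]
  have hXn : X ^ (-ε) = 1 / (X ^ e) ^ 10 := by rw [show -ε = -(10 * e) by rw [he]; ring, Real.rpow_neg hXp.le, pw 10, one_div]; norm_cast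
  have fin1 : (∀ x : ℝ, 0 < x → x ≤ 1 → ‖(χ ^ 2).LFunction (1 + x + 2 * I * y)‖ ≤ K * (X ^ e) ^ 3) →
      m * X ^ (-ε) ≤ ‖χ.LFunction s‖ := by
    intro hB
    have := L_lower_of hχ (one_le_mul_of_one_le_of_one_le hK1 (one_le_pow₀ hXe)) hDone hB hD hxp hx1
    rw [← hs] at this
    refine le_trans ?_ this
    rw [hXn]
    calc _ ≤ 1 / (16 * (208 ^ 3 * K) * C ^ 3) * (1 / (X ^ e) ^ 10) := by gcongr; rw [hm]; exact min_le_left _ _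
      _ ≤ 1 / (16 * (208 ^ 3 * K) * C ^ 3) * (1 / (X ^ e) ^ 6) := by
          gcongr ?_ * (1 / ?_)
          exact pow_le_pow_right₀ hXe (by norm_num)
      _ = _ := by field_simp
  by_cases hχ2 : χ ^ 2 = 1
  · -- real character
    set δ : ℝ := c * (X ^ e)⁻¹ / (4 * (C * (2 ^ e * X ^ e))) with hδ
    have hδp : 0 < δ := by positivity
    have hδinv : 1 / δ = 4 * C * 2 ^ e / c * (X ^ e) ^ 2 := by rw [hδ]; field_simp
    have hHB : ∀ x : ℝ, 0 < x → x ≤ 1 → δ ≤ max x |y| →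
        ‖(χ ^ 2).LFunction (1 + x + 2 * I * y)‖ ≤ K * (X ^ e) ^ 3 := by
      intro x hxp hx1 hmax
      set z : ℂ := 1 + x + 2 * I * y with hz
      have hzre : z.re = 1 + x := by simp [hz]
      have hzim : z.im = 2 * s.im := by simp [hz, hy]
      have hz1 : z ≠ 1 := ne_one_of_re (by rw [hzre]; linarith)
      have h1 := HH' q (χ ^ 2) z (by rw [hzre]; linarith) (by rw [hzre]; linarith)
      rw [HH_eq _ hz1, norm_mul] at h1
      have e1 : z - 1 = (x:ℂ) + 2 * I * y := by rw [hz]; ring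
      have hn := norm_ge_im_re x y
      rw [← e1] at hn
      set n := ‖z - 1‖
      have hnδ : δ ≤ n := by
        rcases le_max_iff.1 hmax with h | h
        · exact h.trans ((le_abs_self x).trans hn.1)
        · rw [abs_mul, abs_two] at hn; linarith [abs_nonneg y, hn.2]
      have hnp : 0 < n := by linarith
      have hXz : XX q z ^ e ≤ 2 ^ e * X ^ e := by
        rw [← Real.mul_rpow (by norm_num) hXp.le]
        exact Real.rpow_le_rpow (by linarith [two_le_XX q z]) (by rw [hX]; exact XX_two hzim) hep.le
      have h2 : |z.im| + 2 ≤ n * (1 + 2 / δ) := by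
        have a1 : |z.im| ≤ n := by rw [hzim, ← hy]; exact hn.2
        have a2 : 2 ≤ n * (2 / δ) := by rw [mul_div_assoc', le_div_iff₀ hδp]; linarith
        linarith
      have h3 : n * ‖(χ ^ 2).LFunction z‖ ≤ n * (C' * (2 ^ e * X ^ e) * (1 + 2 / δ)) := by
        calc _ ≤ _ := h1
          _ ≤ C' * (2 ^ e * X ^ e) * (n * (1 + 2 / δ)) := by gcongr
          _ = _ := by ring
      have h4 := le_of_mul_le_mul_left h3 hnp
      refine h4.trans ?_
      have e2 : 2 / δ = 8 * C * 2 ^ e / c * (X ^ e) ^ 2 := by rw [show 2 / δ = 2 * (1 / δ) by ring, hδinv]; ring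
      rw [e2]
      have h5 : 1 + 8 * C * 2 ^ e / c * (X ^ e) ^ 2 ≤ (1 + 8 * C * 2 ^ e / c) * (X ^ e) ^ 2 := by
        have : 1 ≤ (X ^ e) ^ 2 := one_le_pow₀ hXe
        nlinarith only [this, hcp]
      calc _ ≤ C' * (2 ^ e * X ^ e) * ((1 + 8 * C * 2 ^ e / c) * (X ^ e) ^ 2) := by gcongr
        _ = 1 * (C' * 2 ^ e * (1 + 8 * C * 2 ^ e / c) * (X ^ e) ^ 3) := by ring
        _ ≤ (4 * C) * (C' * 2 ^ e * (1 + 8 * C * 2 ^ e / c) * (X ^ e) ^ 3) := by gcongr; linarith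
        _ = _ := by rw [hK]; ring
    rcases le_or_gt δ |y| with hyδ | hyδ
    · exact fin1 (fun x h1 h2 => hHB x h1 h2 (hyδ.trans (le_max_right _ _)))
    rcases le_or_gt δ x with hxδ | hxδ
    · -- direct
      have h1 := three_four χ hxp hx1 (hHB x hxp hx1 (hxδ.trans (le_max_left _ _)))
      rw [← hs] at h1
      set f := ‖χ.LFunction s‖
      have h2 : δ ^ 3 ≤ x ^ 3 := by gcongr
      have h3 : 1 ≤ (1/δ) ^ 3 * (208 ^ 3 * (K * (X ^ e) ^ 3) * f ^ 4) := by
        have : (1/δ) ^ 3 * δ ^ 3 = 1 := by field_simp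

        have p0 : 0 ≤ (1/δ) ^ 3 := by positivity
        exact this.symm.trans_le (mul_le_mul_of_nonneg_left (h2.trans h1) p0)
      rw [hδinv] at h3
      have hK2 : 4 * C * 2 ^ e / c ≤ K := by
        have k1 : 1 ≤ 4 * C * C' * 2 ^ e := by
          have : 1 ≤ C * C' := one_le_mul_of_one_le_of_one_le hC hC'
          have : 1 ≤ C * C' * 2 ^ e := one_le_mul_of_one_le_of_one_le this h2e
          linarith
        have k2 : 4 * C * 2 ^ e / c ≤ 1 + 8 * C * 2 ^ e / c := by
          have : 8 * C * 2 ^ e / c = 2 * (4 * C * 2 ^ e / c) := by ring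
          linarith
        rw [hK]
        calc _ ≤ 1 * (1 + 8 * C * 2 ^ e / c) := by linarith
          _ ≤ _ := by gcongr
      have h4 : 1 ≤ 208 ^ 3 * K ^ 4 * (X ^ e) ^ 9 * f ^ 4 := by
        calc 1 ≤ _ := h3
          _ ≤ (K * (X ^ e) ^ 2) ^ 3 * (208 ^ 3 * (K * (X ^ e) ^ 3) * f ^ 4) := by gcongr
          _ = _ := by ring
      by_contra hlt
      push Not at hlt
      have h5 : f ≤ 1 / (8 * 208 ^ 3 * K ^ 4) * (1 / (X ^ e) ^ 10) := by
        refine hlt.le.trans ?_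
        rw [hXn]; gcongr; rw [hm]; exact (min_le_right _ _).trans (min_le_right _ _)
      set g := 1 / (8 * 208 ^ 3 * K ^ 4) * (1 / (X ^ e) ^ 10) with hg
      have hgp : 0 < g := by positivity
      have hg1 : g ≤ 1 := by
        rw [hg]
        have : 1 ≤ K ^ 4 := one_le_pow₀ hK1
        have : 1 ≤ (X ^ e) ^ 10 := one_le_pow₀ hXe
        have e9 : 1 / (8 * 208 ^ 3 * K ^ 4) * (1 / (X ^ e) ^ 10) = 1 / (8 * 208 ^ 3 * (K ^ 4 * (X ^ e) ^ 10)) := by field_simp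
        have a1 : 1 ≤ K ^ 4 * (X ^ e) ^ 10 := one_le_mul_of_one_le_of_one_le (by assumption) (by assumption)
        rw [e9, div_le_one (by positivity)]
        linarith
      have h6 : f ^ 4 ≤ g := by
        calc f ^ 4 ≤ g ^ 4 := by gcongr
          _ ≤ g ^ 1 := pow_le_pow_of_le_one hgp.le hg1 (by norm_num)
          _ = g := pow_one _
      have h7 : 208 ^ 3 * K ^ 4 * (X ^ e) ^ 9 * f ^ 4 ≤ 208 ^ 3 * K ^ 4 * (X ^ e) ^ 10 * g := by
        have : (X ^ e) ^ 9 ≤ (X ^ e) ^ 10 := pow_le_pow_right₀ hXe (by norm_num)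
        gcongr
      have h8 : 208 ^ 3 * K ^ 4 * (X ^ e) ^ 10 * g = 1 / 8 := by rw [hg]; field_simp
      linarith
    · -- close to 1
      have h0 := HS q χ hχ hχ2
      have hqX : (q:ℝ) ≤ X := by
        have : (0:ℝ) ≤ q := by positivity
        simp only [hX, XX]; nlinarith only [abs_nonneg s.im, this]
      have hq1 := one_le_q q
      have h0' : c * (X ^ e)⁻¹ ≤ ‖χ.LFunction 1‖ := by
        refine le_trans ?_ h0
        rw [Real.rpow_neg (by linarith)]
        gcongr
      have hd1 : ‖s - 1‖ ≤ 2 * δ := by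
        have := norm_le_abs_re_add_abs_im (s - 1)
        simp only [sub_re, one_re, sub_im, one_im, sub_zero] at this
        rw [← hx, ← hy, abs_of_pos hxp] at this
        linarith
      have hmem : ∀ z ∈ segment ℝ (1:ℂ) s, 1 ≤ z.re ∧ z.re ≤ 2 ∧ |z.im| ≤ |s.im| := by
        rintro z ⟨a, b, ha, hb, hab, rfl⟩
        have hbe : a = 1 - b := by linarith
        subst hbe
        simp only [real_smul, add_re, mul_re, ofReal_re, one_re, ofReal_im, one_im, add_im, mul_im]
        refine ⟨by nlinarith only [hb, hs1], by nlinarith only [hb, hs2, ha], ?_⟩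
        simp only [mul_zero, zero_mul, add_zero, zero_add]
        rw [abs_mul, abs_of_nonneg hb]
        nlinarith only [abs_nonneg s.im, ha]
      have hb : ∀ z ∈ segment ℝ (1:ℂ) s, ‖deriv χ.LFunction z‖ ≤ C * (2 ^ e * X ^ e) := by
        intro z hz
        obtain ⟨z1, z2, z3⟩ := hmem z hz
        have := (HL q χ z hχ (by linarith) (by linarith)).2
        refine this.trans ?_
        have : XX q z ≤ X := by simp only [hX, XX]; gcongr
        have h9 : XX q z ^ e ≤ X ^ e := Real.rpow_le_rpow (by linarith [two_le_XX q z]) this hep.le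
        have : X ^ e ≤ 2 ^ e * X ^ e := by exact le_mul_of_one_le_left (by positivity) h2e
        gcongr; linarith
      have h1 := (convex_segment (1:ℂ) s).norm_image_sub_le_of_norm_deriv_le (f := χ.LFunction)
        (fun z _ => differentiable_LFunction hχ z) hb (left_mem_segment _ _ _) (right_mem_segment _ _ _)
      have h2 : ‖χ.LFunction s - χ.LFunction 1‖ ≤ c * (X ^ e)⁻¹ / 2 := by
        calc _ ≤ _ := h1
          _ ≤ C * (2 ^ e * X ^ e) * (2 * δ) := by gcongr
          _ = _ := by rw [hδ]; field_simp; norm_num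
      have h3 := norm_sub_norm_le (χ.LFunction 1) (χ.LFunction s)
      rw [norm_sub_rev] at h3
      have h4 : c * (X ^ e)⁻¹ / 2 ≤ ‖χ.LFunction s‖ := by linarith
      refine le_trans ?_ h4
      rw [hXn]
      calc _ ≤ c / 2 * (1 / (X ^ e) ^ 10) := by
            gcongr; rw [hm]; exact (min_le_right _ _).trans (min_le_left _ _)
        _ ≤ c / 2 * (1 / (X ^ e) ^ 1) := by gcongr ?_ * (1 / ?_); exact pow_le_pow_right₀ hXe (by norm_num)
        _ = _ := by rw [pow_one]; ring
  · refine fin1 (fun x h1 h2 => ?_)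
    set z : ℂ := 1 + x + 2 * I * y with hz
    have hzre : z.re = 1 + x := by simp [hz]
    have hzim : z.im = 2 * s.im := by simp [hz, hy]
    have h3 := (HL q (χ ^ 2) z hχ2 (by rw [hzre]; linarith) (by rw [hzre]; linarith)).1
    have hXz : XX q z ^ e ≤ 2 ^ e * X ^ e := by
      rw [← Real.mul_rpow (by norm_num) hXp.le]
      exact Real.rpow_le_rpow (by linarith [two_le_XX q z]) (by rw [hX]; exact XX_two hzim) hep.le
    calc _ ≤ _ := h3
      _ ≤ C * (2 ^ e * X ^ e) := by gcongr
      _ = C * 2 ^ e * (X ^ e) ^ 1 := by ring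
      _ ≤ K * (X ^ e) ^ 3 := by
          have : (X ^ e) ^ 1 ≤ (X ^ e) ^ 3 := pow_le_pow_right₀ hXe (by norm_num)
          gcongr
end

section
open DirichletCharacter

theorem HH_lower {ε:ℝ} (hε : 0 < ε) : ∃ c : ℝ, 0 < c ∧ ∀ (s:ℂ), 1 < s.re → s.re ≤ 2 →
    c * (|s.im| + 2) * (|s.im| + 2) ^ (-ε) ≤ ‖HH (1 : DC 1) s‖ := by
  set e := ε / 10 with he
  have hep : 0 < e := by positivity
  obtain ⟨η, C, hη, _, hC, HL⟩ := HH_deriv_growth hep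
  -- compact region
  obtain ⟨c0, hc0, Hc0⟩ : ∃ c0 : ℝ, 0 < c0 ∧ ∀ s : ℂ, 1 ≤ s.re → s.re ≤ 2 → |s.im| ≤ 1 →
      c0 ≤ ‖HH (1 : DC 1) s‖ := by
    have hcomp : IsCompact (Set.Icc (1:ℝ) 2 ×ℂ Set.Icc (-1:ℝ) 1) := isCompact_Icc.reProdIm isCompact_Icc
    have hne : (Set.Icc (1:ℝ) 2 ×ℂ Set.Icc (-1:ℝ) 1).Nonempty := ⟨1, by simp [mem_reProdIm]⟩
    obtain ⟨z, hz, hmin⟩ := hcomp.exists_isMinOn hne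
      (f := fun s => ‖HH (1 : DC 1) s‖) (differentiable_HH _).continuous.norm.continuousOn
    refine ⟨‖HH (1 : DC 1) z‖, norm_pos_iff.2 ?_, fun s h1 h2 h3 => hmin ?_⟩
    · by_cases h : z = 1
      · rw [h]
        have := LFunctionTrivChar₁_apply_one_ne_zero 1
        simpa [HH] using this
      · rw [HH_eq _ h]
        exact mul_ne_zero (sub_ne_zero.2 h) (LFunction_ne_zero_of_one_le_re _ (Or.inr h) (by
          rw [mem_reProdIm] at hz; exact hz.1.1))
    · rw [mem_reProdIm]; exact ⟨⟨h1, h2⟩, abs_le.1 h3⟩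
  have h2e : (1:ℝ) ≤ 2 ^ e := Real.one_le_rpow (by norm_num) hep.le
  set A : ℝ := 208 ^ 3 * (2 * (C * 2 ^ e)) * 81 with hA
  have hA1 : 1 ≤ A := by
    have : 1 ≤ C * 2 ^ e := one_le_mul_of_one_le_of_one_le hC h2e
    rw [hA]; linarith
  refine ⟨min (c0 / 3) (1 / (16 * A * C ^ 3)), by positivity, fun s hs1 hs2 => ?_⟩
  set T := |s.im| + 2 with hT
  have hT2 : 2 ≤ T := by rw [hT]; linarith [abs_nonneg s.im]
  rcases le_or_gt |s.im| 1 with him | him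
  · refine le_trans ?_ (Hc0 s hs1.le hs2 him)
    have h1 : T ^ (-ε) ≤ 1 := Real.rpow_le_one_of_one_le_of_nonpos (by linarith) (by linarith)
    calc _ ≤ (c0 / 3) * 3 * 1 := by
          gcongr
          · exact min_le_left _ _
          · linarith
      _ = c0 := by ring
  · set x := s.re - 1 with hx
    set y := s.im
    have hxp : 0 < x := by simp only [hx]; linarith
    have hx1 : x ≤ 1 := by simp only [hx]; linarith
    have hs : s = 1 + (x:ℂ) + I * (y:ℝ) := eq_line s
    clear_value A x y T
    have hTe : 1 ≤ T ^ e := Real.one_le_rpow (by linarith) hep.le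
    have hTp : 0 < T := by linarith
    set H1 := HH (1 : DC 1) with hH1
    have hXX : ∀ z : ℂ, XX 1 z = |z.im| + 2 := fun z => by simp [XX]
    have key := lower_abs (f := fun x : ℝ => ‖H1 (1 + x + I * y)‖ / T) (A := A * T ^ e) (D := C * T ^ e)
      (one_le_mul_of_one_le_of_one_le hA1 hTe) (one_le_mul_of_one_le_of_one_le hC hTe) (fun _ => by positivity)
      (by
        intro x hxp hx1
        have hB : ‖((1 : DC 1) ^ 2).LFunction (1 + x + 2 * I * y)‖ ≤ 2 * (C * 2 ^ e) * T ^ e := by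
          rw [one_pow]
          set z : ℂ := 1 + x + 2 * I * y with hz
          have hzre : z.re = 1 + x := by simp [hz]
          have hzim : z.im = 2 * y := by simp [hz]
          have hz1 : z ≠ 1 := ne_one_of_re (by rw [hzre]; linarith)
          have h1 := (HL 1 1 z (by rw [hzre]; linarith) (by rw [hzre]; linarith)).1
          rw [HH_eq _ hz1, norm_mul, hXX, hzim] at h1
          have e1 : z - 1 = (x:ℂ) + 2 * I * y := by rw [hz]; ring
          have hn := (norm_ge_im_re x y).2
          rw [← e1] at hn
          set n := ‖z - 1‖
          have h2y : |2 * y| = 2 * |y| := by rw [abs_mul, abs_two]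
          have hnp : 0 < n := by linarith
          have h3 : n * ‖(1 : DC 1).LFunction z‖ ≤ n * (2 * (C * 2 ^ e) * T ^ e) := by
            calc _ ≤ _ := h1
              _ ≤ C * (2 ^ e * T ^ e) * (2 * n) := by
                rw [← Real.mul_rpow (by norm_num) hTp.le]
                gcongr
                · linarith
                · linarith
              _ = _ := by ring
          exact le_of_mul_le_mul_left h3 hnp
        have h4 := three_four (1 : DC 1) hxp hx1 hB
        have hz1 : (1 + (x:ℂ) + I * y) ≠ 1 := ne_one_of_re (by simp [hxp])
        have h5 : ‖(1 : DC 1).LFunction (1 + x + I * y)‖ ≤ 3 * (‖H1 (1 + x + I * y)‖ / T) := by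
          rw [hH1, HH_eq _ hz1, norm_mul]
          have : |y| ≤ ‖(1 + (x:ℂ) + I * y) - 1‖ := by simpa using abs_im_le_norm ((1 + (x:ℂ) + I * y) - 1)
          rw [mul_div_assoc', le_div_iff₀ hTp]
          nlinarith [norm_nonneg ((1 : DC 1).LFunction (1 + x + I * y))]
        calc x ^ 3 ≤ _ := h4
          _ ≤ 208 ^ 3 * (2 * (C * 2 ^ e) * T ^ e) * (3 * (‖H1 (1 + x + I * y)‖ / T)) ^ 4 := by gcongr
          _ = _ := by rw [hA]; ring)
      (by
        intro x x' hx hxx hx'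
        have := lip_line (G := H1) (differentiable_HH _) (D := C * T ^ e * T) (y := y) (by
          intro z h1 h2 h3
          have := (HL 1 1 z (by linarith) (by linarith)).2
          rwa [hXX, h3, ← hT] at this) hx hxx hx'
        rw [← sub_div, div_le_iff₀ hTp]
        linarith) hxp hx1
    rw [← hs, le_div_iff₀ hTp] at key
    refine le_trans ?_ key
    have hTn : T ^ (-ε) = 1 / (T ^ e) ^ 10 := by rw [show -ε = -(e * 10) by rw [he]; ring, Real.rpow_neg hTp.le, Real.rpow_mul hTp.le, one_div]; norm_cast
    rw [hTn]
    calc _ ≤ (1 / (16 * A * C ^ 3)) * T * (1 / (T ^ e) ^ 10) := by gcongr; exact min_le_right _ _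
      _ ≤ (1 / (16 * A * C ^ 3)) * T * (1 / (T ^ e) ^ 4) := by
          have : (T ^ e) ^ 4 ≤ (T ^ e) ^ 10 := pow_le_pow_right₀ hTe (by norm_num)
          gcongr
      _ = _ := by field_simp

lemma iter_logDeriv_bound {G : ℂ → ℂ} (hG : Differentiable ℂ G) {s:ℂ} {D m r:ℝ} (hr : 0 < r) (hm : 0 < m)
    (hD0 : 0 < D) (hD : ∀ z, ‖z - s‖ ≤ r → ‖deriv G z‖ ≤ D) (hs : m ≤ ‖G s‖) (k:ℕ) :
    ‖iteratedDeriv k (fun z => deriv G z / G z) s‖ ≤ k.factorial * (1 / r + 2 * D / m) ^ (k + 1) := by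
  set R := min r (m / (2 * D)) with hR
  have hRp : 0 < R := by positivity
  have hRr : R ≤ r := min_le_left _ _
  have hRm : R ≤ m / (2 * D) := min_le_right _ _
  have hlow : ∀ z, ‖z - s‖ ≤ R → m / 2 ≤ ‖G z‖ := by
    intro z hz
    have h1 := (convex_closedBall s r).norm_image_sub_le_of_norm_deriv_le (f := G) (C := D)
      (fun z _ => hG z) (fun z hz => hD z (by rwa [mem_closedBall_iff_norm] at hz)) (x := s) (y := z)
      (Metric.mem_closedBall_self hr.le) (by rw [mem_closedBall_iff_norm]; linarith)
    have h2 : D * ‖z - s‖ ≤ m / 2 := by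
      calc D * ‖z - s‖ ≤ D * (m / (2 * D)) := by gcongr; linarith
        _ = m / 2 := by field_simp
    have h3 := norm_sub_norm_le (G s) (G z)
    rw [norm_sub_rev] at h3
    linarith
  have hne : ∀ z ∈ Metric.closedBall s R, G z ≠ 0 := by
    intro z hz h
    rw [mem_closedBall_iff_norm] at hz
    have := hlow z hz
    rw [h, norm_zero] at this
    linarith
  have hdiff : DifferentiableOn ℂ (fun z => deriv G z / G z) (Metric.closedBall s R) := by
    intro z hz
    exact ((hG.deriv z).div (hG z) (hne z hz)).differentiableWithinAt
  have hdc : DiffContOnCl ℂ (fun z => deriv G z / G z) (Metric.ball s R) := by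
    apply DifferentiableOn.diffContOnCl
    rwa [closure_ball s hRp.ne']
  have h1 := norm_iteratedDeriv_le_of_forall_mem_sphere_norm_le k hRp hdc (C := 2 * D / m) (by
    intro z hz
    rw [mem_sphere_iff_norm] at hz
    rw [norm_div, div_le_div_iff₀ (lt_of_lt_of_le (by linarith) (hlow z hz.le)) hm]
    have := hD z (by linarith)
    have := hlow z hz.le
    nlinarith)
  refine h1.trans ?_
  have hinv : 1 / R ≤ 1 / r + 2 * D / m := by
    rcases min_choice r (m / (2 * D)) with h | h
    · rw [hR, h]; have : 0 < 2 * D / m := by positivity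
      linarith
    · rw [hR, h, one_div_div]; have : 0 < 1 / r := by positivity
      linarith
  have : 2 * D / m ≤ 1 / r + 2 * D / m := by
    have : 0 < 1 / r := by positivity
    linarith
  calc (k.factorial:ℝ) * (2 * D / m) / R ^ k = k.factorial * ((2 * D / m) * (1 / R) ^ k) := by
        rw [one_div, inv_pow]; ring
    _ ≤ k.factorial * ((1 / r + 2 * D / m) * (1 / r + 2 * D / m) ^ k) := by gcongr
    _ = _ := by ring

lemma logDeriv_aux (k:ℕ) {ε C c η X W:ℝ} (hε : 0 < ε) (hC : 1 ≤ C) (hc : 0 < c) (hη : 0 < η) (hX : 2 ≤ X) (hW : 0 < W) :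
    k.factorial * (1 / (η / 2) + 2 * (C * (2 ^ (ε / (2 * (k + 1))) * X ^ (ε / (2 * (k + 1)))) * (2 * W))
        / (c * W * X ^ (-(ε / (2 * (k + 1)))))) ^ (k + 1)
      ≤ (k.factorial * (1 / (η / 2) + 4 * (C * 2 ^ (ε / (2 * (k + 1)))) / c) ^ (k + 1)) * X ^ ε := by
  set e := ε / (2 * (k + 1)) with he
  have hep : 0 < e := by positivity
  have hXe : 1 ≤ X ^ e := Real.one_le_rpow (by linarith) hep.le
  have h1 : 2 * (C * (2 ^ e * X ^ e) * (2 * W)) / (c * W * X ^ (-e)) = 4 * (C * 2 ^ e) / c * (X ^ e) ^ 2 := by rw [Real.rpow_neg (by linarith)]; field_simp; norm_num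
  have h2 : X ^ ε = ((X ^ e) ^ 2) ^ (k + 1) := by
    rw [← Real.rpow_natCast, ← Real.rpow_natCast, ← Real.rpow_mul (by linarith), ← Real.rpow_mul (by linarith)]
    congr 1; rw [he]; push_cast; field_simp
  rw [h1, h2, mul_assoc, ← mul_pow]
  have h3 : 1 ≤ (X ^ e) ^ 2 := one_le_pow₀ hXe
  gcongr
  rw [add_mul]
  gcongr
  exact le_mul_of_one_le_right (by positivity) h3

theorem L_logDeriv_bound (k:ℕ) {ε:ℝ} (hε : 0 < ε) : ∃ C : ℝ, 0 < C ∧ ∀ (q:ℕ) [NeZero q]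
    (χ : DC q) (s:ℂ), χ ≠ 1 → 1 < s.re → s.re ≤ 2 →
    ‖iteratedDeriv k (fun z => deriv χ.LFunction z / χ.LFunction z) s‖ ≤ C * XX q s ^ ε := by
  set e := ε / (2 * (k + 1))
  have hep : 0 < e := by positivity
  obtain ⟨η, C, hη, hη1, hC, HL⟩ := L_deriv_growth hep
  obtain ⟨c, hc, Hc⟩ := L_lower hep
  refine ⟨k.factorial * (1 / (η / 2) + 4 * (C * 2 ^ e) / c) ^ (k + 1), by positivity, fun q _ χ s hχ h1 h2 => ?_⟩
  have hX := two_le_XX q s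
  have := iter_logDeriv_bound (differentiable_LFunction hχ) (s := s) (D := C * (2 ^ e * XX q s ^ e) * (2 * 1))
    (m := c * 1 * XX q s ^ (-e)) (r := η / 2) (by positivity) (by positivity) (by positivity) (by
      intro z hz
      have hre : |z.re - s.re| ≤ η / 2 := (by simpa using abs_re_le_norm (z - s) : _ ≤ ‖z - s‖).trans hz
      rw [abs_le] at hre
      have h3 := (HL q χ z hχ (by linarith) (by linarith)).2
      have h4 := XX_near q (z := z) (s := s) (by linarith)
      have h5 : XX q z ^ e ≤ 2 ^ e * XX q s ^ e := by
        rw [← Real.mul_rpow (by norm_num) (by linarith)]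
        exact Real.rpow_le_rpow (by linarith [two_le_XX q z]) h4 hep.le
      have h6 : 0 ≤ C * (2 ^ e * XX q s ^ e) := by positivity
      calc _ ≤ _ := h3
        _ ≤ C * (2 ^ e * XX q s ^ e) := by gcongr
        _ ≤ _ := by linarith) (by rw [mul_one]; exact Hc q χ s hχ h1 h2) k
  exact this.trans (logDeriv_aux k hε hC hc hη hX one_pos)

theorem HH_logDeriv_bound (k:ℕ) {ε:ℝ} (hε : 0 < ε) : ∃ C : ℝ, 0 < C ∧ ∀ (s:ℂ), 1 < s.re → s.re ≤ 2 →
    ‖iteratedDeriv k (fun z => deriv (HH (1 : DC 1)) z / HH (1 : DC 1) z) s‖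
      ≤ C * (|s.im| + 2) ^ ε := by
  set e := ε / (2 * (k + 1))
  have hep : 0 < e := by positivity
  obtain ⟨η, C, hη, hη1, hC, HL⟩ := HH_deriv_growth hep
  obtain ⟨c, hc, Hc⟩ := HH_lower hep
  refine ⟨k.factorial * (1 / (η / 2) + 4 * (C * 2 ^ e) / c) ^ (k + 1), by positivity, fun s h1 h2 => ?_⟩
  have hXX : ∀ z : ℂ, XX 1 z = |z.im| + 2 := fun z => by simp [XX]
  have hX := two_le_XX 1 s
  rw [hXX] at hX
  have := iter_logDeriv_bound (differentiable_HH (1 : DC 1)) (s := s)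
    (D := C * (2 ^ e * (|s.im| + 2) ^ e) * (2 * (|s.im| + 2)))
    (m := c * (|s.im| + 2) * (|s.im| + 2) ^ (-e)) (r := η / 2) (by positivity) (by positivity) (by positivity) (by
      intro z hz
      have hre : |z.re - s.re| ≤ η / 2 := (by simpa using abs_re_le_norm (z - s) : _ ≤ ‖z - s‖).trans hz
      rw [abs_le] at hre
      have h3 := (HL 1 1 z (by linarith) (by linarith)).2
      have h4 := XX_near 1 (z := z) (s := s) (by linarith)
      rw [hXX, hXX] at h4
      rw [hXX] at h3
      have h5 : (|z.im| + 2) ^ e ≤ 2 ^ e * (|s.im| + 2) ^ e := by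
        rw [← Real.mul_rpow (by norm_num) (by linarith)]
        exact Real.rpow_le_rpow (by positivity) h4 hep.le
      calc _ ≤ _ := h3
        _ ≤ _ := by gcongr) (Hc s h1 h2) k
  exact this.trans (logDeriv_aux k hε hC hc hη hX (by linarith))
end

section
open MeasureTheory

lemma norm_vert {σ:ℝ} (hσ : 1 ≤ σ) (t:ℝ) :
    ‖1 / (((σ:ℂ) + t * I) * ((σ:ℂ) + t * I + 1))‖ ≤ 1 / (1 + t ^ 2) := by
  have h1 : √(1 + t ^ 2) ≤ ‖(σ:ℂ) + t * I‖ := by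
    rw [norm_add_mul_I]
    apply Real.sqrt_le_sqrt; nlinarith
  have h2 : √(1 + t ^ 2) ≤ ‖(σ:ℂ) + t * I + 1‖ := by
    have : (σ:ℂ) + t * I + 1 = ((σ + 1:ℝ):ℂ) + t * I := by push_cast; ring
    rw [this, norm_add_mul_I]
    apply Real.sqrt_le_sqrt; nlinarith
  rw [norm_div, norm_one, norm_mul]
  apply one_div_le_one_div_of_le (by positivity)
  calc 1 + t ^ 2 = √(1 + t ^ 2) * √(1 + t ^ 2) := (Real.mul_self_sqrt (by positivity)).symm
    _ ≤ _ := by gcongr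

noncomputable def ramp (y:ℝ) : ℂ := ((max (1 - y) 0:ℝ):ℂ)

lemma ramp_mellin {s:ℂ} (hs : 0 < s.re) : HasMellin ramp s (1 / (s * (s + 1))) := by
  have h := hasMellin_sub (hasMellin_one_Ioc hs).1 (hasMellin_cpow_Ioc (1:ℂ) (s := s) (by simp; linarith)).1
  rw [(hasMellin_one_Ioc hs).2, (hasMellin_cpow_Ioc (1:ℂ) (s := s) (by simp; linarith)).2] at h
  have hs0 : s ≠ 0 := by intro h; simp [h] at hs
  have hs1 : s + 1 ≠ 0 := by
    intro h
    have := congrArg re h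
    simp at this; linarith
  have e : 1 / s - 1 / (s + 1) = 1 / (s * (s + 1)) := by field_simp; ring
  rw [e] at h
  have hfun : ∀ t ∈ Set.Ioi (0:ℝ), (Set.Ioc (0:ℝ) 1).indicator (fun _ => (1:ℂ)) t -
      (Set.Ioc (0:ℝ) 1).indicator (fun t : ℝ => (t:ℂ) ^ (1:ℂ)) t = ramp t := by
    intro t ht
    have ht0 : 0 < t := ht
    unfold ramp
    by_cases h1 : t ≤ 1
    · have : t ∈ Set.Ioc (0:ℝ) 1 := ⟨ht0, h1⟩
      rw [Set.indicator_of_mem this, Set.indicator_of_mem this, max_eq_left (by linarith), cpow_one]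
      push_cast; ring
    · have : t ∉ Set.Ioc (0:ℝ) 1 := fun h => h1 h.2
      rw [Set.indicator_of_notMem this, Set.indicator_of_notMem this, max_eq_right (by push Not at h1; linarith)]
      simp
  constructor
  · refine h.1.congr_fun (fun t ht => ?_) measurableSet_Ioi
    simp only [hfun t ht]
  · rw [← h.2]
    refine setIntegral_congr_fun measurableSet_Ioi (fun t ht => ?_)
    simp only [hfun t ht]

lemma integrable_vert {σ:ℝ} (hσ : 1 ≤ σ) :
    Integrable (fun t : ℝ => 1 / (((σ:ℂ) + t * I) * ((σ:ℂ) + t * I + 1))) := by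
  refine Integrable.mono' (g := fun t : ℝ => 1 / (1 + t ^ 2)) ?_ ?_ (Filter.Eventually.of_forall (norm_vert hσ))
  · simpa [one_div] using integrable_inv_one_add_sq
  · apply Continuous.aestronglyMeasurable
    apply Continuous.div continuous_const (by fun_prop)
    intro t h
    rcases mul_eq_zero.1 h with h | h
    · have := congrArg re h
      simp at this; linarith
    · have := congrArg re h
      simp at this; linarith

lemma ramp_inv {σ:ℝ} (hσ : 1 ≤ σ) {y:ℝ} (hy : 0 < y) :
    ramp y = (1 / (2 * pi):ℝ) • ∫ t : ℝ, (y:ℂ) ^ (-((σ:ℂ) + t * I)) * (1 / (((σ:ℂ) + t * I) * ((σ:ℂ) + t * I + 1))) := by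
  have hm : ∀ t : ℝ, mellin ramp ((σ:ℂ) + t * I) = 1 / (((σ:ℂ) + t * I) * ((σ:ℂ) + t * I + 1)) := fun t =>
    (ramp_mellin (by simp; linarith)).2
  have hc : Continuous ramp := by unfold ramp; fun_prop
  have := mellinInv_mellin_eq σ ramp hy (ramp_mellin (s := σ) (by simp; linarith)).1 (by
    unfold VerticalIntegrable
    refine (integrable_vert hσ).congr (Filter.Eventually.of_forall (fun t => (hm t).symm))) hc.continuousAt
  rw [← this]
  unfold mellinInv
  simp only [hm, smul_eq_mul]

noncomputable def kapI : ℝ := ∫ t : ℝ, 2 * (1 + ‖t‖ ^ 2) ^ (-(3/2:ℝ) / 2)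

lemma kapI_integrable : Integrable (fun t : ℝ => 2 * (1 + ‖t‖ ^ 2) ^ (-(3/2:ℝ) / 2)) :=
  (integrable_rpow_neg_one_add_norm_sq (E := ℝ) (r := 3/2) (by norm_num)).const_mul 2

lemma kapI_nonneg : 0 ≤ kapI := integral_nonneg (fun t => by positivity)

lemma weight_le (t:ℝ) : (|t| + 2) ^ (1/2:ℝ) * (1 / (1 + t ^ 2)) ≤ 2 * (1 + ‖t‖ ^ 2) ^ (-(3/2:ℝ) / 2) := by
  rw [Real.norm_eq_abs, sq_abs]
  have hp : 0 < 1 + t ^ 2 := by positivity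
  have h1 : |t| + 2 ≤ 4 * (1 + t ^ 2) ^ (1/2:ℝ) := by
    rw [← Real.sqrt_eq_rpow]
    have h2 : 1 ≤ √(1 + t ^ 2) := by rw [Real.one_le_sqrt]; nlinarith
    have h3 : |t| ≤ √(1 + t ^ 2) := Real.abs_le_sqrt (by linarith)
    linarith
  have h2 : (|t| + 2) ^ (1/2:ℝ) ≤ 2 * (1 + t ^ 2) ^ (1/4:ℝ) := by
    calc _ ≤ (4 * (1 + t ^ 2) ^ (1/2:ℝ)) ^ (1/2:ℝ) := by gcongr
      _ = 2 * (1 + t ^ 2) ^ (1/4:ℝ) := by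
        rw [Real.mul_rpow (by norm_num) (by positivity), ← Real.rpow_mul hp.le, ← Real.sqrt_eq_rpow]
        congr 1
        · rw [show (4:ℝ) = 2 ^ 2 by norm_num, Real.sqrt_sq (by norm_num)]
        · norm_num
  calc _ ≤ 2 * (1 + t ^ 2) ^ (1/4:ℝ) * (1 / (1 + t ^ 2)) := by gcongr
    _ = 2 * ((1 + t ^ 2) ^ (1/4:ℝ) * (1 + t ^ 2) ^ (-1:ℝ)) := by rw [Real.rpow_neg_one]; ring
    _ = _ := by rw [← Real.rpow_add hp]; norm_num

theorem perron_bound {a : ℕ → ℂ} {x K:ℝ} (hx : 3 ≤ x) (hK : 0 ≤ K)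
    (hsum : LSeriesSummable a ((1 + 1 / ln x:ℝ):ℂ))
    (hb : ∀ t : ℝ, ‖LSeries a (((1 + 1 / ln x:ℝ):ℂ) + t * I)‖ ≤ K * (|t| + 2) ^ (1/2:ℝ)) :
    ‖∑ n ∈ Icc 1 ⌊x⌋₊, a n * ((1 - n / x:ℝ):ℂ)‖ ≤ Real.exp 1 * kapI * K * x := by
  have hx0 : 0 < x := by linarith
  have hlog : 1 ≤ ln x := by rw [Real.le_log_iff_exp_le hx0]; linarith [Real.exp_one_lt_d9]
  set σ : ℝ := 1 + 1 / ln x with hσ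
  have hσ1 : 1 ≤ σ := by rw [hσ]; have : 0 < 1 / ln x := by positivity
                         linarith
  have hxσ : x ^ σ = Real.exp 1 * x := by rw [hσ, Real.rpow_add hx0, Real.rpow_one, Real.rpow_def_of_pos hx0, mul_one_div, div_self (by linarith)]; ring
  set g : ℝ → ℂ := fun t => 1 / (((σ:ℂ) + t * I) * ((σ:ℂ) + t * I + 1)) with hg
  -- the terms
  set F : ℕ → ℝ → ℂ := fun n t => LSeries.term a ((σ:ℂ) + t * I) n * ((x:ℂ) ^ ((σ:ℂ) + t * I) * g t) with hF
  have hnx : ∀ t : ℝ, ‖(x:ℂ) ^ ((σ:ℂ) + t * I)‖ = x ^ σ := fun t => by rw [norm_cpow_eq_rpow_re_of_pos hx0]; simp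
  have hnt : ∀ n (t:ℝ), ‖LSeries.term a ((σ:ℂ) + t * I) n‖ = ‖LSeries.term a (σ:ℂ) n‖ := fun n t => by rw [LSeries.norm_term_eq, LSeries.norm_term_eq]; simp
  have hFn : ∀ n t, ‖F n t‖ = ‖LSeries.term a (σ:ℂ) n‖ * x ^ σ * ‖g t‖ := fun n t => by simp only [hF, norm_mul, hnx, hnt]; ring
  have hgi : Integrable g := integrable_vert hσ1
  have hcx : Continuous fun t : ℝ => (x:ℂ) ^ ((σ:ℂ) + t * I) := by refine Continuous.const_cpow (by fun_prop) (Or.inl (by exact_mod_cast hx0.ne'))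
  have hFi : ∀ n, Integrable (F n) := by
    intro n
    refine Integrable.mono' (g := fun t => ‖LSeries.term a (σ:ℂ) n‖ * x ^ σ * ‖g t‖) (hgi.norm.const_mul _) ?_
      (Filter.Eventually.of_forall (fun t => (hFn n t).le))
    refine AEStronglyMeasurable.mul ?_ (hcx.aestronglyMeasurable.mul hgi.aestronglyMeasurable)
    apply Continuous.aestronglyMeasurable
    rcases Nat.eq_zero_or_pos n with h | h
    · simp [h]; exact continuous_const
    · simp only [LSeries.term_of_ne_zero h.ne']
      refine Continuous.div continuous_const (Continuous.const_cpow (by fun_prop) (Or.inl (by exact_mod_cast h.ne'))) ?_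
      intro t; simp [h.ne']
  have hsumF : Summable fun n => ∫ t, ‖F n t‖ := by
    simp only [hFn]
    simp only [integral_const_mul]
    exact (hsum.norm.mul_right _).mul_right _
  have hS := hasSum_integral_of_summable_integral_norm hFi hsumF
  have hterm : ∀ n, (∫ t, F n t) = (2 * pi:ℝ) • (if n = 0 then 0 else a n * ramp (n / x)) := by
    intro n
    split_ifs with h
    · simp [hF, h]
    · have hn : 0 < (n:ℝ) := by exact_mod_cast Nat.pos_of_ne_zero h
      rw [ramp_inv hσ1 (y := n / x) (by positivity)]
      have e : ∀ t : ℝ, F n t = a n * (((n / x:ℝ):ℂ) ^ (-((σ:ℂ) + t * I)) * g t) := by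
        intro t
        simp only [hF, LSeries.term_of_ne_zero h]
        rw [ofReal_div, div_cpow_ofReal_nonneg hn.le hx0.le, cpow_neg, cpow_neg]
        push_cast
        field_simp
      simp only [e]
      rw [integral_const_mul]
      simp only [real_smul, hg]
      push_cast
      generalize (∫ t : ℝ, _:ℂ) = J
      field_simp
  have hfin : HasSum (fun n => ∫ t, F n t) (∑ n ∈ Icc 1 ⌊x⌋₊, (2 * pi:ℝ) • (a n * ((1 - n / x:ℝ):ℂ))) := by
    have : ∑ n ∈ Icc 1 ⌊x⌋₊, (2 * pi:ℝ) • (a n * ((1 - n / x:ℝ):ℂ)) = ∑ n ∈ Icc 1 ⌊x⌋₊, ∫ t, F n t := by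
      apply sum_congr rfl
      intro n hn
      rw [mem_Icc] at hn
      rw [hterm, if_neg (by omega)]
      have : (n:ℝ) ≤ x := (Nat.le_floor_iff hx0.le).1 hn.2
      have : (n:ℝ) / x ≤ 1 := by rwa [div_le_one hx0]
      unfold ramp
      rw [max_eq_left (by linarith)]
    rw [this]
    apply hasSum_sum_of_ne_finset_zero
    intro n hn
    rw [hterm]
    split_ifs with h
    · simp
    · have hn' : ¬ (n ≤ ⌊x⌋₊) := fun h' => hn (mem_Icc.2 ⟨Nat.pos_of_ne_zero h, h'⟩)
      rw [Nat.le_floor_iff hx0.le] at hn'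
      push Not at hn'
      have : 1 ≤ (n:ℝ) / x := by rw [one_le_div hx0]; exact hn'.le
      unfold ramp
      rw [max_eq_right (by linarith)]; simp
  have heq := hfin.unique hS
  have hIntF : ‖∫ t, ∑' n, F n t‖ ≤ (Real.exp 1 * x * K) * kapI := by
    unfold kapI
    rw [← integral_const_mul]
    refine norm_integral_le_of_norm_le (kapI_integrable.const_mul _) (Filter.Eventually.of_forall (fun t => ?_))
    have : ∑' n, F n t = LSeries a ((σ:ℂ) + t * I) * ((x:ℂ) ^ ((σ:ℂ) + t * I) * g t) := by simp only [hF]; rw [tsum_mul_right]; rfl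
    rw [this, norm_mul, norm_mul, hnx, hxσ]
    calc _ ≤ K * (|t| + 2) ^ (1/2:ℝ) * (Real.exp 1 * x * (1 / (1 + t ^ 2))) := by
          gcongr
          · exact hb t
          · exact norm_vert hσ1 t
      _ = Real.exp 1 * x * K * ((|t| + 2) ^ (1/2:ℝ) * (1 / (1 + t ^ 2))) := by ring
      _ ≤ _ := mul_le_mul_of_nonneg_left (weight_le t) (by positivity)
  rw [← heq, ← smul_sum, norm_smul, Real.norm_of_nonneg (by positivity)] at hIntF
  have hpi : 1 ≤ 2 * pi := by linarith [Real.pi_gt_three]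
  have hnn := norm_nonneg (∑ n ∈ Icc 1 ⌊x⌋₊, a n * ((1 - n / x:ℝ):ℂ))
  nlinarith only [hnn, hpi, hIntF]

/-- Abel summation with antitone weights -/
lemma abel_antitone {w : ℕ → ℝ} {b : ℕ → ℂ} {N:ℕ} {M:ℝ} (hw : ∀ i, i + 1 < N → w (i + 1) ≤ w i)
    (hw0 : ∀ i, i < N → 0 ≤ w i) (hM : ∀ n ≤ N, ‖∑ i ∈ range n, b i‖ ≤ M) :
    ‖∑ i ∈ range N, (w i:ℂ) * b i‖ ≤ M * w 0 ∨ N = 0 := by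
  rcases Nat.eq_zero_or_pos N with h | h
  · exact Or.inr h
  left
  have := sum_range_by_parts (R := ℂ) (fun i => (w i:ℂ)) b N
  simp only [smul_eq_mul] at this
  rw [this]
  have htel : ∑ i ∈ range (N - 1), (w i - w (i + 1)) = w 0 - w (N - 1) := by rw [sum_range_sub']
  calc _ ≤ ‖(w (N - 1):ℂ) * ∑ i ∈ range N, b i‖ +
        ‖∑ i ∈ range (N - 1), ((w (i + 1):ℂ) - w i) * ∑ j ∈ range (i + 1), b j‖ := norm_sub_le _ _
    _ ≤ w (N - 1) * M + ∑ i ∈ range (N - 1), (w i - w (i + 1)) * M := by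
        gcongr
        · rw [norm_mul, norm_real, Real.norm_of_nonneg (hw0 _ (by omega))]
          exact mul_le_mul_of_nonneg_left (hM N le_rfl) (hw0 _ (by omega))
        · refine (norm_sum_le _ _).trans (sum_le_sum (fun i hi => ?_))
          rw [mem_range] at hi
          have h1 := hw i (by omega)
          rw [norm_mul, ← ofReal_sub, norm_real, Real.norm_of_nonpos (by linarith), neg_sub]
          exact mul_le_mul_of_nonneg_left (hM _ (by omega)) (by linarith)
    _ = M * w 0 := by rw [← sum_mul, htel]; ring
end

lemma log_pow_le (j:ℕ) : ∃ C : ℝ, 1 ≤ C ∧ ∀ x : ℝ, 1 ≤ x → ln x ^ j ≤ C * √x := by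
  refine ⟨(2 * (j:ℝ) + 1) ^ j, one_le_pow₀ (by positivity |> fun h : (0:ℝ) ≤ 2 * j => by linarith), fun x hx => ?_⟩
  have hx0 : 0 ≤ x := by linarith
  have hε : (0:ℝ) < 1 / (2 * j + 1) := by positivity
  have h := Real.log_le_rpow_div hx0 hε
  have h0 := Real.log_nonneg hx
  calc ln x ^ j ≤ (x ^ (1 / (2 * (j:ℝ) + 1)) / (1 / (2 * j + 1))) ^ j := pow_le_pow_left₀ h0 h j
    _ = (2 * (j:ℝ) + 1) ^ j * x ^ ((j:ℝ) / (2 * j + 1)) := by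
        rw [div_pow, ← Real.rpow_natCast, ← Real.rpow_mul hx0]
        rw [one_div_pow, div_div_eq_mul_div, div_one, mul_comm]
        congr 2; ring
    _ ≤ _ := by
        refine mul_le_mul_of_nonneg_left ?_ (by positivity)
        rw [Real.sqrt_eq_rpow]
        apply Real.rpow_le_rpow_of_exponent_le hx
        rw [div_le_div_iff₀ (by positivity) (by norm_num)]; linarith

/-- unsmoothing step -/
lemma unsmooth_one {b : ℕ → ℂ} {N h:ℕ} {K D:ℝ} (h1 : 1 ≤ h) (hh : h ≤ 2 * N)
    (hK : 0 ≤ K) (hT : ∀ m, N ≤ m → m ≤ 3 * N → ‖∑ n ∈ range m, b n * ((m:ℂ) - n)‖ ≤ K * (m:ℝ) ^ 2)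
    (hD : ∀ n, N ≤ n → n < 3 * N → ‖b n‖ ≤ D) (hD0 : 0 ≤ D) :
    ‖∑ n ∈ range N, b n‖ ≤ 10 * K * N ^ 2 / h + D * h := by
  have hpos : (0:ℝ) < h := by exact_mod_cast h1
  have e : ∑ n ∈ range (N + h), b n * (((N + h:ℕ):ℂ) - n) - ∑ n ∈ range N, b n * ((N:ℂ) - n)
      = h * ∑ n ∈ range N, b n + ∑ n ∈ Ico N (N + h), b n * (((N + h:ℕ):ℂ) - n) := by
    rw [← sum_range_add_sum_Ico _ (Nat.le_add_right N h), mul_sum, add_sub_right_comm, ← sum_sub_distrib]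
    congr 1
    apply sum_congr rfl; intros; push_cast; ring
  have hI : ‖∑ n ∈ Ico N (N + h), b n * (((N + h:ℕ):ℂ) - n)‖ ≤ D * h * h := by
    refine (norm_sum_le _ _).trans ?_
    calc _ ≤ ∑ n ∈ Ico N (N + h), D * h := by
          refine sum_le_sum (fun n hn => ?_)
          rw [mem_Ico] at hn
          rw [norm_mul]
          refine mul_le_mul (hD n hn.1 (by omega)) ?_ (norm_nonneg _) hD0
          rw [← Nat.cast_sub hn.2.le, Complex.norm_natCast]
          exact_mod_cast (by omega : N + h - n ≤ h)
      _ = _ := by simp; ring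
  have hA := hT (N + h) (by omega) (by omega)
  have hB := hT N le_rfl (by omega)
  have key : (h:ℝ) * ‖∑ n ∈ range N, b n‖ ≤ 10 * K * N ^ 2 + D * h * h := by
    have : (h:ℝ) * ‖∑ n ∈ range N, b n‖ = ‖(h:ℂ) * ∑ n ∈ range N, b n‖ := by rw [norm_mul, Complex.norm_natCast]
    rw [this, eq_sub_of_add_eq e.symm]
    refine (norm_sub_le _ _).trans (add_le_add ((norm_sub_le _ _).trans ?_) hI)
    have hNh : ((N + h:ℕ):ℝ) ^ 2 ≤ 9 * N ^ 2 := by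
      have : (N + h) ^ 2 ≤ 9 * N ^ 2 := by
        calc (N + h) ^ 2 ≤ (3 * N) ^ 2 := Nat.pow_le_pow_left (by omega) 2
          _ = _ := by ring
      exact_mod_cast this
    have := mul_le_mul_of_nonneg_left hNh hK
    linarith
  have : ‖∑ n ∈ range N, b n‖ ≤ (10 * K * N ^ 2 + D * h * h) / h := by rw [le_div_iff₀ hpos]; linarith
  refine this.trans (le_of_eq ?_)
  field_simp

/-- The Tauberian core. -/
theorem sw_core (j:ℕ) : ∃ C : ℝ, 1 ≤ C ∧ ∀ (a : ℕ → ℂ) (X:ℕ) (K:ℝ), 9 ≤ X → 0 ≤ K →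
    (∀ n : ℕ, ‖a n‖ ≤ ln n + 1) →
    (∀ m : ℕ, √X ≤ m → m ≤ 3 * X →
      ‖∑ n ∈ range m, (a n * (ln n:ℂ) ^ (2 * j)) * ((m:ℂ) - n)‖ ≤ K * (m:ℝ) ^ 2) →
    ‖∑ n ∈ range X, a n‖ ≤ C * (K + ln X) * X / ln X ^ j := by
  obtain ⟨C1, hC1, hlog1⟩ := log_pow_le (2 * j + 1)
  have hc4 : (1:ℝ) ≤ 4 ^ j := one_le_pow₀ (by norm_num)
  refine ⟨4 ^ j * (2 * (10 + 3 * 4 ^ j * (1 + C1))) + 4 * C1, by nlinarith [mul_nonneg (by linarith : (0:ℝ) ≤ 4^j - 1) (by linarith : (0:ℝ) ≤ C1)], ?_⟩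
  intro a X K hX hK ha hT
  set L := ln X
  have hX9 : (9:ℝ) ≤ X := by exact_mod_cast hX
  have hXpos : (0:ℝ) < X := by linarith
  have hlog3 : 1 ≤ ln 3 := by rw [Real.le_log_iff_exp_le (by norm_num)]; linarith [Real.exp_one_lt_d9]
  have hL2 : 2 ≤ L := by
    have : ln ((3:ℝ) ^ 2) ≤ L := Real.log_le_log (by norm_num) (by linarith)
    rw [Real.log_pow] at this; push_cast at this; linarith
  have hlog3X : ln (3 * X) ≤ 2 * L := by
    have : ln (3 * X) ≤ ln ((X:ℝ) ^ 2) := Real.log_le_log (by linarith) (by nlinarith)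
    rw [Real.log_pow] at this; push_cast at this; linarith
  have hLj : 0 < L ^ j := by positivity
  have hLj1 : 1 ≤ L ^ j := one_le_pow₀ (by linarith)
  set b : ℕ → ℂ := fun n => a n * (ln n:ℂ) ^ (2 * j) with hb
  have hb1 : ∀ n : ℕ, n ≤ 3 * X → ‖b n‖ ≤ 3 * 4 ^ j * L ^ (2 * j + 1) := by
    intro n hn
    have hl0 : 0 ≤ ln n := Real.log_natCast_nonneg n
    have hl : ln n ≤ 2 * L := by
      rcases Nat.eq_zero_or_pos n with h | h
      · simp [h]; linarith
      · refine (Real.log_le_log (by exact_mod_cast h) (by exact_mod_cast hn : (n:ℝ) ≤ 3 * X)).trans hlog3X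
    rw [hb]; simp only [norm_mul, norm_pow, norm_real, Real.norm_of_nonneg hl0]
    calc _ ≤ (3 * L) * (2 * L) ^ (2 * j) := by
          refine mul_le_mul ((ha n).trans (by linarith)) (pow_le_pow_left₀ hl0 hl _) (by positivity) (by linarith)
      _ = _ := by rw [mul_pow, pow_mul]; norm_num; ring
  have hLsq : L ^ (2 * j + 1) ≤ C1 * √X := hlog1 X (by linarith)
  have hsqX : √X * √X = X := Real.mul_self_sqrt hXpos.le
  have hsq3 : 3 ≤ √X := by
    rw [show (3:ℝ) = √9 by rw [show (9:ℝ) = 3 ^ 2 by norm_num]; simp]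
    exact Real.sqrt_le_sqrt hX9
  set c3 : ℝ := 10 + 3 * 4 ^ j * (1 + C1) with hc3
  -- the partial sums of b
  have hB : ∀ N : ℕ, √X ≤ N → N ≤ X → ‖∑ n ∈ range N, b n‖ ≤ c3 * (K + L) * X * L ^ j := by
    intro N hN1 hN2
    have hN0 : (0:ℝ) < N := by linarith
    have hNL : (N:ℝ) / L ^ j ≤ N := div_le_self hN0.le hLj1
    set h := ⌊(N:ℝ) / L ^ j⌋₊ + 1 with hh
    have hf : (⌊(N:ℝ) / L ^ j⌋₊:ℝ) ≤ N / L ^ j := Nat.floor_le (by positivity)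
    have hf2 : ⌊(N:ℝ) / L ^ j⌋₊ ≤ N := by exact_mod_cast hf.trans hNL
    have hN1' : 1 ≤ N := by exact_mod_cast (by linarith : (1:ℝ) ≤ N)
    have hlt : (N:ℝ) / L ^ j < h := by rw [hh]; push_cast; exact Nat.lt_floor_add_one _
    have hle : (h:ℝ) ≤ N / L ^ j + 1 := by rw [hh]; push_cast; linarith
    have hh1 : 1 ≤ h := by omega
    have hh2 : h ≤ 2 * N := by omega
    clear_value h
    have := unsmooth_one (b := b) (N := N) (h := h) (K := K) (D := 3 * 4 ^ j * L ^ (2 * j + 1)) hh1 hh2 hK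
      (fun m h1 h2 => hT m (hN1.trans (by exact_mod_cast h1)) (by omega)) (fun n h1 h2 => hb1 n (by omega)) (by positivity)
    refine this.trans ?_
    have t1 : 10 * K * (N:ℝ) ^ 2 / h ≤ 10 * K * X * L ^ j := by
      rw [div_le_iff₀ (by exact_mod_cast hh1)]
      have : (N:ℝ) ≤ L ^ j * h := by rw [div_lt_iff₀ hLj] at hlt; linarith
      calc 10 * K * (N:ℝ) ^ 2 = 10 * K * (N * N) := by ring
        _ ≤ 10 * K * (X * (L ^ j * h)) := by gcongr
        _ = _ := by ring
    have t2 : 3 * 4 ^ j * L ^ (2 * j + 1) * h ≤ 3 * 4 ^ j * (1 + C1) * (L * X * L ^ j) := by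
      have e1 : L ^ (2 * j + 1) * h ≤ (1 + C1) * (L * X * L ^ j) := by
        calc L ^ (2 * j + 1) * h ≤ L ^ (2 * j + 1) * (X / L ^ j + 1) := by
              gcongr; exact hle.trans (by gcongr)
          _ = L * X * L ^ j + L ^ (2 * j + 1) := by rw [pow_succ, two_mul, pow_add]; field_simp
          _ ≤ L * X * L ^ j + C1 * (L * X * L ^ j) := by
              gcongr
              refine hLsq.trans ?_
              gcongr
              have : √X ≤ X := by nlinarith
              calc √X ≤ X := this
                _ = 1 * X * 1 := by ring
                _ ≤ _ := by gcongr; linarith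
          _ = _ := by ring
      calc _ = 3 * 4 ^ j * (L ^ (2 * j + 1) * h) := by ring
        _ ≤ _ := by rw [mul_assoc (3 * 4 ^ j:ℝ)]; gcongr
    calc _ ≤ 10 * K * X * L ^ j + 3 * 4 ^ j * (1 + C1) * (L * X * L ^ j) := add_le_add t1 t2
      _ ≤ c3 * K * X * L ^ j + c3 * (L * X * L ^ j) := by
        have g1 : 10 ≤ c3 := by rw [hc3]; have : (0:ℝ) ≤ 3 * 4 ^ j * (1 + C1) := by positivity
                                linarith
        have g2 : 3 * 4 ^ j * (1 + C1) ≤ c3 := by rw [hc3]; linarith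
        gcongr
      _ = _ := by ring
  -- start point
  set Y := ⌈√X⌉₊
  have hY1 : √X ≤ Y := Nat.le_ceil _
  have hY2 : (Y:ℝ) < √X + 1 := Nat.ceil_lt_add_one (by positivity)
  have hYX : Y ≤ X := by
    have : (Y:ℝ) ≤ X := by nlinarith
    exact_mod_cast this
  clear_value Y
  have hhead : ‖∑ n ∈ range Y, a n‖ ≤ 4 * C1 * (K + L) * X / L ^ j := by
    rw [le_div_iff₀ hLj]
    calc _ ≤ (Y * (2 * L)) * L ^ j := by
          gcongr
          refine (norm_sum_le _ _).trans ?_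
          calc _ ≤ ∑ n ∈ range Y, (2 * L) := by
                refine sum_le_sum (fun n hn => (ha n).trans ?_)
                rw [mem_range] at hn
                have : ln n ≤ L := by
                  rcases Nat.eq_zero_or_pos n with h | h
                  · simp [h]; linarith
                  · exact Real.log_le_log (by exact_mod_cast h) (by exact_mod_cast (by omega : n ≤ X))
                linarith
            _ = _ := by simp
      _ ≤ (2 * √X * (2 * L)) * (C1 * √X) := by
          have : L ^ j ≤ C1 * √X := (pow_le_pow_right₀ (by linarith) (by omega)).trans hLsq
          gcongr
          linarith
      _ = 4 * C1 * L * X := by rw [← hsqX]; ring_nf; simp [hsqX]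
      _ ≤ _ := by gcongr; linarith
  have htail : ‖∑ n ∈ Ico Y X, a n‖ ≤ 4 ^ j * (2 * c3) * (K + L) * X / L ^ j := by
    rw [sum_Ico_eq_sum_range]
    have hlogY : ∀ i : ℕ, L / 2 ≤ ln ((Y + i:ℕ):ℝ) := by
      intro i
      have : ln (√X) ≤ ln ((Y + i:ℕ):ℝ) :=
        Real.log_le_log (by linarith) (hY1.trans (by push_cast; linarith [(Nat.cast_nonneg i : (0:ℝ) ≤ i)]))
      rwa [Real.log_sqrt hXpos.le] at this
    have hlogpos : ∀ i : ℕ, 0 < ln ((Y + i:ℕ):ℝ) := fun i => lt_of_lt_of_le (by linarith) (hlogY i)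
    have ea : ∀ i ∈ range (X - Y), a (Y + i) = ((((ln ((Y + i:ℕ):ℝ)) ^ (2 * j))⁻¹:ℝ):ℂ) * b (Y + i) := by
      intro i _
      have : (ln ((Y + i:ℕ):ℝ):ℂ) ≠ 0 := by exact_mod_cast (hlogpos i).ne'
      rw [hb]; simp only; rw [ofReal_inv, ofReal_pow]; field_simp
    rw [sum_congr rfl ea]
    have := abel_antitone (w := fun i => ((ln ((Y + i:ℕ):ℝ)) ^ (2 * j))⁻¹) (b := fun i => b (Y + i)) (N := X - Y)
      (M := 2 * (c3 * (K + L) * X * L ^ j)) (by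
        intro i _
        have h2 : ln ((Y + i:ℕ):ℝ) ≤ ln ((Y + (i+1):ℕ):ℝ) := by
          apply Real.log_le_log
          · push_cast; linarith [(Nat.cast_nonneg i : (0:ℝ) ≤ i)]
          · exact_mod_cast (by omega)
        have h3 := hlogpos i
        gcongr) (by intro i _; have := hlogpos i; positivity) (by
        intro n hn
        have : ∑ i ∈ range n, b (Y + i) = ∑ i ∈ range (Y + n), b i - ∑ i ∈ range Y, b i := by rw [sum_range_add]; ring
        rw [this]
        refine (norm_sub_le _ _).trans ?_
        have h1 := hB (Y + n) (hY1.trans (by push_cast; linarith [(Nat.cast_nonneg n : (0:ℝ) ≤ n)])) (by omega)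
        have h2 := hB Y hY1 hYX
        linarith)
    have hr : (0:ℝ) ≤ 4 ^ j * (2 * c3) * (K + L) * X / L ^ j := by positivity
    rcases this with h | h
    · refine h.trans ?_
      have hw : ((ln ((Y + 0:ℕ):ℝ)) ^ (2 * j))⁻¹ ≤ 4 ^ j / (L ^ j * L ^ j) := by
        calc _ ≤ ((L / 2) ^ (2 * j))⁻¹ := by
              have := hlogY 0
              gcongr
          _ = _ := by rw [div_pow, inv_div, pow_mul (2:ℝ), two_mul, pow_add]; norm_num
      calc _ ≤ 2 * (c3 * (K + L) * X * L ^ j) * (4 ^ j / (L ^ j * L ^ j)) := by gcongr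
        _ = _ := by field_simp
    · rw [h]; simpa using hr
  rw [← sum_range_add_sum_Ico _ hYX]
  refine (norm_add_le _ _).trans ((add_le_add hhead htail).trans (le_of_eq ?_))
  ring

lemma logMul_iter (a : ℕ → ℂ) (k n:ℕ) : (LSeries.logMul^[k] a) n = (ln n:ℂ) ^ k * a n := by
  induction k with
  | zero => simp
  | succ k ih =>
    rw [Function.iterate_succ_apply', LSeries.logMul, ih, pow_succ]
    rw [← natCast_log]; ring

lemma line_re (σ t:ℝ) : ((σ:ℂ) + t * I).re = σ := by simp
lemma line_im (σ t:ℝ) : ((σ:ℂ) + t * I).im = t := by simp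

theorem bridge (j:ℕ) (hj : 1 ≤ j) : ∃ C : ℝ, 1 ≤ C ∧ ∀ (a : ℕ → ℂ) (X:ℕ) (K:ℝ), 9 ≤ X → 0 ≤ K →
    (∀ n : ℕ, ‖a n‖ ≤ ln n + 1) → (∀ s : ℂ, 1 < s.re → LSeriesSummable a s) →
    (∀ s : ℂ, 1 < s.re → s.re ≤ 2 → ‖iteratedDeriv (2 * j) (LSeries a) s‖ ≤ K * (|s.im| + 2) ^ (1/2:ℝ)) →
    ‖∑ n ∈ range X, a n‖ ≤ C * (K + ln X) * X / ln X ^ j := by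
  obtain ⟨C, hC, H⟩ := sw_core j
  have hk := kapI_nonneg
  refine ⟨C * (Real.exp 1 * kapI + 1), by nlinarith [mul_nonneg (Real.exp_pos 1).le hk], fun a X K hX hK ha hs hb => ?_⟩
  have hX9 : (9:ℝ) ≤ X := by exact_mod_cast hX
  have hsq3 : 3 ≤ √X := by
    rw [show (3:ℝ) = √9 by rw [show (9:ℝ) = 3 ^ 2 by norm_num]; simp]
    exact Real.sqrt_le_sqrt hX9
  have habs : LSeries.abscissaOfAbsConv a ≤ 1 := by
    have := LSeries.abscissaOfAbsConv_le_of_forall_lt_LSeriesSummable (f := a) (x := 1) (fun y hy => hs y (by simpa using hy))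
    exact_mod_cast this
  have habs' : ∀ s : ℂ, 1 < s.re → LSeries.abscissaOfAbsConv a < s.re := fun s h =>
    lt_of_le_of_lt habs (by exact_mod_cast h)
  have hL0 : 0 ≤ ln X := Real.log_natCast_nonneg X
  refine (H a X (Real.exp 1 * kapI * K) hX (by positivity) ha ?_).trans ?_
  · intro m hm1 _
    have hm3 : (3:ℝ) ≤ m := hsq3.trans hm1
    have hm0 : (0:ℝ) < m := by linarith
    have hlogm : 1 ≤ ln m := by rw [Real.le_log_iff_exp_le hm0]; linarith [Real.exp_one_lt_d9]
    have hσ1 : 1 < 1 + 1 / ln m := by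
      have : 0 < 1 / ln m := by positivity
      linarith
    have hσ2 : 1 + 1 / ln m ≤ 2 := by
      have : 1 / ln m ≤ 1 := by rw [div_le_one (by linarith)]; exact hlogm
      linarith
    have := perron_bound (a := LSeries.logMul^[2 * j] a) (x := m) (K := K) hm3 hK (by
        apply LSeriesSummable_of_abscissaOfAbsConv_lt_re
        rw [LSeries.absicssaOfAbsConv_logPowMul]
        exact habs' _ (by rw [ofReal_re]; exact hσ1)) (by
        intro t
        have h1 : 1 < ((((1 + 1 / ln m:ℝ):ℂ)) + t * I).re := by rw [line_re]; exact hσ1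
        have e := LSeries_iteratedDeriv (f := a) (2 * j) (habs' _ h1)
        have hbb := hb _ h1 (by rw [line_re]; exact hσ2)
        rw [e, norm_mul, norm_pow, norm_neg, norm_one, one_pow, one_mul, line_im] at hbb
        exact hbb)
    have e2 : ∑ n ∈ range m, (a n * (ln n:ℂ) ^ (2 * j)) * ((m:ℂ) - n) =
        (m:ℂ) * ∑ n ∈ Icc 1 ⌊(m:ℝ)⌋₊, (LSeries.logMul^[2 * j] a) n * ((1 - n / (m:ℝ):ℝ):ℂ) := by
      rw [Nat.floor_natCast, mul_sum]
      have e3 : ∀ n, (m:ℂ) * ((LSeries.logMul^[2 * j] a) n * ((1 - n / (m:ℝ):ℝ):ℂ)) =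
          (a n * (ln n:ℂ) ^ (2 * j)) * ((m:ℂ) - n) := by
        intro n
        have : (m:ℂ) ≠ 0 := by exact_mod_cast hm0.ne'
        rw [logMul_iter]; push_cast; field_simp
      simp only [e3]
      have z0 : (a 0 * (ln (0:ℕ):ℂ) ^ (2 * j)) * ((m:ℂ) - (0:ℕ)) = 0 := by
        have : 2 * j ≠ 0 := by omega
        simp [this]
      have zm : (a m * (ln (m:ℕ):ℂ) ^ (2 * j)) * ((m:ℂ) - (m:ℕ)) = 0 := by simp
      have h1 := sum_range_succ (fun n : ℕ => (a n * (ln n:ℂ) ^ (2 * j)) * ((m:ℂ) - n)) m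
      rw [zm, add_zero] at h1
      rw [← h1, range_eq_Ico, sum_eq_sum_Ico_succ_bot (by omega), z0, zero_add]
      rfl
    rw [e2, norm_mul, Complex.norm_natCast]
    calc (m:ℝ) * _ ≤ m * (Real.exp 1 * kapI * K * m) := by gcongr
      _ = _ := by ring
  · have : C * (Real.exp 1 * kapI * K + ln X) ≤ C * (Real.exp 1 * kapI + 1) * (K + ln X) := by
      rw [mul_assoc C]
      refine mul_le_mul_of_nonneg_left ?_ (by linarith)
      have := mul_nonneg (mul_nonneg (Real.exp_pos 1).le hk) hL0
      have h2 := hK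
      nlinarith only [this, h2]
    gcongr

lemma norm_vM_le {q:ℕ} (χ : DC q) (n:ℕ) : ‖vM (fun n => χ n) n‖ ≤ ln n + 1 := by
  unfold vM
  rw [norm_mul, norm_real, Real.norm_of_nonneg ArithmeticFunction.vonMangoldt_nonneg]
  have h1 := χ.norm_le_one (n : ZMod q)
  have h2 := ArithmeticFunction.vonMangoldt_le_log (n := n)
  have h3 : 0 ≤ ArithmeticFunction.vonMangoldt n := ArithmeticFunction.vonMangoldt_nonneg
  nlinarith only [h1, h2, h3]

theorem psi_char (A:ℕ) : ∃ C : ℝ, 1 ≤ C ∧ ∀ (X:ℕ) (q:ℕ) [NeZero q] (χ : DC q), 9 ≤ X →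
    (q:ℝ) ≤ ln X ^ A → χ ≠ 1 →
    ‖∑ n ∈ range X, vM (fun n => χ n) n‖ ≤ C * X / ln X ^ A := by
  obtain ⟨C, hC, H⟩ := bridge (A + 1) (by omega)
  have hε : (0:ℝ) < 1 / (A + 2) := by positivity
  obtain ⟨C1, hC1, H1⟩ := L_logDeriv_bound (2 * (A + 1)) hε
  refine ⟨C * (C1 + 1), by nlinarith, fun X q _ χ hX hq hχ => ?_⟩
  have hX9 : (9:ℝ) ≤ X := by exact_mod_cast hX
  set L := ln X with hL
  have hL1 : 1 ≤ L := by rw [hL, Real.le_log_iff_exp_le (by linarith)]; linarith [Real.exp_one_lt_d9]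
  have hLD := LD_char χ
  refine (H (vM fun n => χ n) X (C1 * L) hX (by positivity) (norm_vM_le χ) hLD.summ ?_).trans ?_
  · intro s h1 h2
    have e : LSeries (vM fun n => χ n) =ᶠ[nhds s] fun z => -(deriv χ.LFunction z / χ.LFunction z) := by
      filter_upwards [halfplane_nhds h1] with z hz
      have hne := DirichletCharacter.LFunction_ne_zero_of_one_le_re χ (Or.inl hχ) (le_of_lt hz)
      rw [hLD.der z hz]; field_simp
    rw [e.iteratedDeriv_eq]
    have := H1 q χ s hχ h1 h2
    rw [show (fun z => -(deriv χ.LFunction z / χ.LFunction z)) = -(fun z => (deriv χ.LFunction z / χ.LFunction z)) from rfl,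
      iteratedDeriv_neg, norm_neg]
    refine this.trans ?_
    have hXX : XX q s ^ (1 / ((A:ℝ) + 2)) ≤ L * (|s.im| + 2) ^ (1/2:ℝ) := by
      unfold XX
      rw [Real.mul_rpow (by positivity) (by positivity)]
      have h3 : (q:ℝ) ^ (1 / ((A:ℝ) + 2)) ≤ L := by
        calc (q:ℝ) ^ (1 / ((A:ℝ) + 2)) ≤ (L ^ A) ^ (1 / ((A:ℝ) + 2)) := by gcongr
          _ = L ^ ((A:ℝ) * (1 / ((A:ℝ) + 2))) := by rw [← Real.rpow_natCast, ← Real.rpow_mul (by linarith)]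
          _ ≤ L ^ (1:ℝ) := by
            apply Real.rpow_le_rpow_of_exponent_le hL1
            rw [mul_one_div, div_le_one (by positivity)]; linarith
          _ = L := Real.rpow_one L
      have h4 : (|s.im| + 2) ^ (1 / ((A:ℝ) + 2)) ≤ (|s.im| + 2) ^ (1/2:ℝ) := by
        apply Real.rpow_le_rpow_of_exponent_le
        · linarith [abs_nonneg s.im]
        · apply one_div_le_one_div_of_le (by norm_num)
          linarith [(Nat.cast_nonneg A : (0:ℝ) ≤ A)]
      gcongr
    calc _ ≤ C1 * (L * (|s.im| + 2) ^ (1/2:ℝ)) := by gcongr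
      _ = _ := by ring
  · rw [pow_succ]
    have : 0 < L ^ A := by positivity
    rw [div_le_div_iff₀ (by positivity) this]
    apply le_of_eq; rw [← hL]; ring

/-! zeta -/

noncomputable def Z1 : ℂ → ℂ := HH (1 : DC 1)

lemma Z1_one : Z1 1 = 1 := by
  unfold Z1 HH
  simp [DirichletCharacter.LFunctionTrivChar₁]

lemma E_growth {ε:ℝ} (hε : 0 < ε) : ∃ η C : ℝ, 0 < η ∧ η ≤ 1/8 ∧ 1 ≤ C ∧ ∀ s : ℂ, 1 - η ≤ s.re → s.re ≤ 5/2 →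
    ‖dslope Z1 1 s‖ ≤ C * (|s.im| + 2) ^ ε := by
  obtain ⟨η, C, hη, hη1, hC, H⟩ := HH_deriv_growth hε
  refine ⟨η, C * 3 ^ ε * 3 + 6 * C, hη, hη1, by
    have : (0:ℝ) ≤ C * 3 ^ ε * 3 := by positivity
    linarith, fun s h1 h2 => ?_⟩
  have hXX : ∀ z : ℂ, XX 1 z = |z.im| + 2 := fun z => by simp [XX]
  have hp : 1 ≤ (|s.im| + 2) ^ ε := Real.one_le_rpow (by linarith [abs_nonneg s.im]) hε.le
  have hdiff : Differentiable ℂ Z1 := differentiable_HH _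
  rcases le_total |s.im| 1 with hi | hi
  · have hconv : ‖dslope Z1 1 s‖ ≤ C * 3 ^ ε * 3 := by
      have hseg : ∀ w ∈ segment ℝ (1:ℂ) s, ‖deriv Z1 w‖ ≤ C * 3 ^ ε * 3 := by
        intro w hw
        obtain ⟨α, β, hα, hβ, hαβ, rfl⟩ := hw
        have hre : (α • (1:ℂ) + β • s).re = α + β * s.re := by simp
        have him : (α • (1:ℂ) + β • s).im = β * s.im := by simp
        have habs : |(α • (1:ℂ) + β • s).im| ≤ 1 := by rw [him, abs_mul, abs_of_nonneg hβ]; nlinarith [abs_nonneg s.im]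
        have := (H 1 1 (α • (1:ℂ) + β • s) (by rw [hre]; nlinarith) (by rw [hre]; nlinarith)).2
        refine this.trans ?_
        rw [hXX]
        have h3 : |(α • (1:ℂ) + β • s).im| + 2 ≤ 3 := by linarith
        gcongr
      by_cases hs : s = 1
      · subst hs
        rw [dslope_same]; exact hseg 1 (left_mem_segment ℝ _ _)
      · rw [dslope_of_ne _ hs, slope_def_field, norm_div]
        have := (convex_segment (𝕜 := ℝ) (1:ℂ) s).norm_image_sub_le_of_norm_deriv_le (f := Z1) (𝕜 := ℂ)
          (fun x _ => hdiff x) hseg (left_mem_segment ℝ _ _) (right_mem_segment ℝ _ _)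
        rw [div_le_iff₀ (norm_pos_iff.2 (sub_ne_zero.2 hs))]
        exact this
    calc _ ≤ C * 3 ^ ε * 3 * 1 := by linarith
      _ ≤ (C * 3 ^ ε * 3 + 6 * C) * (|s.im| + 2) ^ ε := by gcongr; linarith
  · have hs : s ≠ 1 := by rintro rfl; norm_num at hi
    rw [dslope_of_ne _ hs, slope_def_field, norm_div, Z1_one]
    have him : |s.im| ≤ ‖s - 1‖ := by simpa using abs_im_le_norm (s - 1)
    rw [div_le_iff₀ (by linarith)]
    have hZ := (H 1 1 s h1 h2).1
    rw [hXX] at hZ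
    have hCp : 1 ≤ C * (|s.im| + 2) ^ ε := by nlinarith
    calc ‖Z1 s - 1‖ ≤ ‖Z1 s‖ + 1 := by simpa using norm_sub_le (Z1 s) 1
      _ ≤ C * (|s.im| + 2) ^ ε * (|s.im| + 2) + 1 := by gcongr; exact hZ
      _ ≤ C * (|s.im| + 2) ^ ε * (6 * |s.im|) := by nlinarith
      _ ≤ (6 * C) * (|s.im| + 2) ^ ε * ‖s - 1‖ := by
        calc _ = (6 * C) * (|s.im| + 2) ^ ε * |s.im| := by ring
          _ ≤ _ := by gcongr
      _ ≤ _ := by gcongr; have : (0:ℝ) ≤ C * 3 ^ ε * 3 := by positivity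
                  linarith

lemma E_deriv (k:ℕ) {ε:ℝ} (hε : 0 < ε) : ∃ C : ℝ, 0 < C ∧ ∀ s : ℂ, 1 < s.re → s.re ≤ 2 →
    ‖iteratedDeriv k (dslope Z1 1) s‖ ≤ C * (|s.im| + 2) ^ ε := by
  obtain ⟨η, C, hη, hη1, hC, H⟩ := E_growth hε
  refine ⟨k.factorial * (C * 2 ^ ε) / η ^ k, by positivity, fun s h1 h2 => ?_⟩
  have hdiff : Differentiable ℂ (dslope Z1 1) := by
    have := (differentiableOn_dslope (s := Set.univ) (c := 1) (f := Z1) Filter.univ_mem).2 (differentiable_HH _).differentiableOn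
    exact differentiableOn_univ.1 this
  have := norm_iteratedDeriv_le_of_forall_mem_sphere_norm_le (f := dslope Z1 1) (c := s) (R := η) (C := C * 2 ^ ε * (|s.im| + 2) ^ ε) k hη
    hdiff.diffContOnCl (fun z hz => by
      have hz' : ‖z - s‖ = η := by simpa [dist_eq_norm] using hz
      have hre := (abs_re_le_norm (z - s)).trans hz'.le
      have him := (abs_im_le_norm (z - s)).trans hz'.le
      rw [sub_re, abs_le] at hre
      rw [sub_im] at him
      refine (H z (by linarith) (by linarith)).trans ?_
      rw [mul_assoc, ← Real.mul_rpow (by norm_num) (by positivity)]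
      have : |z.im| ≤ |s.im| + η := by have := abs_sub_abs_le_abs_sub z.im s.im; linarith
      have h3 : |z.im| + 2 ≤ 2 * (|s.im| + 2) := by linarith [abs_nonneg s.im]
      gcongr)
  refine this.trans (le_of_eq ?_)
  ring

theorem psi_one (A:ℕ) : ∃ C : ℝ, 1 ≤ C ∧ ∀ (X:ℕ), 9 ≤ X →
    ‖∑ n ∈ range X, ((ArithmeticFunction.vonMangoldt n:ℂ) - 1)‖ ≤ C * X / ln X ^ A := by
  obtain ⟨C, hC, H⟩ := bridge (A + 1) (by omega)
  have hε : (0:ℝ) < 1 / 2 := by positivity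
  obtain ⟨C1, hC1, H1⟩ := HH_logDeriv_bound (2 * (A + 1)) hε
  obtain ⟨C2, hC2, H2⟩ := E_deriv (2 * (A + 1)) hε
  refine ⟨C * (C1 + C2 + 1), by nlinarith, fun X hX => ?_⟩
  have hX9 : (9:ℝ) ≤ X := by exact_mod_cast hX
  have hL1 : 1 ≤ ln X := by rw [Real.le_log_iff_exp_le (by linarith)]; linarith [Real.exp_one_lt_d9]
  have hLD := LD_char (1 : DC 1)
  have evM : (vM fun n => (1 : DC 1) n) = fun n => (ArithmeticFunction.vonMangoldt n:ℂ) := by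
    funext n; unfold vM
    beta_reduce
    rw [MulChar.one_apply (isUnit_of_subsingleton _)]; simp
  rw [evM] at hLD
  have hsum : ∀ s : ℂ, 1 < s.re → LSeriesSummable (fun n => (ArithmeticFunction.vonMangoldt n:ℂ) - 1) s :=
    fun s hs => (hLD.summ s hs).sub (LSeriesSummable_one_iff.2 hs)
  refine (H (fun n => (ArithmeticFunction.vonMangoldt n:ℂ) - 1) X (C1 + C2) hX (by positivity) ?_ hsum ?_).trans ?_
  · intro n
    refine (norm_sub_le _ _).trans ?_
    rw [norm_real, Real.norm_of_nonneg ArithmeticFunction.vonMangoldt_nonneg, norm_one]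
    have := ArithmeticFunction.vonMangoldt_le_log (n := n)
    linarith
  · intro s h1 h2
    have e : LSeries (fun n => (ArithmeticFunction.vonMangoldt n:ℂ) - 1) =ᶠ[nhds s]
        -(fun z => deriv (HH (1 : DC 1)) z / HH (1 : DC 1) z) - dslope Z1 1 := by
      filter_upwards [halfplane_nhds h1] with z hz
      have hz1 := ne_one_of_re hz
      have e1 : LSeries (fun n => (ArithmeticFunction.vonMangoldt n:ℂ) - 1) z =
          LSeries (fun n => (ArithmeticFunction.vonMangoldt n:ℂ)) z - LSeries 1 z := by
        rw [← LSeries_sub (hLD.summ z hz) (LSeriesSummable_one_iff.2 hz)]; rfl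
      have hne := DirichletCharacter.LFunction_ne_zero_of_one_le_re (1 : DC 1) (Or.inr hz1) (le_of_lt hz)
      have eHH : HH (1 : DC 1) =ᶠ[nhds z] fun w => (w - 1) * (1 : DC 1).LFunction w := by filter_upwards [halfplane_nhds hz] with w hw using HH_eq _ (ne_one_of_re hw)
      have ed : deriv (HH (1 : DC 1)) z = (1 : DC 1).LFunction z + (z - 1) * deriv (1 : DC 1).LFunction z := by
        rw [eHH.deriv_eq]
        have := ((hasDerivAt_id z).sub_const 1).mul (hLD.diff z hz).hasDerivAt
        have h3 := this.deriv
        simp only [id, one_mul] at h3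
        exact h3
      have eζ : LSeries 1 z = (1 : DC 1).LFunction z := by rw [LSeries_one_eq_riemannZeta hz, DirichletCharacter.LFunction_modOne_eq]
      rw [e1, eζ]
      simp only [Pi.sub_apply, Pi.neg_apply]
      rw [dslope_of_ne _ hz1, slope_def_field, Z1_one, ed, hLD.der z hz, Z1, HH_eq _ hz1]
      generalize (1 : DC 1).LFunction z = F at *
      field_simp
      ring
    rw [e.iteratedDeriv_eq]
    have hZd : AnalyticAt ℂ (HH (1 : DC 1)) s := (differentiable_HH _).analyticAt s
    have hd : Differentiable ℂ (dslope Z1 1) := by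
      have := (differentiableOn_dslope (s := Set.univ) (c := 1) (f := Z1) Filter.univ_mem).2 (differentiable_HH _).differentiableOn
      exact differentiableOn_univ.1 this
    have hne : HH (1 : DC 1) s ≠ 0 := by
      rw [HH_eq _ (ne_one_of_re h1)]
      exact mul_ne_zero (sub_ne_zero.2 (ne_one_of_re h1)) (DirichletCharacter.LFunction_ne_zero_of_one_le_re _ (Or.inr (ne_one_of_re h1)) h1.le)
    have ha1 : AnalyticAt ℂ (fun z => deriv (HH (1 : DC 1)) z / HH (1 : DC 1) z) s := hZd.deriv.div hZd hne
    rw [iteratedDeriv_sub ha1.neg.contDiffAt (hd.analyticAt s).contDiffAt, iteratedDeriv_neg]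
    refine (norm_sub_le _ _).trans ?_
    rw [norm_neg]
    have g1 := H1 s h1 h2
    have g2 := H2 s h1 h2
    linarith
  · rw [pow_succ]
    have : 0 < ln X ^ A := by positivity
    rw [div_le_div_iff₀ (by positivity) this]
    have : C * (C1 + C2 + ln X) ≤ C * (C1 + C2 + 1) * ln X := by
      rw [mul_assoc C]; refine mul_le_mul_of_nonneg_left ?_ (by linarith)
      nlinarith
    calc _ = (C * (C1 + C2 + ln X)) * (X * ln X ^ A) := by ring
      _ ≤ (C * (C1 + C2 + 1) * ln X) * (X * ln X ^ A) := by gcongr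
      _ = _ := by ring

/-- log weight on primes -/
noncomputable def lp (n:ℕ) : ℝ := if n.Prime then ln n else 0

lemma lp_nonneg (n:ℕ) : 0 ≤ lp n := by
  unfold lp; split_ifs
  · exact Real.log_natCast_nonneg n
  · exact le_rfl

lemma lp_le_log (n:ℕ) : lp n ≤ ln n := by
  unfold lp; split_ifs
  · exact le_rfl
  · exact Real.log_natCast_nonneg n

lemma lp_le_vM (n:ℕ) : lp n ≤ ArithmeticFunction.vonMangoldt n := by
  unfold lp; split_ifs with h
  · rw [ArithmeticFunction.vonMangoldt_apply_prime h]
  · exact ArithmeticFunction.vonMangoldt_nonneg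

lemma sum_vM_sub_lp (X:ℕ) (hX : 1 ≤ X) :
    ∑ n ∈ range X, (ArithmeticFunction.vonMangoldt n - lp n) ≤ 2 * √X * ln X := by
  have h1 : (1:ℝ) ≤ X := by exact_mod_cast hX
  refine le_trans ?_ (Chebyshev.psi_sub_theta_le h1)
  have e : Chebyshev.psi X - Chebyshev.theta X = ∑ n ∈ range (X + 1), (ArithmeticFunction.vonMangoldt n - lp n) := by
    rw [Chebyshev.psi_eq_sum_Icc, Chebyshev.theta_eq_sum_Icc, Nat.floor_natCast, sum_filter, sum_sub_distrib,
      range_eq_Ico]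
    rfl
  rw [e, sum_range_succ]
  linarith [lp_le_vM X]

noncomputable def th (X q:ℕ) (r : ZMod q) : ℝ := ∑ n ∈ range X, if (n : ZMod q) = r then lp n else 0
noncomputable def ps (X q:ℕ) (r : ZMod q) : ℝ := ∑ n ∈ range X, if (n : ZMod q) = r then ArithmeticFunction.vonMangoldt n else 0

lemma ps_sub_th (X q:ℕ) (r : ZMod q) (hX : 1 ≤ X) : |ps X q r - th X q r| ≤ 2 * √X * ln X := by
  have e : ps X q r - th X q r = ∑ n ∈ range X, if (n : ZMod q) = r then ArithmeticFunction.vonMangoldt n - lp n else 0 := by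
    unfold ps th
    rw [← sum_sub_distrib]
    apply sum_congr rfl; intro n _; split_ifs <;> simp
  have h0 : ∀ n, 0 ≤ ArithmeticFunction.vonMangoldt n - lp n := fun n => by linarith [lp_le_vM n]
  rw [e, abs_of_nonneg (sum_nonneg (fun n _ => by split_ifs; exacts [h0 n, le_rfl]))]
  refine le_trans (sum_le_sum (fun n _ => ?_)) (sum_vM_sub_lp X hX)
  split_ifs
  · exact le_rfl
  · exact h0 n

lemma sum_noncoprime (X q:ℕ) [NeZero q] (hX : 1 ≤ X) :
    ∑ n ∈ range X, (if IsUnit (n : ZMod q) then 0 else ArithmeticFunction.vonMangoldt n) ≤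
      2 * √X * ln X + q ^ 2 := by
  have h1 : ∑ n ∈ range X, (if IsUnit (n : ZMod q) then 0 else ArithmeticFunction.vonMangoldt n) ≤
      ∑ n ∈ range X, (ArithmeticFunction.vonMangoldt n - lp n) + ∑ n ∈ range X, (if IsUnit (n : ZMod q) then 0 else lp n) := by
    rw [← sum_add_distrib]
    refine sum_le_sum (fun n _ => ?_)
    have := lp_le_vM n
    split_ifs <;> linarith
  have h2 : ∑ n ∈ range X, (if IsUnit (n : ZMod q) then 0 else lp n) ≤ (q:ℝ) ^ 2 := by
    calc _ ≤ ∑ n ∈ q.divisors, (q:ℝ) := by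
          rw [← sum_filter_ne_zero]
          have hsub : (range X).filter (fun n : ℕ => (if IsUnit (n : ZMod q) then 0 else lp n) ≠ 0) ⊆ q.divisors := by
            intro n hn
            rw [mem_filter] at hn
            obtain ⟨_, hn⟩ := hn
            split_ifs at hn with hu
            · exact absurd rfl hn
            · have hp : n.Prime := by
                by_contra h
                exact hn (by simp [lp, h])
              rw [ZMod.isUnit_iff_coprime, hp.coprime_iff_not_dvd, not_not] at hu
              exact Nat.mem_divisors.2 ⟨hu, NeZero.ne q⟩
          calc _ ≤ ∑ n ∈ (range X).filter (fun n : ℕ => (if IsUnit (n : ZMod q) then 0 else lp n) ≠ 0), (q:ℝ) := by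
                refine sum_le_sum (fun n hn => ?_)
                have hd := Nat.le_of_dvd (NeZero.pos q) (Nat.dvd_of_mem_divisors (hsub hn))
                have : lp n ≤ q := by refine (lp_le_log n).trans ((Real.log_le_self (by positivity)).trans (by exact_mod_cast hd))
                split_ifs
                · positivity
                · exact this
            _ ≤ _ := sum_le_sum_of_subset_of_nonneg hsub (fun _ _ _ => by positivity)
      _ = q.divisors.card * q := by simp
      _ ≤ q * q := by
          gcongr
          exact_mod_cast Nat.card_divisors_le_self q
      _ = _ := by ring
  linarith [sum_vM_sub_lp X hX]

theorem siegel_walfisz (A:ℕ) : ∃ C : ℝ, 1 ≤ C ∧ ∀ (X q:ℕ) [NeZero q] (r : ZMod q), 9 ≤ X →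
    (q:ℝ) ≤ ln X ^ A → IsUnit r → |th X q r - X / q.totient| ≤ C * X / ln X ^ A := by
  obtain ⟨C1, hC1, H1⟩ := psi_char A
  obtain ⟨C2, hC2, H2⟩ := psi_one A
  obtain ⟨C3, hC3, H3⟩ := log_pow_le (A + 1)
  obtain ⟨C4, hC4, H4⟩ := log_pow_le (3 * A)
  refine ⟨C1 + C2 + 4 * C3 + C4, by linarith, fun X q _ r hX hq hr => ?_⟩
  have hX9 : (9:ℝ) ≤ X := by exact_mod_cast hX
  have hX1 : 1 ≤ X := by omega
  set L := ln X with hL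
  have hL1 : 1 ≤ L := by rw [hL, Real.le_log_iff_exp_le (by linarith)]; linarith [Real.exp_one_lt_d9]
  have hLA : 0 < L ^ A := by positivity
  have hφ : 0 < q.totient := Nat.totient_pos.2 (NeZero.pos q)
  have hφ' : (0:ℝ) < q.totient := by exact_mod_cast hφ
  have hφ1 : (1:ℝ) ≤ q.totient := by exact_mod_cast hφ
  have hsqX : √X * √X = X := Real.mul_self_sqrt (by linarith)
  have hsq1 : 1 ≤ √X := by rw [Real.one_le_sqrt]; linarith
  have b1 : 2 * √X * L ≤ 2 * C3 * X / L ^ A := by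
    rw [le_div_iff₀ hLA]
    have := H3 X (by linarith)
    calc 2 * √X * L * L ^ A = 2 * √X * L ^ (A + 1) := by ring
      _ ≤ 2 * √X * (C3 * √X) := by gcongr
      _ = 2 * C3 * (√X * √X) := by ring
      _ = _ := by rw [hsqX]
  have b2 : (q:ℝ) ^ 2 ≤ C4 * X / L ^ A := by
    rw [le_div_iff₀ hLA]
    have := H4 X (by linarith)
    calc (q:ℝ) ^ 2 * L ^ A ≤ (L ^ A) ^ 2 * L ^ A := by gcongr
      _ = L ^ (3 * A) := by ring
      _ ≤ C4 * √X := this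
      _ ≤ C4 * X := by gcongr; nlinarith only [hsqX, hsq1]
  -- orthogonality
  have horth : (q.totient:ℂ) * (ps X q r:ℂ) = ∑ χ : DC q, χ r⁻¹ * ∑ n ∈ range X, vM (fun n => χ n) n := by
    unfold ps vM
    simp only [mul_sum]
    rw [sum_comm]
    push_cast
    rw [mul_sum]
    apply sum_congr rfl; intro n _
    have := DirichletCharacter.sum_char_inv_mul_char_eq ℂ hr (n : ZMod q)
    simp only [← mul_assoc]
    rw [← sum_mul, this]
    by_cases h : (n : ZMod q) = r
    · simp [h]
    · simp [h, Ne.symm h]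
  have hprinc : ‖(∑ n ∈ range X, vM (fun n => (1 : DC q) n) n) - X‖ ≤ (C2 + 2 * C3 + C4) * X / L ^ A := by
    have e : (∑ n ∈ range X, vM (fun n => (1 : DC q) n) n) - X =
        ∑ n ∈ range X, ((ArithmeticFunction.vonMangoldt n:ℂ) - 1) -
        ((∑ n ∈ range X, (if IsUnit (n : ZMod q) then 0 else ArithmeticFunction.vonMangoldt n):ℝ):ℂ) := by
      push_cast
      rw [← sum_sub_distrib]
      have : (X:ℂ) = ∑ n ∈ range X, 1 := by simp
      rw [this, ← sum_sub_distrib]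
      apply sum_congr rfl; intro n _
      unfold vM
      beta_reduce
      split_ifs with h
      · rw [MulChar.one_apply h]; simp
      · rw [MulChar.map_nonunit _ h]; simp
    rw [e]
    refine (norm_sub_le _ _).trans ?_
    have h0 : 0 ≤ ∑ n ∈ range X, (if IsUnit (n : ZMod q) then 0 else ArithmeticFunction.vonMangoldt n) :=
      sum_nonneg (fun n _ => by split_ifs; exacts [le_rfl, ArithmeticFunction.vonMangoldt_nonneg])
    rw [norm_real, Real.norm_of_nonneg h0]
    have := H2 X hX
    have h3 := sum_noncoprime X q hX1
    have : (C2 + 2 * C3 + C4) * X / L ^ A = C2 * X / L ^ A + (2 * C3 * X / L ^ A + C4 * X / L ^ A) := by ring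
    rw [this]
    linarith
  have hmain : ‖(q.totient:ℂ) * (ps X q r:ℂ) - X‖ ≤ q.totient * ((C1 + C2 + 2 * C3 + C4) * X / L ^ A) := by
    rw [horth, ← add_sum_erase _ _ (mem_univ (1 : DC q))]
    have hr1 : (1 : DC q) r⁻¹ = 1 := by
      rw [MulChar.one_apply]
      exact IsUnit.of_mul_eq_one r (ZMod.inv_mul_of_unit r hr)
    rw [hr1, one_mul, add_sub_right_comm]
    refine (norm_add_le _ _).trans ?_
    have h2 : ‖∑ χ ∈ univ.erase (1 : DC q), χ r⁻¹ * ∑ n ∈ range X, vM (fun n => χ n) n‖ ≤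
        q.totient * (C1 * X / L ^ A) := by
      refine (norm_sum_le _ _).trans ?_
      calc _ ≤ ∑ χ ∈ univ.erase (1 : DC q), (C1 * X / L ^ A) := by
            refine sum_le_sum (fun χ hχ => ?_)
            rw [norm_mul]
            have h1 := χ.norm_le_one r⁻¹
            have h2 := H1 X q χ hX hq (ne_of_mem_erase hχ)
            calc _ ≤ 1 * (C1 * X / L ^ A) := by gcongr
              _ = _ := one_mul _
        _ ≤ ∑ χ : DC q, (C1 * X / L ^ A) :=
            sum_le_sum_of_subset_of_nonneg (erase_subset _ _) (fun _ _ _ => by positivity)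
        _ = _ := by rw [sum_const, nsmul_eq_mul, card_univ, ← Nat.card_eq_fintype_card, DirichletCharacter.card_eq_totient_of_hasEnoughRootsOfUnity]
    have h3 : (C2 + 2 * C3 + C4) * X / L ^ A ≤ q.totient * ((C2 + 2 * C3 + C4) * X / L ^ A) :=
      le_mul_of_one_le_left (by positivity) hφ1
    have : q.totient * ((C1 + C2 + 2 * C3 + C4) * X / L ^ A) = q.totient * ((C2 + 2 * C3 + C4) * X / L ^ A) + q.totient * (C1 * X / L ^ A) := by ring
    rw [this]
    linarith
  have hps : |ps X q r - X / q.totient| ≤ (C1 + C2 + 2 * C3 + C4) * X / L ^ A := by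
    have e : ‖(q.totient:ℂ) * (ps X q r:ℂ) - X‖ = q.totient * |ps X q r - X / q.totient| := by
      have : (q.totient:ℂ) * (ps X q r:ℂ) - X = ((q.totient * (ps X q r - X / q.totient):ℝ):ℂ) := by
        have : (q.totient:ℂ) ≠ 0 := by exact_mod_cast hφ.ne'
        push_cast; field_simp
      rw [this, norm_real, Real.norm_eq_abs, abs_mul, abs_of_pos hφ']
    rw [e] at hmain
    exact le_of_mul_le_mul_left hmain hφ'
  have hd := ps_sub_th X q r hX1
  have : th X q r - X / q.totient = (ps X q r - X / q.totient) - (ps X q r - th X q r) := by ring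
  rw [this]
  refine (abs_sub _ _).trans ?_
  have e : (C1 + C2 + 4 * C3 + C4) * X / L ^ A = (C1 + C2 + 2 * C3 + C4) * X / L ^ A + 2 * C3 * X / L ^ A := by ring
  rw [e]
  linarith

noncomputable def ee (x:ℝ) : ℂ := exp (2 * pi * x * I)

lemma ee_add (x y:ℝ) : ee (x + y) = ee x * ee y := by
  unfold ee; rw [← exp_add]; congr 1; push_cast; ring

lemma ee_zero : ee 0 = 1 := by simp [ee]

lemma norm_ee (x:ℝ) : ‖ee x‖ = 1 := by
  unfold ee
  rw [show (2 * pi * x * I:ℂ) = ((2 * pi * x:ℝ):ℂ) * I by push_cast; ring]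
  exact norm_exp_ofReal_mul_I _

lemma ee_neg (x:ℝ) : ee (-x) = (starRingEnd ℂ) (ee x) := by
  unfold ee; rw [← exp_conj]; congr 1
  simp [conj_ofNat]

lemma ee_int (n:ℤ) : ee n = 1 := by
  unfold ee; rw [exp_eq_one_iff]; exact ⟨n, by push_cast; ring⟩

lemma ee_add_int (x:ℝ) (n:ℤ) : ee (x + n) = ee x := by rw [ee_add, ee_int, mul_one]

lemma ee_nsmul (x:ℝ) (n:ℕ) : ee (n * x) = ee x ^ n := by
  unfold ee; rw [← exp_nat_mul]; congr 1; push_cast; ring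

/-- distance to the nearest integer -/
noncomputable def di (x:ℝ) : ℝ := |x - round x|

lemma di_nonneg (x:ℝ) : 0 ≤ di x := abs_nonneg _
lemma di_le_half (x:ℝ) : di x ≤ 1/2 := abs_sub_round x

lemma four_di_le (x:ℝ) : 4 * di x ≤ ‖ee x - 1‖ := by
  have e : ee x = ee (x - round x) := by rw [sub_eq_add_neg, ← Int.cast_neg, ee_add_int]
  rw [e]; unfold di
  have hb := abs_sub_round x
  generalize x - round x = y at hb
  have h1 : ‖ee y - 1‖ = ‖2 * Real.sin (pi * y)‖ := by
    have := norm_exp_I_mul_ofReal_sub_one (2 * pi * y)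
    unfold ee
    rw [show (2 * pi * y * I:ℂ) = I * ((2 * pi * y:ℝ):ℂ) by push_cast; ring, this]
    congr 3; ring
  rw [h1, Real.norm_eq_abs, abs_mul, abs_of_pos (by norm_num : (0:ℝ) < 2)]
  have h2 : |Real.sin (pi * y)| = Real.sin (pi * |y|) := by
    rcases le_total 0 y with h | h
    · rw [abs_of_nonneg h] at *
      rw [abs_of_nonneg]
      exact Real.sin_nonneg_of_nonneg_of_le_pi (by positivity) (by nlinarith [Real.pi_pos])
    · rw [abs_of_nonpos h] at *
      rw [mul_neg, Real.sin_neg, abs_of_nonpos]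
      exact Real.sin_nonpos_of_nonpos_of_neg_pi_le (by nlinarith [Real.pi_pos]) (by nlinarith [Real.pi_pos])
  rw [h2]
  have := Real.mul_le_sin (x := pi * |y|) (by positivity) (by nlinarith [Real.pi_pos])
  have e2 : 2 / pi * (pi * |y|) = 2 * |y| := by field_simp
  linarith

noncomputable def mn (N:ℝ) (x:ℝ) : ℝ := (2 * max (di x) (1 / (2 * N)))⁻¹

lemma mn_nonneg {N:ℝ} (x:ℝ) : 0 ≤ mn N x := by
  unfold mn
  have := (di_nonneg x).trans (le_max_left (di x) (1 / (2 * N)))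
  positivity

lemma mn_le {N:ℝ} (hN : 0 < N) (x:ℝ) : mn N x ≤ N := by
  unfold mn
  rw [inv_le_comm₀ (by have : 0 < 1 / (2 * N) := by positivity
                       positivity) hN]
  have := le_max_right (di x) (1 / (2 * N))
  calc N⁻¹ = 2 * (1 / (2 * N)) := by field_simp
    _ ≤ _ := by linarith

lemma mn_le_of {N d:ℝ} (hd : 0 < d) {x:ℝ} (h : d ≤ di x) : mn N x ≤ 1 / (2 * d) := by
  have := h.trans (le_max_left (di x) (1 / (2 * N)))
  rw [one_div (2 * d)]
  exact inv_anti₀ (by positivity) (by linarith)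

lemma le_mn {N t x:ℝ} (hN : 0 < N) (h1 : t ≤ N) (h2 : t * (2 * di x) ≤ 1) : t ≤ mn N x := by
  unfold mn
  rcases le_or_gt t 0 with ht | ht
  · exact ht.trans (by positivity)
  rw [le_inv_comm₀ ht (by positivity), ← one_div, le_div_iff₀ ht]
  rcases max_cases (di x) (1 / (2 * N)) with ⟨h, _⟩ | ⟨h, _⟩
  · rw [h]; linarith
  · rw [h]
    calc 2 * (1 / (2 * N)) * t = t / N := by field_simp
      _ ≤ 1 := by rw [div_le_one hN]; exact h1

lemma ordConn_linear {J : Finset ℤ} {a:ℤ} {N:ℕ} (hJ : J ⊆ Ico a (a + N)) (hN : 0 < N)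
    (hc : (J : Set ℤ).OrdConnected) (θ:ℝ) (g : ℤ → ℝ) (hg : ∀ x h : ℤ, g (x + h) = g x + θ * h) :
    ‖∑ x ∈ J, ee (g x)‖ ≤ mn N θ := by
  have hN' : (0:ℝ) < N := by exact_mod_cast hN
  have hcard : (J.card:ℝ) ≤ N := by
    have := card_le_card hJ
    rw [Int.card_Ico] at this
    have h2 : J.card ≤ N := by omega
    exact_mod_cast h2
  apply le_mn hN'
  · refine (norm_sum_le _ _).trans ?_
    simp only [norm_ee, sum_const, nsmul_eq_mul, mul_one]; exact hcard
  · rcases J.eq_empty_or_nonempty with h | h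
    · simp [h]
    obtain ⟨u, hu⟩ : ∃ u, u = J.min' h := ⟨_, rfl⟩
    obtain ⟨v, hv⟩ : ∃ v, v = J.max' h := ⟨_, rfl⟩
    have huJ : u ∈ J := hu ▸ J.min'_mem h
    have hvJ : v ∈ J := hv ▸ J.max'_mem h
    have hJe : J = (range (v - u + 1).toNat).image (fun i : ℕ => u + (i:ℤ)) := by
      ext x
      simp only [mem_image, mem_range]
      constructor
      · intro hx
        have h1 : u ≤ x := hu ▸ J.min'_le x hx
        have h2 : x ≤ v := hv ▸ J.le_max' x hx
        exact ⟨(x - u).toNat, by omega, by omega⟩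
      · rintro ⟨i, hi, rfl⟩
        exact mem_coe.1 (hc.out (mem_coe.2 huJ) (mem_coe.2 hvJ) ⟨by omega, by omega⟩)
    rw [hJe, sum_image (fun i _ j _ hij => by simpa using hij)]
    have e : ∀ i : ℕ, ee (g (u + (i:ℤ))) = ee (g u) * ee θ ^ i := by
      intro i
      rw [hg, ee_add, ← ee_nsmul]; congr 2; push_cast; ring
    simp only [e]
    rw [← mul_sum, norm_mul, norm_ee, one_mul]
    have h4 := four_di_le θ
    have hgs := geom_sum_mul (ee θ) (v - u + 1).toNat
    have h5 : ‖∑ i ∈ range (v - u + 1).toNat, ee θ ^ i‖ * ‖ee θ - 1‖ ≤ 2 := by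
      rw [← norm_mul, hgs]
      refine (norm_sub_le _ _).trans ?_
      rw [norm_pow, norm_ee]; norm_num
    have := mul_le_mul_of_nonneg_left h4 (norm_nonneg (∑ i ∈ range (v - u + 1).toNat, ee θ ^ i))
    linarith

/-- spacing -/
lemma spacing {α:ℝ} {a:ℤ} {q:ℕ} (hq : 0 < q) (hc : IsCoprime a (q:ℤ)) (hα : |α - a / q| ≤ 1 / (q:ℝ) ^ 2)
    {d:ℤ} (hd : d ≠ 0) (hd2 : 2 * |d| ≤ q) (z:ℤ) : 1 / (2 * (q:ℝ)) ≤ |α * d - z| := by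
  have hq' : (0:ℝ) < q := by exact_mod_cast hq
  have hne : a * d - z * q ≠ 0 := by
    intro h
    have h2 : (q:ℤ) ∣ a * d := ⟨z, by linarith⟩
    have h3 : (q:ℤ) ∣ d := hc.symm.dvd_of_dvd_mul_left h2
    have := Int.le_of_dvd (abs_pos.2 hd) ((dvd_abs _ _).2 h3)
    omega
  have h4 : (1:ℝ) ≤ |(a * d - z * q:ℝ)| := by
    have := Int.one_le_abs hne
    exact_mod_cast this
  have h5 : 1 / (q:ℝ) ≤ |(a:ℝ) / q * d - z| := by
    have : (a:ℝ) / q * d - z = (a * d - z * q) / q := by field_simp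
    rw [this, abs_div, abs_of_pos hq']
    gcongr
  have h6 : |α * d - a / q * d| ≤ 1 / (2 * (q:ℝ)) := by
    rw [← sub_mul, abs_mul]
    have hd3 : 2 * |(d:ℝ)| ≤ q := by exact_mod_cast hd2
    calc |α - a / q| * |(d:ℝ)| ≤ 1 / (q:ℝ) ^ 2 * (q / 2) := by
          gcongr; linarith
      _ = _ := by field_simp
  have h7 := abs_sub_abs_le_abs_sub ((a:ℝ) / q * d - z) (((a:ℝ) / q * d - z) - (α * d - z))
  rw [sub_sub_cancel] at h7
  have h8 : |((a:ℝ) / q * d - z) - (α * d - z)| = |α * d - a / q * d| := by rw [← abs_neg]; congr 1; ring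
  rw [h8] at h7
  have : 1 / (q:ℝ) - 1 / (2 * q) = 1 / (2 * q) := by field_simp; norm_num
  linarith

lemma half_block {α:ℝ} {q:ℕ} (hq : 0 < q) {N:ℝ} (hN : 0 < N) (T : Finset ℕ)
    (hinj : ∀ ℓ ∈ T, ∀ ℓ' ∈ T, ⌊2 * q * di (α * ℓ)⌋₊ = ⌊2 * q * di (α * ℓ')⌋₊ → ℓ = ℓ') :
    ∑ ℓ ∈ T, mn N (α * ℓ) ≤ N + q * (1 + ln q) := by
  set F : ℕ → ℝ := fun k => if k = 0 then N else q / k with hF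
  have hF0 : ∀ k, 0 ≤ F k := fun k => by simp only [hF]; split_ifs <;> positivity
  calc ∑ ℓ ∈ T, mn N (α * ℓ) ≤ ∑ ℓ ∈ T, F ⌊2 * q * di (α * ℓ)⌋₊ := by
        refine sum_le_sum (fun ℓ _ => ?_)
        simp only [hF]
        split_ifs with h
        · exact mn_le hN _
        · have hk : (0:ℝ) < (⌊2 * q * di (α * ℓ)⌋₊:ℝ) := by exact_mod_cast Nat.pos_of_ne_zero h
          have hfl : (⌊2 * q * di (α * ℓ)⌋₊:ℝ) ≤ 2 * q * di (α * ℓ) := Nat.floor_le (by have := di_nonneg (α * ℓ); positivity)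
          generalize (⌊2 * q * di (α * ℓ)⌋₊:ℝ) = k at hk hfl
          have := mn_le_of (N := N) (d := k / (2 * q)) (x := α * ℓ) (by positivity) (by
            rw [div_le_iff₀ (by positivity)]; linarith)
          refine this.trans (le_of_eq ?_)
          field_simp
    _ = ∑ k ∈ T.image (fun ℓ : ℕ => ⌊2 * q * di (α * ℓ)⌋₊), F k := by rw [sum_image]; intro ℓ h1 ℓ' h2 h3; exact hinj ℓ h1 ℓ' h2 h3
    _ ≤ ∑ k ∈ range (q + 1), F k := by
        refine sum_le_sum_of_subset_of_nonneg ?_ (fun k _ _ => hF0 k)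
        intro k hk
        rw [mem_image] at hk
        obtain ⟨ℓ, _, rfl⟩ := hk
        rw [mem_range, Nat.lt_succ_iff]
        apply Nat.floor_le_of_le
        have := di_le_half (α * ℓ)
        nlinarith
    _ = N + q * ∑ k ∈ range q, ((k + 1:ℝ))⁻¹ := by
        rw [sum_range_succ', mul_sum, add_comm]
        congr 1
        apply sum_congr rfl; intro k _
        simp only [hF]; rw [if_neg (by omega)]; push_cast; rw [div_eq_mul_inv]
    _ ≤ _ := by
        have := harmonic_le_one_add_log q
        have e : ((harmonic q : ℚ):ℝ) = ∑ k ∈ range q, ((k + 1:ℝ))⁻¹ := by unfold harmonic; push_cast; rfl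
        rw [e] at this
        gcongr

lemma block {α:ℝ} {q:ℕ} (hq : 0 < q) {N:ℝ} (hN : 0 < N) (T : Finset ℕ)
    (hsp : ∀ ℓ ∈ T, ∀ ℓ' ∈ T, ℓ ≠ ℓ' → ∀ z : ℤ, 1 / (2 * (q:ℝ)) ≤ |α * ℓ - α * ℓ' - z|) :
    ∑ ℓ ∈ T, mn N (α * ℓ) ≤ 2 * (N + q * (1 + ln q)) := by
  have key : ∀ x y : ℝ, ⌊2 * q * x⌋₊ = ⌊2 * q * y⌋₊ → 0 ≤ x → 0 ≤ y → |x - y| < 1 / (2 * (q:ℝ)) := by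
    intro x y h hx hy
    have a1 : (⌊2 * q * x⌋₊:ℝ) ≤ 2 * q * x := Nat.floor_le (by positivity)
    have a2 : (⌊2 * q * y⌋₊:ℝ) ≤ 2 * q * y := Nat.floor_le (by positivity)
    have a3 := Nat.lt_floor_add_one (2 * q * x)
    have a4 := Nat.lt_floor_add_one (2 * q * y)
    rw [h] at a1 a3
    rw [lt_div_iff₀ (by positivity), ← abs_of_pos (by positivity : (0:ℝ) < 2 * q), ← abs_mul, abs_lt]
    constructor <;> linarith
  have hp := half_block (α := α) hq hN (T.filter (fun ℓ : ℕ => 0 ≤ α * ℓ - round (α * ℓ))) (by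
    intro ℓ h1 ℓ' h2 h3
    rw [mem_filter] at h1 h2
    by_contra hne
    have := hsp ℓ h1.1 ℓ' h2.1 hne (round (α * ℓ) - round (α * ℓ'))
    have h4 := key _ _ h3 (di_nonneg _) (di_nonneg _)
    unfold di at h4
    rw [abs_of_nonneg h1.2, abs_of_nonneg h2.2] at h4
    push_cast at this
    rw [show α * ℓ - α * ℓ' - (round (α * ℓ) - round (α * ℓ'):ℝ) = α * ℓ - round (α * ℓ) - (α * ℓ' - round (α * ℓ')) by ring] at this
    linarith)
  have hm := half_block (α := α) hq hN (T.filter (fun ℓ : ℕ => ¬ 0 ≤ α * ℓ - round (α * ℓ))) (by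
    intro ℓ h1 ℓ' h2 h3
    rw [mem_filter] at h1 h2
    by_contra hne
    have := hsp ℓ h1.1 ℓ' h2.1 hne (round (α * ℓ) - round (α * ℓ'))
    have h4 := key _ _ h3 (di_nonneg _) (di_nonneg _)
    unfold di at h4
    rw [abs_of_neg (not_le.1 h1.2), abs_of_neg (not_le.1 h2.2)] at h4
    push_cast at this
    rw [show α * ℓ - α * ℓ' - (round (α * ℓ) - round (α * ℓ'):ℝ) = α * ℓ - round (α * ℓ) - (α * ℓ' - round (α * ℓ')) by ring, ← abs_neg] at this
    rw [show -(α * ℓ - round (α * ℓ)) - -(α * ℓ' - round (α * ℓ')) = -(α * ℓ - round (α * ℓ) - (α * ℓ' - round (α * ℓ'))) by ring] at h4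
    linarith)
  rw [← sum_filter_add_sum_filter_not T (fun ℓ : ℕ => 0 ≤ α * ℓ - round (α * ℓ))]
  linarith

/-- `∑_{ℓ<L} min(N, 1/‖αℓ‖)` -/
theorem sum_mn {α:ℝ} {a:ℤ} {q:ℕ} (hq : 0 < q) (hc : IsCoprime a (q:ℤ)) (hα : |α - a / q| ≤ 1 / (q:ℝ) ^ 2)
    {N:ℝ} (hN : 0 < N) (L:ℕ) :
    ∑ ℓ ∈ range L, mn N (α * ℓ) ≤ (2 * L / q + 1) * (2 * (N + q * (1 + ln q))) := by
  set b := (q + 1) / 2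
  have hb0 : 0 < b := by omega
  set K := L / b + 1 with hK
  have hLK : L ≤ K * b := by rw [hK]; have := Nat.div_add_mod L b; have := Nat.mod_lt L hb0; nlinarith
  have h1 : ∀ k, ∑ ℓ ∈ range (k * b), mn N (α * ℓ) ≤ k * (2 * (N + q * (1 + ln q))) := by
    intro k
    induction k with
    | zero => simp
    | succ k ih =>
      rw [Nat.succ_mul, ← sum_range_add_sum_Ico _ (Nat.le_add_right (k * b) b)]
      have := block (α := α) hq hN (Ico (k * b) (k * b + b)) (by
        intro ℓ h1 ℓ' h2 hne z
        rw [mem_Ico] at h1 h2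
        have := spacing hq hc hα (d := (ℓ:ℤ) - ℓ') (by omega) (by
          rw [abs_eq_max_neg]; omega) z
        push_cast at this
        rwa [mul_sub] at this)
      push_cast
      linarith
  have hK' : (K:ℝ) ≤ 2 * L / q + 1 := by
    rw [hK]; push_cast
    have h2 : ((L / b:ℕ):ℝ) ≤ L / b := Nat.cast_div_le
    have h3 : (q:ℝ) / 2 ≤ b := by rw [div_le_iff₀ (by norm_num)]; exact_mod_cast (by omega : q ≤ b * 2)
    have h4 : (L:ℝ) / b ≤ L / (q / 2) := by gcongr
    have h5 : (L:ℝ) / (q / 2) = 2 * L / q := by field_simp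
    linarith
  calc _ ≤ ∑ ℓ ∈ range (K * b), mn N (α * ℓ) :=
        sum_le_sum_of_subset_of_nonneg (range_mono hLK) (fun _ _ _ => mn_nonneg _)
    _ ≤ K * (2 * (N + q * (1 + ln q))) := h1 K
    _ ≤ _ := by gcongr

/-- polynomial-difference predicate -/
def PD : ℕ → ℤ → (ℤ → ℤ) → Prop
  | 0, c, g => ∀ x, g x = c
  | d + 1, c, g => ∀ h : ℤ, PD d ((d + 1) * c * h) (fun x => g (x + h) - g x)

lemma PD_poly : ∀ (d:ℕ) (p : Polynomial ℤ), p.natDegree ≤ d → PD d (p.coeff d) (fun x => p.eval x)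
  | 0, p, hp => fun x => by rw [Polynomial.eq_C_of_natDegree_le_zero hp]; simp
  | d + 1, p, hp => fun h => by
    have hc1 : (Polynomial.taylor h p).coeff (d + 1) = p.coeff (d + 1) := by
      rw [Polynomial.taylor_coeff]
      have h1 := Polynomial.natDegree_hasseDeriv_le p (d + 1)
      rw [Polynomial.eq_C_of_natDegree_le_zero (h1.trans (by omega)), Polynomial.eval_C,
        Polynomial.hasseDeriv_coeff]
      simp
    have hc2 : (Polynomial.taylor h p).coeff d = p.coeff d + (d + 1) * p.coeff (d + 1) * h := by
      rw [Polynomial.taylor_coeff]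
      have h1 := Polynomial.natDegree_hasseDeriv_le p d
      rw [Polynomial.eval_eq_sum_range' (n := 2) (by omega), sum_range_succ, sum_range_one,
        Polynomial.hasseDeriv_coeff, Polynomial.hasseDeriv_coeff]
      have : (1 + d).choose d = d + 1 := by rw [add_comm, Nat.choose_succ_self_right]
      rw [this, add_comm 1 d]; simp
    have key := PD_poly d (Polynomial.taylor h p - p) (by
      rw [Polynomial.natDegree_le_iff_coeff_eq_zero]
      intro n hn
      rcases Nat.lt_or_ge (d + 1) n with h2 | h2
      · rw [Polynomial.coeff_sub, Polynomial.coeff_eq_zero_of_natDegree_lt,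
          Polynomial.coeff_eq_zero_of_natDegree_lt, sub_zero]
        · omega
        · rw [Polynomial.natDegree_taylor]; omega
      · have : n = d + 1 := by omega
        rw [this, Polynomial.coeff_sub, hc1, sub_self])
    rw [Polynomial.coeff_sub, hc2, add_sub_cancel_left] at key
    simpa [Polynomial.taylor_eval] using key

lemma PD_pow (d:ℕ) (c:ℤ) : PD d c (fun x => c * x ^ d) := by
  have := PD_poly d (Polynomial.C c * Polynomial.X ^ d) (Polynomial.natDegree_C_mul_X_pow_le _ _)
  simpa using this

noncomputable def Hx (N:ℕ) : Finset ℤ := Ioo (-(N:ℤ)) N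

lemma card_Hx (N:ℕ) : ((Hx N).card:ℝ) ≤ 2 * N := by
  unfold Hx; rw [Int.card_Ioo]
  have : (↑N - -(N:ℤ) - 1).toNat ≤ 2 * N := by omega
  exact_mod_cast this

lemma diffsq {J : Finset ℤ} {a:ℤ} {N:ℕ} (hJ : J ⊆ Ico a (a + N)) (F : ℤ → ℂ) :
    ((‖∑ x ∈ J, F x‖ ^ 2:ℝ):ℂ) =
      ∑ h ∈ Hx N, ∑ x ∈ J with x + h ∈ J, F (x + h) * (starRingEnd ℂ) (F x) := by
  have e1 : ((‖∑ x ∈ J, F x‖ ^ 2:ℝ):ℂ) = (∑ x ∈ J, F x) * (starRingEnd ℂ) (∑ x ∈ J, F x) := by rw [mul_conj, normSq_eq_norm_sq]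
  rw [e1, map_sum, sum_mul_sum, sum_comm]
  have e2 : ∀ h ∈ Hx N, ∑ x ∈ J with x + h ∈ J, F (x + h) * (starRingEnd ℂ) (F x)
      = ∑ x ∈ J, if x + h ∈ J then F (x + h) * (starRingEnd ℂ) (F x) else 0 := by
    intro h _; rw [sum_filter]
  refine Eq.trans ?_ (sum_congr rfl e2).symm
  rw [sum_comm (s := Hx N)]
  refine sum_congr rfl fun x hx => ?_
  rw [← sum_filter]
  refine sum_nbij' (fun y => y - x) (fun h => x + h) ?_ ?_ ?_ ?_ ?_
  · intro y hy
    have h1 := mem_Ico.1 (hJ hx); have h2 := mem_Ico.1 (hJ hy)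
    simp only [mem_filter, Hx, mem_Ioo]
    exact ⟨⟨by omega, by omega⟩, by simpa using hy⟩
  · intro h hh; exact (mem_filter.1 hh).2
  · intro y _; simp
  · intro h _; simp
  · intro y _; simp

lemma filter_shift_ordConn {J : Finset ℤ} (hc : (J : Set ℤ).OrdConnected) (h:ℤ) :
    ((J.filter (fun x => x + h ∈ J) : Finset ℤ) : Set ℤ).OrdConnected := by
  refine ⟨fun x hx y hy z hz => ?_⟩
  simp only [coe_filter, Set.mem_setOf_eq] at hx hy ⊢
  refine ⟨mem_coe.1 (hc.out (mem_coe.2 hx.1) (mem_coe.2 hy.1) hz), ?_⟩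
  exact mem_coe.1 (hc.out (mem_coe.2 hx.2) (mem_coe.2 hy.2) ⟨by linarith [hz.1], by linarith [hz.2]⟩)

lemma ee_mul_conj (x y:ℝ) : ee x * (starRingEnd ℂ) (ee y) = ee (x - y) := by
  rw [← ee_neg, ← ee_add, sub_eq_add_neg]

/-- iterated box sums -/
noncomputable def bs : List ℕ → (ℤ → ℝ) → ℝ
  | [], F => F 1
  | N :: l, F => ∑ h ∈ Hx N, bs l (fun t => F (h * t))

lemma bs_append (l l' : List ℕ) : ∀ F : ℤ → ℝ, bs (l ++ l') F = bs l (fun s => bs l' (fun t => F (s * t))) := by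
  induction l with
  | nil => intro F; simp [bs]
  | cons N l ih =>
    intro F
    simp only [List.cons_append, bs]
    refine sum_congr rfl fun h _ => ?_
    rw [ih]; simp only [mul_assoc]

lemma bs_nonneg (l : List ℕ) : ∀ {F : ℤ → ℝ}, (∀ t, 0 ≤ F t) → 0 ≤ bs l F := by
  induction l with
  | nil => intro F h; exact h 1
  | cons N l ih => intro F h; exact sum_nonneg fun a _ => ih fun t => h _

lemma bs_smul (l : List ℕ) (c:ℝ) : ∀ F : ℤ → ℝ, bs l (fun t => c * F t) = c * bs l F := by
  induction l with
  | nil => intro F; rfl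
  | cons N l ih => intro F; simp only [bs, ih, mul_sum]

lemma pow_mean {ι : Type*} {s : Finset ι} {f : ι → ℝ} (hf : ∀ i ∈ s, 0 ≤ f i) {B:ℝ} (hB : (s.card:ℝ) ≤ B) {p:ℕ}
    (hp : 0 < p) : (∑ i ∈ s, f i) ^ p ≤ B ^ (p - 1) * ∑ i ∈ s, f i ^ p := by
  obtain ⟨n, rfl⟩ : ∃ n, p = n + 1 := ⟨p - 1, by omega⟩
  refine (pow_sum_le_card_mul_sum_pow hf n).trans ?_
  have : 0 ≤ ∑ i ∈ s, f i ^ (n + 1) := sum_nonneg fun i hi => pow_nonneg (hf i hi) _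
  rw [Nat.add_sub_cancel]
  exact mul_le_mul_of_nonneg_right (pow_le_pow_left₀ (Nat.cast_nonneg _) hB _) this

lemma bs_pow {p:ℕ} (hp : 0 < p) (l : List ℕ) : ∀ {F : ℤ → ℝ}, (∀ t, 0 ≤ F t) →
    bs l F ^ p ≤ (l.map (fun N : ℕ => 2 * (N:ℝ))).prod ^ (p - 1) * bs l (fun t => F t ^ p) := by
  induction l with
  | nil => intro F _; simp [bs]
  | cons N l ih =>
    intro F hF
    simp only [bs, List.map_cons, List.prod_cons]
    refine (pow_mean (fun h _ => bs_nonneg l fun t => hF _) (card_Hx N) hp).trans ?_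
    rw [mul_pow (2 * (N:ℝ)), mul_assoc]
    refine mul_le_mul_of_nonneg_left ?_ (by positivity)
    rw [mul_sum]
    exact sum_le_sum fun h _ => ih fun t => hF _

/-- exponent `2^k - k - 1` -/
def ex : ℕ → ℕ
  | 0 => 0
  | k + 1 => (2 ^ k - 1) + ex k

lemma diff_norm {J : Finset ℤ} {a:ℤ} {N:ℕ} (hJ : J ⊆ Ico a (a + N)) (f : ℤ → ℝ) :
    ‖∑ x ∈ J, ee (f x)‖ ^ 2 ≤ ∑ h ∈ Hx N, ‖∑ x ∈ J with x + h ∈ J, ee (f (x + h) - f x)‖ := by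
  have h1 := diffsq hJ (fun x => ee (f x))
  have h2 := congrArg norm h1
  rw [norm_real, Real.norm_of_nonneg (by positivity)] at h2
  rw [h2]
  refine (norm_sum_le _ _).trans (le_of_eq ?_)
  simp only [ee_mul_conj]

theorem weyl (α:ℝ) {N:ℕ} (hN : 0 < N) (k:ℕ) : ∀ (J : Finset ℤ) (a:ℤ) (g : ℤ → ℤ) (c:ℤ),
    J ⊆ Ico a (a + N) → (J : Set ℤ).OrdConnected → PD (k + 1) c g →
    ‖∑ x ∈ J, ee (α * g x)‖ ^ 2 ^ k ≤ (2 * N:ℝ) ^ ex k *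
      bs (List.replicate k N) (fun t => mn N (α * (((k + 1).factorial * c * t:ℤ):ℝ))) := by
  induction k with
  | zero =>
    intro J a g c hJ hc hg
    simp only [pow_zero, pow_one, ex, one_mul, List.replicate_zero, bs]
    refine (ordConn_linear hJ hN hc _ (fun x => α * g x) ?_).trans (le_of_eq rfl)
    intro x h
    have := hg h x
    simp only [Nat.cast_zero, zero_add, one_mul] at this
    have h2 : g (x + h) = g x + c * h := by linarith
    rw [h2]; push_cast; ring
  | succ k ih =>
    intro J a g c hJ hc hg
    have h1 := diff_norm hJ (fun x => α * g x)
    rw [pow_succ' 2 k, pow_mul]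
    have hp : 0 < 2 ^ k := by positivity
    refine (pow_le_pow_left₀ (by positivity) h1 _).trans ?_
    refine (pow_mean (fun h _ => norm_nonneg _) (card_Hx N) hp).trans ?_
    simp only [ex, pow_add, List.replicate_succ, bs]
    rw [mul_assoc]
    refine mul_le_mul_of_nonneg_left ?_ (by positivity)
    rw [mul_sum]
    refine sum_le_sum fun h _ => ?_
    have h2 := ih (J.filter (fun x => x + h ∈ J)) a (fun x => g (x + h) - g x) _
      ((filter_subset _ _).trans hJ) (filter_shift_ordConn hc h) (hg h)
    have e1 : ∀ x, α * (g (x + h):ℝ) - α * g x = α * ((g (x + h) - g x:ℤ):ℝ) := by intro x; push_cast; ring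
    simp only [e1]
    refine h2.trans (le_of_eq ?_)
    congr 2
    funext t
    congr 2
    rw [Nat.factorial_succ (k + 1)]
    push_cast; ring

lemma sum_rot {ι κ R : Type*} [AddCommMonoid R] (A B : Finset ι) (C : Finset κ) (f : ι → ι → κ → R) :
    ∑ n ∈ A, ∑ n' ∈ B, ∑ h ∈ C, f n n' h = ∑ h ∈ C, ∑ n ∈ A, ∑ n' ∈ B, f n n' h := by
  rw [sum_comm (s := C)]
  exact sum_congr rfl fun n _ => sum_comm

/-- the swapping lemma -/
theorem swap (α:ℝ) {M N:ℕ} (b:ℤ) (W : ℤ → ℝ)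
    (hW : ∀ (l:ℤ) (J : Finset ℤ), J ⊆ Ico b (b + N) → (J : Set ℤ).OrdConnected →
      ‖∑ n ∈ J, ee (α * ((l * n ^ 7:ℤ):ℝ))‖ ^ 2 ≤ W l) (k:ℕ) :
    ∀ (I : Finset ℤ) (a:ℤ) (S : ℤ → Finset ℤ) (g : ℤ → ℤ) (c:ℤ), I ⊆ Ico a (a + M) →
    (∀ m, S m ⊆ Ico b (b + N) ∧ (S m : Set ℤ).OrdConnected) → PD (k + 1) c g →
    ∑ n ∈ Ico b (b + N), ∑ n' ∈ Ico b (b + N),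
      ‖∑ m ∈ I with n ∈ S m ∧ n' ∈ S m, ee (α * ((g m * (n ^ 7 - n' ^ 7):ℤ):ℝ))‖ ^ 2 ^ (k + 1) ≤
    (2 * M:ℝ) ^ ex (k + 1) * (M * bs (List.replicate (k + 1) M) (fun t => W ((k + 1).factorial * c * t))) := by
  induction k with
  | zero =>
    intro I a S g c hI hS hg
    simp only [zero_add, pow_one, ex, pow_zero, Nat.sub_self, one_mul, List.replicate_succ, List.replicate_zero, bs, mul_one,
      Nat.factorial_one, Nat.cast_one, add_zero]
    have hg' : ∀ h x, g (x + h) - g x = c * h := by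
      intro h x
      have := hg h x
      simpa using this
    have key : ((∑ n ∈ Ico b (b + N), ∑ n' ∈ Ico b (b + N),
      ‖∑ m ∈ I with n ∈ S m ∧ n' ∈ S m, ee (α * ((g m * (n ^ 7 - n' ^ 7):ℤ):ℝ))‖ ^ 2:ℝ):ℂ) =
      ((∑ h ∈ Hx M, ∑ m ∈ I with m + h ∈ I, ‖∑ n ∈ S m ∩ S (m + h), ee (α * ((c * h * n ^ 7:ℤ):ℝ))‖ ^ 2:ℝ):ℂ) := by
      have e1 : ∀ n n' : ℤ, ((‖∑ m ∈ I with n ∈ S m ∧ n' ∈ S m, ee (α * ((g m * (n ^ 7 - n' ^ 7):ℤ):ℝ))‖ ^ 2:ℝ):ℂ)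
          = ∑ h ∈ Hx M, ∑ m ∈ I with m + h ∈ I, if (n ∈ S m ∩ S (m + h)) then (if (n' ∈ S m ∩ S (m + h)) then
            ee (α * ((c * h * n ^ 7:ℤ):ℝ)) * (starRingEnd ℂ) (ee (α * ((c * h * n' ^ 7:ℤ):ℝ))) else 0) else 0 := by
        intro n n'
        rw [diffsq ((filter_subset _ _).trans hI)]
        refine sum_congr rfl fun h _ => ?_
        simp only [← ite_and]
        rw [← sum_filter, filter_filter, filter_filter]
        refine sum_congr ?_ ?_
        · ext m; simp only [mem_filter, mem_inter]; tauto
        · intro m _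
          rw [ee_mul_conj, ee_mul_conj]
          congr 1
          have := hg' h m
          have h3 : g (m + h) = g m + c * h := by linarith
          rw [h3]; push_cast; ring
      simp only [ofReal_sum]
      simp only [e1]
      calc _ = ∑ h ∈ Hx M, ∑ m ∈ I with m + h ∈ I, ∑ n ∈ Ico b (b + N), ∑ n' ∈ Ico b (b + N),
            (if (n ∈ S m ∩ S (m + h)) then (if (n' ∈ S m ∩ S (m + h)) then
            ee (α * ((c * h * n ^ 7:ℤ):ℝ)) * (starRingEnd ℂ) (ee (α * ((c * h * n' ^ 7:ℤ):ℝ))) else 0) else 0) := by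
            rw [sum_rot]
            exact sum_congr rfl fun h _ => sum_rot _ _ _ _
        _ = _ := by
          refine sum_congr rfl fun h _ => sum_congr rfl fun m _ => ?_
          have hsub : S m ∩ S (m + h) ⊆ Ico b (b + N) := inter_subset_left.trans (hS m).1
          have e2 : ((‖∑ n ∈ S m ∩ S (m + h), ee (α * ((c * h * n ^ 7:ℤ):ℝ))‖ ^ 2:ℝ):ℂ) =
            (∑ n ∈ S m ∩ S (m + h), ee (α * ((c * h * n ^ 7:ℤ):ℝ))) *
            (starRingEnd ℂ) (∑ n ∈ S m ∩ S (m + h), ee (α * ((c * h * n ^ 7:ℤ):ℝ))) := by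
            rw [mul_conj, normSq_eq_norm_sq]
          rw [e2, map_sum, sum_mul_sum]
          have e3 : ∀ f : ℤ → ℂ, ∑ n ∈ Ico b (b + N), (if n ∈ S m ∩ S (m + h) then f n else 0) = ∑ n ∈ S m ∩ S (m + h), f n := by
            intro f
            rw [← sum_filter]
            congr 1
            ext x; simp only [mem_filter]
            exact ⟨fun h => h.2, fun h => ⟨hsub h, h⟩⟩
          rw [← e3]
          refine sum_congr rfl fun n _ => ?_
          split_ifs
          · rw [← e3]
          · simp
    have key2 := ofReal_injective key
    rw [key2, mul_sum]
    refine sum_le_sum fun h _ => ?_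
    have hcard : ((I.filter (fun m => m + h ∈ I)).card:ℝ) ≤ M := by
      have := card_le_card ((filter_subset (fun m => m + h ∈ I) I).trans hI)
      rw [Int.card_Ico] at this
      have h2 : (I.filter (fun m => m + h ∈ I)).card ≤ M := by omega
      exact_mod_cast h2
    calc _ ≤ ∑ m ∈ I with m + h ∈ I, W (c * h) := by
          refine sum_le_sum fun m _ => hW _ _ (inter_subset_left.trans (hS m).1) ?_
          rw [coe_inter]
          exact (hS m).2.inter (hS (m + h)).2
      _ ≤ _ := by
        rw [sum_const, nsmul_eq_mul]
        refine mul_le_mul_of_nonneg_right hcard ?_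
        exact le_trans (by positivity) (hW (c * h) ∅ (by simp) (by simp [Set.ordConnected_empty]))
  | succ k ih =>
    intro I a S g c hI hS hg
    have hp : 0 < 2 ^ (k + 1) := by positivity
    have step : ∀ n n' : ℤ, ‖∑ m ∈ I with n ∈ S m ∧ n' ∈ S m, ee (α * ((g m * (n ^ 7 - n' ^ 7):ℤ):ℝ))‖ ^ 2 ^ (k + 1 + 1)
        ≤ (2 * M:ℝ) ^ (2 ^ (k + 1) - 1) * ∑ h ∈ Hx M, ‖∑ m ∈ I.filter (fun m => m + h ∈ I) with n ∈ S m ∩ S (m + h) ∧ n' ∈ S m ∩ S (m + h),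
          ee (α * (((g (m + h) - g m) * (n ^ 7 - n' ^ 7):ℤ):ℝ))‖ ^ 2 ^ (k + 1) := by
      intro n n'
      rw [pow_succ' 2 (k + 1), pow_mul]
      have h1 := diff_norm ((filter_subset (fun m => n ∈ S m ∧ n' ∈ S m) I).trans hI) (fun m => α * ((g m * (n ^ 7 - n' ^ 7):ℤ):ℝ))
      refine (pow_le_pow_left₀ (by positivity) h1 _).trans ?_
      refine (pow_mean (fun h _ => norm_nonneg _) (card_Hx M) hp).trans (le_of_eq ?_)
      congr 1
      refine sum_congr rfl fun h _ => ?_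
      congr 2
      rw [filter_filter, filter_filter]
      refine sum_congr ?_ ?_
      · ext m; simp only [mem_filter, mem_inter]; tauto
      · intro m _; congr 1; push_cast; ring
    refine (sum_le_sum fun n _ => sum_le_sum fun n' _ => step n n').trans ?_
    simp only [← mul_sum]
    rw [sum_rot, ex, pow_add _ (2 ^ (k + 1) - 1) (ex (k + 1)), mul_assoc, List.replicate_succ (n := k + 1), bs]
    refine mul_le_mul_of_nonneg_left ?_ (by positivity)
    rw [mul_sum, mul_sum]
    refine sum_le_sum fun h _ => ?_
    have h1 := ih (I.filter (fun m => m + h ∈ I)) a (fun m => S m ∩ S (m + h)) (fun m => g (m + h) - g m)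
      (((k + 1:ℕ) + 1) * c * h)
      ((filter_subset _ _).trans hI) (fun m => ⟨inter_subset_left.trans (hS m).1, by
        rw [coe_inter]; exact (hS m).2.inter (hS (m + h)).2⟩) (hg h)
    refine h1.trans (le_of_eq ?_)
    congr 3
    funext t
    congr 1
    rw [Nat.factorial_succ (k + 1)]
    push_cast; ring

noncomputable def tau (n:ℕ) : ℝ := (n.divisors.card:ℝ)

lemma tau_nonneg (n:ℕ) : 0 ≤ tau n := Nat.cast_nonneg _

lemma tau_le_of_dvd {t s:ℕ} (h : t ∣ s) (hs : s ≠ 0) : tau t ≤ tau s := by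
  unfold tau; exact_mod_cast card_le_card (Nat.divisors_subset_of_dvd hs h)

lemma one_le_tau {n:ℕ} (h : n ≠ 0) : 1 ≤ tau n := by
  unfold tau; exact_mod_cast card_pos.2 ⟨1, Nat.one_mem_divisors.2 h⟩

lemma tau_mul_le (a b:ℕ) : tau (a * b) ≤ tau a * tau b := by
  unfold tau
  rw [Nat.divisors_mul]
  exact_mod_cast card_mul_le

lemma divsum {R : Type*} [AddCommMonoid R] (L:ℕ) (f : ℕ → ℕ → R) :
    ∑ l ∈ Icc 1 L, ∑ x ∈ l.divisorsAntidiagonal, f x.1 x.2 = ∑ a ∈ Icc 1 L, ∑ b ∈ Icc 1 (L / a), f a b := by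
  rw [sum_sigma', sum_sigma']
  refine sum_nbij' (fun x => ⟨x.2.1, x.2.2⟩) (fun x => ⟨x.1 * x.2, (x.1, x.2)⟩) ?_ ?_ ?_ ?_ ?_
  · rintro ⟨l, a, b⟩ h
    simp only [mem_sigma, mem_Icc, Nat.mem_divisorsAntidiagonal] at h ⊢
    obtain ⟨⟨h1, h2⟩, h3, h4⟩ := h
    have ha : 0 < a := by rcases Nat.eq_zero_or_pos a with h | h; (· subst h; simp at h3; omega); exact h
    have hb : 0 < b := by rcases Nat.eq_zero_or_pos b with h | h; (· subst h; simp at h3; omega); exact h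
    refine ⟨⟨ha, ?_⟩, hb, ?_⟩
    · exact (Nat.le_mul_of_pos_right a hb).trans (h3 ▸ h2)
    · rw [Nat.le_div_iff_mul_le ha, mul_comm]; exact h3 ▸ h2
  · rintro ⟨a, b⟩ h
    simp only [mem_sigma, mem_Icc, Nat.mem_divisorsAntidiagonal] at h ⊢
    obtain ⟨⟨h1, h2⟩, h3, h4⟩ := h
    rw [Nat.le_div_iff_mul_le h1, mul_comm] at h4
    have : 0 < a * b := Nat.mul_pos h1 h3
    exact ⟨⟨this, h4⟩, trivial, this.ne'⟩
  · rintro ⟨l, a, b⟩ h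
    simp only [mem_sigma, Nat.mem_divisorsAntidiagonal] at h
    obtain ⟨_, rfl, _⟩ := h
    rfl
  · rintro ⟨a, b⟩ _; rfl
  · rintro ⟨l, a, b⟩ _; rfl

lemma sum_tau_mul (L:ℕ) (g : ℕ → ℝ) :
    ∑ l ∈ Icc 1 L, tau l * g l = ∑ a ∈ Icc 1 L, ∑ b ∈ Icc 1 (L / a), g (a * b) := by
  rw [← divsum L (fun a b => g (a * b))]
  refine sum_congr rfl fun l _ => ?_
  have e : ∀ x ∈ l.divisorsAntidiagonal, g (x.1 * x.2) = g l := by intro x hx; rw [(Nat.mem_divisorsAntidiagonal.1 hx).1]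
  rw [sum_congr rfl e, sum_const, nsmul_eq_mul, tau]
  congr 2
  rw [← Nat.map_div_right_divisors, card_map]

lemma sum_inv_le (L:ℕ) : ∑ d ∈ Icc 1 L, (1:ℝ) / d ≤ 1 + ln L := by
  have := harmonic_le_one_add_log L
  rw [harmonic_eq_sum_Icc] at this
  push_cast at this
  simpa [one_div] using this

lemma sum_tau_div (K L:ℕ) : ∑ d ∈ Icc 1 L, tau d ^ K / d ≤ (1 + ln L) ^ 2 ^ K := by
  induction K with
  | zero => simpa using sum_inv_le L
  | succ K ih =>
    have h0 : ∀ d : ℕ, 0 ≤ tau d ^ K / d := fun d => div_nonneg (pow_nonneg (tau_nonneg d) _) (Nat.cast_nonneg _)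
    calc ∑ d ∈ Icc 1 L, tau d ^ (K + 1) / d = ∑ d ∈ Icc 1 L, tau d * (tau d ^ K / d) :=
          sum_congr rfl fun d _ => by ring
      _ = ∑ a ∈ Icc 1 L, ∑ b ∈ Icc 1 (L / a), (tau (a * b) ^ K / ((a * b:ℕ):ℝ)) := sum_tau_mul L _
      _ ≤ ∑ a ∈ Icc 1 L, ∑ b ∈ Icc 1 L, (tau a ^ K / a) * (tau b ^ K / b) := by
          refine sum_le_sum fun a ha => ?_
          refine (sum_le_sum_of_subset_of_nonneg (Icc_subset_Icc_right (Nat.div_le_self L a))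
            fun b _ _ => h0 (a * b)).trans (sum_le_sum fun b hb => ?_)
          rw [div_mul_div_comm, ← mul_pow, Nat.cast_mul]
          gcongr
          exacts [tau_nonneg _, tau_mul_le a b]
      _ = (∑ d ∈ Icc 1 L, tau d ^ K / d) ^ 2 := by rw [sq, sum_mul_sum]
      _ ≤ _ := by
        rw [pow_succ 2 K, pow_mul]
        exact pow_le_pow_left₀ (sum_nonneg fun d _ => h0 d) ih 2

lemma sum_tau_pow (K L:ℕ) : ∑ d ∈ Icc 1 L, tau d ^ K ≤ L * (1 + ln L) ^ 2 ^ K := by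
  induction K generalizing L with
  | zero =>
    rcases Nat.eq_zero_or_pos L with rfl | hL
    · simp
    have : 0 ≤ ln L := Real.log_natCast_nonneg L
    simp only [pow_zero, sum_const, Nat.card_Icc, Nat.add_sub_cancel, nsmul_eq_mul, mul_one, pow_one]
    nlinarith
  | succ K ih =>
    calc ∑ d ∈ Icc 1 L, tau d ^ (K + 1) = ∑ d ∈ Icc 1 L, tau d * (tau d ^ K) :=
          sum_congr rfl fun d _ => by ring
      _ = ∑ a ∈ Icc 1 L, ∑ b ∈ Icc 1 (L / a), (tau (a * b) ^ K) := sum_tau_mul L _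
      _ ≤ ∑ a ∈ Icc 1 L, tau a ^ K / a * (L * (1 + ln L) ^ 2 ^ K) := by
          refine sum_le_sum fun a ha => ?_
          have hak : 0 ≤ tau a ^ K := pow_nonneg (tau_nonneg _) _
          calc _ ≤ ∑ b ∈ Icc 1 (L / a), tau a ^ K * tau b ^ K := by
                refine sum_le_sum fun b _ => ?_
                rw [← mul_pow]
                exact pow_le_pow_left₀ (tau_nonneg _) (tau_mul_le a b) _
            _ = tau a ^ K * ∑ b ∈ Icc 1 (L / a), tau b ^ K := by rw [mul_sum]
            _ ≤ tau a ^ K * ((L / a:ℝ) * (1 + ln L) ^ 2 ^ K) := by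
              refine mul_le_mul_of_nonneg_left ((ih (L / a)).trans ?_) hak
              rcases Nat.eq_zero_or_pos (L / a) with h | h
              · rw [h]; simp; positivity
              have h2 : ((L / a:ℕ):ℝ) ≤ L / a := Nat.cast_div_le
              have h3 : ((L / a:ℕ):ℝ) ≤ L := by exact_mod_cast Nat.div_le_self L a
              gcongr
            _ = _ := by ring
      _ = (∑ a ∈ Icc 1 L, tau a ^ K / a) * (L * (1 + ln L) ^ 2 ^ K) := by rw [sum_mul]
      _ ≤ (1 + ln L) ^ 2 ^ K * (L * (1 + ln L) ^ 2 ^ K) := by refine mul_le_mul_of_nonneg_right (sum_tau_div K L) (by positivity)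
      _ = _ := by rw [pow_succ 2 K, mul_two, pow_add]; ring

lemma mult_le (N P j:ℕ) {F : ℕ → ℝ} (hF : ∀ t, 0 ≤ F t) :
    ∑ h ∈ Icc 1 N, ∑ t ∈ Icc 1 P, tau t ^ j * F (h * t) ≤ ∑ s ∈ Icc 1 (N * P), tau s ^ (j + 1) * F s := by
  rcases Nat.eq_zero_or_pos P with rfl | hP
  · simp
  have e : ∑ s ∈ Icc 1 (N * P), tau s ^ (j + 1) * F s = ∑ s ∈ Icc 1 (N * P), tau s * (tau s ^ j * F s) :=
    sum_congr rfl fun s _ => by ring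
  rw [e, sum_tau_mul]
  have h0 : ∀ s, 0 ≤ tau s ^ j * F s := fun s => mul_nonneg (pow_nonneg (tau_nonneg _) _) (hF s)
  refine le_trans ?_ (sum_le_sum_of_subset_of_nonneg (Icc_subset_Icc_right (Nat.le_mul_of_pos_right N hP))
    fun a _ _ => sum_nonneg fun b _ => h0 _)
  refine sum_le_sum fun a ha => ?_
  obtain ⟨ha1, ha2⟩ := mem_Icc.1 ha
  refine le_trans ?_ (sum_le_sum_of_subset_of_nonneg (Icc_subset_Icc_right (b₁ := P) ?_) fun b _ _ => h0 _)
  · refine sum_le_sum fun b hb => ?_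
    have hb1 := (mem_Icc.1 hb).1
    refine mul_le_mul_of_nonneg_right (pow_le_pow_left₀ (tau_nonneg _) (tau_le_of_dvd (Dvd.intro_left a rfl) (Nat.mul_pos ha1 hb1).ne') _) (hF _)
  · rw [Nat.le_div_iff_mul_le ha1, mul_comm]; exact Nat.mul_le_mul_right _ ha2

lemma sum_Hx_le (N:ℕ) {A : ℤ → ℝ} (h0 : ∀ t, 0 ≤ A t) (he : ∀ t, A (-t) = A t) :
    ∑ h ∈ Hx N, A h ≤ A 0 + 2 * ∑ n ∈ Icc 1 N, A (n:ℤ) := by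
  have key : ∑ h ∈ Hx (N + 1), A h ≤ A 0 + 2 * ∑ n ∈ Icc 1 N, A (n:ℤ) := by
    induction N with
    | zero =>
      have e : Hx (0 + 1) = {0} := by ext x; simp only [Hx, mem_Ioo, mem_singleton]; push_cast; omega
      rw [e]; simp
    | succ N ih =>
      have hs : Hx (N + 1 + 1) ⊆ insert ((N + 1:ℕ):ℤ) (insert (-((N + 1:ℕ):ℤ)) (Hx (N + 1))) := by
        intro x hx
        simp only [Hx, mem_Ioo, mem_insert] at hx ⊢
        push_cast at hx ⊢; omega
      have h1 := sum_le_sum_of_subset_of_nonneg (f := A) hs (fun i _ _ => h0 i)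
      rw [sum_insert (by simp only [Hx, mem_insert, mem_Ioo]; push_cast; omega), sum_insert (by simp only [Hx, mem_Ioo]; push_cast; omega), he] at h1
      have h3 : ∑ n ∈ Icc 1 (N + 1), A (n:ℤ) = ∑ n ∈ Icc 1 N, A (n:ℤ) + A ((N + 1:ℕ):ℤ) := sum_Icc_succ_top (by omega) _
      rw [h3]; linarith
  refine (sum_le_sum_of_subset_of_nonneg ?_ fun i _ _ => h0 i).trans key
  intro x hx
  simp only [Hx, mem_Ioo] at hx ⊢
  push_cast; omega

lemma bs_le_const {T:ℝ} (hT : 0 ≤ T) (l : List ℕ) : ∀ {F : ℤ → ℝ}, (∀ t, F t ≤ T) →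
    bs l F ≤ (l.map (fun N : ℕ => 2 * (N:ℝ))).prod * T := by
  induction l with
  | nil => intro F h; simpa [bs] using h 1
  | cons N l ih =>
    intro F h
    have hp : 0 ≤ (l.map (fun N : ℕ => 2 * (N:ℝ))).prod :=
      List.prod_nonneg (by intro a ha; obtain ⟨n, _, rfl⟩ := List.mem_map.1 ha; positivity)
    simp only [bs, List.map_cons, List.prod_cons]
    calc _ ≤ ∑ h ∈ Hx N, (l.map (fun N : ℕ => 2 * (N:ℝ))).prod * T := sum_le_sum fun a _ => ih fun t => h _
      _ ≤ _ := by
        rw [sum_const, nsmul_eq_mul, mul_assoc]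
        exact mul_le_mul_of_nonneg_right (card_Hx N) (by positivity)

lemma bs_bound {K T:ℝ} (hK : 0 < K) (hT : 0 ≤ T) (l : List ℕ) : (∀ N ∈ l, K ≤ (N:ℝ)) → ∀ {F : ℤ → ℝ},
    (∀ t, 0 ≤ F t) → (∀ t, F (-t) = F t) → (∀ t, F t ≤ T) →
    bs l F ≤ l.length * ((l.map (fun N : ℕ => 2 * (N:ℝ))).prod / K) * T +
      2 ^ l.length * ∑ t ∈ Icc 1 l.prod, tau t ^ l.length * F (t:ℤ) := by
  induction l with
  | nil => intro _ F h0 _ _; simp [bs]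
  | cons N l ih =>
    intro hl F h0 he hFT
    have hp : 0 ≤ (l.map (fun N : ℕ => 2 * (N:ℝ))).prod :=
      List.prod_nonneg (by intro a ha; obtain ⟨n, _, rfl⟩ := List.mem_map.1 ha; positivity)
    have hNK : K ≤ N := hl N (by simp)
    simp only [bs, List.map_cons, List.prod_cons, List.length_cons]
    generalize hPr : (l.map (fun N : ℕ => 2 * (N:ℝ))).prod = Pr at *
    have h1 := sum_Hx_le N (A := fun h => bs l (fun t => F (h * t))) (fun h => bs_nonneg l fun t => h0 _)
      (fun h => by simp only [neg_mul, he])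
    beta_reduce at h1
    have h2 : bs l (fun t => F (0 * t)) ≤ Pr * T := hPr ▸ bs_le_const hT l fun t => hFT _
    have h3 : ∑ n ∈ Icc 1 N, bs l (fun t => F ((n:ℤ) * t)) ≤ ∑ n ∈ Icc 1 N, (l.length * (Pr / K) * T +
      2 ^ l.length * ∑ t ∈ Icc 1 l.prod, tau t ^ l.length * F ((n:ℤ) * (t:ℤ))) := by
      refine sum_le_sum fun n _ => ih (fun N hN => hl N (by simp [hN])) (fun t => h0 _) (fun t => by rw [mul_neg, he]) (fun t => hFT _)
    have h4 := mult_le N l.prod l.length (F := fun t => F (t:ℤ)) (fun t => h0 _)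
    rw [sum_add_distrib, sum_const, nsmul_eq_mul, Nat.card_Icc, Nat.add_sub_cancel, ← mul_sum] at h3
    simp only [Nat.cast_mul] at h4
    have h5 := mul_le_mul_of_nonneg_left h4 (show (0:ℝ) ≤ 2 * 2 ^ l.length by positivity)
    have h6 : Pr * T ≤ (2 * N * Pr / K) * T := by
      refine mul_le_mul_of_nonneg_right ?_ hT
      rw [le_div_iff₀ hK]
      have := mul_le_mul_of_nonneg_left hNK hp
      have h7 : 0 ≤ Pr * N := by positivity
      linarith
    have e1 : ((l.length + 1:ℕ):ℝ) * (2 * N * Pr / K) * T = 2 * (N * (l.length * (Pr / K) * T)) + (2 * N * Pr / K) * T := by push_cast; ring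
    rw [e1, pow_succ' 2 l.length]
    rw [mul_assoc] at h5
    linarith

lemma di_neg (x:ℝ) : di (-x) = di x := by
  unfold di
  apply le_antisymm
  · have := round_le (-x) (-round x)
    refine this.trans (le_of_eq ?_)
    rw [← abs_neg]; push_cast; congr 1; ring
  · have := round_le x (-round (-x))
    refine this.trans (le_of_eq ?_)
    rw [← abs_neg]; push_cast; congr 1; ring

lemma mn_neg (N x:ℝ) : mn N (-x) = mn N x := by unfold mn; rw [di_neg]

lemma scale_le (c L J:ℕ) (hc : 0 < c) {F : ℕ → ℝ} (hF : ∀ t, 0 ≤ F t) :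
    ∑ t ∈ Icc 1 L, tau t ^ J * F (c * t) ≤ ∑ s ∈ Icc 1 (c * L), tau s ^ J * F s := by
  have h1 : ∑ t ∈ Icc 1 L, tau t ^ J * F (c * t) ≤ ∑ s ∈ (Icc 1 L).image (fun t => c * t), tau s ^ J * F s := by
    rw [sum_image (fun i _ j _ hij => Nat.eq_of_mul_eq_mul_left hc hij)]
    refine sum_le_sum fun t ht => mul_le_mul_of_nonneg_right (pow_le_pow_left₀ (tau_nonneg _) ?_ _) (hF _)
    exact tau_le_of_dvd (Dvd.intro_left c rfl) (Nat.mul_pos hc (mem_Icc.1 ht).1).ne'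
  refine h1.trans (sum_le_sum_of_subset_of_nonneg ?_ fun s _ _ => mul_nonneg (pow_nonneg (tau_nonneg _) _) (hF s))
  intro s hs
  obtain ⟨t, ht, rfl⟩ := mem_image.1 hs
  rw [mem_Icc] at ht ⊢
  exact ⟨Nat.mul_pos hc ht.1, Nat.mul_le_mul_left c ht.2⟩

lemma main_sum {α:ℝ} {a:ℤ} {q:ℕ} (hq : 0 < q) (hc : IsCoprime a (q:ℤ)) (hα : |α - a / q| ≤ 1 / (q:ℝ) ^ 2)
    {N:ℕ} (hN : 0 < N) (L J:ℕ) :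
    (∑ t ∈ Icc 1 L, tau t ^ J * mn N (α * (t:ℤ))) ^ 2 ≤
      (L * (1 + ln L) ^ 2 ^ (2 * J)) * (N * ((2 * (L + 1) / q + 1) * (2 * (N + q * (1 + ln q))))) := by
  have hN' : (0:ℝ) < N := by exact_mod_cast hN
  refine (sum_mul_sq_le_sq_mul_sq _ _ _).trans ?_
  have h1 : ∑ t ∈ Icc 1 L, (tau t ^ J) ^ 2 ≤ L * (1 + ln L) ^ 2 ^ (2 * J) := by
    have := sum_tau_pow (2 * J) L
    simpa only [← pow_mul, mul_comm J 2] using this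
  have h2 : ∑ t ∈ Icc 1 L, mn N (α * (t:ℤ)) ^ 2 ≤ N * ((2 * (L + 1) / q + 1) * (2 * (N + q * (1 + ln q)))) := by
    have h3 := sum_mn hq hc hα hN' (L + 1)
    have h4 : ∑ t ∈ Icc 1 L, mn N (α * (t:ℤ)) ≤ ∑ l ∈ range (L + 1), mn N (α * l) := by
      refine (le_of_eq ?_).trans (sum_le_sum_of_subset_of_nonneg (s := Icc 1 L) ?_ fun i _ _ => mn_nonneg _)
      · simp
      · intro x hx; rw [mem_Icc] at hx; rw [mem_range]; omega
    push_cast at h3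
    calc _ ≤ ∑ t ∈ Icc 1 L, N * mn N (α * (t:ℤ)) := sum_le_sum fun t _ => by
          rw [sq]; exact mul_le_mul_of_nonneg_right (mn_le hN' _) (mn_nonneg _)
      _ ≤ _ := by
        rw [← mul_sum]
        exact mul_le_mul_of_nonneg_left (h4.trans h3) hN'.le
  exact mul_le_mul h1 h2 (sum_nonneg fun _ _ => sq_nonneg _) ((sum_nonneg fun _ _ => sq_nonneg _).trans h1)

lemma bilin {α:ℝ} {N:ℕ} {b:ℤ} (I : Finset ℤ) (S : ℤ → Finset ℤ) (hS : ∀ m, S m ⊆ Ico b (b + N))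
    (c d : ℤ → ℂ) {X:ℝ} (hX : (∑ m ∈ I, ‖c m‖ ^ 2) * (∑ n ∈ Ico b (b + N), ‖d n‖ ^ 2) ≤ X) :
    ‖∑ m ∈ I, c m * ∑ n ∈ S m, d n * ee (α * ((m ^ 7 * n ^ 7:ℤ):ℝ))‖ ^ 4 ≤
      X ^ 2 * ∑ n ∈ Ico b (b + N), ∑ n' ∈ Ico b (b + N),
      ‖∑ m ∈ I with n ∈ S m ∧ n' ∈ S m, ee (α * ((m ^ 7 * (n ^ 7 - n' ^ 7):ℤ):ℝ))‖ ^ 2 := by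
  set G : ℤ → ℂ := fun m => ∑ n ∈ S m, d n * ee (α * ((m ^ 7 * n ^ 7:ℤ):ℝ)) with hG
  set R := Ico b (b + (N:ℤ))
  set Z : ℤ → ℤ → ℂ := fun n n' => ∑ m ∈ I with n ∈ S m ∧ n' ∈ S m, ee (α * ((m ^ 7 * (n ^ 7 - n' ^ 7):ℤ):ℝ)) with hZ
  have h1 : ‖∑ m ∈ I, c m * G m‖ ^ 2 ≤ (∑ m ∈ I, ‖c m‖ ^ 2) * ∑ m ∈ I, ‖G m‖ ^ 2 := by
    refine le_trans ?_ (sum_mul_sq_le_sq_mul_sq I (fun m => ‖c m‖) (fun m => ‖G m‖))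
    refine pow_le_pow_left₀ (norm_nonneg _) ((norm_sum_le _ _).trans (le_of_eq ?_)) 2
    simp only [norm_mul]
  have h2 : ((∑ m ∈ I, ‖G m‖ ^ 2:ℝ):ℂ) = ∑ n ∈ R, ∑ n' ∈ R, d n * (starRingEnd ℂ) (d n') * Z n n' := by
    have e3 : ∀ (m:ℤ) (f : ℤ → ℂ), ∑ n ∈ S m, f n = ∑ n ∈ R, (if n ∈ S m then f n else 0) := by
      intro m f
      rw [← sum_filter]
      congr 1
      ext x; simp only [mem_filter]
      exact ⟨fun h => ⟨hS m h, h⟩, fun h => h.2⟩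
    have e4 : ∀ n n', d n * (starRingEnd ℂ) (d n') * Z n n' = ∑ m ∈ I, (if n ∈ S m then (if n' ∈ S m then
        (d n * ee (α * ((m ^ 7 * n ^ 7:ℤ):ℝ))) * (starRingEnd ℂ) (d n' * ee (α * ((m ^ 7 * n' ^ 7:ℤ):ℝ))) else 0) else 0) := by
      intro n n'
      simp only [hZ, ← ite_and]
      rw [mul_sum, ← sum_filter]
      refine sum_congr rfl fun m _ => ?_
      rw [map_mul, mul_mul_mul_comm, ee_mul_conj]
      congr 2
      push_cast; ring
    simp only [e4]
    rw [sum_rot, ofReal_sum]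
    refine sum_congr rfl fun m _ => ?_
    have e5 : ((‖G m‖ ^ 2:ℝ):ℂ) = G m * (starRingEnd ℂ) (G m) := by rw [mul_conj, normSq_eq_norm_sq]
    rw [e5, hG]
    simp only
    rw [map_sum, sum_mul_sum, e3]
    refine sum_congr rfl fun n _ => ?_
    split_ifs
    · rw [e3]
    · simp
  have h3 : (∑ m ∈ I, ‖G m‖ ^ 2) ^ 2 ≤ (∑ n ∈ R, ‖d n‖ ^ 2) ^ 2 * ∑ n ∈ R, ∑ n' ∈ R, ‖Z n n'‖ ^ 2 := by
    have h4 : ∑ m ∈ I, ‖G m‖ ^ 2 ≤ ∑ x ∈ R ×ˢ R, (‖d x.1‖ * ‖d x.2‖) * ‖Z x.1 x.2‖ := by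
      have := congrArg norm h2
      rw [norm_real, Real.norm_of_nonneg (sum_nonneg fun _ _ => by positivity)] at this
      rw [this, ← sum_product']
      refine (norm_sum_le _ _).trans (le_of_eq ?_)
      refine sum_congr rfl fun x _ => ?_
      rw [norm_mul, norm_mul, RCLike.norm_conj]
    refine (pow_le_pow_left₀ (sum_nonneg fun _ _ => by positivity) h4 2).trans ?_
    refine (sum_mul_sq_le_sq_mul_sq _ _ _).trans (le_of_eq ?_)
    rw [sum_product' R R (fun n n' => ‖Z n n'‖ ^ 2)]
    congr 1
    rw [sq (∑ n ∈ R, ‖d n‖ ^ 2), sum_mul_sum, ← sum_product']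
    refine sum_congr rfl fun x _ => ?_
    rw [mul_pow]
  have hE : 0 ≤ ∑ n ∈ R, ∑ n' ∈ R, ‖Z n n'‖ ^ 2 := sum_nonneg fun _ _ => sum_nonneg fun _ _ => by positivity
  calc _ = (‖∑ m ∈ I, c m * G m‖ ^ 2) ^ 2 := by ring
    _ ≤ ((∑ m ∈ I, ‖c m‖ ^ 2) * ∑ m ∈ I, ‖G m‖ ^ 2) ^ 2 := pow_le_pow_left₀ (by positivity) h1 2
    _ = (∑ m ∈ I, ‖c m‖ ^ 2) ^ 2 * (∑ m ∈ I, ‖G m‖ ^ 2) ^ 2 := by ring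
    _ ≤ (∑ m ∈ I, ‖c m‖ ^ 2) ^ 2 * ((∑ n ∈ R, ‖d n‖ ^ 2) ^ 2 * ∑ n ∈ R, ∑ n' ∈ R, ‖Z n n'‖ ^ 2) :=
        mul_le_mul_of_nonneg_left h3 (sq_nonneg _)
    _ = ((∑ m ∈ I, ‖c m‖ ^ 2) * (∑ n ∈ R, ‖d n‖ ^ 2)) ^ 2 * ∑ n ∈ R, ∑ n' ∈ R, ‖Z n n'‖ ^ 2 := by ring
    _ ≤ _ := mul_le_mul_of_nonneg_right (pow_le_pow_left₀ (by positivity) hX 2) hE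

lemma chain_alg {T X E2 E W1 Sg:ℝ} {p p' r r' e f:ℕ} (hT : 0 ≤ T) (hX : 0 ≤ X) (hE2 : 0 ≤ E2)
    (hW : 0 ≤ W1) {m n:ℕ} (h1 : T ^ 4 ≤ X ^ 2 * E2) (h2 : E2 ^ p ≤ ((n:ℝ) ^ 2) ^ p' * E)
    (h3 : E ≤ (2 * (m:ℝ)) ^ e * (m * W1)) (h5 : W1 ^ r ≤ ((2 * (m:ℝ)) ^ 7) ^ r' * ((2 * (n:ℝ)) ^ f * Sg)) :
    T ^ (4 * (p * r)) ≤ X ^ (2 * (p * r)) * n ^ (2 * p' * r) * ((2 * m) ^ (e * r + 7 * r') * m ^ r * (2 * n) ^ f) * Sg := by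
  have s1 : E2 ^ p ≤ ((n:ℝ) ^ 2) ^ p' * ((2 * (m:ℝ)) ^ e * (m * W1)) :=
    h2.trans (mul_le_mul_of_nonneg_left h3 (by positivity))
  have s2 : (E2 ^ p) ^ r ≤ (((n:ℝ) ^ 2) ^ p') ^ r * (((2 * (m:ℝ)) ^ e) ^ r * ((m:ℝ) ^ r * (((2 * (m:ℝ)) ^ 7) ^ r' * ((2 * (n:ℝ)) ^ f * Sg)))) := by
    refine (pow_le_pow_left₀ (by positivity) s1 r).trans ?_
    rw [mul_pow, mul_pow _ ((m:ℝ) * W1), mul_pow (m:ℝ) W1]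
    exact mul_le_mul_of_nonneg_left (mul_le_mul_of_nonneg_left (mul_le_mul_of_nonneg_left h5 (by positivity)) (by positivity)) (by positivity)
  have s3 : (T ^ 4) ^ (p * r) ≤ (X ^ 2) ^ (p * r) * (E2 ^ p) ^ r := by
    refine (pow_le_pow_left₀ (by positivity) h1 _).trans (le_of_eq ?_)
    rw [mul_pow, ← pow_mul E2]
  calc T ^ (4 * (p * r)) = (T ^ 4) ^ (p * r) := by rw [← pow_mul]
    _ ≤ _ := s3
    _ ≤ (X ^ 2) ^ (p * r) * _ := mul_le_mul_of_nonneg_left s2 (by positivity)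
    _ = _ := by
      simp only [← pow_mul, pow_add]
      ac_rfl

theorem typeII_core {α:ℝ} {M N:ℕ} (hN : 0 < N) {a b:ℤ} (I : Finset ℤ) (S : ℤ → Finset ℤ)
    (hI : I ⊆ Ico a (a + M)) (hS : ∀ m, S m ⊆ Ico b (b + N) ∧ (S m : Set ℤ).OrdConnected)
    (c d : ℤ → ℂ) {X:ℝ} (hX : (∑ m ∈ I, ‖c m‖ ^ 2) * (∑ n ∈ Ico b (b + N), ‖d n‖ ^ 2) ≤ X) :
    ‖∑ m ∈ I, c m * ∑ n ∈ S m, d n * ee (α * ((m ^ 7 * n ^ 7:ℤ):ℝ))‖ ^ 8192 ≤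
      X ^ 4096 * N ^ 4032 * ((2 * M) ^ 4057 * M ^ 32 * (2 * N) ^ 57) *
      bs (List.replicate 7 M ++ List.replicate 6 N) (fun t => mn N (α * (((5040 * 5040) * t:ℤ):ℝ))) := by
  set T := ‖∑ m ∈ I, c m * ∑ n ∈ S m, d n * ee (α * ((m ^ 7 * n ^ 7:ℤ):ℝ))‖ with hT
  have hT0 : 0 ≤ T := norm_nonneg _
  have h1 := bilin (α := α) I S (fun m => (hS m).1) c d hX
  rw [← hT] at h1
  set Z : ℤ → ℤ → ℂ := fun n n' => ∑ m ∈ I with n ∈ S m ∧ n' ∈ S m, ee (α * ((m ^ 7 * (n ^ 7 - n' ^ 7):ℤ):ℝ))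
  set R := Ico b (b + (N:ℤ)) with hR
  have hX0 : 0 ≤ X := le_trans (by positivity) hX
  -- power mean over pairs
  have h2 : (∑ n ∈ R, ∑ n' ∈ R, ‖Z n n'‖ ^ 2) ^ 64 ≤ ((N:ℝ) ^ 2) ^ 63 * ∑ n ∈ R, ∑ n' ∈ R, ‖Z n n'‖ ^ 128 := by
    rw [← sum_product' R R (fun n n' => ‖Z n n'‖ ^ 2), ← sum_product' R R (fun n n' => ‖Z n n'‖ ^ 128)]
    have hcard : (((R ×ˢ R).card:ℕ):ℝ) ≤ (N:ℝ) ^ 2 := by rw [card_product, hR, Int.card_Ico]; simp [sq]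
    have hpm := pow_mean (s := R ×ˢ R) (f := fun x => ‖Z x.1 x.2‖ ^ 2) (p := 64) (fun _ _ => by positivity) hcard (by norm_num)
    rw [show (64:ℕ) - 1 = 63 from rfl] at hpm
    have e64 : ∀ x : ℤ × ℤ, (‖Z x.1 x.2‖ ^ 2) ^ 64 = ‖Z x.1 x.2‖ ^ 128 := fun x => by rw [← pow_mul]
    simp only [e64] at hpm
    exact hpm
  set Y : ℤ → ℝ := fun l => (2 * N:ℝ) ^ 57 * bs (List.replicate 6 N) (fun t => mn N (α * ((5040 * l * t:ℤ):ℝ))) with hY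
  have hY0 : ∀ l, 0 ≤ Y l := fun l => mul_nonneg (by positivity) (bs_nonneg _ fun t => mn_nonneg _)
  set W : ℤ → ℝ := fun l => (Y l) ^ ((32:ℕ):ℝ)⁻¹
  have hW0 : ∀ l, 0 ≤ W l := fun l => Real.rpow_nonneg (hY0 l) _
  have hW32 : ∀ l, W l ^ 32 = Y l := fun l => Real.rpow_inv_natCast_pow (hY0 l) (by norm_num)
  have h3 := swap α (M := M) (N := N) b W (by
    intro l J hJ hc
    have h4 := weyl α hN 6 J b (fun x => l * x ^ 7) l hJ hc (PD_pow 7 l)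
    have e : ex 6 = 57 := by decide
    have e2 : (6 + 1).factorial = 5040 := by decide
    rw [e, e2] at h4
    refine le_of_pow_le_pow_left₀ (n := 32) (by norm_num) (hW0 l) ?_
    rw [hW32, ← pow_mul]
    exact h4) 6 I a S (fun x => x ^ 7) 1 hI hS (by simpa using PD_pow 7 1)
  have e : ex (6 + 1) = 120 := by decide
  have e2 : (6 + 1).factorial = 5040 := by decide
  rw [e, e2] at h3
  have h3' : ∑ n ∈ R, ∑ n' ∈ R, ‖Z n n'‖ ^ 128 ≤ (2 * M:ℝ) ^ 120 * (M * bs (List.replicate 7 M) (fun t => W (5040 * t))) := by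
    have e6 : ∀ t : ℤ, ((5040:ℕ):ℤ) * 1 * t = 5040 * t := by intro t; push_cast; ring
    simp only [e6, show (2:ℕ) ^ (6 + 1) = 128 by norm_num, show 6 + 1 = 7 by norm_num] at h3
    exact h3
  have h5 := bs_pow (p := 32) (by norm_num) (List.replicate 7 M) (F := fun t => W (5040 * t)) (fun t => hW0 _)
  simp only [hW32] at h5
  have e3 : bs (List.replicate 7 M) (fun t => Y (5040 * t)) = (2 * N:ℝ) ^ 57 *
      bs (List.replicate 7 M ++ List.replicate 6 N) (fun t => mn N (α * (((5040 * 5040) * t:ℤ):ℝ))) := by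
    rw [hY, bs_smul, bs_append]
    refine congrArg (fun F => (2 * N:ℝ) ^ 57 * bs (List.replicate 7 M) F) (funext fun s => congrArg (bs (List.replicate 6 N)) (funext fun t => ?_))
    rw [show (5040 * (5040 * s) * t:ℤ) = 5040 * 5040 * (s * t) by ring]
  rw [e3] at h5
  set Sg := bs (List.replicate 7 M ++ List.replicate 6 N) (fun t => mn N (α * (((5040 * 5040) * t:ℤ):ℝ)))
  set W1 := bs (List.replicate 7 M) (fun t => W (5040 * t))
  have hW10 : 0 ≤ W1 := bs_nonneg _ fun t => hW0 _
  have e4 : (List.map (fun N : ℕ => 2 * (N:ℝ)) (List.replicate 7 M)).prod = (2 * M:ℝ) ^ 7 := by rw [List.map_replicate, List.prod_replicate]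
  rw [e4] at h5
  set E2 := ∑ n ∈ R, ∑ n' ∈ R, ‖Z n n'‖ ^ 2
  have hE20 : 0 ≤ E2 := sum_nonneg fun _ _ => sum_nonneg fun _ _ => by positivity
  rw [show (32:ℕ) - 1 = 31 from rfl] at h5
  have fin := chain_alg hT0 hX0 hE20 hW10 h1 h2 h3' h5
  simp only [Nat.reduceMul, Nat.reduceAdd] at fin
  exact fin

lemma one_le_log {P:ℕ} (hP : 3 ≤ P) : 1 ≤ ln P := by
  rw [Real.le_log_iff_exp_le (by positivity)]
  have : (3:ℝ) ≤ P := by exact_mod_cast hP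
  linarith [Real.exp_one_lt_d9]

lemma ms_bound {α:ℝ} {a:ℤ} {q:ℕ} (hq : 0 < q) (hc : IsCoprime a (q:ℤ)) (hα : |α - a / q| ≤ 1 / (q:ℝ) ^ 2)
    {P N L:ℕ} {D K:ℝ} (hP : 3 ≤ P) (hqP : q ≤ P ^ 7) (hLP : L ≤ P ^ 23) (hK : 1 ≤ K) (hKN : K ≤ N) (hKL : K ≤ L)
    (hD : 1 ≤ D) (hDq : D ≤ q) (hqD : q * D ≤ L * N) (J:ℕ) :
    (∑ t ∈ Icc 1 L, tau t ^ J * mn N (α * (t:ℤ))) ^ 2 ≤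
      (L * N) ^ 2 * ((24 * ln P) ^ 2 ^ (2 * J) * (160 * ln P * (1 / D + 1 / K))) := by
  have hN' : (0:ℝ) < N := by linarith
  have hL' : (0:ℝ) < L := by linarith
  have hN : 0 < N := by exact_mod_cast hN'
  have hq' : (0:ℝ) < q := by exact_mod_cast hq
  have hlog1 := one_le_log hP
  have l1 : 1 + ln L ≤ 24 * ln P := by
    have : ln L ≤ ln ((P:ℝ) ^ 23) := Real.log_le_log hL' (by exact_mod_cast hLP)
    rw [Real.log_pow] at this; push_cast at this; linarith
  have l2 : 1 + ln q ≤ 8 * ln P := by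
    have : ln q ≤ ln ((P:ℝ) ^ 7) := Real.log_le_log hq' (by exact_mod_cast hqP)
    rw [Real.log_pow] at this; push_cast at this; linarith
  have l4 := Real.log_natCast_nonneg L
  refine (main_sum hq hc hα hN L J).trans ?_
  set y := ln P
  have b1 : (N:ℝ) * ((2 * (L + 1) / q + 1) * (2 * (N + q * (1 + ln q)))) ≤ L * N ^ 2 * (160 * y * (1 / D + 1 / K)) := by
    have c1 : (2 * ((L:ℝ) + 1) / q + 1) ≤ L * (4 / q + 1 / L) := by
      have : L * (4 / (q:ℝ) + 1 / L) = 4 * L / q + 1 := by field_simp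
      rw [this]
      have := div_le_div_of_nonneg_right (show 2 * ((L:ℝ) + 1) ≤ 4 * L by linarith) hq'.le
      linarith
    have c2 : 2 * ((N:ℝ) + q * (1 + ln q)) ≤ N * (2 + 16 * y * q / N) := by
      have : N * (2 + 16 * y * q / N) = 2 * N + 2 * (q * (8 * y)) := by field_simp; ring
      rw [this]
      have := mul_le_mul_of_nonneg_left l2 hq'.le
      linarith
    have c3 : (4 / (q:ℝ) + 1 / L) * (2 + 16 * y * q / N) ≤ 160 * y * (1 / D + 1 / K) := by
      have e : (4 / (q:ℝ) + 1 / L) * (2 + 16 * y * q / N) = 8 / q + 64 * y * (1 / N) + 2 * (1 / L) + 16 * y * (q / (L * N)) := by field_simp; ring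
      have d1 : 1 / (q:ℝ) ≤ 1 / D := one_div_le_one_div_of_le (by linarith) hDq
      have d2 : 1 / (N:ℝ) ≤ 1 / K := one_div_le_one_div_of_le (by linarith) hKN
      have d3 : 1 / (L:ℝ) ≤ 1 / K := one_div_le_one_div_of_le (by linarith) hKL
      have d4 : (q:ℝ) / (L * N) ≤ 1 / D := by rw [div_le_div_iff₀ (by positivity) (by linarith)]; linarith
      have hD0 : 0 ≤ 1 / D := by positivity
      have hK0 : 0 ≤ 1 / K := by positivity
      rw [e, show 8 / (q:ℝ) = 8 * (1 / q) by ring]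
      have f1 := mul_le_mul_of_nonneg_left d2 (show 0 ≤ y by linarith)
      have f2 := mul_le_mul_of_nonneg_left d4 (show 0 ≤ y by linarith)
      have f3 := mul_le_mul_of_nonneg_right hlog1 hD0
      have f4 := mul_le_mul_of_nonneg_right hlog1 hK0
      linarith
    calc _ ≤ (N:ℝ) * ((L * (4 / q + 1 / L)) * (N * (2 + 16 * y * q / N))) := by gcongr
      _ = L * N ^ 2 * ((4 / (q:ℝ) + 1 / L) * (2 + 16 * y * q / N)) := by ring
      _ ≤ _ := mul_le_mul_of_nonneg_left c3 (by positivity)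
  have b0 : (0:ℝ) ≤ (N:ℝ) * ((2 * (L + 1) / q + 1) * (2 * (N + q * (1 + ln q)))) := by positivity
  generalize hE : 2 ^ (2 * J) = E
  calc _ ≤ (L * (24 * y) ^ E) * (L * N ^ 2 * (160 * y * (1 / D + 1 / K))) := by
        refine mul_le_mul (mul_le_mul_of_nonneg_left ?_ hL'.le) b1 b0 (by positivity)
        exact pow_le_pow_left₀ (by linarith) l1 E
    _ = _ := by ring

lemma sq_aux (a b z:ℝ) (k:ℕ) : ((a * b) ^ k * z) ^ 2 = a ^ (k * 2) * b ^ (k * 2) * z ^ 2 := by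
  rw [mul_pow, mul_pow, mul_pow, ← pow_mul, ← pow_mul]

theorem typeI : ∃ (C:ℝ) (c:ℕ), 1 ≤ C ∧ ∀ (α:ℝ) (a:ℤ) (q P m:ℕ) (D:ℝ) (J : Finset ℤ), 0 < q → IsCoprime a (q:ℤ) →
    |α - a / q| ≤ 1 / (q:ℝ) ^ 2 → 3 ≤ P → 1 ≤ D → D ≤ q → q * D ≤ (P:ℝ) ^ 7 → 0 < m → m ≤ P →
    J ⊆ Ico 1 (1 + ((P / m:ℕ):ℤ)) → (J : Set ℤ).OrdConnected →
    ‖∑ x ∈ J, ee (α * (((m:ℤ) ^ 7 * x ^ 7:ℤ):ℝ))‖ ^ 128 ≤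
      C * ln P ^ c * m ^ 14 * ((P / m:ℕ):ℝ) ^ 128 * (1 / D + 1 / ((P / m:ℕ):ℝ)) := by
  obtain ⟨E, hE⟩ : ∃ E : ℕ, 2 ^ (2 * 6) = E := ⟨_, rfl⟩
  refine ⟨2 ^ 114 * (2 * 384 ^ 2 + 2 * 64 ^ 2 * (5040 ^ 2 * (24 ^ E * 160))), E + 1, ?_, ?_⟩
  · have : (1:ℝ) ≤ 24 ^ E := one_le_pow₀ (by norm_num)
    nlinarith
  intro α a q P m D J hq hc hα hP hD hDq hqD hm hmP hJ hJc
  obtain ⟨N, hN⟩ : ∃ N, N = P / m := ⟨_, rfl⟩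
  rw [← hN] at hJ ⊢
  have hN0 : 0 < N := hN ▸ Nat.div_pos hmP hm
  have hN' : (1:ℝ) ≤ N := by exact_mod_cast hN0
  have hm' : (1:ℝ) ≤ m := by exact_mod_cast hm
  have hlog1 := one_le_log hP
  have hmN : m * N ≤ P := hN ▸ Nat.mul_div_le P m
  have hmN2 : P ≤ 2 * (m * N) := by
    have h1 : P < m * (P / m + 1) := by rw [Nat.mul_add, mul_one]; have := Nat.div_add_mod P m; have := Nat.mod_lt P hm; omega
    rw [← hN] at h1
    nlinarith
  have h1 := weyl α hN0 6 J 1 (fun x => (m:ℤ) ^ 7 * x ^ 7) ((m:ℤ) ^ 7) hJ hJc (PD_pow 7 _)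
  have e : ex 6 = 57 := by decide
  have e2 : (6 + 1).factorial = 5040 := by decide
  rw [e, e2, show (2:ℕ) ^ 6 = 64 by norm_num] at h1
  have h2 := bs_bound (K := N) (T := N) (by linarith) (by linarith) (List.replicate 6 N) (by intro n hn; rw [List.eq_of_mem_replicate hn])
    (F := fun t => mn N (α * ((((5040:ℕ):ℤ) * (m:ℤ) ^ 7 * t:ℤ):ℝ))) (fun t => mn_nonneg _)
    (fun t => by rw [← mn_neg]; congr 1; push_cast; ring) (fun t => mn_le (by linarith) _)
  rw [List.map_replicate, List.prod_replicate, List.prod_replicate, List.length_replicate] at h2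
  have h3 := scale_le (5040 * m ^ 7) (N ^ 6) 6 (by positivity) (F := fun t => mn N (α * (t:ℤ))) (fun t => mn_nonneg _)
  have e3 : ∀ t : ℕ, ((5040:ℕ):ℤ) * (m:ℤ) ^ 7 * (t:ℤ) = ((5040 * m ^ 7 * t:ℕ):ℤ) := by intro t; push_cast; ring
  simp only [e3] at h2
  have hLN : (((5040 * m ^ 7 * N ^ 6:ℕ)):ℝ) * N = 5040 * (m:ℝ) ^ 7 * N ^ 7 := by push_cast; ring
  have hP7 : (P:ℝ) ^ 7 ≤ 5040 * (m:ℝ) ^ 7 * N ^ 7 := by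
    have : (P:ℝ) ≤ 2 * (m * N) := by exact_mod_cast hmN2
    calc (P:ℝ) ^ 7 ≤ (2 * (m * N)) ^ 7 := pow_le_pow_left₀ (by positivity) this 7
      _ = 128 * ((m:ℝ) ^ 7 * N ^ 7) := by ring
      _ ≤ _ := by have : (0:ℝ) ≤ (m:ℝ) ^ 7 * N ^ 7 := by positivity
                  linarith
  have hqP : q ≤ P ^ 7 := by
    have : (q:ℝ) ≤ (P:ℝ) ^ 7 := le_trans (le_mul_of_one_le_right (by positivity) hD) hqD
    exact_mod_cast this
  have hLP : 5040 * m ^ 7 * N ^ 6 ≤ P ^ 23 := by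
    calc 5040 * m ^ 7 * N ^ 6 ≤ 3 ^ 8 * (m ^ 7 * N ^ 7) := by
          have : N ^ 6 ≤ N ^ 7 := Nat.pow_le_pow_right hN0 (by norm_num)
          have := Nat.mul_le_mul_left (m ^ 7) this
          rw [mul_assoc]
          exact Nat.mul_le_mul (by norm_num) this
      _ ≤ P ^ 8 * P ^ 7 := by rw [← mul_pow]; exact Nat.mul_le_mul (Nat.pow_le_pow_left hP 8) (Nat.pow_le_pow_left hmN 7)
      _ = P ^ 15 := by ring
      _ ≤ _ := Nat.pow_le_pow_right (by omega) (by norm_num)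
  have hKL : (N:ℝ) ≤ ((5040 * m ^ 7 * N ^ 6:ℕ):ℝ) := by
    have : N ≤ 5040 * m ^ 7 * N ^ 6 := by
      calc N = N ^ 1 := (pow_one N).symm
        _ ≤ N ^ 6 := Nat.pow_le_pow_right hN0 (by norm_num)
        _ ≤ _ := Nat.le_mul_of_pos_left _ (by positivity)
    exact_mod_cast this
  have h4 := ms_bound hq hc hα (K := N) hP hqP hLP hN' le_rfl hKL hD hDq (by rw [hLN]; exact hqD.trans hP7) 6
  rw [hE, hLN] at h4
  set S1 := ∑ t ∈ Icc 1 (5040 * m ^ 7 * N ^ 6), tau t ^ 6 * mn N (α * (t:ℤ))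
  set y := ln P
  set T := ‖∑ x ∈ J, ee (α * (((m:ℤ) ^ 7 * x ^ 7:ℤ):ℝ))‖
  have hT0 : 0 ≤ T := norm_nonneg _
  have h5 : T ^ 64 ≤ (2 * N) ^ 57 * (384 * N ^ 6 + 64 * S1) := by
    refine h1.trans (mul_le_mul_of_nonneg_left (h2.trans ?_) (by positivity))
    have e5 : ((6:ℕ):ℝ) * ((2 * (N:ℝ)) ^ 6 / N) * N = 384 * N ^ 6 := by field_simp; norm_num
    rw [e5]
    linarith
  set G := 1 / D + 1 / (N:ℝ)
  have hG1 : 1 / (N:ℝ) ≤ G := by have : 0 < 1 / D := by positivity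
                                 linarith
  have h6 : (384 * (N:ℝ) ^ 6 + 64 * S1) ^ 2 ≤ (2 * 384 ^ 2 + 2 * 64 ^ 2 * (5040 ^ 2 * (24 ^ E * 160))) * (y ^ (E + 1) * m ^ 14 * N ^ 14 * G) := by
    have g1 : (N:ℝ) ^ 12 ≤ y ^ (E + 1) * m ^ 14 * N ^ 14 * G := by
      have i1 : 1 ≤ y ^ (E + 1) * (m:ℝ) ^ 14 := one_le_mul_of_one_le_of_one_le (one_le_pow₀ hlog1) (one_le_pow₀ hm')
      have i2 : (N:ℝ) ^ 12 ≤ N ^ 14 * G := by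
        calc (N:ℝ) ^ 12 ≤ N ^ 13 := pow_le_pow_right₀ hN' (by norm_num)
          _ = N ^ 14 * (1 / N) := by field_simp
          _ ≤ _ := mul_le_mul_of_nonneg_left hG1 (by positivity)
      calc (N:ℝ) ^ 12 ≤ 1 * (N ^ 14 * G) := by linarith
        _ ≤ y ^ (E + 1) * (m:ℝ) ^ 14 * (N ^ 14 * G) := mul_le_mul_of_nonneg_right i1 (by positivity)
        _ = _ := by ring
    have g2 : S1 ^ 2 ≤ 5040 ^ 2 * (24 ^ E * 160) * (y ^ (E + 1) * m ^ 14 * N ^ 14 * G) := by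
      refine h4.trans (le_of_eq ?_)
      rw [mul_pow 24 y]; ring
    generalize y ^ (E + 1) * m ^ 14 * N ^ 14 * G = Z at g1 g2 ⊢
    generalize (5040:ℝ) ^ 2 * (24 ^ E * 160) = V at g2 ⊢
    have : (384 * (N:ℝ) ^ 6 + 64 * S1) ^ 2 ≤ 2 * 384 ^ 2 * N ^ 12 + 2 * 64 ^ 2 * S1 ^ 2 := by
      have := sq_nonneg (384 * (N:ℝ) ^ 6 - 64 * S1)
      linarith [this, show (384 * (N:ℝ) ^ 6 + 64 * S1) ^ 2 + (384 * (N:ℝ) ^ 6 - 64 * S1) ^ 2 = 2 * (2 * 384 ^ 2 * N ^ 12 + 2 * 64 ^ 2 * S1 ^ 2) / 2 by ring]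
    linarith
  calc T ^ 128 = (T ^ 64) ^ 2 := by rw [← pow_mul]
    _ ≤ ((2 * N) ^ 57 * (384 * N ^ 6 + 64 * S1)) ^ 2 := pow_le_pow_left₀ (pow_nonneg hT0 64) h5 2
    _ = 2 ^ 114 * N ^ 114 * (384 * N ^ 6 + 64 * S1) ^ 2 := by
        have := sq_aux 2 N (384 * N ^ 6 + 64 * S1) 57
        rw [show 57 * 2 = 114 by norm_num] at this
        exact this
    _ ≤ 2 ^ 114 * N ^ 114 * _ := mul_le_mul_of_nonneg_left h6 (by positivity)
    _ = _ := by
      generalize (2 * 384 ^ 2 + 2 * 64 ^ 2 * (5040 ^ 2 * (24 ^ E * 160)):ℝ) = V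
      generalize (2:ℝ) ^ 114 = V2
      rw [show (N:ℝ) ^ 128 = N ^ 114 * N ^ 14 by rw [← pow_add]]
      ac_rfl

lemma alg2 {T X N M z S Y:ℝ} {e a b c1 c2 c3:ℕ} (hT : 0 ≤ T) (hX : 0 ≤ X) (hN : 0 ≤ N) (hM : 0 ≤ M) (hz : 0 ≤ z)
    (h : T ^ e ≤ X ^ a * N ^ b * ((z * M) ^ c1 * M ^ c2 * (z * N) ^ c3) * S) (hS : S ^ 2 ≤ M ^ 14 * N ^ 14 * Y) :
    T ^ (e * 2) ≤ z ^ ((c1 + c3) * 2) * X ^ (a * 2) * M ^ ((c1 + c2) * 2 + 14) * N ^ ((b + c3) * 2 + 14) * Y := by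
  calc T ^ (e * 2) = (T ^ e) ^ 2 := pow_mul _ _ _
    _ ≤ (X ^ a * N ^ b * ((z * M) ^ c1 * M ^ c2 * (z * N) ^ c3) * S) ^ 2 := pow_le_pow_left₀ (by positivity) h 2
    _ = (X ^ a * N ^ b * ((z * M) ^ c1 * M ^ c2 * (z * N) ^ c3)) ^ 2 * S ^ 2 := by ring
    _ ≤ (X ^ a * N ^ b * ((z * M) ^ c1 * M ^ c2 * (z * N) ^ c3)) ^ 2 * (M ^ 14 * N ^ 14 * Y) := by gcongr
    _ = _ := by rw [mul_pow z M c1, mul_pow z N c3]; ring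

theorem typeII : ∃ (C:ℝ) (c:ℕ), 1 ≤ C ∧ ∀ (α:ℝ) (a:ℤ) (q P M N:ℕ) (D K:ℝ) (b b':ℤ) (I : Finset ℤ) (S : ℤ → Finset ℤ)
    (u v : ℤ → ℂ) (X:ℝ), 0 < q → IsCoprime a (q:ℤ) →
    |α - a / q| ≤ 1 / (q:ℝ) ^ 2 → 3 ≤ P → 1 ≤ D → D ≤ q → q * D ≤ (P:ℝ) ^ 7 → M * N ≤ P → P ≤ 4 * (M * N) →
    1 ≤ K → K ≤ M → K ≤ N →
    I ⊆ Ico b (b + M) → (∀ m, S m ⊆ Ico b' (b' + N) ∧ (S m : Set ℤ).OrdConnected) →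
    (∑ m ∈ I, ‖u m‖ ^ 2) * (∑ n ∈ Ico b' (b' + N), ‖v n‖ ^ 2) ≤ X →
    ‖∑ m ∈ I, u m * ∑ n ∈ S m, v n * ee (α * ((m ^ 7 * n ^ 7:ℤ):ℝ))‖ ^ 16384 ≤
      C * X ^ 8192 * (M:ℝ) ^ 8192 * (N:ℝ) ^ 8192 * (ln P ^ c * (1 / D + 1 / K)) := by
  obtain ⟨E, hE⟩ : ∃ E : ℕ, 2 ^ (2 * 13) = E := ⟨_, rfl⟩
  obtain ⟨W, hW⟩ : ∃ W : ℝ, W = 2 * (13 * 8192) ^ 2 + 2 * 8192 ^ 2 * ((5040 * 5040) ^ 2 * (24 ^ E * 160)) := ⟨_, rfl⟩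
  have hW1 : 1 ≤ W := by
    have : (1:ℝ) ≤ 24 ^ E := one_le_pow₀ (by norm_num)
    rw [hW]; nlinarith
  obtain ⟨z2, hz2⟩ : ∃ z : ℝ, z = 2 ^ ((4057 + 57) * 2) := ⟨_, rfl⟩
  have hz21 : 1 ≤ z2 := hz2 ▸ one_le_pow₀ (by norm_num)
  refine ⟨z2 * W, E + 1, one_le_mul_of_one_le_of_one_le hz21 hW1, ?_⟩
  intro α a q P M N D K b b' I S u v X hq hc hα hP hD hDq hqD hMN hMN2 hK hKM hKN hI hS hX
  have hN0 : 0 < N := by exact_mod_cast (show (0:ℝ) < N by linarith)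
  have hM0 : 0 < M := by exact_mod_cast (show (0:ℝ) < M by linarith)
  have hlog1 := one_le_log hP
  have h1 := typeII_core (α := α) (M := M) hN0 I S hI hS u v hX
  have hl : ∀ n ∈ List.replicate 7 M ++ List.replicate 6 N, K ≤ (n:ℝ) := by
    intro n hn
    rw [List.mem_append] at hn
    rcases hn with hn | hn <;> rw [List.eq_of_mem_replicate hn] <;> assumption
  have h2 := bs_bound (K := K) (T := N) (by linarith) (by linarith) _ hl
    (F := fun t => mn N (α * (((5040 * 5040) * t:ℤ):ℝ))) (fun t => mn_nonneg _)
    (fun t => by rw [← mn_neg]; congr 1; push_cast; ring) (fun t => mn_le (by linarith) _)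
  rw [List.map_append, List.map_replicate, List.map_replicate, List.prod_append, List.prod_append, List.prod_replicate, List.prod_replicate,
    List.prod_replicate, List.prod_replicate, List.length_append, List.length_replicate, List.length_replicate] at h2
  have h3 := scale_le (5040 * 5040) (M ^ 7 * N ^ 6) 13 (by positivity) (F := fun t => mn N (α * (t:ℤ))) (fun t => mn_nonneg _)
  have e3 : ∀ t : ℕ, (5040 * 5040) * (t:ℤ) = ((5040 * 5040 * t:ℕ):ℤ) := by intro t; push_cast; ring
  simp only [e3] at h2
  have hLN : (((5040 * 5040 * (M ^ 7 * N ^ 6):ℕ)):ℝ) * N = 5040 * 5040 * (M:ℝ) ^ 7 * N ^ 7 := by push_cast; ring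
  have hP7 : (P:ℝ) ^ 7 ≤ 5040 * 5040 * (M:ℝ) ^ 7 * N ^ 7 := by
    have : (P:ℝ) ≤ 4 * (M * N) := by exact_mod_cast hMN2
    calc (P:ℝ) ^ 7 ≤ (4 * (M * N)) ^ 7 := pow_le_pow_left₀ (by positivity) this 7
      _ = 16384 * ((M:ℝ) ^ 7 * N ^ 7) := by ring
      _ ≤ _ := by have : (0:ℝ) ≤ (M:ℝ) ^ 7 * N ^ 7 := by positivity
                  linarith
  have hqP : q ≤ P ^ 7 := by
    have : (q:ℝ) ≤ (P:ℝ) ^ 7 := le_trans (le_mul_of_one_le_right (by positivity) hD) hqD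
    exact_mod_cast this
  have hLP : 5040 * 5040 * (M ^ 7 * N ^ 6) ≤ P ^ 23 := by
    calc 5040 * 5040 * (M ^ 7 * N ^ 6) ≤ 3 ^ 16 * (M ^ 7 * N ^ 7) := by
          have : N ^ 6 ≤ N ^ 7 := Nat.pow_le_pow_right hN0 (by norm_num)
          have := Nat.mul_le_mul_left (M ^ 7) this
          exact Nat.mul_le_mul (by norm_num) this
      _ ≤ P ^ 16 * P ^ 7 := by rw [← mul_pow]; exact Nat.mul_le_mul (Nat.pow_le_pow_left hP 16) (Nat.pow_le_pow_left hMN 7)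
      _ = P ^ 23 := by ring
  have hKL : K ≤ ((5040 * 5040 * (M ^ 7 * N ^ 6):ℕ):ℝ) := by
    refine hKN.trans ?_
    have : N ≤ 5040 * 5040 * (M ^ 7 * N ^ 6) := by
      calc N = N ^ 1 := (pow_one N).symm
        _ ≤ N ^ 6 := Nat.pow_le_pow_right hN0 (by norm_num)
        _ ≤ 5040 * 5040 * M ^ 7 * N ^ 6 := Nat.le_mul_of_pos_left _ (by positivity)
        _ = _ := by ring
    exact_mod_cast this
  have h4 := ms_bound hq hc hα (K := K) hP hqP hLP hK hKN hKL hD hDq (by rw [hLN]; exact hqD.trans hP7) 13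
  rw [hE, hLN] at h4
  set S1 := ∑ t ∈ Icc 1 (5040 * 5040 * (M ^ 7 * N ^ 6)), tau t ^ 13 * mn N (α * (t:ℤ))
  set y := ln P
  have hT0 : 0 ≤ ‖∑ m ∈ I, u m * ∑ n ∈ S m, v n * ee (α * ((m ^ 7 * n ^ 7:ℤ):ℝ))‖ := norm_nonneg _
  generalize ‖∑ m ∈ I, u m * ∑ n ∈ S m, v n * ee (α * ((m ^ 7 * n ^ 7:ℤ):ℝ))‖ = T at h1 hT0 ⊢
  have hX0 : 0 ≤ X := le_trans (by positivity) hX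
  set B := bs (List.replicate 7 M ++ List.replicate 6 N) (fun t => mn N (α * (((5040 * 5040) * t:ℤ):ℝ)))
  have hB0 : 0 ≤ B := bs_nonneg _ (fun t => mn_nonneg _)
  have h5 : B ≤ 13 * 8192 * (M ^ 7 * N ^ 7 / K) + 8192 * S1 := by
    refine h2.trans ?_
    have e5 : ((7 + 6:ℕ):ℝ) * ((2 * (M:ℝ)) ^ 7 * (2 * (N:ℝ)) ^ 6 / K) * N = 13 * 8192 * (M ^ 7 * N ^ 7 / K) := by push_cast; ring
    rw [e5, show 7 + 6 = 13 by norm_num, show (2:ℝ) ^ 13 = 8192 by norm_num]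
    linarith
  set G := 1 / D + 1 / K
  have hG1 : 1 / K ≤ G := by have : 0 < 1 / D := by positivity
                             linarith
  have h6 : B ^ 2 ≤ (M:ℝ) ^ 14 * N ^ 14 * (W * (y ^ (E + 1) * G)) := by
    have g1 : ((M:ℝ) ^ 7 * N ^ 7 / K) ^ 2 ≤ (M:ℝ) ^ 14 * N ^ 14 * (y ^ (E + 1) * G) := by
      have i1 : 1 ≤ y ^ (E + 1) := one_le_pow₀ hlog1
      have i2 : (1 / K) ^ 2 ≤ G := by
        refine le_trans ?_ hG1
        rw [sq]
        refine mul_le_of_le_one_left (by positivity) ?_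
        rw [div_le_one (by linarith)]; exact hK
      calc ((M:ℝ) ^ 7 * N ^ 7 / K) ^ 2 = (M:ℝ) ^ 14 * N ^ 14 * (1 * (1 / K) ^ 2) := by ring
        _ ≤ _ := by gcongr
    have g2 : S1 ^ 2 ≤ (5040 * 5040) ^ 2 * (24 ^ E * 160) * ((M:ℝ) ^ 14 * N ^ 14 * (y ^ (E + 1) * G)) := by
      refine h4.trans (le_of_eq ?_)
      rw [mul_pow 24 y]; ring
    rw [show (M:ℝ) ^ 14 * N ^ 14 * (W * (y ^ (E + 1) * G)) = W * ((M:ℝ) ^ 14 * N ^ 14 * (y ^ (E + 1) * G)) by ring, hW]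
    generalize (M:ℝ) ^ 14 * N ^ 14 * (y ^ (E + 1) * G) = Z at g1 g2 ⊢
    generalize ((5040:ℝ) * 5040) ^ 2 * (24 ^ E * 160) = V at g2 ⊢
    generalize (M:ℝ) ^ 7 * N ^ 7 / K = R at g1 h5
    refine (pow_le_pow_left₀ hB0 h5 2).trans ?_
    have := sq_nonneg (13 * 8192 * R - 8192 * S1)
    nlinarith
  have h7 := alg2 hT0 hX0 (by linarith) (by linarith) (by norm_num) h1 h6
  rw [← hz2] at h7
  simp only [Nat.reduceMul, Nat.reduceAdd] at h7
  refine h7.trans (le_of_eq ?_)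
  generalize X ^ 8192 = x1
  generalize (M:ℝ) ^ 8192 = x2
  generalize (N:ℝ) ^ 8192 = x3
  ring

open ArithmeticFunction in
/-- restriction of an arithmetic function to arguments at most `U` -/
noncomputable def cut (U:ℕ) (f : AF) : AF :=
  ⟨fun n => if n ≤ U then f n else 0, by simp⟩

lemma cut_apply (U:ℕ) (f : AF) (n:ℕ) : cut U f n = if n ≤ U then f n else 0 := rfl

lemma dconv (f h : AF) (y:ℕ) (g : ℕ → ℂ) :
    ∑ n ∈ Icc 1 y, (((f * h) n:ℝ):ℂ) * g n = ∑ a ∈ Icc 1 y, (f a:ℂ) * ∑ b ∈ Icc 1 (y / a), (h b:ℂ) * g (a * b) := by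
  have := divsum y (fun a b => (f a:ℂ) * ((h b:ℂ) * g (a * b)))
  simp only [← mul_sum] at this
  rw [← this]
  refine sum_congr rfl fun n _ => ?_
  rw [ArithmeticFunction.mul_apply, ofReal_sum, sum_mul]
  refine sum_congr rfl fun x hx => ?_
  rw [Nat.mem_divisorsAntidiagonal] at hx
  rw [hx.1]; push_cast; ring

lemma abs_moebius_real (n:ℕ) : |((ArithmeticFunction.moebius : AF) n)| ≤ 1 := by
  rw [ArithmeticFunction.intCoe_apply, ← Int.cast_abs]
  exact_mod_cast ArithmeticFunction.abs_moebius_le_one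

open ArithmeticFunction in
lemma vaughan_id (U:ℕ) : (vonMangoldt : AF) = cut U vonMangoldt + cut U (moebius : AF) * ArithmeticFunction.log
    - (cut U vonMangoldt * cut U (moebius : AF)) * (zeta : AF)
    + (vonMangoldt - cut U vonMangoldt) * ((zeta : AF) * ((moebius : AF) - cut U (moebius : AF))) := by
  have h1 := vonMangoldt_mul_zeta
  have h2 : ((zeta : AF) * (moebius : AF)) = 1 := coe_zeta_mul_coe_moebius
  rw [← h1]
  linear_combination (-(vonMangoldt - cut U vonMangoldt)) * h2

lemma log_weight {g : ℕ → ℂ} {Z:ℕ} {B:ℝ} (hB : ∀ z ≤ Z, ‖∑ b ∈ Icc 1 z, g b‖ ≤ B) :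
    ‖∑ b ∈ Icc 1 Z, (ln b:ℂ) * g b‖ ≤ 2 * ln Z * B := by
  have e : ∀ (f : ℕ → ℂ) z, ∑ b ∈ Icc 1 z, f b = ∑ i ∈ range z, f (i + 1) := by
    intro f z
    rw [range_eq_Ico, sum_Ico_add' f 0 z 1]
    rfl
  have hl : 0 ≤ ln Z := Real.log_natCast_nonneg Z
  have h := abel_antitone (w := fun i => ln Z - ln ((i + 1:ℕ):ℝ)) (b := fun i => g (i + 1)) (N := Z) (M := B) ?_ ?_ ?_
  · rcases h with h | h
    · have e2 : ∑ b ∈ Icc 1 Z, (ln b:ℂ) * g b = ln Z * ∑ b ∈ Icc 1 Z, g b -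
          ∑ i ∈ range Z, ((ln Z - ln ((i + 1:ℕ):ℝ):ℝ):ℂ) * g (i + 1) := by
        rw [e, e, mul_sum, ← sum_sub_distrib]
        refine sum_congr rfl fun i _ => ?_
        rw [ofReal_sub]; ring
      rw [e2]
      refine (norm_sub_le _ _).trans ?_
      rw [norm_mul, norm_real, Real.norm_of_nonneg hl]
      have h3 := mul_le_mul_of_nonneg_left (hB Z le_rfl) hl
      simp only [zero_add, Nat.cast_one, Real.log_one, sub_zero] at h
      linarith
    · subst h; simp
  · intro i hi
    have := Real.log_le_log (show (0:ℝ) < ((i + 1:ℕ):ℝ) by positivity) (show ((i + 1:ℕ):ℝ) ≤ ((i + 1 + 1:ℕ):ℝ) by exact_mod_cast Nat.le_succ _)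
    beta_reduce; linarith
  · intro i hi
    have := Real.log_le_log (show (0:ℝ) < ((i + 1:ℕ):ℝ) by positivity) (show ((i + 1:ℕ):ℝ) ≤ Z by exact_mod_cast hi)
    beta_reduce; linarith
  · intro n hn
    rw [← e]; exact hB n hn

open ArithmeticFunction in
lemma vaughan_ineq {g : ℕ → ℂ} (hg : ∀ n, ‖g n‖ ≤ 1) {y P U:ℕ} (hy : y ≤ P) (hU : 1 ≤ U) {δ η:ℝ} (hδ : 0 ≤ δ)
    (hI : ∀ m, 1 ≤ m → m ≤ U ^ 2 → m ≤ y → ∀ z ≤ y / m, ‖∑ b ∈ Icc 1 z, g (m * b)‖ ≤ (P / m:ℝ) * δ)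
    (hII : ∀ i ≤ Nat.log 2 P, ∀ c d : ℕ → ℝ, (∀ m, 1 ≤ m → m ≤ P → |c m| ≤ ln P) → (∀ m ≤ U, c m = 0) → (∀ k, |d k| ≤ tau k) → (∀ k ≤ U, d k = 0) →
      ‖∑ m ∈ Icc 1 y with Nat.log 2 m = i, (c m:ℂ) * ∑ k ∈ Icc 1 (y / m), (d k:ℂ) * g (m * k)‖ ≤ P * η) :
    ‖∑ n ∈ Icc 1 y, (vonMangoldt n:ℂ) * g n‖ ≤ U * ln P + 3 * ln P * (1 + ln P) * (P * δ) + (Nat.log 2 P + 1) * (P * η) := by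
  have hlog : ∀ m : ℕ, 1 ≤ m → m ≤ P → ln m ≤ ln P := fun m h1 h2 =>
    Real.log_le_log (by exact_mod_cast h1) (by exact_mod_cast h2)
  have hlP := Real.log_natCast_nonneg P
  have hv : ∀ m : ℕ, 1 ≤ m → m ≤ P → vonMangoldt m ≤ ln P := fun m h1 h2 => vonMangoldt_le_log.trans (hlog m h1 h2)
  have hsplit : ∑ n ∈ Icc 1 y, (vonMangoldt n:ℂ) * g n = ∑ n ∈ Icc 1 y, (cut U vonMangoldt n:ℂ) * g n
      + ∑ n ∈ Icc 1 y, (((cut U (moebius : AF) * ArithmeticFunction.log) n:ℝ):ℂ) * g n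
      - ∑ n ∈ Icc 1 y, ((((cut U vonMangoldt * cut U (moebius : AF)) * (zeta : AF)) n:ℝ):ℂ) * g n
      + ∑ n ∈ Icc 1 y, ((((vonMangoldt - cut U vonMangoldt) * ((zeta : AF) * ((moebius : AF) - cut U (moebius : AF)))) n:ℝ):ℂ) * g n := by
    rw [← sum_add_distrib, ← sum_sub_distrib, ← sum_add_distrib]
    refine sum_congr rfl fun n _ => ?_
    have := congrArg (fun f : AF => ((f n:ℝ):ℂ)) (vaughan_id U)
    beta_reduce at this
    rw [this, ArithmeticFunction.add_apply, sub_eq_add_neg, ArithmeticFunction.add_apply, ArithmeticFunction.add_apply, ArithmeticFunction.neg_apply]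
    push_cast; ring
  have hP1 : ∑ a ∈ Icc 1 y, (P / a:ℝ) * δ ≤ (1 + ln P) * (P * δ) := by
    have h1 : ∑ a ∈ Icc 1 y, (P / a:ℝ) * δ = (P * δ) * ∑ a ∈ Icc 1 y, (1:ℝ) / a := by rw [mul_sum]; exact sum_congr rfl fun a _ => by ring
    have h2 : ∑ a ∈ Icc 1 y, (1:ℝ) / a ≤ ∑ a ∈ Icc 1 P, (1:ℝ) / a :=
      sum_le_sum_of_subset_of_nonneg (Icc_subset_Icc_right hy) fun _ _ _ => by positivity
    rw [h1, mul_comm]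
    exact mul_le_mul_of_nonneg_right (h2.trans (sum_inv_le P)) (by positivity)
  have t0 : ‖∑ n ∈ Icc 1 y, (cut U vonMangoldt n:ℂ) * g n‖ ≤ U * ln P := by
    calc _ ≤ ∑ n ∈ Icc 1 y, if n ≤ U then ln P else 0 := by
          refine norm_sum_le_of_le _ fun n hn => ?_
          rw [mem_Icc] at hn
          rw [norm_mul, cut_apply, norm_real]
          split_ifs with h
          · rw [Real.norm_of_nonneg vonMangoldt_nonneg]
            calc _ ≤ ln P * 1 := mul_le_mul (hv n hn.1 (hn.2.trans hy)) (hg n) (norm_nonneg _) hlP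
              _ = _ := mul_one _
          · simp
      _ = #{n ∈ Icc 1 y | n ≤ U} * ln P := by rw [← sum_filter, sum_const, nsmul_eq_mul]
      _ ≤ #(Icc 1 U) * ln P := by gcongr; intro n hn; simp only [mem_filter, mem_Icc] at hn ⊢; omega
      _ = _ := by simp
  have t1 : ‖∑ n ∈ Icc 1 y, (((cut U (moebius : AF) * ArithmeticFunction.log) n:ℝ):ℂ) * g n‖ ≤ 2 * ln P * ((1 + ln P) * (P * δ)) := by
    rw [dconv]
    refine (norm_sum_le_of_le (f := fun a => _) (n := fun a : ℕ => 2 * ln P * ((P / a:ℝ) * δ)) _ fun a ha => ?_).trans ?_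
    · rw [mem_Icc] at ha
      rw [norm_mul, cut_apply, norm_real]
      have hy1 : y / a ≤ P := (Nat.div_le_self _ _).trans hy
      split_ifs with h
      · rw [← one_mul (2 * ln P * ((P / a:ℝ) * δ))]
        refine mul_le_mul (abs_moebius_real a) ?_ (norm_nonneg _) zero_le_one
        refine (log_weight (g := fun b => g (a * b)) (hI a ha.1 (h.trans (by nlinarith)) ha.2)).trans ?_
        have : ln ((y / a:ℕ):ℝ) ≤ ln P := by
          rcases Nat.eq_zero_or_pos (y / a) with h0 | h0
          · rw [h0]; simpa using hlP
          · exact hlog _ h0 hy1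
        gcongr
      · simp only [norm_zero, zero_mul]; positivity
    · rw [← mul_sum]
      exact mul_le_mul_of_nonneg_left hP1 (by linarith)
  have t2 : ‖∑ n ∈ Icc 1 y, ((((cut U vonMangoldt * cut U (moebius : AF)) * (zeta : AF)) n:ℝ):ℂ) * g n‖ ≤ ln P * ((1 + ln P) * (P * δ)) := by
    rw [dconv]
    refine (norm_sum_le_of_le (f := fun a => _) (n := fun a : ℕ => ln P * ((P / a:ℝ) * δ)) _ fun a ha => ?_).trans ?_
    · rw [mem_Icc] at ha
      rw [norm_mul, norm_real]
      have e1 : ∑ b ∈ Icc 1 (y / a), (((zeta : AF) b:ℝ):ℂ) * g (a * b) = ∑ b ∈ Icc 1 (y / a), g (a * b) := by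
        refine sum_congr rfl fun b hb => ?_
        rw [mem_Icc] at hb
        rw [natCoe_apply, zeta_apply_ne (by omega)]; simp
      rw [e1]
      by_cases h : a ≤ U ^ 2
      · refine mul_le_mul ?_ (hI a ha.1 h ha.2 _ le_rfl) (norm_nonneg _) hlP
        rw [mul_apply]
        have h3 : ∑ x ∈ a.divisorsAntidiagonal, vonMangoldt x.1 = ln a := by rw [← vonMangoldt_sum, Nat.sum_divisorsAntidiagonal (f := fun x _ => vonMangoldt x)]
        refine le_trans ?_ (h3.le.trans (hlog a ha.1 (ha.2.trans hy)))
        refine norm_sum_le_of_le _ fun x _ => ?_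
        rw [norm_mul, cut_apply, cut_apply]
        have i1 : ‖(if x.1 ≤ U then vonMangoldt x.1 else 0)‖ ≤ vonMangoldt x.1 := by
          split_ifs
          · exact (Real.norm_of_nonneg vonMangoldt_nonneg).le
          · simp
        have i2 : ‖(if x.2 ≤ U then (moebius : AF) x.2 else 0)‖ ≤ 1 := by
          split_ifs
          · exact abs_moebius_real _
          · simp
        calc _ ≤ vonMangoldt x.1 * 1 := mul_le_mul i1 i2 (norm_nonneg _) vonMangoldt_nonneg
          _ = _ := mul_one _
      · have : (cut U vonMangoldt * cut U (moebius : AF)) a = 0 := by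
          rw [mul_apply]
          refine sum_eq_zero fun x hx => ?_
          rw [Nat.mem_divisorsAntidiagonal] at hx
          rw [cut_apply, cut_apply]
          split_ifs with j1 j2
          · exact absurd (hx.1 ▸ (Nat.mul_le_mul j1 j2).trans (by rw [sq])) h
          all_goals simp
        rw [this, norm_zero, zero_mul]; positivity
    · rw [← mul_sum]
      exact mul_le_mul_of_nonneg_left hP1 (by linarith)
  have t3 : ‖∑ n ∈ Icc 1 y, ((((vonMangoldt - cut U vonMangoldt) * ((zeta : AF) * ((moebius : AF) - cut U (moebius : AF)))) n:ℝ):ℂ) * g n‖ ≤ (Nat.log 2 P + 1) * (P * η) := by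
    rw [dconv]
    have hm : ∀ a ∈ Icc 1 y, Nat.log 2 a ∈ range (Nat.log 2 P + 1) := fun a ha => by rw [mem_range, Nat.lt_succ_iff]; exact Nat.log_mono_right ((mem_Icc.1 ha).2.trans hy)
    rw [← sum_fiberwise_of_maps_to hm]
    refine (norm_sum_le_of_le (n := fun _ => P * η) _ fun i hi => ?_).trans (by simp)
    have e0 : ∀ (f : AF) m, (f - cut U f) m = if m ≤ U then 0 else f m := by
      intro f m
      rw [sub_eq_add_neg, ArithmeticFunction.add_apply, ArithmeticFunction.neg_apply, cut_apply]
      split_ifs <;> ring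
    refine hII i (by rw [mem_range] at hi; omega) _ _ ?_ ?_ ?_ ?_
    · intro m h1 h2
      rw [e0]; split_ifs
      · simpa using hlP
      · rw [abs_of_nonneg vonMangoldt_nonneg]; exact hv m h1 h2
    · intro m h1; rw [e0, if_pos h1]
    · intro k
      rw [mul_apply, tau, card_eq_sum_ones, Nat.cast_sum, ← Nat.sum_divisorsAntidiagonal (f := fun _ _ => ((1:ℕ):ℝ))]
      refine (abs_sum_le_sum_abs _ _).trans (sum_le_sum fun x hx => ?_)
      rw [abs_mul, e0, natCoe_apply]
      have i1 : |((zeta x.1:ℕ):ℝ)| ≤ 1 := by rw [zeta_apply]; split_ifs <;> simp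
      have i2 : |(if x.2 ≤ U then 0 else (moebius : AF) x.2)| ≤ 1 := by
        split_ifs
        · simp
        · exact abs_moebius_real _
      calc _ ≤ (1:ℝ) * 1 := mul_le_mul i1 i2 (abs_nonneg _) zero_le_one
        _ = _ := by simp
    · intro k hk
      rw [mul_apply]
      refine sum_eq_zero fun x hx => ?_
      rw [Nat.mem_divisorsAntidiagonal] at hx
      have : x.2 ≤ k := Nat.le_of_dvd (by omega) (Dvd.intro_left _ hx.1)
      rw [e0, if_pos (this.trans hk), mul_zero]
  rw [hsplit]
  refine (norm_add_le _ _).trans (le_trans (add_le_add ((norm_sub_le _ _).trans (add_le_add ((norm_add_le _ _).trans (add_le_add t0 t1)) t2)) t3) ?_)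
  apply le_of_eq; ring

lemma log_large (T:ℝ) (k:ℕ) : ∃ P0 : ℕ, ∀ P : ℕ, P0 ≤ P → T ≤ ln P ∧ ln P ^ k ≤ P := by
  have h1 := (Real.tendsto_log_atTop.comp tendsto_natCast_atTop_atTop).eventually_ge_atTop T
  have h2 := tendsto_natCast_atTop_atTop.eventually ((Real.isLittleO_pow_log_id_atTop (n := k)).bound one_pos)
  obtain ⟨P0, h⟩ := Filter.eventually_atTop.1 (h1.and h2)
  refine ⟨P0, fun P hP => ⟨(h P hP).1, ?_⟩⟩
  have := (h P hP).2
  rw [Real.norm_eq_abs, id, one_mul, Real.norm_of_nonneg (Nat.cast_nonneg P)] at this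
  exact (le_abs_self _).trans this

lemma fin2 {T C X M N Y P η L:ℝ} {e:ℕ} (he : e ≠ 0) (hM : 0 ≤ M) (hN : 0 ≤ N) (hη : 0 ≤ η)
    (h : T ^ (e * 2) ≤ C * X ^ e * M ^ e * N ^ e * Y) (hX : X = 16 * (M * N) * L ^ 6) (hP : M * N ≤ P)
    (hf : C * 16 ^ e * L ^ (6 * e) * Y ≤ η ^ (e * 2)) : T ≤ P * η := by
  have hP0 : 0 ≤ P := le_trans (by positivity) hP
  refine le_of_pow_le_pow_left₀ (n := e * 2) (by omega) (by positivity) (h.trans ?_)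
  calc C * X ^ e * M ^ e * N ^ e * Y = (C * 16 ^ e * L ^ (6 * e) * Y) * (M * N) ^ (e * 2) := by
        rw [hX, mul_pow (16 * (M * N)) (L ^ 6), mul_pow 16 (M * N), ← pow_mul L, pow_mul (M * N) e 2, mul_pow M N]; ring
    _ ≤ η ^ (e * 2) * P ^ (e * 2) := by gcongr
    _ = (P * η) ^ (e * 2) := by rw [mul_pow P η, mul_comm]

lemma Ico_eq_map (Z:ℕ) : Ico (1:ℤ) (1 + Z) = (Icc 1 Z).map Nat.castEmbedding := by
  ext x
  simp only [mem_Ico, mem_map, mem_Icc, Nat.castEmbedding_apply]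
  constructor
  · intro h; exact ⟨x.toNat, by omega, by omega⟩
  · rintro ⟨k, hk, rfl⟩; omega

lemma blockII {α:ℝ} {C2:ℝ} {c2:ℕ} (hC2 : 1 ≤ C2)
    (H : ∀ (α:ℝ) (a:ℤ) (q P M N:ℕ) (D K:ℝ) (b b':ℤ) (I : Finset ℤ) (S : ℤ → Finset ℤ)
    (u v : ℤ → ℂ) (X:ℝ), 0 < q → IsCoprime a (q:ℤ) →
    |α - a / q| ≤ 1 / (q:ℝ) ^ 2 → 3 ≤ P → 1 ≤ D → D ≤ q → q * D ≤ (P:ℝ) ^ 7 → M * N ≤ P → P ≤ 4 * (M * N) →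
    1 ≤ K → K ≤ M → K ≤ N →
    I ⊆ Ico b (b + M) → (∀ m, S m ⊆ Ico b' (b' + N) ∧ (S m : Set ℤ).OrdConnected) →
    (∑ m ∈ I, ‖u m‖ ^ 2) * (∑ n ∈ Ico b' (b' + N), ‖v n‖ ^ 2) ≤ X →
    ‖∑ m ∈ I, u m * ∑ n ∈ S m, v n * ee (α * ((m ^ 7 * n ^ 7:ℤ):ℝ))‖ ^ 16384 ≤
      C2 * X ^ 8192 * (M:ℝ) ^ 8192 * (N:ℝ) ^ 8192 * (ln P ^ c2 * (1 / D + 1 / K)))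
    {a:ℤ} {q P U y:ℕ} {D η:ℝ} (hq : 0 < q) (hc : IsCoprime a (q:ℤ))
    (hα : |α - a / q| ≤ 1 / (q:ℝ) ^ 2) (hP : 3 ≤ P) (hD : 1 ≤ D) (hDq : D ≤ q) (hqD : q * D ≤ (P:ℝ) ^ 7) (hy : y ≤ P) (hU : 2 ≤ U)
    (hη : 0 ≤ η) (hf : C2 * 16 ^ 8192 * ln P ^ (6 * 8192) * (ln P ^ c2 * (1 / D + 1 / (U / 2))) ≤ η ^ (8192 * 2))
    (i:ℕ) (c d : ℕ → ℝ) (hc1 : ∀ m, 1 ≤ m → m ≤ P → |c m| ≤ ln P) (hc2 : ∀ m ≤ U, c m = 0) (hd1 : ∀ k, |d k| ≤ tau k) (hd2 : ∀ k ≤ U, d k = 0) :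
    ‖∑ m ∈ Icc 1 y with Nat.log 2 m = i, (c m:ℂ) * ∑ k ∈ Icc 1 (y / m), (d k:ℂ) * ee (α * ((m * k:ℕ):ℝ) ^ 7)‖ ≤ P * η := by
  have hlog1 := one_le_log hP
  have hmem : ∀ m ∈ {m ∈ Icc 1 y | Nat.log 2 m = i}, 1 ≤ m ∧ m ≤ y ∧ 2 ^ i ≤ m ∧ m < 2 ^ (i + 1) := by
    intro m hm
    simp only [mem_filter, mem_Icc] at hm
    exact ⟨hm.1.1, hm.1.2, hm.2 ▸ Nat.pow_log_le_self 2 (by omega), hm.2 ▸ Nat.lt_pow_succ_log_self (by norm_num) m⟩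
  by_cases h1 : 2 ^ (i + 1) ≤ U
  · rw [sum_eq_zero fun m hm => by rw [hc2 m ((hmem m hm).2.2.2.le.trans h1)]; simp]
    simp; positivity
  by_cases h2 : P < 2 ^ i * U
  · rw [sum_eq_zero fun m hm => ?_]
    · simp; positivity
    rw [sum_eq_zero fun k hk => ?_, mul_zero]
    rw [hd2 k, ofReal_zero, zero_mul]
    rw [mem_Icc] at hk
    refine hk.2.trans ((Nat.div_le_div (hy) (hmem m hm).2.2.1 (by positivity)).trans ?_)
    exact (Nat.div_lt_of_lt_mul h2).le
  push Not at h1 h2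
  set I0 := {m ∈ Icc 1 y | Nat.log 2 m = i}
  obtain ⟨M, hM⟩ : ∃ M, M = 2 ^ i := ⟨_, rfl⟩
  obtain ⟨N, hN⟩ : ∃ N, N = P / M := ⟨_, rfl⟩
  rw [pow_succ] at h1 hmem
  rw [← hM] at h1 h2 hmem
  have hM0 : 0 < M := by rw [hM]; positivity
  have hUN : U ≤ N := by rw [hN, Nat.le_div_iff_mul_le hM0]; linarith
  have hMN : M * N ≤ P := hN ▸ Nat.mul_div_le P M
  have hMN2 : P ≤ 4 * (M * N) := by
    have h1 : P < M * (N + 1) := by rw [Nat.mul_add, mul_one, hN]; have := Nat.div_add_mod P M; have := Nat.mod_lt P hM0; omega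
    nlinarith
  set S : ℤ → Finset ℤ := fun m => if m ∈ I0.map Nat.castEmbedding then Ico 1 (1 + ((y / m.toNat:ℕ):ℤ)) else ∅ with hS
  have key := H α a q P M N D (U / 2) M 1 (I0.map Nat.castEmbedding) S (fun m => (c m.toNat:ℂ)) (fun n => (d n.toNat:ℂ)) (16 * (M * N) * ln P ^ 6)
    hq hc hα hP hD hDq hqD hMN hMN2 ?_ ?_ ?_ ?_ ?_ ?_
  · have e : ∑ m ∈ I0.map Nat.castEmbedding, (c m.toNat:ℂ) * ∑ n ∈ S m, (d n.toNat:ℂ) * ee (α * ((m ^ 7 * n ^ 7:ℤ):ℝ)) =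
        ∑ m ∈ I0, (c m:ℂ) * ∑ k ∈ Icc 1 (y / m), (d k:ℂ) * ee (α * ((m * k:ℕ):ℝ) ^ 7) := by
      rw [sum_map]
      refine sum_congr rfl fun m hm => ?_
      simp only [hS, Nat.castEmbedding_apply, Int.toNat_natCast]
      rw [if_pos (show (m:ℤ) ∈ I0.map Nat.castEmbedding from mem_map_of_mem Nat.castEmbedding hm), Ico_eq_map, sum_map]
      congr 1
      refine sum_congr rfl fun k _ => ?_
      simp only [Nat.castEmbedding_apply, Int.toNat_natCast]
      congr 3; push_cast; ring
    rw [e] at key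
    refine fin2 (e := 8192) (by norm_num) (Nat.cast_nonneg M) (Nat.cast_nonneg N) hη key rfl (by exact_mod_cast hMN) hf
  · rw [le_div_iff₀ (by norm_num)]; exact_mod_cast hU
  · rw [div_le_iff₀ (by norm_num)]; exact_mod_cast h1.le
  · have : (U:ℝ) ≤ N := by exact_mod_cast hUN
    linarith
  · intro x hx
    rw [mem_map] at hx
    obtain ⟨m, hm, rfl⟩ := hx
    have := hmem m hm
    simp only [Nat.castEmbedding_apply, mem_Ico]; omega
  · intro m
    simp only [hS]
    split_ifs with h
    · rw [mem_map] at h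
      obtain ⟨m, hm, rfl⟩ := h
      have := hmem m hm
      simp only [Nat.castEmbedding_apply, Int.toNat_natCast]
      have h3 : y / m ≤ N := hN ▸ Nat.div_le_div hy this.2.2.1 (by omega)
      exact ⟨Ico_subset_Ico_right (by omega), by rw [coe_Ico]; exact Set.ordConnected_Ico⟩
    · simp [Set.ordConnected_empty]
  · have hN1 : 1 ≤ N := by omega
    have s1 : ∑ m ∈ I0.map (Nat.castEmbedding (R := ℤ)), ‖((c m.toNat:ℝ):ℂ)‖ ^ 2 ≤ M * ln P ^ 2 := by
      rw [sum_map]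
      calc _ ≤ ∑ m ∈ I0, ln P ^ 2 := sum_le_sum fun m hm => by
            have := hmem m hm
            simp only [Nat.castEmbedding_apply, Int.toNat_natCast, norm_real, Real.norm_eq_abs]
            exact pow_le_pow_left₀ (abs_nonneg _) (hc1 m this.1 (by omega)) 2
        _ = #I0 * ln P ^ 2 := by rw [sum_const, nsmul_eq_mul]
        _ ≤ #(Ico M (M + M)) * ln P ^ 2 := by gcongr; intro m hm; have := hmem m hm; rw [mem_Ico]; omega
        _ = _ := by simp
    have s2 : ∑ n ∈ Ico (1:ℤ) (1 + N), ‖((d n.toNat:ℝ):ℂ)‖ ^ 2 ≤ N * (2 * ln P) ^ 4 := by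
      rw [Ico_eq_map, sum_map]
      have h3 : ln N ≤ ln P := Real.log_le_log (by exact_mod_cast hN1) (by exact_mod_cast hN ▸ Nat.div_le_self P M)
      calc _ ≤ ∑ k ∈ Icc 1 N, tau k ^ 2 := sum_le_sum fun k _ => by
            simp only [Nat.castEmbedding_apply, Int.toNat_natCast, norm_real, Real.norm_eq_abs]
            exact pow_le_pow_left₀ (abs_nonneg _) (hd1 k) 2
        _ ≤ N * (1 + ln N) ^ 2 ^ 2 := sum_tau_pow 2 N
        _ ≤ N * (2 * ln P) ^ 4 := by
            rw [show 2 ^ 2 = 4 by norm_num]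
            gcongr; linarith
    refine (mul_le_mul s1 s2 (sum_nonneg fun _ _ => by positivity) (by positivity)).trans (le_of_eq ?_)
    ring

lemma pow_fin {C L:ℝ} {a b e:ℕ} (h1 : 1 ≤ L) (hC : C ≤ L) (hab : a + e + 1 ≤ b) : C * L ^ a * (1 / L ^ b) ≤ (1 / L ^ e) := by
  rw [mul_one_div, div_le_div_iff₀ (by positivity) (by positivity), one_mul]
  calc C * L ^ a * L ^ e ≤ L * L ^ a * L ^ e := by gcongr
    _ = L ^ (a + e + 1) := by ring
    _ ≤ L ^ b := pow_le_pow_right₀ h1 hab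

lemma pow_fin2 {C L η:ℝ} {c2 A u e:ℕ} (hL : 1 ≤ L) (hC : 3 * C * 16 ^ e ≤ L) (hu : 6 * e + c2 + A * (e * 2) + 1 ≤ u) (hC0 : 0 ≤ C) (hη : η = 1 / L ^ A)
    {g:ℝ} (hg : g ≤ 3 * (1 / L ^ u)) : C * 16 ^ e * L ^ (6 * e) * (L ^ c2 * g) ≤ η ^ (e * 2) := by
  calc _ ≤ C * 16 ^ e * L ^ (6 * e) * (L ^ c2 * (3 * (1 / L ^ u))) := by gcongr
    _ = (3 * C * 16 ^ e) * L ^ (6 * e + c2) * (1 / L ^ u) := by ring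
    _ ≤ 1 / L ^ (A * (e * 2)) := pow_fin hL hC (by omega)
    _ = _ := by rw [hη, div_pow, one_pow, ← pow_mul]

lemma fin_alg {L P U l:ℝ} {A u:ℕ} (hL : 100 ≤ L) (hP : 0 ≤ P) (hU : U ≤ 2 * L ^ u) (hl : l + 1 ≤ 3 * L)
    (h1 : L ^ (u + 1 + A + 1) ≤ P) (hs : L ^ (A + 2) ≤ √P) :
    U * L + 3 * L * (1 + L) * (P * (1 / L ^ (A + 4))) + (l + 1) * (P * (1 / L ^ (A + 3))) + 8 * √P * L ≤ P / L ^ A := by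
  have hA : 0 < L ^ A := by positivity
  have hLL : 100 * L ≤ L ^ 2 := by nlinarith
  rw [le_div_iff₀ hA]
  have p1 : U * L * L ^ A ≤ P / 50 := by
    have h5 : L ^ u * L * L ^ A * L ≤ P := le_trans (le_of_eq (by ring)) h1
    have h6 : 0 ≤ L ^ u * L * L ^ A := by positivity
    have h7 : U * L * L ^ A ≤ 2 * L ^ u * L * L ^ A := by gcongr
    have h8 := mul_le_mul_of_nonneg_left hL h6
    linarith
  have hL3 : 100 * L ^ 2 ≤ L ^ 3 := by
    have := mul_le_mul_of_nonneg_right hL (sq_nonneg L)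
    linarith [show L ^ 3 = L * L ^ 2 by ring]
  have p2 : 3 * L * (1 + L) * (P * (1 / L ^ (A + 4))) * L ^ A ≤ P * (6 / 100) := by
    have : 3 * L * (1 + L) * (P * (1 / L ^ (A + 4))) * L ^ A = P * (3 * (1 + L) / L ^ 3) := by rw [pow_add]; field_simp
    rw [this]
    refine mul_le_mul_of_nonneg_left ?_ hP
    rw [div_le_div_iff₀ (by positivity) (by norm_num)]
    linarith
  have p3 : (l + 1) * (P * (1 / L ^ (A + 3))) * L ^ A ≤ P * (3 / 100) := by
    have : (l + 1) * (P * (1 / L ^ (A + 3))) * L ^ A = P * ((l + 1) / L ^ 3) := by rw [pow_add]; field_simp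
    rw [this]
    refine mul_le_mul_of_nonneg_left ?_ hP
    rw [div_le_div_iff₀ (by positivity) (by norm_num)]
    linarith
  have p4 : 8 * √P * L * L ^ A ≤ 8 * P / 100 := by
    have h5 : √P * L ^ A * L * L ≤ P := by
      calc √P * L ^ A * L * L = √P * L ^ (A + 2) := by ring
        _ ≤ √P * √P := by gcongr
        _ = P := Real.mul_self_sqrt hP
    have h6 : 0 ≤ √P * L ^ A * L := by positivity
    have h8 := mul_le_mul_of_nonneg_left hL h6
    linarith
  linarith

theorem minor_arc (A:ℕ) : ∃ B P0 : ℕ, ∀ (P y q:ℕ) (a:ℤ) (α:ℝ), P0 ≤ P → y ≤ P → IsCoprime a (q:ℤ) →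
    |α - a / q| ≤ 1 / (q:ℝ) ^ 2 → ln P ^ B ≤ q → q * ln P ^ B ≤ (P:ℝ) ^ 7 →
    ‖∑ n ∈ range (y + 1), (lp n:ℂ) * ee (α * (n:ℝ) ^ 7)‖ ≤ P / ln P ^ A := by
  obtain ⟨C1, c1, hC1, H1⟩ := typeI
  obtain ⟨C2, c2, hC2, H2⟩ := typeII
  obtain ⟨e, he⟩ : ∃ e : ℕ, e = 8192 := ⟨_, rfl⟩
  obtain ⟨u, hu⟩ : ∃ u : ℕ, u = 6 * e + c2 + (A + 3) * (e * 2) + 1 := ⟨_, rfl⟩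
  obtain ⟨B, hB⟩ : ∃ B : ℕ, B = 28 * u + c1 + (A + 4) * 128 + 1 := ⟨_, rfl⟩
  obtain ⟨P0, hP0⟩ := log_large (100 + 3 * C2 * 16 ^ e + 2 * 4 ^ 14 * C1) (2 * u + B + 2 * A + 10)
  refine ⟨B, max P0 3, ?_⟩
  intro P y q a α hP hy hc hα hBq hqB
  obtain ⟨hL, hLP⟩ := hP0 P (le_trans (le_max_left _ _) hP)
  have hP3 : 3 ≤ P := le_trans (le_max_right _ _) hP
  have hPr : (3:ℝ) ≤ P := by exact_mod_cast hP3
  set L := ln P with hLdef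
  have hx1 : 0 ≤ 3 * C2 * 16 ^ e := by positivity
  have hL100 : 100 ≤ L := by linarith
  have hL1 : 1 ≤ L := by linarith
  have hD : 1 ≤ L ^ B := one_le_pow₀ hL1
  have hq : 0 < q := by
    have : (0:ℝ) < q := by linarith
    exact_mod_cast this
  obtain ⟨U, hU⟩ : ∃ U, U = ⌈L ^ u⌉₊ := ⟨_, rfl⟩
  have hU1 : L ^ u ≤ U := hU ▸ Nat.le_ceil _
  have hU2 : (U:ℝ) ≤ 2 * L ^ u := by
    have := (Nat.ceil_lt_add_one (show 0 ≤ L ^ u by positivity)).le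
    rw [← hU] at this
    have : 1 ≤ L ^ u := one_le_pow₀ hL1
    linarith
  have hLu : L ≤ L ^ u := le_self_pow₀ hL1 (by omega)
  have hU3 : 2 ≤ U := by
    have : (2:ℝ) ≤ U := by linarith
    exact_mod_cast this
  have hmain := vaughan_ineq (g := fun n => ee (α * (n:ℝ) ^ 7)) (y := y) (P := P) (U := U) (δ := 1 / L ^ (A + 4)) (η := 1 / L ^ (A + 3))
    (fun n => (norm_ee _).le) hy (by omega) (by positivity) ?_ ?_
  · -- conclusion
    have e1 : ∑ n ∈ range (y + 1), (lp n:ℂ) * ee (α * (n:ℝ) ^ 7) = ∑ n ∈ Icc 1 y, (ArithmeticFunction.vonMangoldt n:ℂ) * ee (α * (n:ℝ) ^ 7) -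
        ∑ n ∈ range (y + 1), ((ArithmeticFunction.vonMangoldt n - lp n:ℝ):ℂ) * ee (α * (n:ℝ) ^ 7) := by
      have : ∑ n ∈ Icc 1 y, (ArithmeticFunction.vonMangoldt n:ℂ) * ee (α * (n:ℝ) ^ 7) = ∑ n ∈ range (y + 1), (ArithmeticFunction.vonMangoldt n:ℂ) * ee (α * (n:ℝ) ^ 7) := by
        refine sum_subset (fun n hn => by rw [mem_Icc] at hn; rw [mem_range]; omega) fun n hn hn2 => ?_
        have : n = 0 := by rw [mem_range] at hn; rw [mem_Icc] at hn2; omega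
        subst this; simp
      rw [this, ← sum_sub_distrib]
      refine sum_congr rfl fun n _ => ?_
      push_cast; ring
    have e2 : ‖∑ n ∈ range (y + 1), ((ArithmeticFunction.vonMangoldt n - lp n:ℝ):ℂ) * ee (α * (n:ℝ) ^ 7)‖ ≤ 8 * √P * L := by
      calc _ ≤ ∑ n ∈ range (y + 1), (ArithmeticFunction.vonMangoldt n - lp n) := by
            refine norm_sum_le_of_le _ fun n _ => ?_
            rw [norm_mul, norm_ee, mul_one, norm_real, Real.norm_of_nonneg]
            linarith [lp_le_vM n]
        _ ≤ 2 * √((y + 1:ℕ):ℝ) * ln ((y + 1:ℕ):ℝ) := sum_vM_sub_lp (y + 1) (by omega)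
        _ ≤ 2 * (2 * √P) * (2 * L) := by
            have hyP : ((y + 1:ℕ):ℝ) ≤ 2 * P := by
              have : (y:ℝ) ≤ P := by exact_mod_cast hy
              push_cast; linarith
            have s1 : √((y + 1:ℕ):ℝ) ≤ 2 * √P := by rw [Real.sqrt_le_left (by positivity), mul_pow, Real.sq_sqrt (by linarith)]; linarith
            have s2 : ln ((y + 1:ℕ):ℝ) ≤ 2 * L := by
              rw [hLdef, ← Real.log_rpow (by linarith)]
              refine Real.log_le_log (by positivity) (hyP.trans ?_)
              norm_cast; nlinarith
            gcongr
        _ = _ := by ring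
    rw [e1]
    refine (norm_sub_le _ _).trans ((add_le_add hmain e2).trans ?_)
    have hlog2 : ((Nat.log 2 P:ℕ):ℝ) + 1 ≤ 3 * L := by
      have h3 : ((Nat.log 2 P:ℕ):ℝ) ≤ Real.logb 2 P := Real.natLog_le_logb P 2
      have h4 : Real.logb 2 P ≤ 2 * L := by
        rw [Real.logb, div_le_iff₀ (Real.log_pos (by norm_num))]
        nlinarith [Real.log_two_gt_d9]
      linarith
    have hLpow : ∀ k ≤ 2 * u + B + 2 * A + 10, L ^ k ≤ P := fun k hk => (pow_le_pow_right₀ hL1 hk).trans hLP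
    have hsq : L ^ (A + 2) ≤ √P := by
      apply Real.le_sqrt_of_sq_le
      rw [← pow_mul]; exact hLpow _ (by omega)
    exact fin_alg hL100 (by linarith) hU2 hlog2 (hLpow (u + 1 + A + 1) (by omega)) hsq
  · -- type I
    intro m hm1 hmU hmy z hz
    have hmP : m ≤ P := hmy.trans hy
    have h3 := H1 α a q P m (L ^ B) (Ico 1 (1 + (z:ℤ))) hq hc hα hP3 hD hBq hqB (by omega) hmP ?_ ?_
    · rw [Ico_eq_map, sum_map] at h3
      have e1 : ∀ b : ℕ, ee (α * (((m:ℤ) ^ 7 * (Nat.castEmbedding b:ℤ) ^ 7:ℤ):ℝ)) = ee (α * ((m * b:ℕ):ℝ) ^ 7) := by intro b; congr 2; simp only [Nat.castEmbedding_apply]; push_cast; ring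
      simp only [e1] at h3
      have hm' : (1:ℝ) ≤ m := by exact_mod_cast hm1
      have hm2 : (m:ℝ) ≤ 4 * L ^ (2 * u) := by
        calc (m:ℝ) ≤ (U:ℝ) ^ 2 := by exact_mod_cast hmU
          _ ≤ (2 * L ^ u) ^ 2 := by gcongr
          _ = _ := by ring
      have hNr : L ^ B ≤ ((P / m:ℕ):ℝ) := by
        have h5 : (P:ℝ) / m - 1 ≤ ((P / m:ℕ):ℝ) := by
          have := Nat.lt_floor_add_one ((P:ℝ) / m)
          rw [Nat.floor_div_natCast, Nat.floor_natCast] at this; linarith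
        have h6 : 2 * L ^ B ≤ (P:ℝ) / m := by
          rw [le_div_iff₀ (by linarith)]
          calc 2 * L ^ B * m ≤ 2 * L ^ B * (4 * L ^ (2 * u)) := by gcongr
            _ = 8 * L ^ (2 * u + B) := by ring
            _ ≤ L * L ^ (2 * u + B) := by gcongr; linarith
            _ = L ^ (2 * u + B + 1) := by ring
            _ ≤ _ := (pow_le_pow_right₀ hL1 (by omega)).trans hLP
        linarith
      have hNle : ((P / m:ℕ):ℝ) ≤ P / m := Nat.cast_div_le
      refine le_of_pow_le_pow_left₀ (n := 128) (by norm_num) (by positivity) (h3.trans ?_)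
      rw [mul_pow (P / m:ℝ)]
      calc _ ≤ C1 * L ^ c1 * (4 * L ^ (2 * u)) ^ 14 * (P / m:ℝ) ^ 128 * (1 / L ^ B + 1 / L ^ B) := by gcongr
        _ = (P / m:ℝ) ^ 128 * (2 * 4 ^ 14 * C1 * L ^ (28 * u + c1) * (1 / L ^ B)) := by
            generalize (P / m:ℝ) ^ 128 = w
            rw [mul_pow 4, ← pow_mul, pow_add, show 2 * u * 14 = 28 * u by ring]; ring
        _ ≤ (P / m:ℝ) ^ 128 * (1 / L ^ ((A + 4) * 128)) := by refine mul_le_mul_of_nonneg_left (pow_fin hL1 (by linarith) (by omega)) (pow_nonneg (by positivity) _)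
        _ = _ := by rw [div_pow 1, one_pow, pow_mul]
    · exact Ico_subset_Ico_right (by have : z ≤ P / m := hz.trans (Nat.div_le_div_right hy); omega)
    · rw [coe_Ico]; exact Set.ordConnected_Ico
  · -- type II
    intro i _ c d h1 h2 h3 h4
    refine blockII hC2 H2 hq hc hα hP3 hD hBq hqB hy hU3 (by positivity) ?_ i c d h1 h2 h3 h4
    have := pow_fin2 (C := C2) (L := L) (η := 1 / L ^ (A + 3)) (c2 := c2) (A := A + 3) (u := u) (e := e) hL1 (by linarith) hu.ge (by linarith) rfl
      (g := 1 / L ^ B + 1 / ((U:ℝ) / 2)) ?_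
    · rw [he] at this; exact this
    · have i1 : 1 / L ^ B ≤ 1 / L ^ u := one_div_le_one_div_of_le (by positivity) (pow_le_pow_right₀ hL1 (by omega))
      have i2 : 1 / (U:ℝ) ≤ 1 / L ^ u := one_div_le_one_div_of_le (by positivity) hU1
      rw [one_div_div]
      have : (2:ℝ) / U = 2 * (1 / U) := by ring
      linarith

lemma sum_ee_div {M:ℕ} (hM : 0 < M) (h:ℤ) : ∑ j ∈ range M, ee ((j:ℝ) / M * h) = if (M:ℤ) ∣ h then (M:ℂ) else 0 := by
  have hM' : (M:ℝ) ≠ 0 := by positivity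
  have e : ∀ j : ℕ, ee ((j:ℝ) / M * h) = ee (h / M) ^ j := fun j => by rw [← ee_nsmul]; congr 1; ring
  simp only [e]
  split_ifs with hd
  · obtain ⟨c, rfl⟩ := hd
    have : (((M:ℤ) * c:ℤ):ℝ) / M = (c:ℤ) := by push_cast; field_simp
    rw [this, ee_int]; simp
  · have h1 : ee ((h:ℝ) / M) ≠ 1 := by
      intro h1
      have h2 := four_di_le ((h:ℝ) / M)
      rw [h1, sub_self, norm_zero] at h2
      have h3 : di ((h:ℝ) / M) = 0 := le_antisymm (by linarith) (di_nonneg _)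
      rw [di, abs_eq_zero, sub_eq_zero, div_eq_iff hM'] at h3
      exact hd ⟨round ((h:ℝ) / M), by rw [mul_comm]; exact_mod_cast h3⟩
    rw [geom_sum_eq h1, ← ee_nsmul, show (M:ℝ) * (h / M) = h by field_simp, ee_int, sub_self, zero_div]

lemma parseval {ι : Type*} {T : Finset ι} {M:ℕ} (hM : 0 < M) (c : ι → ℂ) (f : ι → ℕ) (hf : ∀ t ∈ T, f t < M) :
    ∑ j ∈ range M, ‖∑ t ∈ T, c t * ee ((j:ℝ) / M * f t)‖ ^ 2 ≤ M * ∑ p ∈ T ×ˢ T with f p.1 = f p.2, ‖c p.1‖ * ‖c p.2‖ := by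
  have e1 : ((∑ j ∈ range M, ‖∑ t ∈ T, c t * ee ((j:ℝ) / M * f t)‖ ^ 2:ℝ):ℂ) =
      M * ∑ p ∈ T ×ˢ T with f p.1 = f p.2, c p.1 * (starRingEnd ℂ) (c p.2) := by
    push_cast
    have : ∀ j ∈ range M, ((‖∑ t ∈ T, c t * ee ((j:ℝ) / M * f t)‖:ℝ):ℂ) ^ 2 =
        ∑ p ∈ T ×ˢ T, c p.1 * (starRingEnd ℂ) (c p.2) * ee ((j:ℝ) / M * ((f p.1:ℤ) - f p.2:ℤ)) := by
      intro j _
      rw [← mul_conj', map_sum, sum_mul_sum, ← sum_product']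
      refine sum_congr rfl fun p _ => ?_
      rw [map_mul, ← ee_neg, show (j:ℝ) / M * (((f p.1:ℤ) - f p.2:ℤ):ℝ) = (j:ℝ) / M * f p.1 + -((j:ℝ) / M * f p.2) by push_cast; ring, ee_add]
      ring
    rw [sum_congr rfl this, sum_comm]
    simp only [← mul_sum, sum_ee_div hM]
    rw [sum_filter, mul_sum]
    refine sum_congr rfl fun p hp => ?_
    rw [mem_product] at hp
    have h1 := hf _ hp.1
    have h2 := hf _ hp.2
    by_cases h : f p.1 = f p.2
    · rw [if_pos h, if_pos (by simp [h])]; ring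
    · rw [if_neg h, if_neg, mul_zero, mul_zero]
      intro h3
      have := Int.eq_zero_of_abs_lt_dvd h3 (by rw [abs_lt]; omega)
      omega
  have e2 := congrArg norm e1
  rw [norm_real, Real.norm_of_nonneg (sum_nonneg fun _ _ => by positivity), norm_mul, norm_natCast] at e2
  rw [e2]
  refine mul_le_mul_of_nonneg_left (norm_sum_le_of_le _ fun p _ => ?_) (Nat.cast_nonneg M)
  rw [norm_mul, RCLike.norm_conj]

lemma diff_count {k:ℕ} (H : ∀ x y δ : ℕ, x < y → 0 < δ → (x + δ) ^ k + y ^ k < (y + δ) ^ k + x ^ k) (hk : k ≠ 0) (A : Finset ℕ)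
    {u v:ℕ} (h : u ≠ v) : (#{p ∈ A ×ˢ A | p.1 ^ k + u = p.2 ^ k + v}:ℝ) ≤ tau ((u:ℤ) - v).natAbs := by
  unfold tau
  have H2 : ∀ x y δ : ℕ, 0 < δ → (x + δ) ^ k + y ^ k = (y + δ) ^ k + x ^ k → x = y := by
    intro x y δ hδ he
    rcases lt_trichotomy x y with h1 | h1 | h1
    · have := H x y δ h1 hδ; omega
    · exact h1
    · have := H y x δ h1 hδ; omega
  refine Nat.cast_le.2 (card_le_card_of_injOn (fun p => ((p.2:ℤ) - p.1).natAbs) ?_ ?_)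
  · intro p hp
    simp only [coe_filter, Set.mem_setOf_eq] at hp
    simp only [mem_coe, Nat.mem_divisors]
    refine ⟨?_, by omega⟩
    rw [Int.natAbs_dvd_natAbs]
    have h1 : (u:ℤ) - v = (p.2:ℤ) ^ k - (p.1:ℤ) ^ k := by
      have : ((p.1 ^ k + u:ℕ):ℤ) = ((p.2 ^ k + v:ℕ):ℤ) := by rw [hp.2]
      push_cast at this; linarith
    rw [h1]
    exact sub_dvd_pow_sub_pow _ _ _
  · rintro ⟨a, b⟩ hp ⟨a', b'⟩ hp' he
    simp only [coe_filter, Set.mem_setOf_eq] at hp hp' he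
    have m1 : ∀ x y : ℕ, x ≤ y ↔ x ^ k ≤ y ^ k := fun x y => (Nat.pow_le_pow_iff_left hk).symm
    rcases lt_or_gt_of_ne h with h1 | h1
    · have hb : b < a := by rw [← not_le, m1]; omega
      have hb' : b' < a' := by rw [← not_le, m1]; omega
      obtain ⟨δ, hδ⟩ := Nat.exists_eq_add_of_lt hb
      have e : a' = b' + (δ + 1) := by omega
      have := H2 b b' (δ + 1) (by omega) (by rw [← e, ← add_assoc, ← hδ]; omega)
      rw [Prod.mk.injEq]; omega
    · have hb : a < b := by rw [← not_le, m1]; omega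
      have hb' : a' < b' := by rw [← not_le, m1]; omega
      obtain ⟨δ, hδ⟩ := Nat.exists_eq_add_of_lt hb
      have e : b' = a' + (δ + 1) := by omega
      have := H2 a a' (δ + 1) (by omega) (by rw [← e, ← add_assoc, ← hδ]; omega)
      rw [Prod.mk.injEq]; omega

lemma landreau {y:ℕ} (hy : 1 ≤ y) (L:ℕ) : ∀ m : ℕ, 1 ≤ m → m ≤ y ^ L → ∃ d, d ∣ m ∧ d ≤ y ∧ tau m ≤ (2 * tau d) ^ L := by
  induction L with
  | zero =>
    intro m h1 h2
    have : m = 1 := by simp at h2; omega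
    subst this
    exact ⟨1, one_dvd _, hy, by simp [tau]⟩
  | succ L ih =>
    intro m h1 h2
    obtain ⟨d, hd, hmax⟩ := exists_max_image {d ∈ m.divisors | d ≤ y} id ⟨1, by simp; omega⟩
    simp only [mem_filter, Nat.mem_divisors, id] at hd hmax
    have t1 := one_le_tau (n := d) (by rintro rfl; simp at hd)
    by_cases hdm : d = m
    · refine ⟨m, dvd_rfl, hdm ▸ hd.2, ?_⟩
      rw [hdm] at t1
      calc tau m ≤ 2 * tau m := by linarith
        _ ≤ _ := le_self_pow₀ (by linarith) (by omega)
    obtain ⟨e, he⟩ := hd.1.1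
    have he1 : e ≠ 1 := by rintro rfl; omega
    obtain ⟨p, hp, f, hf⟩ := Nat.exists_prime_and_dvd he1
    have hf0 : 1 ≤ f := by rcases Nat.eq_zero_or_pos f with h | h
                           · subst h; simp [hf] at he; omega
                           · exact h
    have hdp : y < d * p := by
      by_contra hc
      push Not at hc
      have := hmax (d * p) ⟨⟨⟨f, by rw [he, hf]; ring⟩, by omega⟩, hc⟩
      have := hp.two_le
      nlinarith
    have hfy : f ≤ y ^ L := by
      have : y * f ≤ y * y ^ L := by
        calc y * f ≤ d * p * f := Nat.mul_le_mul_right f hdp.le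
          _ = m := by rw [he, hf]; ring
          _ ≤ _ := by rw [← pow_succ']; exact h2
      exact Nat.le_of_mul_le_mul_left this (by omega)
    obtain ⟨d', h3, h4, h5⟩ := ih f hf0 hfy
    have t2 := one_le_tau (n := d') (by rintro rfl; rw [zero_dvd_iff] at h3; omega)
    have htp : tau p = 2 := by unfold tau; rw [hp.divisors, card_pair hp.one_lt.ne]; norm_num
    have h6 : tau m ≤ 2 * tau d * (2 * tau d') ^ L := by
      calc tau m = tau (d * (p * f)) := by rw [he, hf]
        _ ≤ tau d * (tau p * tau f) := (tau_mul_le _ _).trans (mul_le_mul_of_nonneg_left (tau_mul_le _ _) (by linarith))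
        _ ≤ tau d * (2 * (2 * tau d') ^ L) := by rw [htp]; gcongr
        _ = _ := by ring
    have hd'm : d' ∣ m := h3.trans ⟨d * p, by rw [he, hf]; ring⟩
    rcases le_total (tau d) (tau d') with h7 | h7
    · refine ⟨d', hd'm, h4, h6.trans ?_⟩
      rw [pow_succ']; gcongr
    · refine ⟨d, hd.1.1, hd.2, h6.trans ?_⟩
      rw [pow_succ']; gcongr

lemma cub (d:ℕ) (hd : 0 < d) : Nat.card {u : (ZMod d)ˣ // u ^ 3 = 1} ≤ d.divisors.card ^ 2 := by
  induction d using Nat.recOnPosPrimePosCoprime with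
  | zero => omega
  | one =>
    have : Nat.card {u : (ZMod 1)ˣ // u ^ 3 = 1} ≤ Nat.card (ZMod 1)ˣ := Nat.card_le_card_of_injective _ Subtype.val_injective
    simpa using this
  | prime_pow p n hp hn =>
    have : NeZero (p ^ n) := ⟨by have := hp.pos; positivity⟩
    have h4 : 2 ^ 2 ≤ (p ^ n).divisors.card ^ 2 := by
      refine Nat.pow_le_pow_left ?_ 2
      rw [Nat.divisors_prime_pow hp, card_map, card_range]; omega
    refine le_trans ?_ h4
    by_cases h2 : p = 2
    · subst h2
      have : Subsingleton {u : (ZMod (2 ^ n))ˣ // u ^ 3 = 1} := by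
        suffices h : ∀ u : (ZMod (2 ^ n))ˣ, u ^ 3 = 1 → u = 1 from ⟨fun a b => Subtype.ext ((h _ a.2).trans (h _ b.2).symm)⟩
        intro u hu
        have h1 : u ^ (2 ^ n).totient = 1 := ZMod.pow_totient u
        rw [Nat.totient_prime_pow hp hn] at h1
        have h5 : orderOf u ∣ Nat.gcd 3 (2 ^ (n - 1) * (2 - 1)) := Nat.dvd_gcd (orderOf_dvd_of_pow_eq_one hu) (orderOf_dvd_of_pow_eq_one h1)
        rw [show Nat.gcd 3 (2 ^ (n - 1) * (2 - 1)) = 1 by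
          rw [show 2 - 1 = 1 from rfl, mul_one]; exact Nat.Coprime.pow_right _ (by norm_num)] at h5
        exact orderOf_eq_one_iff.1 (Nat.dvd_one.1 h5)
      have := Finite.card_le_one_iff_subsingleton.2 this
      omega
    · have := ZMod.isCyclic_units_of_prime_pow p hp h2 n
      have := IsCyclic.card_pow_eq_one_le (α := (ZMod (p ^ n))ˣ) (n := 3) (by norm_num)
      rw [Nat.card_eq_fintype_card, Fintype.card_subtype]
      omega
  | coprime a b ha hb hab iha ihb =>
    have : NeZero (a * b) := ⟨by positivity⟩
    have : NeZero a := ⟨by omega⟩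
    have : NeZero b := ⟨by omega⟩
    rw [Nat.Coprime.card_divisors_mul hab, mul_pow]
    refine le_trans ?_ (Nat.mul_le_mul (iha (by omega)) (ihb (by omega)))
    rw [← Nat.card_prod]
    let fa := Units.map (ZMod.castHom (dvd_mul_right a b) (ZMod a)).toMonoidHom
    let fb := Units.map (ZMod.castHom (dvd_mul_left b a) (ZMod b)).toMonoidHom
    refine Nat.card_le_card_of_injective (fun u => (⟨fa u.1, by rw [← map_pow, u.2, map_one]⟩, ⟨fb u.1, by rw [← map_pow, u.2, map_one]⟩)) ?_
    intro u v huv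
    simp only [Prod.mk.injEq, Subtype.mk.injEq] at huv
    have e1 := congrArg Units.val huv.1
    have e2 := congrArg Units.val huv.2
    have key : ∀ x y : ZMod (a * b), ZMod.castHom (dvd_mul_right a b) (ZMod a) x = ZMod.castHom (dvd_mul_right a b) (ZMod a) y →
        ZMod.castHom (dvd_mul_left b a) (ZMod b) x = ZMod.castHom (dvd_mul_left b a) (ZMod b) y → x = y := by
      intro x y
      obtain ⟨x, rfl⟩ := ZMod.natCast_zmod_surjective x
      obtain ⟨y, rfl⟩ := ZMod.natCast_zmod_surjective y
      simp only [map_natCast, ZMod.natCast_eq_natCast_iff]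
      exact fun h1 h2 => (Nat.modEq_and_modEq_iff_modEq_mul hab).1 ⟨h1, h2⟩
    exact Subtype.ext (Units.ext (key _ _ e1 e2))

lemma cub_count {d:ℕ} (hd : 0 < d) (Y:ℕ) (A : Finset ℕ) (hA : ∀ y ∈ A, y ≤ Y ∧ y.Coprime d) (c : ZMod d) :
    (#{y ∈ A | ((y:ℕ) : ZMod d) ^ 3 = c}:ℝ) ≤ tau d ^ 2 * (Y / d + 1) := by
  have : NeZero d := ⟨by omega⟩
  set B := {y ∈ A | ((y:ℕ) : ZMod d) ^ 3 = c} with hB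
  have h1 : #B ≤ (Y / d + 1) * #(B.image (fun y : ℕ => (y : ZMod d))) := by
    refine card_le_mul_card_image _ _ fun r _ => ?_
    calc _ ≤ #(range (Y / d + 1)) := by
          refine card_le_card_of_injOn (fun y => y / d) ?_ ?_
          · intro y hy
            simp only [coe_filter, Set.mem_setOf_eq, hB, mem_filter] at hy
            simp only [coe_range, Set.mem_Iio]
            exact Nat.lt_succ_of_le (Nat.div_le_div_right (hA y hy.1.1).1)
          · intro y hy z hz hyz
            simp only [coe_filter, Set.mem_setOf_eq] at hy hz hyz
            have : y % d = z % d := (ZMod.natCast_eq_natCast_iff' _ _ _).1 (hy.2.trans hz.2.symm)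
            rw [← Nat.div_add_mod y d, ← Nat.div_add_mod z d, hyz, this]
      _ = _ := card_range _
  have h2 : #(B.image (fun y : ℕ => (y : ZMod d))) ≤ d.divisors.card ^ 2 := by
    refine le_trans ?_ (cub d hd)
    rcases B.eq_empty_or_nonempty with h | ⟨y0, hy0⟩
    · simp [h]
    have hu : ∀ y ∈ B, IsUnit (y : ZMod d) := fun y hy => (ZMod.isUnit_iff_coprime y d).2 (hA y (mem_filter.1 hy).1).2
    rw [Nat.card_eq_fintype_card, Fintype.card_subtype]
    obtain ⟨u0, hu0⟩ := hu y0 hy0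
    have : B.image (fun y : ℕ => (y : ZMod d)) ⊆ (univ.filter fun u : (ZMod d)ˣ => u ^ 3 = 1).image (fun u : (ZMod d)ˣ => (u : ZMod d) * u0) := by
      intro r hr
      obtain ⟨y, hy, rfl⟩ := mem_image.1 hr
      obtain ⟨u, hu⟩ := hu y hy
      refine mem_image.2 ⟨u * u0⁻¹, ?_, ?_⟩
      · rw [mem_filter]
        refine ⟨mem_univ _, ?_⟩
        rw [mul_pow, inv_pow, mul_inv_eq_one]
        apply Units.ext
        rw [Units.val_pow_eq_pow_val, Units.val_pow_eq_pow_val, hu, hu0, (mem_filter.1 hy).2, (mem_filter.1 hy0).2]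
      · rw [← hu]; simp
    exact (card_le_card this).trans card_image_le
  have h3 : (#B:ℝ) ≤ ((Y / d:ℕ) + 1) * (d.divisors.card:ℝ) ^ 2 := by exact_mod_cast h1.trans (Nat.mul_le_mul_left _ h2)
  refine h3.trans ?_
  rw [mul_comm]
  unfold tau
  gcongr
  exact Nat.cast_div_le

def PP (k n:ℕ) : Finset ℕ := {p ∈ range (n + 1) | p.Prime ∧ n < 100 * p ^ k ∧ p ^ k ≤ n}

noncomputable def SS (k n:ℕ) (α:ℝ) : ℂ := ∑ p ∈ PP k n, (lp p:ℂ) * ee (α * ((p ^ k:ℕ):ℝ))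

lemma le_root {a k n:ℕ} (hk : k ≠ 0) (h : a ^ k ≤ n) : (a:ℝ) ≤ (n:ℝ) ^ (1 / (k:ℝ)) := by
  rw [one_div, ← Real.pow_rpow_inv_natCast (Nat.cast_nonneg a) hk]
  exact Real.rpow_le_rpow (by positivity) (by exact_mod_cast h) (by positivity)

lemma PP_le {k n p:ℕ} (hk : k ≠ 0) (h : p ∈ PP k n) : (p:ℝ) ≤ (n:ℝ) ^ (1 / (k:ℝ)) := by
  have h1 : p ^ k ≤ n := by simp only [PP, mem_filter] at h; exact h.2.2.2
  exact le_root hk h1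

lemma PP_card {k n:ℕ} (hk : k ≠ 0) : (#(PP k n):ℝ) ≤ (n:ℝ) ^ (1 / (k:ℝ)) := by
  have h1 : #(PP k n) ≤ #(Icc 1 ⌊(n:ℝ) ^ (1 / (k:ℝ))⌋₊) := by
    refine card_le_card fun p hp => ?_
    have h2 := PP_le hk hp
    simp only [PP, mem_filter] at hp
    exact mem_Icc.2 ⟨hp.2.1.pos, Nat.le_floor h2⟩
  rw [Nat.card_Icc, Nat.add_sub_cancel] at h1
  exact (Nat.cast_le.2 h1).trans (Nat.floor_le (by positivity))

lemma fib {β : Type*} [DecidableEq β] (A : Finset ℕ) (W : Finset β) (g : β → ℕ) (k:ℕ) :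
    #{p ∈ (A ×ˢ W) ×ˢ (A ×ˢ W) | p.1.1 ^ k + g p.1.2 = p.2.1 ^ k + g p.2.2} ≤
      ∑ q ∈ W ×ˢ W, #{r ∈ A ×ˢ A | r.1 ^ k + g q.1 = r.2 ^ k + g q.2} := by
  rw [card_eq_sum_card_fiberwise (f := fun p => (p.1.2, p.2.2)) (t := W ×ˢ W)
    (by intro p hp; simp only [coe_filter, Set.mem_setOf_eq, mem_product] at hp; simp [hp.1.1.2, hp.1.2.2])]
  refine sum_le_sum fun q _ => card_le_card_of_injOn (fun p => (p.1.1, p.2.1)) ?_ ?_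
  · rintro ⟨⟨a, b⟩, ⟨c, d⟩⟩ hp
    simp only [coe_filter, Set.mem_setOf_eq, mem_product, mem_filter] at hp ⊢
    obtain ⟨hp, rfl⟩ := hp
    exact ⟨⟨hp.1.1.1, hp.1.2.1⟩, hp.2⟩
  · rintro ⟨⟨a, b⟩, ⟨c, d⟩⟩ hp ⟨⟨a', b'⟩, ⟨c', d'⟩⟩ hp' h
    simp only [coe_filter, Set.mem_setOf_eq, mem_filter] at hp hp' h
    obtain ⟨_, rfl⟩ := hp
    have h2 := hp'.2
    simp only [Prod.mk.injEq] at h h2 ⊢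
    exact ⟨⟨h.1, h2.1.symm⟩, h.2, h2.2.symm⟩

lemma diag_count (A : Finset ℕ) (k:ℕ) (hk : k ≠ 0) (u:ℕ) : #{r ∈ A ×ˢ A | r.1 ^ k + u = r.2 ^ k + u} ≤ #A := by
  refine card_le_card_of_injOn Prod.fst (fun r hr => ?_) ?_
  · simp only [coe_filter, Set.mem_setOf_eq, mem_product] at hr
    exact hr.1.1
  · rintro ⟨a, b⟩ hp ⟨a', b'⟩ hp' h
    simp only [coe_filter, Set.mem_setOf_eq, add_left_inj] at hp hp' h
    simp_all

lemma conv2 (x y δ:ℕ) (h : x < y) (hd : 0 < δ) : (x + δ) ^ 2 + y ^ 2 < (y + δ) ^ 2 + x ^ 2 := by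
  nlinarith

lemma conv3 (x y δ:ℕ) (h : x < y) (hd : 0 < δ) : (x + δ) ^ 3 + y ^ 3 < (y + δ) ^ 3 + x ^ 3 := by
  have := Nat.mul_lt_mul_of_pos_right h hd
  nlinarith

lemma tau_bd (n m:ℕ) (h1 : 1 ≤ m) (h2 : m ≤ n) : tau m ≤ (n:ℝ) ^ (1 / (6:ℝ)) * (1 + ln n) ^ 11 := by
  have h := sum_tau_pow 6 n
  have h3 : tau m ^ 6 ≤ n * (1 + ln n) ^ 2 ^ 6 :=
    (single_le_sum (f := fun d => tau d ^ 6) (fun d _ => pow_nonneg (tau_nonneg d) 6) (mem_Icc.2 ⟨h1, h2⟩)).trans h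
  have hl : 0 ≤ ln n := Real.log_natCast_nonneg n
  refine le_of_pow_le_pow_left₀ (n := 6) (by norm_num) (by positivity) (h3.trans ?_)
  rw [mul_pow, ← Real.rpow_mul_natCast (Nat.cast_nonneg n), ← pow_mul]
  norm_num
  gcongr
  · linarith
  · norm_num

lemma offdiag {n l:ℕ} (hn : 51200 < n) :
    ∑ q ∈ ((PP 3 n ×ˢ PP l n) ×ˢ (PP 3 n ×ˢ PP l n)) with q.1.1 ^ 3 + q.1.2 ^ l ≠ q.2.1 ^ 3 + q.2.2 ^ l,
      tau (((q.1.1 ^ 3 + q.1.2 ^ l:ℕ):ℤ) - (q.2.1 ^ 3 + q.2.2 ^ l:ℕ)).natAbs ≤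
      512 * ((n:ℝ) ^ (1 / (3:ℝ)) * #(PP l n)) ^ 2 * (1 + ln n) ^ 2 ^ 10 := by
  obtain ⟨D, hD, hD1⟩ : ∃ D : ℕ, 2 * n ≤ D ^ 8 ∧ 100 * D ^ 3 ≤ n := by
    have hex : ∃ D : ℕ, 2 * n ≤ D ^ 8 := ⟨2 * n, Nat.le_self_pow (by norm_num) _⟩
    classical
    obtain ⟨D, h1, h2⟩ : ∃ D : ℕ, 2 * n ≤ D ^ 8 ∧ ∀ d < D, ¬ 2 * n ≤ d ^ 8 := ⟨Nat.find hex, Nat.find_spec hex, fun d hd => Nat.find_min hex hd⟩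
    refine ⟨D, h1, ?_⟩
    by_contra hc
    push Not at hc
    have hD8 : 9 ≤ D := by
      by_contra h
      have : D ^ 3 ≤ 8 ^ 3 := Nat.pow_le_pow_left (by omega) 3
      omega
    have h3 := h2 (D - 1) (by omega)
    push Not at h3
    have h4 : D ^ 8 ≤ 2 ^ 8 * (D - 1) ^ 8 := by rw [← mul_pow]; exact Nat.pow_le_pow_left (by omega) 8
    have h5 : D ^ 3 * 9 ^ 5 ≤ D ^ 3 * D ^ 5 := Nat.mul_le_mul_left _ (Nat.pow_le_pow_left hD8 5)
    rw [← pow_add] at h5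
    norm_num at h5 h4
    omega
  have hD0 : 1 ≤ D := by rcases Nat.eq_zero_or_pos D with h | h
                         · subst h; omega
                         · exact h
  have hDn : D ≤ n := by have := Nat.le_self_pow (n := 3) (by norm_num) D; omega
  have hDY : (D:ℝ) ≤ (n:ℝ) ^ (1 / (3:ℝ)) := le_root (k := 3) (by norm_num) (by omega)
  set Y : ℝ := (n:ℝ) ^ (1 / (3:ℝ))
  set W := PP 3 n ×ˢ PP l n with hW
  -- the number of pairs with given divisor
  have key : ∀ d ∈ Icc 1 D, (#{q ∈ W ×ˢ W | (((q.1.1 ^ 3 + q.1.2 ^ l:ℕ):ℤ) : ZMod d) = (((q.2.1 ^ 3 + q.2.2 ^ l:ℕ):ℤ) : ZMod d)}:ℝ) ≤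
      2 * (Y * #(PP l n)) ^ 2 * (tau d ^ 2 / d) := by
    intro d hd
    rw [mem_Icc] at hd
    have hd' : (0:ℝ) < d := by exact_mod_cast hd.1
    have hdD : (d:ℝ) ≤ D := by exact_mod_cast hd.2
    set V := PP l n ×ˢ W
    have h1 : (#{q ∈ W ×ˢ W | (((q.1.1 ^ 3 + q.1.2 ^ l:ℕ):ℤ) : ZMod d) = (((q.2.1 ^ 3 + q.2.2 ^ l:ℕ):ℤ) : ZMod d)}:ℝ) ≤
        ∑ v ∈ V, (#{y ∈ PP 3 n | ((y:ℕ) : ZMod d) ^ 3 = ((v.2.1:ZMod d) ^ 3 + (v.2.2:ZMod d) ^ l) - (v.1:ZMod d) ^ l}:ℝ) := by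
      rw [card_eq_sum_card_fiberwise (f := fun q => (q.1.2, q.2)) (t := V)
        (by intro p hp; simp only [coe_filter, Set.mem_setOf_eq, mem_product, hW] at hp; simp [V, hW, hp.1.1.2, hp.1.2])]
      push_cast
      refine sum_le_sum fun v _ => Nat.cast_le.2 (card_le_card_of_injOn (fun q => q.1.1) ?_ ?_)
      · rintro ⟨⟨a, b⟩, q⟩ hp
        simp only [coe_filter, Set.mem_setOf_eq, mem_product, mem_filter, hW] at hp ⊢
        obtain ⟨hp, rfl⟩ := hp
        exact ⟨hp.1.1.1, eq_sub_of_add_eq hp.2⟩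
      · rintro ⟨⟨a, b⟩, q⟩ hp ⟨⟨a', b'⟩, q'⟩ hp' h
        simp only [coe_filter, Set.mem_setOf_eq, mem_filter] at hp hp' h
        obtain ⟨_, rfl⟩ := hp
        have h2 := hp'.2
        simp only [Prod.mk.injEq] at h h2 ⊢
        exact ⟨⟨h, h2.1.symm⟩, h2.2.symm⟩
    have h2 : ∀ v ∈ V, (#{y ∈ PP 3 n | ((y:ℕ) : ZMod d) ^ 3 = ((v.2.1:ZMod d) ^ 3 + (v.2.2:ZMod d) ^ l) - (v.1:ZMod d) ^ l}:ℝ) ≤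
        tau d ^ 2 * (2 * Y / d) := by
      intro v _
      refine (cub_count hd.1 ⌊Y⌋₊ (PP 3 n) (fun y hy => ?_) _).trans ?_
      · refine ⟨Nat.le_floor (PP_le (k := 3) (by norm_num) hy), ?_⟩
        simp only [PP, mem_filter] at hy
        have : D < y := lt_of_pow_lt_pow_left₀ 3 (Nat.zero_le _) (Nat.lt_of_mul_lt_mul_left (hD1.trans_lt hy.2.2.1))
        exact Nat.coprime_of_lt_prime (by omega) (by omega) hy.2.1
      · have : ((⌊Y⌋₊:ℕ):ℝ) ≤ Y := Nat.floor_le (by positivity)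
        gcongr
        rw [div_add_one hd'.ne']
        gcongr
        linarith
    refine h1.trans ((sum_le_sum h2).trans ?_)
    rw [sum_const, nsmul_eq_mul]
    simp only [V, hW, card_product]
    push_cast
    have h3 : (#(PP 3 n):ℝ) ≤ Y := PP_card (k := 3) (n := n) (by norm_num)
    calc (#(PP l n) * (#(PP 3 n) * #(PP l n)) * (tau d ^ 2 * (2 * Y / d)):ℝ) ≤ #(PP l n) * (Y * #(PP l n)) * (tau d ^ 2 * (2 * Y / d)) := by gcongr
      _ = _ := by ring
  calc _ ≤ ∑ q ∈ W ×ˢ W, ∑ d ∈ Icc 1 D, (if (((q.1.1 ^ 3 + q.1.2 ^ l:ℕ):ℤ) : ZMod d) = (((q.2.1 ^ 3 + q.2.2 ^ l:ℕ):ℤ) : ZMod d) then (2 * tau d) ^ 8 else 0) := by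
        rw [sum_filter]
        refine sum_le_sum fun q hq => ?_
        have hnn : ∀ d ∈ Icc 1 D, (0:ℝ) ≤ (if (((q.1.1 ^ 3 + q.1.2 ^ l:ℕ):ℤ) : ZMod d) = (((q.2.1 ^ 3 + q.2.2 ^ l:ℕ):ℤ) : ZMod d) then (2 * tau d) ^ 8 else 0) := by
          intro d _
          split_ifs <;> positivity
        split_ifs with h
        swap
        · exact sum_nonneg hnn
        simp only [hW, mem_product, PP, mem_filter] at hq
        obtain ⟨d, h1, h2, h3⟩ := landreau hD0 8 (((q.1.1 ^ 3 + q.1.2 ^ l:ℕ):ℤ) - (q.2.1 ^ 3 + q.2.2 ^ l:ℕ)).natAbs (by omega) (by omega)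
        have hd0 : 1 ≤ d := Nat.pos_of_dvd_of_pos h1 (by omega)
        refine h3.trans ?_
        refine le_trans ?_ (single_le_sum hnn (mem_Icc.2 ⟨hd0, h2⟩))
        rw [if_pos]
        rw [← sub_eq_zero, ← Int.cast_sub, ZMod.intCast_zmod_eq_zero_iff_dvd]
        exact Int.natCast_dvd.2 h1
    _ = ∑ d ∈ Icc 1 D, (2 * tau d) ^ 8 * (#{q ∈ W ×ˢ W | (((q.1.1 ^ 3 + q.1.2 ^ l:ℕ):ℤ) : ZMod d) = (((q.2.1 ^ 3 + q.2.2 ^ l:ℕ):ℤ) : ZMod d)}:ℝ) := by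
        rw [sum_comm]
        refine sum_congr rfl fun d _ => ?_
        rw [← sum_filter, sum_const, nsmul_eq_mul, mul_comm]
    _ ≤ ∑ d ∈ Icc 1 D, (2 * tau d) ^ 8 * (2 * (Y * #(PP l n)) ^ 2 * (tau d ^ 2 / d)) := by
        refine sum_le_sum fun d hd => mul_le_mul_of_nonneg_left (key d hd) ?_
        positivity
    _ = 512 * (Y * #(PP l n)) ^ 2 * ∑ d ∈ Icc 1 D, tau d ^ 10 / d := by
        rw [mul_sum]
        exact sum_congr rfl fun d _ => by ring
    _ ≤ _ := by
        refine mul_le_mul_of_nonneg_left ((sum_tau_div 10 D).trans ?_) (by positivity)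
        gcongr

lemma rpow_merge {n:ℕ} (hn : 1 ≤ n) {a b:ℝ} (h : a ≤ b) : (n:ℝ) ^ a ≤ (n:ℝ) ^ b :=
  Real.rpow_le_rpow_of_exponent_le (by exact_mod_cast hn) h

lemma quad_count {n l:ℕ} (hn : 51200 < n) (hl1 : 1 ≤ l) (hl : l ≤ 6) :
    (#{p ∈ (PP 2 n ×ˢ (PP 3 n ×ˢ PP l n)) ×ˢ (PP 2 n ×ˢ (PP 3 n ×ˢ PP l n)) |
      p.1.1 ^ 2 + (p.1.2.1 ^ 3 + p.1.2.2 ^ l) = p.2.1 ^ 2 + (p.2.2.1 ^ 3 + p.2.2.2 ^ l)}:ℝ) ≤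
    514 * ((n:ℝ) ^ (1 / (3:ℝ)) * (n:ℝ) ^ (1 / (l:ℝ))) ^ 2 * (1 + ln n) ^ 2 ^ 10 := by
  have hl0 : 0 ≤ ln n := Real.log_natCast_nonneg n
  have hn0 : (0:ℝ) < n := by exact_mod_cast (by omega : 0 < n)
  have hlR : (0:ℝ) < l := by exact_mod_cast hl1
  have hl6 : 1 / 6 ≤ 1 / (l:ℝ) := one_div_le_one_div_of_le hlR (by exact_mod_cast hl)
  set W := PP 3 n ×ˢ PP l n
  set g : ℕ × ℕ → ℕ := fun w => w.1 ^ 3 + w.2 ^ l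
  have h2 : (#(PP 2 n):ℝ) ≤ (n:ℝ) ^ (1 / (2:ℝ)) := PP_card (k := 2) (n := n) (by norm_num)
  have h3 : (#(PP 3 n):ℝ) ≤ (n:ℝ) ^ (1 / (3:ℝ)) := PP_card (k := 3) (n := n) (by norm_num)
  have h4 : (#(PP l n):ℝ) ≤ (n:ℝ) ^ (1 / (l:ℝ)) := PP_card (k := l) (n := n) (by omega)
  have f1 := fib (PP 2 n) W g 2
  refine (Nat.cast_le.2 f1).trans ?_
  rw [Nat.cast_sum, ← sum_filter_add_sum_filter_not _ (fun q => g q.1 = g q.2)]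
  have d1 : (#{q ∈ W ×ˢ W | g q.1 = g q.2}:ℝ) ≤ (n:ℝ) ^ (1 / (3:ℝ)) * (n:ℝ) ^ (1 / (l:ℝ)) +
      ((n:ℝ) ^ (1 / (l:ℝ))) ^ 2 * ((n:ℝ) ^ (1 / (6:ℝ)) * (1 + ln n) ^ 11) := by
    refine (Nat.cast_le.2 (fib (PP 3 n) (PP l n) (fun z => z ^ l) 3)).trans ?_
    rw [Nat.cast_sum, ← sum_filter_add_sum_filter_not _ (fun q => q.1 = q.2)]
    refine add_le_add ?_ ?_
    · refine (sum_le_card_nsmul _ _ ((n:ℝ) ^ (1 / (3:ℝ))) ?_).trans ?_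
      · intro q hq
        rw [(mem_filter.1 hq).2]
        exact (Nat.cast_le.2 (diag_count _ 3 (by norm_num) _)).trans h3
      · rw [nsmul_eq_mul, mul_comm]
        gcongr
        refine le_trans (Nat.cast_le.2 (card_le_card_of_injOn Prod.fst (t := PP l n) ?_ ?_)) h4
        · intro q hq
          simp only [coe_filter, Set.mem_setOf_eq, mem_product] at hq
          exact hq.1.1
        · rintro ⟨a, b⟩ hq ⟨c, d⟩ hq' h
          simp only [coe_filter, Set.mem_setOf_eq] at hq hq' h
          simp_all
    · refine (sum_le_card_nsmul _ _ ((n:ℝ) ^ (1 / (6:ℝ)) * (1 + ln n) ^ 11) ?_).trans ?_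
      · intro q hq
        rw [mem_filter, mem_product] at hq
        have hne : q.1 ^ l ≠ q.2 ^ l := fun h => hq.2 (Nat.pow_left_injective (by omega) h)
        refine (diff_count conv3 (by norm_num) _ hne).trans (tau_bd n _ (by omega) ?_)
        have := hq.1
        simp only [PP, mem_filter] at this
        omega
      · rw [nsmul_eq_mul]
        gcongr
        refine (Nat.cast_le.2 (card_filter_le _ _)).trans ?_
        rw [card_product, Nat.cast_mul, sq]
        gcongr
  have d2 : ∑ q ∈ W ×ˢ W with ¬ g q.1 = g q.2, (#{r ∈ PP 2 n ×ˢ PP 2 n | r.1 ^ 2 + g q.1 = r.2 ^ 2 + g q.2}:ℝ) ≤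
      512 * ((n:ℝ) ^ (1 / (3:ℝ)) * (n:ℝ) ^ (1 / (l:ℝ))) ^ 2 * (1 + ln n) ^ 2 ^ 10 := by
    refine (sum_le_sum fun q hq => diff_count conv2 (by norm_num) _ (mem_filter.1 hq).2).trans ((offdiag hn).trans ?_)
    gcongr
  have d3 : ∑ q ∈ W ×ˢ W with g q.1 = g q.2, (#{r ∈ PP 2 n ×ˢ PP 2 n | r.1 ^ 2 + g q.1 = r.2 ^ 2 + g q.2}:ℝ) ≤
      ((n:ℝ) ^ (1 / (3:ℝ)) * (n:ℝ) ^ (1 / (l:ℝ)) + ((n:ℝ) ^ (1 / (l:ℝ))) ^ 2 * ((n:ℝ) ^ (1 / (6:ℝ)) * (1 + ln n) ^ 11)) * (n:ℝ) ^ (1 / (2:ℝ)) := by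
    refine (sum_le_card_nsmul _ _ ((n:ℝ) ^ (1 / (2:ℝ))) ?_).trans ?_
    · intro q hq
      rw [(mem_filter.1 hq).2]
      exact (Nat.cast_le.2 (diag_count _ 2 (by norm_num) _)).trans h2
    · rw [nsmul_eq_mul]
      gcongr
  have e1 : (n:ℝ) ^ (1 / (3:ℝ)) * (n:ℝ) ^ (1 / (l:ℝ)) * (n:ℝ) ^ (1 / (2:ℝ)) ≤ ((n:ℝ) ^ (1 / (3:ℝ)) * (n:ℝ) ^ (1 / (l:ℝ))) ^ 2 := by
    rw [← Real.rpow_add hn0, ← Real.rpow_add hn0, ← Real.rpow_mul_natCast hn0.le]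
    exact rpow_merge (by omega) (by push_cast; linarith)
  have e2 : ((n:ℝ) ^ (1 / (l:ℝ))) ^ 2 * (n:ℝ) ^ (1 / (6:ℝ)) * (n:ℝ) ^ (1 / (2:ℝ)) = ((n:ℝ) ^ (1 / (3:ℝ)) * (n:ℝ) ^ (1 / (l:ℝ))) ^ 2 := by
    rw [← Real.rpow_add hn0, ← Real.rpow_mul_natCast hn0.le, ← Real.rpow_mul_natCast hn0.le, ← Real.rpow_add hn0, ← Real.rpow_add hn0]
    congr 1; push_cast; ring
  set Z := ((n:ℝ) ^ (1 / (3:ℝ)) * (n:ℝ) ^ (1 / (l:ℝ))) ^ 2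
  have hZ : 0 ≤ Z := by positivity
  have l1 : (1:ℝ) ≤ (1 + ln n) ^ 2 ^ 10 := one_le_pow₀ (by linarith)
  have l2 : (1 + ln n) ^ 11 ≤ (1 + ln n) ^ 2 ^ 10 := pow_le_pow_right₀ (by linarith) (by norm_num)
  generalize (1 + ln n) ^ 2 ^ 10 = X at *
  generalize (1 + ln n) ^ 11 = X' at *
  have m1 := mul_le_mul_of_nonneg_left l1 hZ
  have m2 := mul_le_mul_of_nonneg_left l2 hZ
  rw [← e2] at m2
  nlinarith [d2, d3, e1, e2, m1, m2]

/-- Mean value estimate. -/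
lemma mean_value {n l:ℕ} (hn : 51200 < n) (hl1 : 1 ≤ l) (hl : l ≤ 6) :
    ∑ j ∈ range (8 * n), (‖SS 2 n (j /₈ n)‖ * ‖SS 3 n (j /₈ n)‖ * ‖SS l n (j /₈ n)‖) ^ 2 ≤
    (8 * n:ℕ) * (514 * ((n:ℝ) ^ (1 / (3:ℝ)) * (n:ℝ) ^ (1 / (l:ℝ))) ^ 2 * (1 + ln n) ^ (2 ^ 10 + 6)) := by
  set c : ℕ × ℕ × ℕ → ℂ := fun t => (lp t.1:ℂ) * ((lp t.2.1:ℂ) * (lp t.2.2:ℂ)) with hc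
  have h1 := parseval (T := PP 2 n ×ˢ (PP 3 n ×ˢ PP l n)) (M := 8 * n) (by omega) c (fun t => t.1 ^ 2 + (t.2.1 ^ 3 + t.2.2 ^ l))
    (by intro t ht; simp only [PP, mem_product, mem_filter] at ht; omega)
  have h2 : ∀ α : ℝ, ‖SS 2 n α‖ * ‖SS 3 n α‖ * ‖SS l n α‖ = ‖∑ t ∈ PP 2 n ×ˢ (PP 3 n ×ˢ PP l n), c t * ee (α * (t.1 ^ 2 + (t.2.1 ^ 3 + t.2.2 ^ l):ℕ))‖ := by
    intro α
    rw [← norm_mul, ← norm_mul, mul_assoc]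
    unfold SS
    rw [sum_mul_sum (s := PP 3 n), ← sum_product', sum_mul_sum, ← sum_product']
    congr 1
    refine sum_congr rfl fun t _ => ?_
    rw [Nat.cast_add, Nat.cast_add, mul_add, mul_add, ee_add, ee_add]
    ring
  simp only [h2]
  refine h1.trans (mul_le_mul_of_nonneg_left ?_ (by positivity))
  have hlp : ∀ {k p}, p ∈ PP k n → ‖(lp p:ℂ)‖ ≤ 1 + ln n := by
    intro k p hp
    simp only [PP, mem_filter, mem_range] at hp
    rw [norm_real, Real.norm_of_nonneg (lp_nonneg _)]
    have := lp_le_log p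
    have : ln p ≤ ln n := Real.log_le_log (by exact_mod_cast hp.2.1.pos) (by exact_mod_cast (by omega : p ≤ n))
    linarith
  have hcb : ∀ t ∈ PP 2 n ×ˢ (PP 3 n ×ˢ PP l n), ‖c t‖ ≤ (1 + ln n) ^ 3 := by
    intro t ht
    simp only [mem_product] at ht
    simp only [hc, norm_mul]
    calc _ ≤ (1 + ln n) * ((1 + ln n) * (1 + ln n)) := by
          have := hlp ht.1
          have := hlp ht.2.1
          have := hlp ht.2.2
          gcongr
      _ = _ := by ring
  refine (sum_le_card_nsmul _ _ ((1 + ln n) ^ 6) ?_).trans ?_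
  · intro p hp
    simp only [mem_filter, mem_product] at hp
    calc _ ≤ (1 + ln n) ^ 3 * (1 + ln n) ^ 3 := by
          refine mul_le_mul (hcb _ ?_) (hcb _ ?_) (norm_nonneg _) (by positivity)
          · simpa using hp.1.1
          · simpa using hp.1.2
      _ = _ := by ring
  · rw [nsmul_eq_mul, pow_add _ (2 ^ 10), ← mul_assoc]
    exact mul_le_mul_of_nonneg_right (quad_count hn hl1 hl) (by positivity)

def kk : Fin 7 → ℕ := ![2, 2, 3, 3, 5, 6, 7]

noncomputable def Gs (k q a:ℕ) : ℂ := ∑ r ∈ range q with r.Coprime q, ee (((a * r ^ k:ℕ):ℝ) / q)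

noncomputable def As (n q:ℕ) : ℂ := ∑ a ∈ range q with a.Coprime q, (∏ i, Gs (kk i) q a / q.totient) * ee (-(((n * a:ℕ):ℝ) / q))

noncomputable def gz (k q:ℕ) [NeZero q] (a : ZMod q) : ℂ := ∑ u : (ZMod q)ˣ, ZMod.stdAddChar (a * (u : ZMod q) ^ k)

noncomputable def bz (n q:ℕ) [NeZero q] (a : ZMod q) : ℂ := (∏ i, gz (kk i) q a / q.totient) * ZMod.stdAddChar (-((n : ZMod q) * a))

lemma sum_units (q:ℕ) [NeZero q] (f : ZMod q → ℂ) : ∑ r ∈ range q with r.Coprime q, f r = ∑ u : (ZMod q)ˣ, f u := by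
  symm
  refine sum_nbij (fun u => (u : ZMod q).val) (fun u _ => ?_) (fun u _ v _ h => ?_) (fun r hr => ?_) (fun u _ => ?_)
  · exact mem_filter.2 ⟨mem_range.2 (ZMod.val_lt _), ZMod.val_coe_unit_coprime u⟩
  · exact Units.ext (ZMod.val_injective q h)
  · simp only [coe_filter, mem_range, Set.mem_setOf_eq] at hr
    refine ⟨ZMod.unitOfCoprime r hr.2, by simp, ?_⟩
    simp [ZMod.coe_unitOfCoprime, ZMod.val_natCast, Nat.mod_eq_of_lt hr.1]
  · simp

lemma std_ee (q:ℕ) [NeZero q] (j:ℤ) : ZMod.stdAddChar (j : ZMod q) = ee ((j:ℝ) / q) := by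
  rw [ZMod.stdAddChar_coe, ee]
  congr 1; push_cast; ring

lemma Gs_eq (k q:ℕ) [NeZero q] (a:ℕ) : Gs k q a = gz k q a := by
  rw [gz, ← sum_units q (fun u => ZMod.stdAddChar ((a : ZMod q) * u ^ k)), Gs]
  refine sum_congr rfl fun r _ => ?_
  have := std_ee q ((a * r ^ k:ℕ):ℤ)
  push_cast at this ⊢
  rw [this]

lemma As_eq (n q:ℕ) [NeZero q] : As n q = ∑ u : (ZMod q)ˣ, bz n q u := by
  rw [← sum_units q (bz n q), As]
  refine sum_congr rfl fun a _ => ?_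
  have := std_ee q (-((n * a:ℕ):ℤ))
  push_cast at this
  simp only [bz, Gs_eq, this]
  push_cast
  rw [neg_div]

lemma units_sum_mul {q r:ℕ} [NeZero q] [NeZero r] (h : q.Coprime r) (f : ZMod q → ℂ) (g : ZMod r → ℂ) :
    ∑ u : (ZMod (q * r))ˣ, f (ZMod.castHom (dvd_mul_right q r) (ZMod q) u) * g (ZMod.castHom (dvd_mul_left r q) (ZMod r) u) =
      (∑ u : (ZMod q)ˣ, f u) * ∑ u : (ZMod r)ˣ, g u := by
  rw [sum_mul_sum, ← sum_product', univ_product_univ]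
  refine Fintype.sum_equiv ((Units.mapEquiv (ZMod.chineseRemainder h).toMulEquiv).trans MulEquiv.prodUnits).toEquiv _ _ fun u => ?_
  congr 1
  · exact congrArg f (DFunLike.congr_fun (Subsingleton.elim (ZMod.castHom (dvd_mul_right q r) (ZMod q)) ((RingHom.fst _ _).comp (ZMod.chineseRemainder h).toRingHom)) (u : ZMod (q * r)))
  · exact congrArg g (DFunLike.congr_fun (Subsingleton.elim (ZMod.castHom (dvd_mul_left r q) (ZMod r)) ((RingHom.snd _ _).comp (ZMod.chineseRemainder h).toRingHom)) (u : ZMod (q * r)))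

lemma std_mul {q r:ℕ} [NeZero q] [NeZero r] (h : q.Coprime r) : ∃ (s : (ZMod q)ˣ) (t : (ZMod r)ˣ), ∀ z : ZMod (q * r),
    ZMod.stdAddChar z = ZMod.stdAddChar ((s : ZMod q) * ZMod.castHom (dvd_mul_right q r) (ZMod q) z) *
      ZMod.stdAddChar ((t : ZMod r) * ZMod.castHom (dvd_mul_left r q) (ZMod r) z) := by
  have e := Int.gcd_eq_gcd_ab q r
  rw [Int.gcd_natCast_natCast, h] at e
  set a := Int.gcdA q r
  set b := Int.gcdB q r
  have h1 : (b : ZMod q) * (r : ZMod q) = 1 := by have := congrArg (Int.cast : ℤ → ZMod q) e; push_cast at this; simp at this; rw [mul_comm]; exact this.symm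
  have h2 : (a : ZMod r) * (q : ZMod r) = 1 := by have := congrArg (Int.cast : ℤ → ZMod r) e; push_cast at this; simp at this; rw [mul_comm]; exact this.symm
  refine ⟨⟨b, r, h1, by rw [mul_comm]; exact h1⟩, ⟨a, q, h2, by rw [mul_comm]; exact h2⟩, fun z => ?_⟩
  obtain ⟨j, rfl⟩ := ZMod.intCast_surjective z
  simp only [map_intCast, ← Int.cast_mul]
  rw [std_ee, std_ee, std_ee, ← ee_add]
  congr 1
  have hq : (q:ℝ) ≠ 0 := NeZero.ne _
  have hr : (r:ℝ) ≠ 0 := NeZero.ne _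
  have e' : (1:ℝ) = q * a + r * b := by exact_mod_cast e
  push_cast
  field_simp
  linear_combination (j:ℝ) * e'

lemma As_mul_aux (n:ℕ) {N q r:ℕ} [NeZero N] [NeZero q] [NeZero r] (c : ZMod N →+* ZMod q) (d : ZMod N →+* ZMod r)
    (hφ : N.totient = q.totient * r.totient) (US : ∀ (f : ZMod q → ℂ) (g : ZMod r → ℂ), ∑ u : (ZMod N)ˣ, f (c u) * g (d u) =
      (∑ u : (ZMod q)ˣ, f u) * ∑ u : (ZMod r)ˣ, g u) (s : (ZMod q)ˣ) (t : (ZMod r)ˣ)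
    (hst : ∀ z : ZMod N, ZMod.stdAddChar z = ZMod.stdAddChar ((s : ZMod q) * c z) * ZMod.stdAddChar ((t : ZMod r) * d z)) :
    As n N = As n q * As n r := by
  have hg : ∀ k (a : ZMod N), gz k N a = gz k q ((s : ZMod q) * c a) * gz k r ((t : ZMod r) * d a) := by
    intro k a
    unfold gz
    rw [← US (fun u => ZMod.stdAddChar (((s : ZMod q) * c a) * u ^ k)) (fun u => ZMod.stdAddChar (((t : ZMod r) * d a) * u ^ k))]
    refine sum_congr rfl fun u _ => ?_
    rw [hst]; simp only [map_mul, map_pow, mul_assoc]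
  have hb : ∀ a : ZMod N, bz n N a = bz n q ((s : ZMod q) * c a) * bz n r ((t : ZMod r) * d a) := by
    intro a
    unfold bz
    rw [hst, hφ]
    simp only [hg, map_neg, map_mul, map_natCast]
    rw [mul_mul_mul_comm, ← prod_mul_distrib]
    congr 1
    · refine prod_congr rfl fun i _ => ?_
      push_cast
      rw [mul_div_mul_comm]
    · congr 2 <;> ring
  rw [As_eq n N, As_eq n q, As_eq n r, sum_congr (g := fun u : (ZMod N)ˣ => bz n q ((s : ZMod q) * c u) * bz n r ((t : ZMod r) * d u)) rfl fun u _ => hb u]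
  rw [US (fun a => bz n q ((s : ZMod q) * a)) (fun a => bz n r ((t : ZMod r) * a)),
    ← Equiv.sum_comp (Equiv.mulLeft s) (fun u : (ZMod q)ˣ => bz n q u), ← Equiv.sum_comp (Equiv.mulLeft t) (fun u : (ZMod r)ˣ => bz n r u)]
  simp only [Equiv.coe_mulLeft, Units.val_mul]

lemma As_mul (n:ℕ) {q r:ℕ} (h : q.Coprime r) : As n (q * r) = As n q * As n r := by
  rcases Nat.eq_zero_or_pos q with rfl | hq
  · simp [As]
  rcases Nat.eq_zero_or_pos r with rfl | hr
  · simp [As]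
  have : NeZero q := ⟨hq.ne'⟩
  have : NeZero r := ⟨hr.ne'⟩
  obtain ⟨s, t, hst⟩ := std_mul h
  exact As_mul_aux n _ _ (Nat.totient_mul h) (units_sum_mul h) s t hst

lemma sum_std (q:ℕ) [NeZero q] (b : ZMod q) : ∑ x : ZMod q, ZMod.stdAddChar (x * b) = if b = 0 then (q:ℂ) else 0 := by
  rw [AddChar.sum_mulShift b (ZMod.isPrimitive_stdAddChar q), ZMod.card]; push_cast; rfl

lemma gz_zero {p e k:ℕ} (hp : p.Prime) (he : 2 ≤ e) (hk : ¬ p ∣ k) (hk2 : k = 2 ∨ k = 3) {q:ℕ} (hq : q = p ^ e) [NeZero q] (a : (ZMod q)ˣ) :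
    gz k q a = 0 := by
  set ε : ZMod q := ((p ^ (e - 1):ℕ) : ZMod q) with hε
  have h1 : ε * ε = 0 := by
    rw [hε, ← Nat.cast_mul, ZMod.natCast_eq_zero_iff, ← pow_add, hq]
    exact pow_dvd_pow p (by omega)
  have h2 : (k : ZMod q) * ε ≠ 0 := by
    rw [hε, ← Nat.cast_mul, Ne, ZMod.natCast_eq_zero_iff, hq]
    intro h
    rw [show p ^ e = p * p ^ (e - 1) by rw [← pow_succ']; congr 1; omega] at h
    exact hk (Nat.dvd_of_mul_dvd_mul_right (pow_pos hp.pos _) h)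
  have h3 : ∀ s : ZMod q, gz k q a = ∑ u : (ZMod q)ˣ, ZMod.stdAddChar ((a : ZMod q) * (u : ZMod q) ^ k) * ZMod.stdAddChar (s * ((a : ZMod q) * (u : ZMod q) ^ k * ((k : ZMod q) * ε))) := by
    intro s
    have hu : (1 + ε * s) * (1 - ε * s) = 1 := by linear_combination (-s ^ 2) * h1
    let v : (ZMod q)ˣ := ⟨1 + ε * s, 1 - ε * s, hu, by rw [mul_comm]; exact hu⟩
    unfold gz
    rw [← Equiv.sum_comp (Equiv.mulRight v)]
    refine sum_congr rfl fun u _ => ?_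
    rw [← AddChar.map_add_eq_mul]
    congr 1
    rw [Equiv.coe_mulRight, Units.val_mul, show ((v : (ZMod q)ˣ) : ZMod q) = 1 + ε * s from rfl]
    rcases hk2 with rfl | rfl
    · push_cast; linear_combination ((a : ZMod q) * (u : ZMod q) ^ 2 * s ^ 2) * h1
    · push_cast; linear_combination ((a : ZMod q) * (u : ZMod q) ^ 3 * (3 * s ^ 2 + ε * s ^ 3)) * h1
  have h4 : (q:ℂ) * gz k q a = 0 := by
    have : ∑ s : ZMod q, gz k q a = (q:ℂ) * gz k q a := by simp [ZMod.card]
    rw [← this, sum_congr rfl fun s _ => h3 s, sum_comm]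
    refine sum_eq_zero fun u _ => ?_
    rw [← mul_sum, sum_std, if_neg, mul_zero]
    intro h
    apply h2
    have : (((a * u ^ k)⁻¹ * (a * u ^ k) : (ZMod q)ˣ) : ZMod q) * (k * ε) = 0 := by rw [Units.val_mul, mul_assoc]; push_cast; rw [h, mul_zero]
    simpa using this
  exact (mul_eq_zero.1 h4).resolve_left (NeZero.ne _)

lemma As_pp (n:ℕ) {p e:ℕ} (hp : p.Prime) (he : 2 ≤ e) : As n (p ^ e) = 0 := by
  have : NeZero (p ^ e) := ⟨pow_ne_zero _ hp.ne_zero⟩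
  rw [As_eq]
  refine sum_eq_zero fun u _ => ?_
  obtain ⟨i, hi, h2⟩ : ∃ i, ¬ p ∣ kk i ∧ (kk i = 2 ∨ kk i = 3) := by
    by_cases h : p = 2
    · subst h; exact ⟨2, by simp [kk], by simp [kk]⟩
    · exact ⟨0, by rw [show kk 0 = 2 from rfl, Nat.prime_dvd_prime_iff_eq hp Nat.prime_two]; exact h, by simp [kk]⟩
  rw [bz, prod_eq_zero (mem_univ i), zero_mul]
  rw [gz_zero hp he hi h2 rfl, zero_div]

lemma root_count {p:ℕ} [Fact p.Prime] {k:ℕ} (hk : 0 < k) (c : ZMod p) : #{u : (ZMod p)ˣ | (u : ZMod p) ^ k = c} ≤ k := by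
  refine le_trans ?_ (Polynomial.card_nthRoots k c)
  refine le_trans ?_ (Multiset.toFinset_card_le _)
  refine card_le_card_of_injOn (fun u => (u : ZMod p)) (fun u hu => ?_) (fun u _ v _ h => Units.ext h)
  simp only [coe_filter, mem_univ, true_and, Set.mem_setOf_eq] at hu
  simp [Polynomial.mem_nthRoots hk, hu]

lemma gz_bound {p:ℕ} [Fact p.Prime] {k:ℕ} (hk : 0 < k) (a : (ZMod p)ˣ) : ‖gz k p a‖ ^ 2 ≤ k ^ 2 * p := by
  have hp1 : (0:ℝ) < Fintype.card (ZMod p)ˣ := by exact_mod_cast Fintype.card_pos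
  have h1 : ∀ u : (ZMod p)ˣ, gz k p ((a : ZMod p) * (u : ZMod p) ^ k) = gz k p a := by
    intro u
    unfold gz
    exact Fintype.sum_equiv (Equiv.mulLeft u) _ _ fun v => by simp [mul_pow, mul_assoc]
  have h2 : ∑ u : (ZMod p)ˣ, ‖gz k p ((a : ZMod p) * (u : ZMod p) ^ k)‖ ^ 2 ≤ k * ∑ b : ZMod p, ‖gz k p b‖ ^ 2 := by
    rw [← sum_fiberwise_of_maps_to (s := univ) (t := univ) (g := fun u : (ZMod p)ˣ => (a : ZMod p) * (u : ZMod p) ^ k) (fun _ _ => mem_univ _), mul_sum]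
    refine sum_le_sum fun b _ => ?_
    rw [sum_congr rfl (g := fun _ => ‖gz k p b‖ ^ 2) (fun u hu => by rw [(mem_filter.1 hu).2]), sum_const, nsmul_eq_mul]
    gcongr
    refine le_trans (card_le_card fun u hu => ?_) (root_count hk (((a⁻¹ : (ZMod p)ˣ) : ZMod p) * b))
    simp only [mem_filter, mem_univ, true_and] at hu ⊢
    rw [← hu, Units.inv_mul_cancel_left]
  have h3 : ∑ b : ZMod p, ‖gz k p b‖ ^ 2 ≤ p * (k * Fintype.card (ZMod p)ˣ) := by
    have e : ((∑ b : ZMod p, ‖gz k p b‖ ^ 2:ℝ):ℂ) = ((p * ∑ u : (ZMod p)ˣ, (#{v : (ZMod p)ˣ | (v : ZMod p) ^ k = (u : ZMod p) ^ k}:ℝ):ℝ):ℂ) := by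
      push_cast
      have : ∀ b : ZMod p, ((‖gz k p b‖:ℝ):ℂ) ^ 2 = ∑ u : (ZMod p)ˣ, ∑ v : (ZMod p)ˣ, ZMod.stdAddChar (b * ((u : ZMod p) ^ k - (v : ZMod p) ^ k)) := by
        intro b
        rw [← mul_conj', gz, map_sum, sum_mul_sum]
        refine sum_congr rfl fun u _ => sum_congr rfl fun v _ => ?_
        rw [← AddChar.map_neg_eq_conj, ← AddChar.map_add_eq_mul]
        congr 1; ring
      simp only [this]
      rw [sum_comm, mul_sum]
      refine sum_congr rfl fun u _ => ?_
      rw [sum_comm, card_filter, Nat.cast_sum, mul_sum]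
      refine sum_congr rfl fun v _ => ?_
      rw [sum_std]
      simp only [sub_eq_zero, eq_comm (a := (u : ZMod p) ^ k)]
      split_ifs <;> simp
    rw [ofReal_inj] at e
    rw [e]
    gcongr
    refine (sum_le_card_nsmul _ _ (k:ℝ) fun u _ => Nat.cast_le.2 (root_count hk _)).trans ?_
    rw [nsmul_eq_mul, card_univ, mul_comm]
  simp only [h1, sum_const, nsmul_eq_mul, card_univ] at h2
  have h4 : (Fintype.card (ZMod p)ˣ:ℝ) * ‖gz k p a‖ ^ 2 ≤ Fintype.card (ZMod p)ˣ * (k ^ 2 * p) := by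
    calc _ ≤ k * ∑ b : ZMod p, ‖gz k p b‖ ^ 2 := h2
      _ ≤ k * (p * (k * Fintype.card (ZMod p)ˣ)) := by gcongr
      _ = _ := by ring
  exact le_of_mul_le_mul_left h4 hp1

lemma As_prime_bound (n:ℕ) {p:ℕ} (hp : p.Prime) : ‖As n p‖ ≤ 4 ^ 10 * (p:ℝ) ^ (-(5 / 2):ℝ) := by
  have : Fact p.Prime := ⟨hp⟩
  have hp0 : (0:ℝ) < p := by exact_mod_cast hp.pos
  have hp2 : (2:ℝ) ≤ p := by exact_mod_cast hp.two_le
  rw [As_eq]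
  have hc : (p.totient:ℝ) = p - 1 := by rw [Nat.totient_prime hp, Nat.cast_sub hp.one_le]; simp
  set x := √p
  have hx0 : 0 < x := Real.sqrt_pos.2 hp0
  have hxx : x ^ 2 = p := Real.sq_sqrt hp0.le
  have h1 : ∀ u : (ZMod p)ˣ, ‖bz n p u‖ ≤ ∏ i, ((kk i:ℝ) * (x / (x ^ 2 / 2))) := by
    intro u
    rw [bz, norm_mul, AddChar.norm_apply, mul_one, norm_prod]
    refine prod_le_prod (fun _ _ => norm_nonneg _) fun i _ => ?_
    rw [norm_div, norm_natCast, hc, ← mul_div_assoc]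
    refine div_le_div₀ (by positivity) ?_ (by positivity) (by linarith)
    refine le_of_pow_le_pow_left₀ two_ne_zero (by positivity) ?_
    rw [mul_pow, hxx]
    refine gz_bound ?_ u
    fin_cases i <;> simp [kk]
  have h2 : (p:ℝ) ^ (-(5 / 2):ℝ) = (x ^ 5)⁻¹ := by
    rw [Real.rpow_neg hp0.le, ← hxx, ← Real.rpow_natCast_mul hx0.le]
    congr 1
    rw [← Real.rpow_natCast]; congr 1; norm_num
  refine (norm_sum_le_of_le _ fun u _ => h1 u).trans ?_
  rw [sum_const, nsmul_eq_mul, card_univ, ZMod.card_units_eq_totient, hc, h2]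
  rw [prod_mul_distrib, ← Nat.cast_prod, show ∏ i, kk i = 7560 by decide, prod_const, card_univ, Fintype.card_fin, ← hxx, ← sub_nonneg]
  field_simp
  push_cast
  nlinarith

lemma loc_sol {p:ℕ} [hF : Fact p.Prime] {n:ℕ} (hn : n % 2 = 1) : ∃ x : Fin 7 → (ZMod p)ˣ, ∑ i, (x i : ZMod p) ^ kk i = n := by
  have hp := hF.out
  by_cases h2 : p = 2
  · subst h2
    refine ⟨fun _ => 1, ?_⟩
    have : (n : ZMod 2) = 1 := (ZMod.natCast_eq_one_iff_odd).2 (Nat.odd_iff.2 hn)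
    rw [this]
    simp
    rfl
  have hp3 : 3 ≤ p := by have := hp.two_le; omega
  let A : ℕ → Finset (ZMod p) := fun k => univ.image fun u : (ZMod p)ˣ => (u : ZMod p) ^ k
  have hA2 : p - 1 ≤ 2 * #(A 2) := by
    have := card_le_mul_card_image (f := fun u : (ZMod p)ˣ => (u : ZMod p) ^ 2) univ 2 (fun b _ => root_count (by norm_num) b)
    rwa [card_univ, ZMod.card_units_eq_totient, Nat.totient_prime hp] at this
  have hA3 : 2 ≤ #(A 3) := by
    have : Fact (2 < p) := ⟨by omega⟩
    refine le_trans (card_pair (ZMod.neg_one_ne_one (n := p)).symm).ge (card_le_card ?_)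
    intro b hb
    rcases mem_insert.1 hb with rfl | hb
    · exact mem_image.2 ⟨1, mem_univ _, by simp⟩
    · rw [mem_singleton.1 hb]; exact mem_image.2 ⟨-1, mem_univ _, by push_cast; ring⟩
  have ne2 : (A 2).Nonempty := ⟨1, mem_image.2 ⟨1, mem_univ _, by simp⟩⟩
  have ne3 : (A 3).Nonempty := ⟨1, mem_image.2 ⟨1, mem_univ _, by simp⟩⟩
  open scoped Pointwise in
  have c : (n : ZMod p) - 3 ∈ (A 2 + A 2) + (A 3 + A 3) := by
    have c1 := ZMod.cauchy_davenport hp ne2 ne2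
    have c2 := ZMod.cauchy_davenport hp ne3 ne3
    have c3 := ZMod.cauchy_davenport hp (ne2.add ne2) (ne3.add ne3)
    have c4 : #((A 2 + A 2) + (A 3 + A 3)) = Fintype.card (ZMod p) := le_antisymm (card_le_univ _) (by rw [ZMod.card]; omega)
    rw [(card_eq_iff_eq_univ _).1 c4]; exact mem_univ _
  simp only [mem_add, A, mem_image, mem_univ, true_and] at c
  obtain ⟨_, ⟨_, ⟨a, rfl⟩, _, ⟨b, rfl⟩, rfl⟩, _, ⟨_, ⟨c, rfl⟩, _, ⟨d, rfl⟩, rfl⟩, he⟩ := c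
  refine ⟨![a, b, c, d, 1, 1, 1], ?_⟩
  simp only [Fin.sum_univ_seven, kk]
  simp only [Matrix.cons_val, Units.val_one, one_pow]
  linear_combination he

lemma As_prime {n p:ℕ} (hn : n % 2 = 1) (hp : p.Prime) : ∃ r : ℝ, 1 + As n p = r ∧ (p:ℝ) ^ (-6:ℤ) ≤ r := by
  have : Fact p.Prime := ⟨hp⟩
  have hp2 : (2:ℝ) ≤ p := by exact_mod_cast hp.two_le
  let F : (Fin 7 → (ZMod p)ˣ) → ZMod p := fun x => (∑ i, (x i : ZMod p) ^ kk i) - n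
  have h0 : ∀ b : ZMod p, ∑ u : (ZMod p)ˣ, ZMod.stdAddChar ((u : ZMod p) * b) = (if b = 0 then (p:ℂ) else 0) - 1 := by
    intro b
    rw [← sum_std, ← add_sum_erase univ _ (mem_univ (0 : ZMod p)), zero_mul, AddChar.map_zero_eq_one, add_sub_cancel_left]
    refine sum_nbij (fun u => (u : ZMod p)) (fun u _ => by simp) (fun u _ v _ h => Units.ext h) (fun a ha => ?_) (fun _ _ => rfl)
    have : a ≠ 0 := by simpa using ha
    exact ⟨Units.mk0 a this, by simp, rfl⟩
  have h1 : (p.totient:ℂ) ^ 7 * As n p = p * (#{x | F x = 0}:ℕ) - (p.totient:ℂ) ^ 7 := by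
    have e : ∀ u : (ZMod p)ˣ, (p.totient:ℂ) ^ 7 * bz n p u = ∑ x : Fin 7 → (ZMod p)ˣ, ZMod.stdAddChar ((u : ZMod p) * F x) := by
      intro u
      have ht : (p.totient:ℂ) ≠ 0 := by exact_mod_cast (Nat.totient_pos.2 hp.pos).ne'
      rw [bz, prod_div_distrib, prod_const, card_univ, Fintype.card_fin, ← mul_assoc, mul_div_cancel₀ _ (pow_ne_zero _ ht)]
      unfold gz
      rw [prod_univ_sum, Fintype.piFinset_univ, sum_mul]
      refine sum_congr rfl fun x _ => ?_
      have hs : ∀ (y : Fin 7 → ZMod p), ∏ i, ZMod.stdAddChar (y i) = ZMod.stdAddChar (∑ i, y i) := fun y => by simp only [Fin.prod_univ_seven, Fin.sum_univ_seven, AddChar.map_add_eq_mul]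
      rw [hs, ← AddChar.map_add_eq_mul]
      congr 1
      simp only [F, mul_sub, mul_sum]
      ring
    rw [As_eq, mul_sum, sum_congr rfl fun u _ => e u, sum_comm]
    simp only [h0]
    rw [sum_sub_distrib, ← sum_filter, sum_const, sum_const, card_univ, Fintype.card_fun, Fintype.card_fin, ZMod.card_units_eq_totient]
    simp [mul_comm]
  have hN : 1 ≤ #{x | F x = 0} := by
    obtain ⟨x, hx⟩ := loc_sol (p := p) hn
    exact card_pos.2 ⟨x, by simp [F, hx]⟩
  have hc : (p.totient:ℝ) = p - 1 := by rw [Nat.totient_prime hp, Nat.cast_sub hp.one_le]; simp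
  have ht : (0:ℝ) < p.totient := by rw [hc]; linarith
  refine ⟨p * (#{x | F x = 0}:ℕ) / (p.totient:ℝ) ^ 7, ?_, ?_⟩
  · push_cast
    rw [eq_div_iff (pow_ne_zero _ (by exact_mod_cast ht.ne'))]
    linear_combination h1
  · rw [le_div_iff₀ (by positivity)]
    calc (p:ℝ) ^ (-6:ℤ) * (p.totient:ℝ) ^ 7 ≤ (p:ℝ) ^ (-6:ℤ) * (p:ℝ) ^ 7 := by gcongr; exact Nat.totient_le p
      _ = (p:ℝ) * 1 := by rw [← zpow_natCast, ← zpow_add₀ (by positivity)]; norm_num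
      _ ≤ _ := by gcongr; exact_mod_cast hN

lemma As_bound : ∃ K : ℝ, 1 ≤ K ∧ ∀ n q : ℕ, ‖As n q‖ ≤ K * ((q:ℝ) ^ 2)⁻¹ := by
  obtain ⟨C, hC, h⟩ := pow_omega_le (ε := 1 / 20) (by norm_num)
  refine ⟨C ^ 10, one_le_pow₀ hC, fun n q => ?_⟩
  rcases Nat.eq_zero_or_pos q with rfl | hq
  · simp [As]
  have hq' : (0:ℝ) < q := by exact_mod_cast hq
  have h1 : ‖As n q‖ ≤ ∏ p ∈ q.primeFactors, (4 ^ 10 * ((p ^ q.factorization p:ℕ):ℝ) ^ (-(5 / 2):ℝ)) := by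
    rw [Nat.multiplicative_factorization (As n) (fun _ _ h => As_mul n h) (by simp [As, Gs, ee_zero]) hq.ne', Finsupp.prod, norm_prod, Nat.support_factorization]
    refine prod_le_prod (fun _ _ => norm_nonneg _) fun p hp => ?_
    have hpp := Nat.prime_of_mem_primeFactors hp
    have : q.factorization p ≠ 0 := by rw [← Finsupp.mem_support_iff]; exact hp
    rcases (by omega : q.factorization p = 1 ∨ 2 ≤ q.factorization p) with h3 | h3
    · rw [h3, pow_one]; exact As_prime_bound n hpp
    · rw [As_pp n hpp h3, norm_zero]; positivity
  rw [prod_mul_distrib, prod_const, Real.finsetProd_rpow _ _ (fun _ _ => by positivity), ← Nat.cast_prod,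
    show ∏ p ∈ q.primeFactors, p ^ q.factorization p = q from Nat.prod_factorization_pow_eq_self hq.ne', ← pow_mul, mul_comm 10, pow_mul] at h1
  refine h1.trans ?_
  calc _ ≤ (C * (q:ℝ) ^ (1 / 20:ℝ)) ^ 10 * (q:ℝ) ^ (-(5 / 2):ℝ) := by gcongr; exact h q hq.ne'
    _ = C ^ 10 * ((q:ℝ) ^ (1 / 20 * (10:ℕ):ℝ) * (q:ℝ) ^ (-(5 / 2):ℝ)) := by rw [mul_pow, Real.rpow_mul_natCast hq'.le]; ring
    _ = _ := by rw [← Real.rpow_add hq', ← Real.rpow_natCast (q:ℝ) 2, ← Real.rpow_neg hq'.le]; norm_num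

/-- Lower bound for the truncated singular series. -/
lemma sing : ∃ c : ℝ, 0 < c ∧ ∃ Q0 : ℕ, ∀ n Q : ℕ, n % 2 = 1 → Q0 ≤ Q → c ≤ (∑ q ∈ range (Q + 1), As n q).re := by
  obtain ⟨K, hK, hb⟩ := As_bound
  obtain ⟨P, hP⟩ := exists_nat_ge (K ^ 2 + 4 ^ 20 + 2)
  have hP2 : 2 ≤ P := by
    have : (2:ℝ) ≤ P := by nlinarith
    exact_mod_cast this
  let c : ℝ := (∏ p ∈ Nat.primesBelow P, (p:ℝ) ^ (-6:ℤ)) * (1 / P)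
  have hsum : Summable fun q : ℕ => K * ((q:ℝ) ^ 2)⁻¹ := (Real.summable_nat_pow_inv.2 one_lt_two).mul_left K
  have hc : 0 < c := mul_pos (prod_pos fun p hp => zpow_pos (by exact_mod_cast (Nat.prime_of_mem_primesBelow hp).pos) _) (by positivity)
  have ht := (tendsto_order.1 (tendsto_sum_nat_add fun q : ℕ => K * ((q:ℝ) ^ 2)⁻¹)).2 (c / 2) (by positivity)
  obtain ⟨Q0, hQ0⟩ := Filter.eventually_atTop.1 ht
  refine ⟨c / 2, by positivity, Q0, fun n Q hn hQ => ?_⟩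
  have hs : Summable fun q => ‖As n q‖ := Summable.of_nonneg_of_le (fun _ => norm_nonneg _) (hb n) hsum
  choose! r hr1 hr2 using fun p hp => As_prime (n := n) (p := p) hn hp
  have h1 : ∀ p, p.Prime → ∑' e, As n (p ^ e) = r p := by
    intro p hp
    rw [tsum_eq_sum (s := range 2) (fun e he => As_pp n hp (by simp at he; omega)), sum_range_succ, sum_range_one, pow_zero, pow_one, ← hr1 p hp]
    simp [As, Gs, ee_zero]
  have h2 : ∀ N, P ≤ N → c ≤ ∏ p ∈ Nat.primesBelow N, r p := by
    intro N hN
    obtain ⟨D, hD⟩ : ∃ D, D = ∏ p ∈ Nat.primesBelow P, (p:ℝ) ^ (-6:ℤ) := ⟨_, rfl⟩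
    have hD0 : 0 < D := hD ▸ prod_pos fun p hp => zpow_pos (by exact_mod_cast (Nat.prime_of_mem_primesBelow hp).pos) _
    have hP' : (2:ℝ) ≤ P := by exact_mod_cast hP2
    have key : D * (1 / P * (N / (N - 1))) ≤ ∏ p ∈ Nat.primesBelow N, r p := by
      induction N, hN using Nat.le_induction with
      | base =>
        calc _ ≤ D * 1 := by
              gcongr
              rw [one_div, ← mul_div_assoc, inv_mul_cancel₀ (by linarith), div_le_one (by linarith)]
              linarith
          _ ≤ _ := by
              rw [mul_one, hD]
              exact prod_le_prod (fun p hp => by positivity) fun p hp => hr2 p (Nat.prime_of_mem_primesBelow hp)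
      | succ N hN ih =>
        have hN' : (P:ℝ) ≤ N := by exact_mod_cast hN
        have hN0 : (0:ℝ) < N := by linarith
        have hN1 : (0:ℝ) < N - 1 := by linarith
        push_cast
        rw [add_sub_cancel_right, Nat.primesBelow_succ]
        split_ifs with hp
        · rw [prod_insert (Nat.notMem_primesBelow N), mul_comm (r N)]
          have hrN : 1 - 1 / (N:ℝ) ^ 2 ≤ r N := by
            have a1 := As_prime_bound n hp
            have a2 := (abs_le.1 ((abs_re_le_norm _).trans a1)).1
            have a3 := congrArg re (hr1 N hp)
            rw [add_re, one_re, ofReal_re] at a3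
            have a4 : 4 ^ 10 * (N:ℝ) ^ (-(5 / 2):ℝ) ≤ 1 / (N:ℝ) ^ 2 := by
              rw [show (-(5 / 2):ℝ) = -(1 / 2) + -(2:ℕ) by norm_num, Real.rpow_add hN0, Real.rpow_neg hN0.le, Real.rpow_neg hN0.le, Real.rpow_natCast, ← Real.sqrt_eq_rpow, one_div, ← mul_assoc]
              refine mul_le_of_le_one_left (by positivity) ?_
              rw [← div_eq_mul_inv, div_le_one (by positivity)]
              exact Real.le_sqrt_of_sq_le (by nlinarith [sq_nonneg K])
            linarith
          calc _ = D * (1 / P * (N / (N - 1))) * (1 - 1 / (N:ℝ) ^ 2) := by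
                field_simp
                ring
            _ ≤ _ := mul_le_mul ih hrN (by rw [sub_nonneg, div_le_one (by positivity)]; nlinarith) (le_trans (by positivity) ih)
        · refine le_trans ?_ ih
          gcongr D * (1 / P * ?_)
          rw [div_le_div_iff₀ hN0 hN1]; nlinarith
    refine le_trans ?_ key
    have hN' : (P:ℝ) ≤ N := by exact_mod_cast hN
    simp only [c, ← hD]
    gcongr
    refine le_mul_of_one_le_right (by positivity) ?_
    rw [le_div_iff₀ (by linarith)]; linarith
  have h3 : c ≤ (∑' q, As n q).re := by
    have := EulerProduct.eulerProduct (f := As n) (by simp [As, Gs, ee_zero]) (fun h => As_mul n h) hs (by simp [As])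
    refine ge_of_tendsto ((continuous_re.tendsto _).comp this) ?_
    filter_upwards [Filter.eventually_ge_atTop P] with N hN
    rw [Function.comp_apply, prod_congr rfl fun p hp => h1 p (Nat.prime_of_mem_primesBelow hp), ← ofReal_prod, ofReal_re]
    exact h2 N hN
  have h4 := (hs.of_norm).sum_add_tsum_nat_add (Q + 1)
  have h5 : ‖∑' q, As n (q + (Q + 1))‖ ≤ ∑' q, K * (((q + (Q + 1):ℕ):ℝ) ^ 2)⁻¹ :=
    tsum_of_norm_bounded ((summable_nat_add_iff (Q + 1)).2 hsum).hasSum fun q => hb n _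
  have h6 := hQ0 (Q + 1) (by omega)
  have h7 := (abs_re_le_norm (∑' q, As n (q + (Q + 1)))).trans h5
  rw [← h4, add_re] at h3
  have := (abs_le.1 h7).2
  linarith

noncomputable def rr (k m:ℕ) : ℝ := (m:ℝ) ^ (1 / (k:ℝ))

noncomputable def ww (k m:ℕ) : ℝ := rr k m - rr k (m - 1)

def II (n:ℕ) : Finset ℕ := Ico (n / 100 + 1) (n + 1)

noncomputable def vv (k n:ℕ) (β:ℝ) : ℂ := ∑ m ∈ II n, (ww k m:ℂ) * ee (β * m)

lemma rr_pow {k:ℕ} (hk : k ≠ 0) (m:ℕ) : rr k m ^ k = m := by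
  rw [rr, one_div, Real.rpow_inv_natCast_pow (by positivity) hk]

lemma rr_nonneg (k m:ℕ) : 0 ≤ rr k m := by unfold rr; positivity

lemma rr_mono (k:ℕ) {a b:ℕ} (h : a ≤ b) : rr k a ≤ rr k b := by unfold rr; gcongr

lemma mem_II {n m:ℕ} : m ∈ II n ↔ n < 100 * m ∧ m ≤ n := by
  rw [II, mem_Ico]; omega

lemma ww_nonneg (k m:ℕ) : 0 ≤ ww k m := sub_nonneg.2 (rr_mono k (by omega))

lemma ww_eq {k m:ℕ} (hk : k ≠ 0) (hm : 1 ≤ m) : rr k m ^ k - rr k (m - 1) ^ k = 1 := by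
  rw [rr_pow hk, rr_pow hk, Nat.cast_sub hm]; simp

lemma ww_le {k n m:ℕ} (hk : k ≠ 0) (hm : m ∈ II n) : ww k m ≤ 100 * rr k n / n := by
  rw [mem_II] at hm
  have h1 := ww_eq hk (by omega : 1 ≤ m)
  have h2 : rr k (m - 1) ≤ rr k m := rr_mono k (by omega)
  have h3 := rr_nonneg k (m - 1)
  have h4 : rr k m ≤ rr k n := rr_mono k hm.2
  have h5 := rr_pow hk m
  have h6 : (n:ℝ) ≤ 100 * m := by exact_mod_cast hm.1.le
  have hw := ww_nonneg k m
  rw [le_div_iff₀ (by have : 0 < n := by omega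
                      positivity)]
  have h7 : ww k m * m ≤ rr k m := by
    obtain ⟨j, rfl⟩ := Nat.exists_eq_succ_of_ne_zero hk
    unfold ww at *
    generalize rr j.succ m = a at *
    generalize rr j.succ (m - 1) = b at *
    have := mul_le_mul_of_nonneg_left (pow_le_pow_left₀ h3 h2 j) (mul_nonneg (h3.trans h2) h3)
    rw [← h5]
    rw [Nat.succ_eq_add_one, pow_succ, pow_succ] at *
    nlinarith
  nlinarith

lemma pow_sub_le {a b:ℝ} (hb : 0 ≤ b) (h : b ≤ a) (j:ℕ) : a ^ (j + 1) - b ^ (j + 1) ≤ (j + 1) * a ^ j * (a - b) := by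
  induction j with
  | zero => simp
  | succ j ih =>
    have h2 := mul_le_mul_of_nonneg_right (pow_le_pow_left₀ hb h (j + 1)) (sub_nonneg.2 h)
    push_cast
    rw [pow_succ a (j + 1), pow_succ b (j + 1)]
    rw [pow_succ a j] at *
    nlinarith

lemma ww_ge {k n m:ℕ} (hk : k ≠ 0) (h0 : 1 ≤ m) (hm : m ≤ n) : rr k n / (k * n) ≤ ww k m := by
  have h1 := ww_eq hk h0
  have h2 : rr k (m - 1) ≤ rr k m := rr_mono k (by omega)
  have h4 : rr k m ≤ rr k n := rr_mono k hm
  have h5 := rr_pow hk n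
  rw [div_le_iff₀ (by have : 0 < n := by omega
                      positivity), ← h5]
  obtain ⟨j, rfl⟩ := Nat.exists_eq_succ_of_ne_zero hk
  have h6 := pow_sub_le (rr_nonneg _ _) h2 j
  rw [Nat.succ_eq_add_one] at *
  have h7 := pow_le_pow_left₀ (rr_nonneg _ _) h4 j
  have h8 : 1 ≤ ((j:ℝ) + 1) * rr (j + 1) n ^ j * ww (j + 1) m := by rw [h1] at h6; refine h6.trans ?_; unfold ww at *; gcongr
  have := mul_le_mul_of_nonneg_left h8 (rr_nonneg (j + 1) n)
  rw [pow_succ]; push_cast; linarith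

lemma ww_anti {k m:ℕ} (hk : k ≠ 0) (hm : 1 ≤ m) : ww k (m + 1) ≤ ww k m := by
  have hk1 : (1:ℝ) ≤ k := by exact_mod_cast Nat.one_le_iff_ne_zero.2 hk
  obtain ⟨_, hc⟩ := Real.concaveOn_rpow (p := 1 / (k:ℝ)) (by positivity) (by rw [div_le_one (by linarith)]; exact hk1)
  have := hc (Set.mem_Ici.2 (Nat.cast_nonneg (m - 1))) (Set.mem_Ici.2 (Nat.cast_nonneg (m + 1)))
    (by norm_num : (0:ℝ) ≤ 1 / 2) (by norm_num : (0:ℝ) ≤ 1 / 2) (by norm_num)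
  simp only [smul_eq_mul] at this
  rw [show (1 / 2:ℝ) * ((m - 1:ℕ):ℝ) + 1 / 2 * ((m + 1:ℕ):ℝ) = m by push_cast [Nat.cast_sub hm]; ring] at this
  unfold ww rr
  rw [Nat.add_sub_cancel]
  linarith

lemma vv_le {k n:ℕ} (hk : k ≠ 0) (hn : 0 < n) (β:ℝ) : ‖vv k n β‖ ≤ 100 * rr k n := by
  calc _ ≤ ∑ m ∈ II n, 100 * rr k n / n := by
        refine norm_sum_le_of_le _ fun m hm => ?_
        rw [norm_mul, norm_ee, mul_one, norm_real, Real.norm_of_nonneg (ww_nonneg k m)]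
        exact ww_le hk hm
    _ = #(II n) * (100 * rr k n / n) := by rw [sum_const, nsmul_eq_mul]
    _ ≤ n * (100 * rr k n / n) := by
        have := rr_nonneg k n
        gcongr
        rw [II, Nat.card_Ico]; omega
    _ = _ := by field_simp

lemma vv_decay {k n:ℕ} (hk : k ≠ 0) (hn : 0 < n) {β:ℝ} (hβ : 0 < di β) : ‖vv k n β‖ ≤ 50 * rr k n / (n * di β) := by
  have hz := four_di_le β
  have h1 : ee β ≠ 1 := fun h => by rw [h] at hz; simp at hz; linarith
  have h2 := abel_antitone (w := fun i => ww k (n / 100 + 1 + i)) (b := fun i => ee (β * (n / 100 + 1 + i:ℕ))) (N := n + 1 - (n / 100 + 1)) (M := 1 / (2 * di β))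
    (fun i _ => ww_anti (m := n / 100 + 1 + i) hk (by omega)) (fun i _ => ww_nonneg _ _) (fun N _ => by
      have e : ∀ i : ℕ, ee (β * (n / 100 + 1 + i:ℕ)) = ee (β * (n / 100 + 1:ℕ)) * ee β ^ i := fun i => by rw [← ee_nsmul, ← ee_add]; congr 1; push_cast; ring
      rw [sum_congr rfl fun i _ => e i, ← mul_sum, norm_mul, norm_ee, one_mul, geom_sum_eq h1, norm_div]
      have : ‖ee β ^ N - 1‖ ≤ 2 := (norm_sub_le _ _).trans (by rw [norm_pow, norm_ee]; norm_num)
      calc _ ≤ 2 / (4 * di β) := by gcongr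
        _ = _ := by field_simp; norm_num)
  rcases h2 with h2 | h2
  · rw [vv, II, sum_Ico_eq_sum_range]
    refine h2.trans ?_
    rw [add_zero]
    calc _ ≤ 1 / (2 * di β) * (100 * rr k n / n) := by
          gcongr; exact ww_le hk (mem_II.2 (by omega))
      _ = _ := by field_simp; ring
  · omega

lemma abel_var {b z : ℕ → ℂ} {s n:ℕ} {E δ:ℝ} (hE : 0 ≤ E) (hδ : 0 ≤ δ) (hB : ∀ T, s ≤ T → T ≤ n → ‖∑ m ∈ Ico s T, b m‖ ≤ E)
    (hz : ∀ m, ‖z m - z (m + 1)‖ ≤ δ) (T:ℕ) (hs : s ≤ T) (hT : T ≤ n) :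
    ‖∑ m ∈ Ico s T, b m * z m - (∑ m ∈ Ico s T, b m) * z T‖ ≤ E * (T * δ) := by
  induction T, hs using Nat.le_induction with
  | base => simp; positivity
  | succ T hs ih =>
    have h1 := hB (T + 1) (by omega) hT
    rw [sum_Ico_succ_top hs] at *
    rw [sum_Ico_succ_top hs]
    calc _ = ‖(∑ m ∈ Ico s T, b m * z m - (∑ m ∈ Ico s T, b m) * z T) + (∑ m ∈ Ico s T, b m + b T) * (z T - z (T + 1))‖ := by congr 1; ring
      _ ≤ E * (T * δ) + E * δ := (norm_add_le _ _).trans (add_le_add (ih (by omega)) (by rw [norm_mul]; exact mul_le_mul h1 (hz T) (norm_nonneg _) hE))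
      _ = _ := by push_cast; ring

lemma norm_ee_sub_one (β:ℝ) : ‖ee β - 1‖ ≤ 7 * |β| := by
  have := Real.norm_exp_I_mul_ofReal_sub_one_le (x := 2 * pi * β)
  rw [ee, show (2 * pi * β * I:ℂ) = I * ((2 * pi * β:ℝ):ℂ) by push_cast; ring]
  refine this.trans ?_
  rw [Real.norm_eq_abs, abs_mul, abs_of_pos (by positivity)]
  gcongr; linarith [Real.pi_lt_d2]

lemma mem_PP {k n p:ℕ} (hk : k ≠ 0) : p ∈ PP k n ↔ p.Prime ∧ n < 100 * p ^ k ∧ p ^ k ≤ n := by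
  simp only [PP, mem_filter, mem_range, and_iff_right_iff_imp]
  rintro ⟨_, _, h⟩
  have := Nat.le_self_pow hk p
  omega

lemma PP_sum {k n T:ℕ} (hk : k ≠ 0) (F z : ℕ → ℂ) :
    ∑ m ∈ Ico (n / 100 + 1) T, (∑ p ∈ PP k n, if p ^ k = m then F p else 0) * z m = ∑ p ∈ PP k n, if p ^ k < T then F p * z (p ^ k) else 0 := by
  simp only [sum_mul]
  rw [sum_comm]
  refine sum_congr rfl fun p hp => ?_
  simp only [ite_mul, zero_mul, sum_ite_eq, mem_Ico]
  rw [mem_PP hk] at hp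
  exact if_congr (by omega) rfl rfl

lemma le_rt {k a m:ℕ} (hk : k ≠ 0) : a < ⌊rr k m⌋₊ + 1 ↔ a ^ k ≤ m := by
  rw [Nat.lt_succ_iff, Nat.le_floor_iff (rr_nonneg k m)]
  refine ⟨fun h => ?_, le_root hk⟩
  have := pow_le_pow_left₀ (by positivity) h k
  rw [rr_pow hk] at this
  exact_mod_cast this

lemma SS_abel {k n q a:ℕ} (hk : k ≠ 0) (hq : 0 < q) {E:ℝ} (hE : 0 ≤ E) (hn : 0 < n) (hc : ∀ p ∈ PP k n, p.Coprime q)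
    (h : ∀ (t r:ℕ), n / 100 ≤ t → t ≤ n → r.Coprime q → |th (⌊rr k t⌋₊ + 1) q r - rr k t / q.totient| ≤ E) (β:ℝ) :
    ‖SS k n (a / q + β) - Gs k q a / q.totient * vv k n β‖ ≤ 2 * q * E * (1 + 14 * n * |β|) := by
  have : NeZero q := ⟨hq.ne'⟩
  let g : ℕ → ℂ := fun p => ee (((a * p ^ k:ℕ):ℝ) / q)
  let b : ℕ → ℂ := fun m => (∑ p ∈ PP k n, if p ^ k = m then lp p * g p else 0) - Gs k q a / q.totient * ww k m
  have hg : ∀ x y : ℕ, (x : ZMod q) = y → g x = g y := by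
    intro x y hxy
    have h1 := std_ee q ((a * x ^ k:ℕ):ℤ)
    have h2 := std_ee q ((a * y ^ k:ℕ):ℤ)
    rw [Int.cast_natCast, Int.cast_natCast] at h1 h2
    rw [show g x = _ from h1.symm, show g y = _ from h2.symm]; push_cast; rw [hxy]
  have hB : ∀ T, n / 100 + 1 ≤ T → T ≤ n + 1 → ‖∑ m ∈ Ico (n / 100 + 1) T, b m‖ ≤ 2 * q * E := by
    intro T h1 h2
    have e1 : ∑ m ∈ Ico (n / 100 + 1) T, ww k m = rr k (T - 1) - rr k (n / 100) := by
      induction T, h1 using Nat.le_induction with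
      | base => simp
      | succ T hs ih =>
        rw [sum_Ico_succ_top hs, ih (by omega), ww, Nat.add_sub_cancel]; ring
    have e2 : ∑ m ∈ Ico (n / 100 + 1) T, (∑ p ∈ PP k n, if p ^ k = m then lp p * g p else 0) =
        ∑ r ∈ range q with r.Coprime q, g r * ((th (⌊rr k (T - 1:ℕ)⌋₊ + 1) q r - th (⌊rr k (n / 100:ℕ)⌋₊ + 1) q r:ℝ):ℂ) := by
      have e3 := PP_sum (T := T) (n := n) hk (fun p => lp p * g p) 1
      simp only [Pi.one_apply, mul_one] at e3
      have hle : ⌊rr k (n / 100:ℕ)⌋₊ + 1 ≤ ⌊rr k (T - 1:ℕ)⌋₊ + 1 := Nat.succ_le_succ (Nat.floor_mono (rr_mono k (by omega)))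
      simp only [th]
      simp only [← sum_Ico_eq_sub _ hle, ofReal_sum, mul_sum]
      rw [e3, sum_comm, ← sum_filter]
      refine sum_subset_zero_on_sdiff (fun p hp => ?_) (fun p hp => ?_) (fun p hp => ?_)
      · rw [mem_filter, mem_PP hk] at hp
        rw [mem_Ico, le_rt hk, ← not_lt, le_rt hk]; omega
      · simp only [mem_sdiff, mem_Ico, le_rt hk, ← not_lt, mem_filter, mem_PP hk] at hp
        have : lp p = 0 := if_neg fun h => by simp only [h, true_and] at hp; omega
        simp [this]
      · rw [mem_filter] at hp
        rw [sum_eq_single (p % q)]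
        · rw [if_pos (by simp), hg (p % q) p (by simp)]; ring
        · intro r hr hne
          rw [if_neg, ofReal_zero, mul_zero]
          intro h3
          rw [ZMod.natCast_eq_natCast_iff'] at h3
          simp only [mem_filter, mem_range] at hr
          rw [h3, Nat.mod_eq_of_lt hr.1] at hne; exact hne rfl
        · intro h3
          refine absurd (mem_filter.2 ⟨mem_range.2 (Nat.mod_lt _ hq), ?_⟩) h3
          rw [Nat.Coprime, ← Nat.gcd_rec, Nat.gcd_comm]; exact hc p hp.1
    have e4 : ∑ m ∈ Ico (n / 100 + 1) T, b m = ∑ r ∈ range q with r.Coprime q, g r *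
        (((th (⌊rr k (T - 1:ℕ)⌋₊ + 1) q r - rr k (T - 1) / q.totient) - (th (⌊rr k (n / 100:ℕ)⌋₊ + 1) q r - rr k (n / 100) / q.totient):ℝ):ℂ) := by
      rw [sum_sub_distrib, e2, ← mul_sum, ← ofReal_sum, e1, Gs, div_mul_eq_mul_div, mul_div_assoc, sum_mul, ← sum_sub_distrib]
      refine sum_congr rfl fun r _ => ?_
      simp only [g]; push_cast; ring
    rw [e4]
    calc _ ≤ ∑ r ∈ range q with r.Coprime q, (E + E) := norm_sum_le_of_le _ fun r hr => by
          rw [norm_mul, norm_ee, one_mul, norm_real]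
          have hr := (mem_filter.1 hr).2
          exact (norm_sub_le _ _).trans (add_le_add (h _ r (by omega) (by omega) hr) (h _ r le_rfl (by omega) hr))
      _ = #{r ∈ range q | r.Coprime q} * (E + E) := by rw [sum_const, nsmul_eq_mul]
      _ ≤ q * (E + E) := by gcongr; simpa using card_filter_le (range q) fun r => r.Coprime q
      _ = _ := by ring
  have e5 : SS k n (a / q + β) - Gs k q a / q.totient * vv k n β = ∑ m ∈ Ico (n / 100 + 1) (n + 1), b m * ee (β * m) := by
    simp only [b, sub_mul]
    rw [sum_sub_distrib, PP_sum hk (fun p => lp p * g p) (fun m => ee (β * m)), vv, mul_sum, SS, II]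
    congr 1
    · refine sum_congr rfl fun p hp => ?_
      rw [if_pos (Nat.lt_succ_of_le ((mem_PP hk).1 hp).2.2), add_mul, ee_add]
      simp only [g]; push_cast; ring_nf
    · exact sum_congr rfl fun _ _ => by ring
  have h1 := abel_var (z := fun m => ee (β * m)) (by positivity) (by positivity : 0 ≤ 7 * |β|) hB (fun m => by
    push_cast
    rw [mul_add, ee_add, mul_one, ← mul_one_sub, norm_mul, norm_ee, one_mul, norm_sub_rev]; exact norm_ee_sub_one β) (n + 1) (by omega) le_rfl
  have h2 := hB (n + 1) (by omega) le_rfl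
  rw [e5]
  have h3 := norm_le_norm_sub_add (∑ m ∈ Ico (n / 100 + 1) (n + 1), b m * ee (β * m)) ((∑ m ∈ Ico (n / 100 + 1) (n + 1), b m) * ee (β * (n + 1:ℕ)))
  rw [norm_mul, norm_ee, mul_one] at h3
  have hn' : (1:ℝ) ≤ n := by exact_mod_cast hn
  calc _ ≤ 2 * q * E * ((n + 1:ℕ) * (7 * |β|)) + 2 * q * E := by linarith
    _ ≤ 2 * q * E * ((n + n) * (7 * |β|)) + 2 * q * E := by push_cast; gcongr
    _ = _ := by ring

lemma ev_log (T:ℝ) (A:ℕ) : ∀ᶠ n : ℕ in Filter.atTop, T ≤ ln n ∧ ln n ^ A ≤ (n:ℝ) ^ (1 / 14:ℝ) := by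
  have h1 := (isLittleO_log_rpow_rpow_atTop (A:ℝ) (by norm_num : (0:ℝ) < 1 / 14)).bound one_pos
  have h2 := (h1.and (Real.tendsto_log_atTop.eventually_ge_atTop (max T 0)))
  filter_upwards [tendsto_natCast_atTop_atTop.eventually h2] with n hn
  have h3 := max_le_iff.1 hn.2
  refine ⟨h3.1, ?_⟩
  rw [← Real.rpow_natCast]
  have := hn.1
  rw [one_mul, Real.norm_eq_abs, Real.norm_eq_abs, abs_of_nonneg (Real.rpow_nonneg h3.2 _), abs_of_nonneg (by positivity)] at this
  exact this

lemma rr_low {k t n:ℕ} (hk : 1 ≤ k) (hk7 : k ≤ 7) (hn : 40000 ≤ n) (ht : n / 100 ≤ t) : (n:ℝ) ^ (1 / 14:ℝ) ≤ rr k t := by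
  have h7 : (k:ℝ) ≤ 7 := by exact_mod_cast hk7
  have hn1 : (40000:ℝ) ≤ n := by exact_mod_cast hn
  have h1 : (n:ℝ) ^ (1 / 2:ℝ) ≤ t := by
    rw [← Real.sqrt_eq_rpow, Real.sqrt_le_left (by positivity)]
    have : n ≤ t ^ 2 := by nlinarith [(by omega : n < 100 * t + 100), (by omega : 400 ≤ t)]
    exact_mod_cast this
  calc (n:ℝ) ^ (1 / 14:ℝ) ≤ (n:ℝ) ^ (1 / 2 * (1 / k):ℝ) := by
        refine Real.rpow_le_rpow_of_exponent_le (by linarith) ?_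
        have : (1:ℝ) / 7 ≤ 1 / k := by gcongr
        linarith
    _ ≤ _ := by rw [Real.rpow_mul (by positivity), rr]; gcongr

lemma SS_approx (D:ℕ) : ∀ᶠ n : ℕ in Filter.atTop, ∀ (k q a:ℕ) (β:ℝ), 1 ≤ k → k ≤ 7 → 0 < q → (q:ℝ) ≤ ln n ^ D →
    ‖SS k n (a / q + β) - Gs k q a / q.totient * vv k n β‖ ≤ rr k n / ln n ^ D * (1 + 14 * n * |β|) := by
  obtain ⟨C, hC, hsw⟩ := siegel_walfisz (2 * D + 1)
  filter_upwards [ev_log (2 * (2 * C * 14 ^ (2 * D + 1) + 1) + 9) (2 * D + 1), Filter.eventually_ge_atTop 40000] with n hL hn k q a β hk hk7 hq hqL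
  obtain ⟨L, hLd⟩ : ∃ L, L = ln n := ⟨_, rfl⟩
  obtain ⟨W, hW⟩ : ∃ W : ℝ, W = 14 ^ (2 * D + 1) := ⟨_, rfl⟩
  rw [← hLd] at hL hqL ⊢
  rw [← hW] at hL
  have hk0 : k ≠ 0 := by omega
  have hW1 : 1 ≤ W := hW ▸ one_le_pow₀ (by norm_num)
  have hL9 : 9 ≤ L := by nlinarith
  have hL1 : 1 ≤ L := by linarith
  have hLD : 1 ≤ L ^ D := one_le_pow₀ hL1
  have hA : L ^ (2 * D + 1) = L ^ D * (L ^ D * L) := by ring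
  have hlow : ∀ t, n / 100 ≤ t → L ^ (2 * D + 1) ≤ rr k t := fun t ht => hL.2.trans (rr_low hk hk7 hn ht)
  have hqA : (q:ℝ) < L ^ (2 * D + 1) := by rw [hA]; nlinarith [mul_le_mul hLD hL1 zero_le_one (by positivity)]
  have hr0 := rr_nonneg k n
  have key := SS_abel (a := a) (E := (2 * C * W + 1) * rr k n / L ^ (2 * D + 1)) hk0 hq (by positivity) (by omega : 0 < n) (fun p hp => by
    rw [mem_PP hk0] at hp
    refine (Nat.Prime.coprime_iff_not_dvd hp.1).2 fun h => (Nat.le_of_dvd hq h).not_gt ?_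
    have h1 : ¬ p < ⌊rr k (n / 100:ℕ)⌋₊ + 1 := by rw [le_rt hk0]; omega
    have h2 : ((⌊rr k (n / 100:ℕ)⌋₊ + 1:ℕ):ℝ) ≤ p := by exact_mod_cast not_lt.1 h1
    have h3 := Nat.lt_floor_add_one (rr k (n / 100:ℕ))
    push_cast at h2
    exact_mod_cast (by linarith [hlow _ le_rfl] : (q:ℝ) < p)) (fun t r ht1 ht2 hr => by
    have : NeZero q := ⟨hq.ne'⟩
    have h1 := hlow t ht1
    obtain ⟨X, hX⟩ : ∃ X, X = ⌊rr k t⌋₊ + 1 := ⟨_, rfl⟩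
    rw [← hX]
    have hX1 : rr k t ≤ X := by rw [hX]; push_cast; exact (Nat.lt_floor_add_one _).le
    have hX2 : (X:ℝ) ≤ rr k t + 1 := by rw [hX]; push_cast; linarith [Nat.floor_le (rr_nonneg k t)]
    have hX3 := rr_mono k ht2
    have hLA : L ≤ L ^ (2 * D + 1) := le_self_pow₀ hL1 (by omega)
    have hlog : L / 14 ≤ ln X := by
      have hn0 : (0:ℝ) < n := by have : 0 < n := by omega
                                 positivity
      have := Real.log_le_log (by positivity) ((rr_low hk hk7 hn ht1).trans hX1)
      rw [Real.log_rpow hn0, ← hLd] at this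
      linarith
    have hpw : L ^ (2 * D + 1) / W ≤ ln X ^ (2 * D + 1) := by rw [hW, ← div_pow]; gcongr
    have h2 := hsw X q r (by exact_mod_cast (by linarith : (9:ℝ) ≤ X)) (hqL.trans (le_trans ?_ hpw)) ((ZMod.isUnit_iff_coprime r q).2 hr)
    · have hphi : (1:ℝ) ≤ q.totient := by exact_mod_cast Nat.totient_pos.2 hq
      have h3 : |(X:ℝ) / q.totient - rr k t / q.totient| ≤ 1 := by rw [← sub_div, abs_of_nonneg (div_nonneg (by linarith) (by linarith)), div_le_one (by linarith)]; linarith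
      refine (abs_sub_le _ _ _).trans ((add_le_add h2 h3).trans ?_)
      rw [le_div_iff₀ (by positivity), add_mul]
      have h4 : C * X / ln X ^ (2 * D + 1) * L ^ (2 * D + 1) ≤ C * X * W := by
        calc _ ≤ C * X / (L ^ (2 * D + 1) / W) * L ^ (2 * D + 1) := by gcongr
          _ = _ := by field_simp
      have h5 : C * X * W ≤ C * (2 * rr k n) * W := by gcongr; linarith
      linarith
    · rw [le_div_iff₀ (by linarith), hA]; gcongr; nlinarith) β
  refine key.trans ?_
  gcongr
  rw [le_div_iff₀ (by positivity)]
  calc _ ≤ 2 * L ^ D * ((2 * C * W + 1) * rr k n / L ^ (2 * D + 1)) * L ^ D := by gcongr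
    _ = 2 * (2 * C * W + 1) / L * rr k n := by rw [hA]; field_simp
    _ ≤ 1 * rr k n := by gcongr; rw [div_le_one (by linarith)]; linarith
    _ = _ := one_mul _

lemma ortho {n:ℕ} (hn : 0 < n) (T : Fin 7 → Finset ℕ) (f : Fin 7 → ℕ → ℕ) (c : Fin 7 → ℕ → ℂ) (hf : ∀ i, ∀ t ∈ T i, f i t ≤ n) :
    ∑ j ∈ range (8 * n), (∏ i, ∑ t ∈ T i, c i t * ee (j /₈ n * (f i t:ℕ))) * ee (-(j /₈ n * n)) =
      (8 * n:ℕ) * ∑ x ∈ Fintype.piFinset T with ∑ i, f i (x i) = n, ∏ i, c i (x i) := by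
  have h1 : ∀ (j:ℕ) (x : Fin 7 → ℕ), (∏ i, c i (x i) * ee (j /₈ n * (f i (x i):ℕ))) * ee (-(j /₈ n * n)) =
      (∏ i, c i (x i)) * ee (j /₈ n * ((∑ i, (f i (x i):ℤ) - n:ℤ):ℝ)) := by
    intro j x
    rw [prod_mul_distrib, mul_assoc]
    simp only [Fin.prod_univ_seven, Fin.sum_univ_seven, ← ee_add]
    congr 2; push_cast; ring
  simp only [prod_univ_sum, sum_mul, h1]
  rw [sum_comm, sum_filter, mul_sum]
  refine sum_congr rfl fun x hx => ?_
  rw [← mul_sum, sum_ee_div (by omega)]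
  have h2 : ∀ i, f i (x i) ≤ n := fun i => hf i _ (Fintype.mem_piFinset.1 hx i)
  have h3 : ∑ i, f i (x i) ≤ 7 * n := by simpa using sum_le_card_nsmul univ (fun i => f i (x i)) n fun i _ => h2 i
  rw [← Nat.cast_sum]
  generalize ∑ i, f i (x i) = s at *
  have h4 : ((8 * n:ℕ):ℤ) ∣ (s:ℤ) - n ↔ s = n :=
    ⟨fun h => by have := Int.eq_zero_of_abs_lt_dvd h (by rw [abs_lt]; omega)
                 omega, fun h => by rw [h]; simp⟩
  simp only [h4]
  split_ifs <;> ring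

noncomputable def JJ (n:ℕ) : ℝ := ∑ x ∈ Fintype.piFinset (fun _ : Fin 7 => II n) with ∑ i, x i = n, ∏ i, ww (kk i) (x i)

noncomputable def Xi (n:ℕ) : ℝ := rr 3 n ^ 2 * rr 5 n * rr 6 n * rr 7 n

lemma prod_rr (n:ℕ) : ∏ i, rr (kk i) n = n * Xi n := by
  rw [Fin.prod_univ_seven, Xi, ← rr_pow two_ne_zero n]
  simp only [kk, Matrix.cons_val]; ring

lemma kk_mem (i : Fin 7) : 1 ≤ kk i ∧ kk i ≤ 7 := by fin_cases i <;> simp [kk]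

lemma JJ_low {n:ℕ} (hn : 10000 ≤ n) : Xi n / 10 ^ 16 ≤ JJ n := by
  have hX : 0 ≤ Xi n := by unfold Xi; have := rr_nonneg; have := this 5 n; have := rr_nonneg 6 n; have := rr_nonneg 7 n; positivity
  have h1 : (n / 100:ℝ) ^ 6 ≤ #{x ∈ Fintype.piFinset (fun _ : Fin 7 => II n) | ∑ i, x i = n} := by
    have h2 := card_le_card_of_injOn (s := Fintype.piFinset fun _ : Fin 6 => Ioc (n / 8) (n / 7)) (t := {x ∈ Fintype.piFinset (fun _ : Fin 7 => II n) | ∑ i, x i = n})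
      (fun y => Fin.cons (n - ∑ i, y i) y) (fun y hy => by
        have hy := fun i => mem_Ioc.1 (Fintype.mem_piFinset.1 hy i)
        have hs : ∑ i, y i ≤ 6 * (n / 7) := by simpa using sum_le_card_nsmul univ y (n / 7) fun i _ => (hy i).2
        simp only [coe_filter, Set.mem_setOf_eq, Fintype.mem_piFinset, mem_II, Fin.sum_univ_succ (n := 6), Fin.cons_zero, Fin.cons_succ]
        refine ⟨fun i => ?_, by omega⟩
        refine Fin.cases ?_ (fun i => ?_) i
        · rw [Fin.cons_zero]; omega
        · rw [Fin.cons_succ]; have := hy i; omega)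
      (fun y _ z _ h => funext fun i => by simpa using congrFun h i.succ)
    rw [Fintype.card_piFinset_const, Nat.card_Ioc] at h2
    refine le_trans ?_ (Nat.cast_le.2 h2)
    push_cast [Fintype.card_fin]
    gcongr
    rw [div_le_iff₀ (by norm_num)]
    exact_mod_cast (by omega : n ≤ (n / 7 - n / 8) * 100)
  calc Xi n / 10 ^ 16 ≤ (n / 100:ℝ) ^ 6 * ∏ i, (rr (kk i) n / (kk i * n)) := by
        rw [prod_div_distrib, prod_rr, prod_mul_distrib, prod_const, card_univ, Fintype.card_fin,
          show ∏ i, (kk i:ℝ) = 7560 by simp only [Fin.prod_univ_seven, kk, Matrix.cons_val]; norm_num]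
        rw [show (n / 100:ℝ) ^ 6 * (n * Xi n / (7560 * n ^ 7)) = Xi n / (7560 * 10 ^ 12) by field_simp; ring]
        gcongr; norm_num
    _ ≤ _ := mul_le_mul_of_nonneg_right h1 (prod_nonneg fun i _ => div_nonneg (rr_nonneg _ _) (by positivity))
    _ ≤ JJ n := by
        rw [← nsmul_eq_mul]
        refine card_nsmul_le_sum _ _ _ fun x hx => ?_
        refine prod_le_prod (fun i _ => div_nonneg (rr_nonneg _ _) (by positivity)) fun i _ => ?_
        have := mem_II.1 (Fintype.mem_piFinset.1 (mem_filter.1 hx).1 i)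
        exact ww_ge (by have := kk_mem i; omega) (by omega) this.2

lemma S7_minor (A:ℕ) : ∃ B : ℕ, ∀ᶠ n : ℕ in Filter.atTop, ∀ (Q q:ℕ) (a:ℤ) (α:ℝ), ln n ^ B ≤ Q → IsCoprime a (q:ℤ) →
    |α - a / q| ≤ 1 / (q:ℝ) ^ 2 → Q ≤ q → q * Q ≤ n → ‖SS 7 n α‖ ≤ rr 7 n / ln n ^ A := by
  obtain ⟨B, P0, h⟩ := minor_arc (A + 1)
  refine ⟨B, ?_⟩
  filter_upwards [ev_log (4 * 14 ^ (A + 1) + P0 + 1) 1, Filter.eventually_ge_atTop 40000] with n hL hn Q q a α hB hc hα hQ hqQ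
  obtain ⟨L, hLd⟩ : ∃ L, L = ln n := ⟨_, rfl⟩
  rw [← hLd] at hL hB ⊢
  have hn0 : (0:ℝ) < n := by have : 0 < n := by omega
                             positivity
  have hpos : (0:ℝ) < 4 * 14 ^ (A + 1) := by positivity
  have hL0 : (0:ℝ) < L := by linarith [(Nat.cast_nonneg P0 : (0:ℝ) ≤ P0)]
  obtain ⟨y, hy⟩ : ∃ y, y = ⌊rr 7 n⌋₊ := ⟨_, rfl⟩
  have h1 : rr 7 n ≤ (y + 1:ℕ) := by rw [hy]; push_cast; exact (Nat.lt_floor_add_one _).le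
  have hlow := rr_low (t := n) (by norm_num : 1 ≤ 7) le_rfl hn (by omega)
  have hr1 : 1 ≤ rr 7 n := by linarith [hL.1, hL.2, (Nat.cast_nonneg P0 : (0:ℝ) ≤ P0)]
  have h2 : ((y + 1:ℕ):ℝ) ≤ 2 * rr 7 n := by rw [hy]; push_cast; linarith [Nat.floor_le (rr_nonneg 7 n)]
  have hlog : L / 14 ≤ ln (y + 1:ℕ) := by
    have := Real.log_le_log (by positivity) (hlow.trans h1)
    rw [Real.log_rpow hn0, ← hLd] at this
    linarith
  have hyn : y ^ 7 ≤ n := (le_rt (by norm_num)).1 (by omega)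
  have hy1 : n ≤ (y + 1) ^ 7 := by
    have := (le_rt (by norm_num : 7 ≠ 0) (a := y + 1) (m := n)).not.1 (by omega)
    omega
  have hyn2 : y + 1 ≤ n := by
    have h8 : 2 ≤ y := by by_contra h9; have : (y + 1) ^ 7 ≤ 2 ^ 7 := Nat.pow_le_pow_left (by omega) 7; omega
    nlinarith [Nat.pow_le_pow_right (by omega : 0 < y) (by norm_num : 2 ≤ 7)]
  have hlog2 : ln (y + 1:ℕ) ^ B ≤ Q := by
    refine le_trans ?_ hB
    rw [hLd]; gcongr
  have key : ∀ z ≤ y + 1, ‖∑ p ∈ range (z + 1), (lp p:ℂ) * ee (α * (p:ℝ) ^ 7)‖ ≤ rr 7 n / L ^ A / 2 := by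
    intro z hz
    refine (h (y + 1) z q a α ?_ hz hc hα (hlog2.trans (by exact_mod_cast hQ)) ?_).trans ?_
    · exact_mod_cast (by linarith [hL.1, hL.2] : (P0:ℝ) ≤ (y + 1:ℕ))
    · calc _ ≤ (q:ℝ) * Q := by gcongr
        _ ≤ (y + 1:ℕ) ^ 7 := by exact_mod_cast hqQ.trans hy1
    · calc _ ≤ 2 * rr 7 n / (L / 14) ^ (A + 1) := by gcongr
        _ = 4 * 14 ^ (A + 1) / L * (rr 7 n / L ^ A / 2) := by rw [div_pow, pow_succ L]; field_simp; norm_num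
        _ ≤ 1 * (rr 7 n / L ^ A / 2) := by gcongr; rw [div_le_one hL0]; linarith [hL.1, (Nat.cast_nonneg P0 : (0:ℝ) ≤ P0)]
        _ = _ := one_mul _
  have e : SS 7 n α = ∑ p ∈ Ico (⌊rr 7 (n / 100:ℕ)⌋₊ + 1) (y + 1), (lp p:ℂ) * ee (α * (p:ℝ) ^ 7) := by
    have h7 : (7:ℕ) ≠ 0 := by norm_num
    rw [SS, hy]
    refine sum_subset_zero_on_sdiff (fun p hp => ?_) (fun p hp => ?_) (fun p hp => by push_cast; rfl)
    · rw [mem_PP h7] at hp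
      rw [mem_Ico, le_rt h7, ← not_lt, le_rt h7]; omega
    · simp only [mem_sdiff, mem_Ico, le_rt h7, ← not_lt, mem_PP h7] at hp
      have : lp p = 0 := if_neg fun h => by simp only [h, true_and] at hp; omega
      simp [this]
  have hle : ⌊rr 7 (n / 100:ℕ)⌋₊ ≤ y := hy ▸ Nat.floor_mono (rr_mono 7 (by omega))
  rw [e, sum_Ico_eq_sub _ (by omega)]
  exact (norm_sub_le _ _).trans (by linarith [key y (by omega), key _ (hle.trans (by omega))])

lemma minor_sum {n:ℕ} (hn : 51200 < n) {s : Finset ℕ} (hs : s ⊆ range (8 * n)) {U:ℝ} (hU : ∀ j ∈ s, ‖SS 7 n (j /₈ n)‖ ≤ U) (h0 : 0 ≤ U) :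
    ∑ j ∈ s, ‖∏ i, SS (kk i) n (j /₈ n)‖ ≤ U * ((8 * n:ℕ) * (514 * (rr 3 n ^ 2 * rr 5 n * rr 6 n) * (1 + ln n) ^ (2 ^ 10 + 6))) := by
  obtain ⟨e, he⟩ : ∃ e, e = 2 ^ 10 + 6 := ⟨_, rfl⟩
  have m5 := mean_value hn (l := 5) (by norm_num) (by norm_num)
  have m6 := mean_value hn (l := 6) (by norm_num) (by norm_num)
  rw [← he] at *
  have r5 := rr_nonneg 5 n
  have r6 := rr_nonneg 6 n
  let F : ℕ → ℕ → ℝ := fun l j => ‖SS 2 n (j /₈ n)‖ * ‖SS 3 n (j /₈ n)‖ * ‖SS l n (j /₈ n)‖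
  have hF : ∀ l j, 0 ≤ F l j := fun l j => by positivity
  have cs := sum_mul_sq_le_sq_mul_sq (range (8 * n)) (F 5) (F 6)
  have h1 : ∑ j ∈ range (8 * n), F 5 j * F 6 j ≤ (8 * n:ℕ) * (514 * (rr 3 n ^ 2 * rr 5 n * rr 6 n) * (1 + ln n) ^ e) := by
    refine abs_le_of_sq_le_sq' (cs.trans ((mul_le_mul m5 m6 (sum_nonneg fun _ _ => sq_nonneg _) (by positivity)).trans (le_of_eq ?_))) (by positivity) |>.2
    simp only [rr, Nat.cast_ofNat]; ring
  refine le_trans ?_ (mul_le_mul_of_nonneg_left h1 h0)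
  rw [mul_sum]
  refine (sum_le_sum fun j hj => ?_).trans (sum_le_sum_of_subset_of_nonneg hs fun j _ _ => mul_nonneg h0 (mul_nonneg (hF 5 j) (hF 6 j)))
  rw [norm_prod, Fin.prod_univ_seven]
  simp only [kk, Matrix.cons_val]
  calc _ = ‖SS 7 n (j /₈ n)‖ * (F 5 j * F 6 j) := by simp only [F]; ring
    _ ≤ _ := mul_le_mul_of_nonneg_right (hU j hj) (mul_nonneg (hF 5 j) (hF 6 j))

lemma assemble {ι : Type*} [DecidableEq ι] (J : Finset ℕ) (R : Finset ι) (arc : ι → ℕ → Prop) [∀ u j, Decidable (arc u j)] (S e : ℕ → ℂ) (W : ι → ℕ → ℂ) (he : ∀ j, ‖e j‖ = 1)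
    (hd : ∀ j, ∀ u ∈ R, ∀ v ∈ R, arc u j → arc v j → u = v) :
    ‖∑ j ∈ J, S j * e j - ∑ j ∈ J, (∑ u ∈ R, W u j) * e j‖ ≤
      ∑ u ∈ R, (∑ j ∈ J with arc u j, ‖S j - W u j‖ + ∑ j ∈ J with ¬ arc u j, ‖W u j‖) + ∑ j ∈ J with ∀ u ∈ R, ¬ arc u j, ‖S j‖ := by
  simp only [sum_filter, ← sum_add_distrib]
  rw [sum_comm, ← sum_add_distrib, ← sum_sub_distrib]
  refine norm_sum_le_of_le _ fun j _ => ?_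
  rw [← sub_mul, norm_mul, he, mul_one]
  split_ifs with h
  · rw [add_comm]
    refine (norm_sub_le _ _).trans (add_le_add_right (norm_sum_le_of_le _ fun u hu => ?_) _)
    simp [h u hu]
  · push Not at h
    obtain ⟨u, hu, ha⟩ := h
    rw [← add_sum_erase R _ hu, ← add_sum_erase R _ hu, ← sub_sub, add_zero, if_pos ha, if_neg (not_not.2 ha), add_zero]
    refine (norm_sub_le _ _).trans (add_le_add_right (norm_sum_le_of_le _ fun v hv => ?_) _)
    have : ¬ arc v j := fun h => (mem_erase.1 hv).1 (hd j v (mem_erase.1 hv).2 u hu h ha)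
    simp [this]

lemma prod_diff {a b : Fin 7 → ℂ} {B : Fin 7 → ℝ} {ε:ℝ} (ha : ∀ i, ‖a i‖ ≤ B i) (hb : ∀ i, ‖b i‖ ≤ B i) (hd : ∀ i, ‖a i - b i‖ ≤ ε * B i) :
    ‖∏ i, a i - ∏ i, b i‖ ≤ 7 * ε * ∏ i, B i := by
  suffices ∀ s : Finset (Fin 7), ‖∏ i ∈ s, a i - ∏ i ∈ s, b i‖ ≤ #s * ε * ∏ i ∈ s, B i by simpa using this univ
  intro s
  induction s using Finset.induction_on with
  | empty => simp
  | insert x s hx ih =>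
    rw [prod_insert hx, prod_insert hx, prod_insert hx, card_insert_of_notMem hx,
      show a x * ∏ i ∈ s, a i - b x * ∏ i ∈ s, b i = (a x - b x) * ∏ i ∈ s, a i + b x * (∏ i ∈ s, a i - ∏ i ∈ s, b i) by ring]
    have h1 : ‖∏ i ∈ s, a i‖ ≤ ∏ i ∈ s, B i := by rw [norm_prod]; exact prod_le_prod (fun _ _ => norm_nonneg _) fun i _ => ha i
    have h2 := mul_le_mul (hd x) h1 (norm_nonneg _) ((norm_nonneg _).trans (hd x))
    have h3 := mul_le_mul (hb x) ih (norm_nonneg _) ((norm_nonneg _).trans (hb x))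
    refine (norm_add_le _ _).trans ?_
    rw [norm_mul, norm_mul]; push_cast; linarith

lemma arc_count {M:ℕ} (hM : 0 < M) (θ:ℝ) {δ:ℝ} (hδ : 0 ≤ δ) : (#{j ∈ range M | di (((j:ℕ):ℝ) / M - θ) ≤ δ / M}:ℝ) ≤ 2 * δ + 1 := by
  have hM' : (0:ℝ) < M := by exact_mod_cast hM
  have h : {j ∈ range M | di (((j:ℕ):ℝ) / M - θ) ≤ δ / M} ⊆ (Icc ⌈M * θ - δ⌉ ⌊M * θ + δ⌋).image fun u : ℤ => (u % M).toNat := by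
    intro j hj
    obtain ⟨h1, h2⟩ := mem_filter.1 hj
    rw [di, le_div_iff₀ hM', ← abs_of_pos hM', ← abs_mul, abs_of_pos hM', abs_le] at h2
    rw [sub_mul, sub_mul, div_mul_cancel₀ _ hM'.ne'] at h2
    refine mem_image.2 ⟨(j:ℤ) - round ((j:ℝ) / M - θ) * M, mem_Icc.2 ⟨Int.ceil_le.2 ?_, Int.le_floor.2 ?_⟩, ?_⟩
    · push_cast; linarith
    · push_cast; linarith
    · rw [Int.sub_mul_emod_self_right, Int.emod_eq_of_lt (by omega) (by have := mem_range.1 h1; omega)]; simp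
  have h3 := (card_le_card h).trans card_image_le
  rw [Int.card_Icc] at h3
  refine (Nat.cast_le.2 h3).trans ?_
  have h4 : (((⌊M * θ + δ⌋ + 1 - ⌈M * θ - δ⌉).toNat:ℤ):ℝ) ≤ 2 * δ + 1 := by
    rw [Int.toNat_eq_max, Int.cast_max]
    refine max_le ?_ (by simp; linarith)
    push_cast
    linarith [Int.floor_le (M * θ + δ), Int.le_ceil (M * θ - δ)]
  exact_mod_cast h4

lemma arc_disj {Q q a q' a':ℕ} {α δ:ℝ} (hδ : 2 * δ * (Q:ℝ) ^ 2 < 1) (hq : q ≤ Q) (hq' : q' ≤ Q) (ha : a < q) (ha' : a' < q') (hc : a.Coprime q) (hc' : a'.Coprime q')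
    (h : di (α - a / q) ≤ δ) (h' : di (α - a' / q') ≤ δ) : q = q' ∧ a = a' := by
  have hq0 : (0:ℝ) < q := by exact_mod_cast (by omega : 0 < q)
  have hq0' : (0:ℝ) < q' := by exact_mod_cast (by omega : 0 < q')
  unfold di at h h'
  generalize round (α - a / q) = z at h
  generalize round (α - a' / q') = z' at h'
  have h1 : ((a:ℤ) + z * q) * q' = (a' + z' * q') * q := by
    rw [← sub_eq_zero, ← Int.abs_lt_one_iff]
    have : |((a:ℝ) + z * q) * q' - (a' + z' * q') * q| < 1 := by
      calc _ = |((α - a' / q' - z') - (α - a / q - z)) * (q * q')| := by congr 1; field_simp; ring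
        _ ≤ (δ + δ) * (Q * Q) := by
            rw [abs_mul, abs_of_pos (mul_pos hq0 hq0')]
            refine mul_le_mul ((abs_sub _ _).trans (by linarith)) (by gcongr) (by positivity) (by linarith [(abs_nonneg _).trans h])
        _ < 1 := by linarith
    exact_mod_cast this
  have h2 : (q:ℤ) ∣ q' := by
    have : (q:ℤ) ∣ (a + z * q) * q' := ⟨_, h1.trans (mul_comm _ _)⟩
    refine IsCoprime.dvd_of_dvd_mul_left ?_ this
    exact ((Nat.isCoprime_iff_coprime.2 hc).add_mul_right_left z).symm
  have h3 : (q':ℤ) ∣ q := by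
    have : (q':ℤ) ∣ (a' + z' * q') * q := ⟨_, h1.symm.trans (mul_comm _ _)⟩
    refine IsCoprime.dvd_of_dvd_mul_left ?_ this
    exact ((Nat.isCoprime_iff_coprime.2 hc').add_mul_right_left z').symm
  have h4 : q = q' := Nat.dvd_antisymm (Int.natCast_dvd_natCast.1 h2) (Int.natCast_dvd_natCast.1 h3)
  subst h4
  refine ⟨rfl, ?_⟩
  have h5 := mul_right_cancel₀ (by omega) h1
  have h6 := congrArg (· % (q:ℤ)) h5
  simp only [Int.add_mul_emod_self_right] at h6
  rw [Int.emod_eq_of_lt (by omega) (by omega), Int.emod_eq_of_lt (by omega) (by omega)] at h6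
  omega

def AR (Q:ℕ) : Finset (Σ _ : ℕ, ℕ) := (range (Q + 1)).sigma fun q => {a ∈ range q | a.Coprime q}

noncomputable def WW (n:ℕ) (u : Σ _ : ℕ, ℕ) (α:ℝ) : ℂ := ∏ i, (Gs (kk i) u.1 u.2 / u.1.totient * vv (kk i) n (α - u.2 / u.1))

lemma kk_ne (i : Fin 7) : kk i ≠ 0 := by have := kk_mem i; omega

lemma mem_AR {Q:ℕ} {u : Σ _ : ℕ, ℕ} : u ∈ AR Q ↔ u.1 ≤ Q ∧ u.2 < u.1 ∧ u.2.Coprime u.1 := by simp [AR, Nat.lt_succ_iff]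

lemma AR_card {Q:ℕ} (hQ : 0 < Q) : (#(AR Q):ℝ) ≤ 2 * Q ^ 2 := by
  have : #(AR Q) ≤ (Q + 1) * Q := by
    rw [AR, card_sigma]
    refine (sum_le_card_nsmul _ _ Q fun q hq => (card_filter_le _ _).trans ?_).trans (by simp)
    rw [card_range]; have := mem_range.1 hq; omega
  exact_mod_cast this.trans (by nlinarith)

lemma Gs_le (k q a:ℕ) : ‖Gs k q a / q.totient‖ ≤ 1 := by
  rw [norm_div, norm_natCast]
  refine div_le_one_of_le₀ ?_ (by positivity)
  refine (norm_sum_le_of_le _ fun r _ => (norm_ee _).le).trans ?_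
  rw [sum_const, nsmul_one, Nat.totient_eq_card_coprime]
  simp only [Nat.coprime_comm, le_refl]

lemma SS_arc {D n:ℕ} {k q a:ℕ} {α:ℝ} (h : ∀ β : ℝ, ‖SS k n (a / q + β) - Gs k q a / q.totient * vv k n β‖ ≤ rr k n / ln n ^ D * (1 + 14 * n * |β|)) :
    ‖SS k n α - Gs k q a / q.totient * vv k n (α - a / q)‖ ≤ rr k n / ln n ^ D * (1 + 14 * n * di (α - a / q)) := by
  have e : ∀ (x:ℝ) (z:ℤ) (m:ℕ), ee ((x - z) * m) = ee (x * m) := fun x z m => by rw [← ee_add_int (x * m) (-(z * m))]; congr 1; push_cast; ring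
  have := h (α - a / q - round (α - a / q))
  rw [add_sub, add_sub_cancel] at this
  simp only [SS, vv, e] at this ⊢
  exact this

lemma off_arc {n:ℕ} (hn : 0 < n) {θ Q:ℝ} (hQ : 0 < Q) : ∑ j ∈ range (8 * n) with ¬ di (j /₈ n - θ) ≤ Q / n, ∏ i, ‖vv (kk i) n (j /₈ n - θ)‖ ≤
    (8 * n:ℕ) * (50 ^ 5 * 10 ^ 4 * Xi n / Q ^ 5) := by
  have hn' : (0:ℝ) < n := by exact_mod_cast hn
  have r3 := rr_nonneg 3 n
  have r5 := rr_nonneg 5 n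
  have r6 := rr_nonneg 6 n
  have r7 := rr_nonneg 7 n
  have hX : 0 ≤ Xi n := by unfold Xi; positivity
  have h1 : ∀ (k:ℕ) (x:ℝ), k ≠ 0 → ¬ di x ≤ Q / n → ‖vv k n x‖ ≤ 50 * rr k n / Q := fun k x hk hx => by
    rw [not_le, div_lt_iff₀ hn', mul_comm] at hx
    have := rr_nonneg k n
    exact (vv_decay hk hn (pos_of_mul_pos_right (hQ.trans hx) hn'.le)).trans (by gcongr)
  have h2 := parseval (T := II n) (M := 8 * n) (by omega) (fun m => (ww 2 m:ℂ) * ee (-θ * m)) id (fun m hm => by have := mem_II.1 hm; simp only [id]; omega)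
  have e : ∀ j : ℕ, ∑ t ∈ II n, (ww 2 t:ℂ) * ee (-θ * t) * ee (j /₈ n * (id t:ℕ)) = vv 2 n (j /₈ n - θ) := fun j => by
    refine sum_congr rfl fun t _ => ?_
    rw [mul_assoc, ← ee_add]; congr 2; simp only [id]; ring
  have h3 : ∑ j ∈ range (8 * n), ‖vv 2 n (j /₈ n - θ)‖ ^ 2 ≤ (8 * n:ℕ) * 10 ^ 4 := by
    simp only [e] at h2
    refine h2.trans (mul_le_mul_of_nonneg_left ?_ (by positivity))
    rw [sum_filter, sum_product]
    simp only [id, norm_mul, norm_ee, mul_one, norm_real, Real.norm_of_nonneg (ww_nonneg _ _), sum_ite_eq]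
    calc _ ≤ ∑ m ∈ II n, (100 * rr 2 n / n) * (100 * rr 2 n / n) := sum_le_sum fun m hm => by
          rw [if_pos hm]
          have := ww_le two_ne_zero hm
          exact mul_self_le_mul_self (ww_nonneg _ _) this
      _ = #(II n) * (10 ^ 4 * rr 2 n ^ 2 / n ^ 2) := by rw [sum_const, nsmul_eq_mul]; ring
      _ ≤ n * (10 ^ 4 * rr 2 n ^ 2 / n ^ 2) := by gcongr; rw [II, Nat.card_Ico]; omega
      _ = _ := by rw [rr_pow two_ne_zero]; field_simp
  calc _ ≤ ∑ j ∈ range (8 * n), 50 ^ 5 * Xi n / Q ^ 5 * ‖vv 2 n (j /₈ n - θ)‖ ^ 2 := by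
        refine (sum_le_sum fun j hj => ?_).trans (sum_le_sum_of_subset_of_nonneg (filter_subset _ _) fun _ _ _ => by positivity)
        have := fun k hk => h1 k _ hk (mem_filter.1 hj).2
        rw [Fin.prod_univ_seven]
        simp only [kk, Matrix.cons_val]
        generalize j /₈ n - θ = x at *
        calc _ ≤ ‖vv 2 n x‖ * ‖vv 2 n x‖ * (50 * rr 3 n / Q) * (50 * rr 3 n / Q) * (50 * rr 5 n / Q) * (50 * rr 6 n / Q) * (50 * rr 7 n / Q) := by
              gcongr <;> exact this _ (by norm_num)
          _ = _ := by rw [Xi]; field_simp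
    _ ≤ 50 ^ 5 * Xi n / Q ^ 5 * ((8 * n:ℕ) * 10 ^ 4) := by
        rw [← mul_sum]
        gcongr
    _ = _ := by ring

lemma WW_sum {n:ℕ} (hn : 0 < n) (Q:ℕ) : ∑ j ∈ range (8 * n), (∑ u ∈ AR Q, WW n u (j /₈ n)) * ee (-(j /₈ n * n)) =
    (8 * n:ℕ) * (JJ n * ∑ q ∈ range (Q + 1), As n q) := by
  simp only [sum_mul]
  rw [sum_comm, AR, sum_sigma]
  simp only [As, mul_sum]
  refine sum_congr rfl fun q _ => sum_congr rfl fun a _ => ?_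
  have h1 := ortho hn (fun _ => II n) (fun _ t => t) (fun i t => Gs (kk i) q a / q.totient * (ww (kk i) t * ee (-(a / q) * t))) fun i t ht => (mem_II.1 ht).2
  refine Eq.trans (sum_congr rfl fun j _ => ?_) (h1.trans ?_)
  · simp only [WW, vv, mul_sum]
    congr 1
    refine prod_congr rfl fun i _ => sum_congr rfl fun t _ => ?_
    rw [sub_mul, sub_eq_add_neg, ee_add, neg_mul]; ring
  · rw [JJ, ofReal_sum, sum_mul]
    congr 1
    refine sum_congr rfl fun x hx => ?_
    have hx := (mem_filter.1 hx).2
    rw [prod_mul_distrib, prod_mul_distrib, ofReal_prod, ← hx]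
    simp only [Fin.prod_univ_seven, Fin.sum_univ_seven, ← ee_add]
    rw [mul_left_comm]
    congr 3; push_cast; ring

lemma dirich {n Q:ℕ} (hQ : 0 < Q) (hQn : Q ≤ n) {α:ℝ} (h : ∀ u ∈ AR Q, ¬ di (α - u.2 / u.1) ≤ Q / n) :
    ∃ (q:ℕ) (a:ℤ), IsCoprime a (q:ℤ) ∧ |α - a / q| ≤ 1 / (q:ℝ) ^ 2 ∧ Q ≤ q ∧ q * Q ≤ n := by
  obtain ⟨r, h1, h2⟩ := Real.exists_rat_abs_sub_le_and_den_le α (Nat.div_pos hQn hQ)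
  have hr : ((r.num:ℝ) / r.den) = (r:ℝ) := by exact_mod_cast Rat.num_div_den r
  have hn : (0:ℝ) < n := by exact_mod_cast (by omega : 0 < n)
  refine ⟨r.den, r.num, ?_, ?_, ?_, (Nat.mul_le_mul_right Q h2).trans (Nat.div_mul_le_self n Q)⟩
  · rw [Int.isCoprime_iff_gcd_eq_one]; exact r.reduced
  · rw [hr, sq]; refine h1.trans ?_
    have : (r.den:ℝ) ≤ (n / Q:ℕ) := by exact_mod_cast h2
    gcongr; linarith
  · by_contra hlt
    have hdz : (r.den:ℤ) ≠ 0 := by exact_mod_cast r.den_pos.ne'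
    obtain ⟨b, hb⟩ := Int.eq_ofNat_of_zero_le (Int.emod_nonneg r.num hdz)
    have hb2 := Int.emod_lt_of_pos r.num (by omega : (0:ℤ) < r.den)
    have hb3 := Int.emod_add_mul_ediv r.num r.den
    refine h ⟨r.den, b⟩ (mem_AR.2 ⟨by dsimp; omega, by dsimp; omega, ?_⟩) ((round_le _ (r.num / r.den)).trans ?_)
    · rw [← Nat.isCoprime_iff_coprime, ← IsCoprime.add_mul_left_left_iff (z := r.num / r.den), ← hb, hb3, Int.isCoprime_iff_gcd_eq_one]
      exact r.reduced
    · rw [hb] at hb3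
      have e : (r.num:ℝ) = b + r.den * (r.num / r.den:ℤ) := by exact_mod_cast hb3.symm
      rw [show α - (b:ℝ) / r.den - (r.num / r.den:ℤ) = α - r by rw [← hr, e]; field_simp; ring]
      refine h1.trans ?_
      rw [div_le_div_iff₀ (by positivity) hn, one_mul]
      have h5 : n ≤ Q * ((n / Q + 1) * r.den) := by nlinarith [Nat.div_add_mod n Q, Nat.mod_lt n hQ, r.den_pos, Nat.zero_le (Q * (n / Q + 1))]
      exact_mod_cast h5

lemma on_arc {n Q H:ℕ} {L:ℝ} (hL : L = ln n) (hn : 0 < n) (hQ : 1 ≤ Q) (hQL : (Q:ℝ) ≤ L ^ H) (hL15 : 15 ≤ L)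
    (h : ∀ (k q a:ℕ) (β:ℝ), 1 ≤ k → k ≤ 7 → 0 < q → (q:ℝ) ≤ ln n ^ (4 * H + 1) →
      ‖SS k n (a / q + β) - Gs k q a / q.totient * vv k n β‖ ≤ rr k n / ln n ^ (4 * H + 1) * (1 + 14 * n * |β|)) {u : Σ _ : ℕ, ℕ} (hu : u ∈ AR Q) :
    ∑ j ∈ range (8 * n) with di (j /₈ n - u.2 / u.1) ≤ Q / n, ‖∏ i, SS (kk i) n (j /₈ n) - WW n u (j /₈ n)‖ ≤
      17 * Q * (7 * (15 * Q / L ^ (4 * H + 1)) * (101 ^ 7 * (n * Xi n))) := by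
  have hn' : (0:ℝ) < n := by exact_mod_cast hn
  have hQ1 : (1:ℝ) ≤ Q := by exact_mod_cast hQ
  obtain ⟨h1, h2, _⟩ := mem_AR.1 hu
  have hLH : L ^ H ≤ L ^ (4 * H + 1) := pow_le_pow_right₀ (by linarith) (by omega)
  have hq : (u.1:ℝ) ≤ ln n ^ (4 * H + 1) := hL ▸ le_trans (by exact_mod_cast h1) (hQL.trans hLH)
  have hs : 15 * (Q:ℝ) / L ^ (4 * H + 1) ≤ 1 := by
    rw [div_le_one (by positivity)]
    calc 15 * (Q:ℝ) ≤ L * L ^ H := by gcongr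
      _ = L ^ (H + 1) := by ring
      _ ≤ _ := pow_le_pow_right₀ (by linarith) (by omega)
  have hB : ∏ i, 101 * rr (kk i) n = 101 ^ 7 * (n * Xi n) := by rw [prod_mul_distrib, prod_rr]; simp
  have key : ∀ α : ℝ, di (α - u.2 / u.1) ≤ Q / n → ‖∏ i, SS (kk i) n α - WW n u α‖ ≤ 7 * (15 * Q / L ^ (4 * H + 1)) * (101 ^ 7 * (n * Xi n)) := by
    intro α hα
    have hd : ∀ i, ‖SS (kk i) n α - Gs (kk i) u.1 u.2 / u.1.totient * vv (kk i) n (α - u.2 / u.1)‖ ≤ 15 * Q / L ^ (4 * H + 1) * rr (kk i) n := fun i => by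
      have hr := rr_nonneg (kk i) n
      refine (SS_arc fun β => h (kk i) u.1 u.2 β (kk_mem i).1 (kk_mem i).2 (by omega) hq).trans ?_
      rw [← hL]
      calc _ ≤ rr (kk i) n / L ^ (4 * H + 1) * (1 + 14 * n * (Q / n)) := by gcongr
        _ ≤ rr (kk i) n / L ^ (4 * H + 1) * (15 * Q) := by gcongr; rw [mul_assoc, mul_div_cancel₀ _ hn'.ne']; linarith
        _ = _ := by ring
    have hb : ∀ i, ‖Gs (kk i) u.1 u.2 / u.1.totient * vv (kk i) n (α - u.2 / u.1)‖ ≤ 100 * rr (kk i) n := fun i => by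
      rw [norm_mul]
      exact (mul_le_of_le_one_left (norm_nonneg _) (Gs_le _ _ _)).trans (vv_le (kk_ne i) hn _)
    rw [← hB]
    refine prod_diff (fun i => ?_) (fun i => ?_) (fun i => ?_)
    · have := mul_le_mul_of_nonneg_right hs (rr_nonneg (kk i) n)
      linarith [norm_le_norm_sub_add (SS (kk i) n α) (Gs (kk i) u.1 u.2 / u.1.totient * vv (kk i) n (α - u.2 / u.1)), hd i, hb i]
    · linarith [hb i, rr_nonneg (kk i) n]
    · refine (hd i).trans (mul_le_mul_of_nonneg_left ?_ (by positivity)); linarith [rr_nonneg (kk i) n]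
  have hX : 0 ≤ n * Xi n := by rw [← prod_rr]; exact prod_nonneg fun i _ => rr_nonneg _ _
  refine (sum_le_card_nsmul _ _ _ fun j hj => key _ (mem_filter.1 hj).2).trans ?_
  rw [nsmul_eq_mul]
  refine mul_le_mul_of_nonneg_right ?_ (by positivity)
  have := arc_count (M := 8 * n) (by omega) ((u.2:ℝ) / u.1) (δ := 8 * Q) (by positivity)
  rw [show (8 * Q:ℝ) / (8 * n:ℕ) = Q / n by push_cast; field_simp] at this
  linarith

theorem main : ∃ N : ℕ, ∀ n ≥ N, n % 2 = 1 → ∃ p : Fin 7 → ℕ, (∀ i, (p i).Prime) ∧ ∑ i, p i ^ kk i = n := by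
  obtain ⟨c, hc, Q0, hsing⟩ := sing
  obtain ⟨e, he⟩ : ∃ e, e = 2 ^ 10 + 6 := ⟨_, rfl⟩
  obtain ⟨B, hB⟩ := S7_minor (e + 1)
  obtain ⟨K, hK⟩ : ∃ K : ℝ, K = 10 ^ 18 + 2 * 10 ^ 13 + 514 * 2 ^ e := ⟨_, rfl⟩
  have hK0 : 0 < K := by rw [hK]; positivity
  rw [← Filter.eventually_atTop]
  filter_upwards [hB, SS_approx (4 * (B + 1) + 1), ev_log (10 ^ 16 * K / c + Q0 + 15) (3 * (B + 1) + 1), Filter.eventually_ge_atTop 51201] with n h7 hSS hLn hn hodd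
  obtain ⟨L, hL⟩ : ∃ L, L = ln n := ⟨_, rfl⟩
  rw [← hL] at h7 hLn
  have hkc : 0 < 10 ^ 16 * K / c := by positivity
  have hn' : (1:ℝ) ≤ n := by exact_mod_cast (by omega : 1 ≤ n)
  have hL15 : 15 ≤ L := by linarith [hLn.1]
  obtain ⟨Q, hQ⟩ : ∃ Q, Q = ⌊L ^ (B + 1)⌋₊ := ⟨_, rfl⟩
  have hQ1 : (Q:ℝ) ≤ L ^ (B + 1) := hQ ▸ Nat.floor_le (by positivity)
  have hQ2 : L ^ (B + 1) < Q + 1 := hQ ▸ Nat.lt_floor_add_one _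
  have hLB : 1 ≤ L ^ B := one_le_pow₀ (by linarith)
  rw [pow_succ] at hQ2
  have hQ3 : L - 1 ≤ Q := by nlinarith
  have hQ4 : 1 ≤ Q := by exact_mod_cast (by linarith : (1:ℝ) ≤ Q)
  have hQ5 : (1:ℝ) ≤ Q := by exact_mod_cast hQ4
  have hQn : 2 * (Q:ℝ) ^ 3 < n := by
    calc 2 * (Q:ℝ) ^ 3 ≤ 2 * (L ^ (B + 1)) ^ 3 := by gcongr
      _ < L * (L ^ (B + 1)) ^ 3 := by gcongr; linarith
      _ = L ^ (3 * (B + 1) + 1) := by rw [← pow_mul]; ring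
      _ ≤ (n:ℝ) ^ (1:ℝ) := hLn.2.trans (Real.rpow_le_rpow_of_exponent_le hn' (by norm_num))
      _ = n := Real.rpow_one _
  by_contra hno
  push Not at hno
  have hX : 0 < Xi n := by
    have h : ∀ k, 0 < rr k n := fun k => Real.rpow_pos_of_pos (by linarith) _
    have := h 3; have := h 5; have := h 6; have := h 7
    unfold Xi; positivity
  have hR : ∑ j ∈ range (8 * n), (∏ i, SS (kk i) n (j /₈ n)) * ee (-(j /₈ n * n)) = 0 := by
    refine (ortho (by omega) (fun i => PP (kk i) n) (fun i t => t ^ kk i) (fun _ t => lp t) fun i t ht => ((mem_PP (kk_ne i)).1 ht).2.2).trans ?_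
    rw [filter_false_of_mem, sum_empty, mul_zero]
    exact fun x hx => hno x fun i => ((mem_PP (kk_ne i)).1 (Fintype.mem_piFinset.1 hx i)).1
  classical
  have key := assemble (range (8 * n)) (AR Q) (fun u j => di (j /₈ n - u.2 / u.1) ≤ Q / n) (fun j => ∏ i, SS (kk i) n (j /₈ n))
    (fun j => ee (-(j /₈ n * n))) (fun u j => WW n u (j /₈ n)) (fun j => norm_ee _) (fun j u hu v hv h1 h2 => by
      obtain ⟨a1, a2, a3⟩ := mem_AR.1 hu
      obtain ⟨b1, b2, b3⟩ := mem_AR.1 hv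
      have := arc_disj (by rw [mul_div_assoc', div_mul_eq_mul_div, div_lt_one (by linarith)]; linarith) a1 b1 a2 b2 a3 b3 h1 h2
      exact Sigma.ext this.1 (heq_of_eq this.2))
  rw [hR, WW_sum (by omega), zero_sub, norm_neg, norm_mul, norm_natCast] at key
  have hJ := JJ_low (by omega : 10000 ≤ n)
  have low : (8 * n:ℕ) * (Xi n / 10 ^ 16 * c) ≤ (8 * n:ℕ) * ‖(JJ n:ℂ) * ∑ q ∈ range (Q + 1), As n q‖ := by
    have hs := hsing n Q hodd (by exact_mod_cast (by linarith [hLn.1] : (Q0:ℝ) ≤ Q))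
    rw [norm_mul, norm_real]
    gcongr
    · exact hJ.trans (le_abs_self _)
    · exact hs.trans (re_le_norm _)
  have u3 := minor_sum (n := n) (by omega) (filter_subset (fun j : ℕ => ∀ u ∈ AR Q, ¬ di (j /₈ n - u.2 / u.1) ≤ Q / n) (range (8 * n)))
    (U := rr 7 n / L ^ (e + 1)) (fun j hj => by
      have hQn2 : Q ≤ n := by exact_mod_cast (by nlinarith [one_le_pow₀ hQ5 (n := 2)] : (Q:ℝ) ≤ n)
      obtain ⟨q, a, a1, a2, a3, a4⟩ := dirich hQ4 hQn2 (mem_filter.1 hj).2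
      exact h7 Q q a _ (by nlinarith) a1 a2 a3 a4) (div_nonneg (rr_nonneg _ _) (by positivity))
  rw [← he, ← hL] at u3
  have u1 : ∑ u ∈ AR Q, (∑ j ∈ range (8 * n) with di (j /₈ n - u.2 / u.1) ≤ Q / n, ‖∏ i, SS (kk i) n (j /₈ n) - WW n u (j /₈ n)‖ +
      ∑ j ∈ range (8 * n) with ¬ di (j /₈ n - u.2 / u.1) ≤ Q / n, ‖WW n u (j /₈ n)‖) ≤
      2 * Q ^ 2 * (17 * Q * (7 * (15 * Q / L ^ (4 * (B + 1) + 1)) * (101 ^ 7 * (n * Xi n))) + (8 * n:ℕ) * (50 ^ 5 * 10 ^ 4 * Xi n / (Q:ℝ) ^ 5)) := by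
    refine (sum_le_card_nsmul _ _ _ fun u hu => add_le_add (on_arc hL (by omega) hQ4 hQ1 hL15 hSS hu) (le_trans (sum_le_sum fun j _ => ?_)
      (off_arc (θ := u.2 / u.1) (by omega) (by linarith : (0:ℝ) < Q)))).trans ?_
    · rw [WW, norm_prod]
      exact prod_le_prod (fun _ _ => norm_nonneg _) fun i _ => by rw [norm_mul]; exact mul_le_of_le_one_left (norm_nonneg _) (Gs_le _ _ _)
    · rw [nsmul_eq_mul]
      exact mul_le_mul_of_nonneg_right (AR_card hQ4) (by positivity)
  have tot := low.trans (key.trans (add_le_add u1 u3))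
  have f1 : 2 * (Q:ℝ) ^ 2 * (17 * Q * (7 * (15 * Q / L ^ (4 * (B + 1) + 1)) * (101 ^ 7 * (n * Xi n)))) ≤ 8 * n * Xi n * (10 ^ 18 / L) := by
    calc _ = 3570 * 101 ^ 7 * (n * Xi n) / L ^ (4 * (B + 1) + 1) * (Q:ℝ) ^ 4 := by ring
      _ ≤ 3570 * 101 ^ 7 * (n * Xi n) / L ^ (4 * (B + 1) + 1) * (L ^ (B + 1)) ^ 4 := by gcongr
      _ = 3570 * 101 ^ 7 * (n * Xi n) / L := by rw [pow_succ L (4 * (B + 1)), mul_comm 4, pow_mul]; field_simp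
      _ ≤ 8 * 10 ^ 18 * (n * Xi n) / L := by gcongr ?_ * (n * Xi n) / L; norm_num
      _ = _ := by ring
  have f2 : 2 * (Q:ℝ) ^ 2 * ((8 * n:ℕ) * (50 ^ 5 * 10 ^ 4 * Xi n / (Q:ℝ) ^ 5)) ≤ 8 * n * Xi n * (2 * 10 ^ 13 / L) := by
    calc _ = 8 * n * Xi n * (2 * 50 ^ 5 * 10 ^ 4 / (Q:ℝ) ^ 3) := by push_cast; field_simp
      _ ≤ 8 * n * Xi n * (10 ^ 13 / (L / 2)) := by
          gcongr
          · norm_num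
          · linarith [le_self_pow₀ hQ5 (three_ne_zero)]
      _ = _ := by ring
  have f3 : rr 7 n / L ^ (e + 1) * ((8 * n:ℕ) * (514 * (rr 3 n ^ 2 * rr 5 n * rr 6 n) * (1 + L) ^ e)) ≤ 8 * n * Xi n * (514 * 2 ^ e / L) := by
    calc _ = 8 * n * Xi n * (514 * (1 + L) ^ e / L ^ (e + 1)) := by rw [Xi]; push_cast; ring
      _ ≤ 8 * n * Xi n * (514 * (2 * L) ^ e / L ^ (e + 1)) := by gcongr; linarith
      _ = _ := by rw [mul_pow, pow_succ L]; field_simp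
  have g : 8 * n * Xi n * (c / 10 ^ 16) ≤ 8 * n * Xi n * (K / L) := by
    have e1 : (8 * n:ℕ) * (Xi n / 10 ^ 16 * c) = 8 * n * Xi n * (c / 10 ^ 16) := by push_cast; ring
    rw [e1, mul_add] at tot
    refine tot.trans ((add_le_add (add_le_add f1 f2) f3).trans (le_of_eq ?_))
    rw [hK]; ring
  have g2 := le_of_mul_le_mul_left g (by positivity)
  rw [div_le_div_iff₀ (by positivity) (by linarith)] at g2
  have g3 : 10 ^ 16 * K / c < L := by linarith [hLn.1]
  rw [div_lt_iff₀ hc] at g3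
  linarith

end WG

/-- Every sufficiently large odd integer `n` can be written as
`n = p1^2 + p2^2 + p3^3 + p4^3 + p5^5 + p6^6 + p7^7` with all `pᵢ` prime. -/
theorem waring_goldbach_c7 :
    ∃ N : ℕ, ∀ n : ℕ, N ≤ n → ¬ 2 ∣ n →
      ∃ p1 p2 p3 p4 p5 p6 p7 : ℕ,
        p1.Prime ∧ p2.Prime ∧ p3.Prime ∧ p4.Prime ∧ p5.Prime ∧ p6.Prime ∧ p7.Prime ∧
        n = p1 ^ 2 + p2 ^ 2 + p3 ^ 3 + p4 ^ 3 + p5 ^ 5 + p6 ^ 6 + p7 ^ 7 := by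
  obtain ⟨N, h⟩ := WG.main
  refine ⟨N, fun n hn h2 => ?_⟩
  obtain ⟨p, hp, hs⟩ := h n hn (by omega)
  refine ⟨p 0, p 1, p 2, p 3, p 4, p 5, p 6, hp 0, hp 1, hp 2, hp 3, hp 4, hp 5, hp 6, ?_⟩
  rw [← hs]
  simp [Fin.sum_univ_seven, WG.kk]
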